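/- Let A and B be separable C*-algebras. A closed ideal K of A ⊗̂ B is primitive if and only if K = A ⊗̂ F + E ⊗̂ B for some primitive ideals E of A and F of B. -/

import Mathlib

open scoped TensorProduct
open Pointwise

universe u

noncomputable section

/-- A C⋆-norm on a complex `*`-algebra.  On a matrix algebra over a C⋆-algebra such a
norm is unique, namely the canonical C⋆-norm. -/
structure IsCStarNorm {M : Type*} [NonUnitalRing M] [StarRing M] [Module ℂ M]
    (N : M → ℝ) : Prop where
  add_le : ∀ x y, N (x + y) ≤ N x + N y
  smul_eq : ∀ (c : ℂ) (x : M), N (c • x) = ‖c‖ * N x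
  eq_zero_of : ∀ x, N x = 0 → x = 0
  mul_le : ∀ x y, N (x * y) ≤ N x * N y
  star_mul_self : ∀ x, N (star x * x) = N x * N x

/-- The operator space projective tensor norm `‖·‖_∧` on the algebraic tensor product
`A ⊗ B`, relative to given families of matrix norms on `A` and `B`:
`‖u‖_∧ = inf { ‖α‖ ‖v‖ ‖w‖ ‖β‖ : u = α (v ⊗ w) β }` where `v ∈ M_p(A)`, `w ∈ M_q(B)`,
`α ∈ M_{1,pq}(ℂ)` and `β ∈ M_{pq,1}(ℂ)` (row and column vectors carrying the Euclidean
norm, which is their norm as scalar matrices). -/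
noncomputable def osProjNorm {A B : Type u}
    [AddCommGroup A] [Module ℂ A] [AddCommGroup B] [Module ℂ B]
    (NA : ∀ p : ℕ, Matrix (Fin p) (Fin p) A → ℝ)
    (NB : ∀ q : ℕ, Matrix (Fin q) (Fin q) B → ℝ) (u : A ⊗[ℂ] B) : ℝ :=
  sInf { r : ℝ | ∃ (p q : ℕ) (α : Fin p × Fin q → ℂ) (v : Matrix (Fin p) (Fin p) A)
      (w : Matrix (Fin q) (Fin q) B) (β : Fin p × Fin q → ℂ),
      u = ∑ ik : Fin p × Fin q, ∑ jl : Fin p × Fin q,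
            (α ik * β jl) • (v ik.1 jl.1 ⊗ₜ[ℂ] w ik.2 jl.2) ∧
      r = Real.sqrt (∑ ik, ‖α ik‖ ^ 2) * NA p v * NB q w *
            Real.sqrt (∑ jl, ‖β jl‖ ^ 2) }

/-- `X` is a completion of the algebraic tensor product `A ⊗ B` with respect to the
norm `ν`, via the (necessarily isometric) dense embedding `ι`, and the multiplication and
involution of `X` are the canonical ones induced from `A` and `B`.  Applied with
`ν = osProjNorm NA NB` (for the canonical matrix C⋆-norms `NA`, `NB`) this characterizes
the Banach `*`-algebra `A ⊗̂ B` (the operator space projective tensor product) up to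
isometric `*`-isomorphism; applied with `ν = bsProjNorm` it characterizes the Banach
space projective tensor product `A ⊗_γ B`. -/
structure IsTensorCompletion {A B : Type u} [NonUnitalRing A] [StarRing A] [Module ℂ A]
    [NonUnitalRing B] [StarRing B] [Module ℂ B] (ν : A ⊗[ℂ] B → ℝ)
    (X : Type u) [NonUnitalNormedRing X] [StarRing X] [NormedSpace ℂ X] [CompleteSpace X]
    (ι : A ⊗[ℂ] B →ₗ[ℂ] X) : Prop where
  norm_eq : ∀ u, ‖ι u‖ = ν u
  dense : DenseRange ι
  mul_tmul : ∀ (a c : A) (b d : B),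
    ι (a ⊗ₜ[ℂ] b) * ι (c ⊗ₜ[ℂ] d) = ι ((a * c) ⊗ₜ[ℂ] (b * d))
  star_tmul : ∀ (a : A) (b : B), star (ι (a ⊗ₜ[ℂ] b)) = ι (star a ⊗ₜ[ℂ] star b)

/-- The product ideal `S ⊗̂ T`: the closure in `X` (a completion of `A ⊗ B`) of the span of
elementary tensors `a ⊗ b` with `a ∈ S`, `b ∈ T`. -/
def tensorIdeal {A B : Type u} [NonUnitalRing A] [StarRing A] [Module ℂ A]
    [NonUnitalRing B] [StarRing B] [Module ℂ B]
    {X : Type u} [NonUnitalNormedRing X] [StarRing X] [NormedSpace ℂ X] [CompleteSpace X]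
    (ι : A ⊗[ℂ] B →ₗ[ℂ] X) (S : Set A) (T : Set B) : Set X :=
  closure (ι '' (Submodule.span ℂ (Set.image2 (fun a b => a ⊗ₜ[ℂ] b) S T)))

/-- A closed prime (two-sided) ideal of a Banach algebra: a proper closed two-sided ideal `K`
such that whenever the product of two closed two-sided ideals is contained in `K`, one of them
is contained in `K`. -/
def IsClosedPrimeIdeal {Y : Type u} [NonUnitalNormedRing Y] (K : TwoSidedIdeal Y) : Prop :=
  IsClosed (K : Set Y) ∧ (K : Set Y) ≠ Set.univ ∧
    ∀ I J : TwoSidedIdeal Y, IsClosed (I : Set Y) → IsClosed (J : Set Y) →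
      (∀ x ∈ I, ∀ y ∈ J, x * y ∈ K) → (I : Set Y) ⊆ (K : Set Y) ∨ (J : Set Y) ⊆ (K : Set Y)

/-- An irreducible continuous `*`-representation of a Banach `*`-algebra `Y` on a complex
Hilbert space. -/
structure IrreducibleRepOn (Y : Type u)
    [NonUnitalNormedRing Y] [StarRing Y] [NormedSpace ℂ Y] where
  H : Type u
  [normH : NormedAddCommGroup H]
  [ipsH : InnerProductSpace ℂ H]
  [csH : CompleteSpace H]
  π : Y →⋆ₙₐ[ℂ] (H →L[ℂ] H)
  continuous : Continuous π
  nonzero : ∃ y, π y ≠ 0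
  irreducible : ∀ S : Submodule ℂ H, IsClosed (S : Set H) →
    (∀ y : Y, ∀ v ∈ S, π y v ∈ S) → S = ⊥ ∨ S = ⊤

/-- A primitive ideal: the kernel of an irreducible `*`-representation. -/
def IsPrimitiveIdeal {Y : Type u} [NonUnitalNormedRing Y] [StarRing Y] [NormedSpace ℂ Y]
    (K : TwoSidedIdeal Y) : Prop :=
  ∃ ρ : IrreducibleRepOn Y, ∀ y, y ∈ K ↔ ρ.π y = 0

/-- A subset `K` of a ring is modular (as an ideal) if there is a relative unit `e`
with `x * e - x ∈ K` and `e * x - x ∈ K` for every `x`. -/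
def IsModularIdealSet {Y : Type u} [NonUnitalRing Y] (K : Set Y) : Prop :=
  ∃ e : Y, ∀ x : Y, x * e - x ∈ K ∧ e * x - x ∈ K

/-- A maximal modular (two-sided) ideal: a modular ideal which is proper and maximal among
proper two-sided ideals. -/
def IsMaximalModularIdeal {Y : Type u} [NonUnitalRing Y] (K : TwoSidedIdeal Y) : Prop :=
  IsModularIdealSet (K : Set Y) ∧ (K : Set Y) ≠ Set.univ ∧
    ∀ L : TwoSidedIdeal Y, (K : Set Y) ⊆ (L : Set Y) →
      (L : Set Y) = (K : Set Y) ∨ (L : Set Y) = Set.univ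

/-- The operator norm of a `p × p` matrix of bounded operators on a Hilbert space `H`,
viewed as an operator on the `ℓ²`-direct sum `H ⊕ ⋯ ⊕ H`. -/
noncomputable def opMatrixNorm {H : Type u} [NormedAddCommGroup H] [InnerProductSpace ℂ H]
    {p : ℕ} (T : Matrix (Fin p) (Fin p) (H →L[ℂ] H)) : ℝ :=
  sSup { r : ℝ | ∃ x : Fin p → H, (∑ i, ‖x i‖ ^ 2) ≤ 1 ∧
      r = Real.sqrt (∑ i, ‖∑ j, (T i j) (x j)‖ ^ 2) }

/-- An operator algebra structure on a Banach algebra `Y`: a bicontinuous algebra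
homomorphism of `Y` into the bounded operators on some Hilbert space. -/
structure OperatorAlgebraEmbedding (Y : Type u) [NonUnitalNormedRing Y] [NormedSpace ℂ Y] where
  H : Type u
  [normH : NormedAddCommGroup H]
  [ipsH : InnerProductSpace ℂ H]
  [csH : CompleteSpace H]
  ρ : Y →ₙₐ[ℂ] (H →L[ℂ] H)
  c : ℝ
  C : ℝ
  c_pos : 0 < c
  lower : ∀ y, c * ‖y‖ ≤ ‖ρ y‖
  upper : ∀ y, ‖ρ y‖ ≤ C * ‖y‖

/-- The matrix norms on `Y` induced by an operator algebra embedding, giving `Y` its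
operator space structure: the norm of `v ∈ M_p(Y)` is the operator norm of the matrix
of operators obtained by applying the embedding entrywise. -/
noncomputable def OperatorAlgebraEmbedding.matrixNorm {Y : Type u}
    [NonUnitalNormedRing Y] [NormedSpace ℂ Y] (e : OperatorAlgebraEmbedding Y)
    (p : ℕ) (v : Matrix (Fin p) (Fin p) Y) : ℝ :=
  letI := e.normH; letI := e.ipsH
  opMatrixNorm (v.map e.ρ)

/-- The Banach space projective tensor norm `‖·‖_γ` on the algebraic tensor product. -/
noncomputable def bsProjNorm {A B : Type u} [NonUnitalNormedRing A] [NormedSpace ℂ A]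
    [NonUnitalNormedRing B] [NormedSpace ℂ B] (u : A ⊗[ℂ] B) : ℝ :=
  sInf { r : ℝ | ∃ (n : ℕ) (a : Fin n → A) (b : Fin n → B),
      u = ∑ i, a i ⊗ₜ[ℂ] b i ∧ r = ∑ i, ‖a i‖ * ‖b i‖ }

/-- A C⋆-algebra `A` is subhomogeneous if there is `n : ℕ` bounding the (finite)
dimensions of all its irreducible `*`-representations. -/
def IsSubhomogeneous (A : Type u) [NonUnitalCStarAlgebra A] : Prop :=
  ∃ n : ℕ, ∀ ρ : IrreducibleRepOn A,
    letI := ρ.normH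
    letI := ρ.ipsH
    FiniteDimensional ℂ ρ.H ∧ Module.finrank ℂ ρ.H ≤ n

set_option linter.all false

namespace TP

/-- abstract commutative core -/
structure CoreForm (L : ℝ) (v : C(ℝ,ℝ) →ₗ[ℝ] C(ℝ,ℝ) →ₗ[ℝ] ℂ) : Prop where
  bd : ∀ f g : C(ℝ,ℝ), (∀ x, |x| ≤ L → |f x| ≤ 1) → (∀ x, |x| ≤ L → |g x| ≤ 1) → ‖v f g‖ ≤ 1
  basic : ∀ ρ s ρ' s' : C(ℝ,ℝ), (∀ x, |x| ≤ L → ρ x ^ 2 + s x ^ 2 ≤ 2 * ρ x) →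
    (∀ x, |x| ≤ L → ρ' x ^ 2 + s' x ^ 2 ≤ 2 * ρ' x) →
    (v ρ ρ').re - (v s s').re + (v ρ s').im + (v s ρ').im ≤
      (v ρ 1).re + (v s 1).im + (v 1 ρ').re + (v 1 s').im

variable {L : ℝ} {v : C(ℝ,ℝ) →ₗ[ℝ] C(ℝ,ℝ) →ₗ[ℝ] ℂ}

theorem CoreForm.flip (h : CoreForm L v) : CoreForm L v.flip := by
  constructor
  · intro f g hf hg
    simpa using h.bd g f hg hf
  · intro ρ s ρ' s' h1 h2
    have := h.basic ρ' s' ρ s h2 h1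
    simp only [LinearMap.flip_apply]
    linarith

theorem exists_bound (L : ℝ) (f : C(ℝ,ℝ)) : ∃ M : ℝ, 0 < M ∧ ∀ x, |x| ≤ L → |f x| ≤ M := by
  obtain ⟨M, hM⟩ := (isCompact_Icc (a := -L) (b := L)).exists_bound_of_continuousOn
    f.continuous.continuousOn
  refine ⟨max M 1, by positivity, fun x hx => ?_⟩
  exact (hM x (abs_le.mp hx)).trans (le_max_left _ _)

theorem CoreForm.pos (h : CoreForm L v) (f : C(ℝ,ℝ)) (hf : ∀ x, |x| ≤ L → 0 ≤ f x) :
    0 ≤ (v f 1).re := by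
  obtain ⟨M, hM0, hM⟩ := exists_bound L f
  have := h.basic (M⁻¹ • f) 0 0 0 (by
    intro x hx
    have h1 := hf x hx
    have h2 := (abs_le.mp (hM x hx)).2
    have h3 : M⁻¹ * f x ≤ 1 := by rw [inv_mul_le_iff₀ hM0]; linarith
    have h4 : 0 ≤ M⁻¹ * f x := by positivity
    simp
    nlinarith) (by intro x _; simp)
  simp at this
  have h5 : 0 ≤ M⁻¹ * (v f 1).re := by linarith
  exact (mul_nonneg_iff_of_pos_left (by positivity)).mp h5

theorem CoreForm.mono (h : CoreForm L v) (f g : C(ℝ,ℝ)) (hf : ∀ x, |x| ≤ L → f x ≤ g x) :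
    (v f 1).re ≤ (v g 1).re := by
  have := h.pos (g - f) (by intro x hx; simpa using hf x hx)
  simp at this
  linarith

theorem small_le {a b c : ℝ} (δ : ℝ) (hδ : 0 < δ)
    (h : ∀ l : ℝ, 0 < l → l ≤ δ → a ≤ b + l * c) : a ≤ b := by
  by_contra hab
  push Not at hab
  have hc : 0 < |c| + 1 := by positivity
  let l := min δ ((a - b) / (2 * (|c| + 1)))
  have hl : 0 < l := lt_min hδ (by apply div_pos; linarith; positivity)
  have h1 := h l hl (min_le_left _ _)
  have h2 : l ≤ (a - b) / (2 * (|c| + 1)) := min_le_right _ _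
  rw [le_div_iff₀ (by positivity)] at h2
  have h3 : l * c ≤ l * (|c| + 1) := by
    apply mul_le_mul_of_nonneg_left _ hl.le
    linarith [le_abs_self c]
  linarith

theorem CoreForm.im_nonneg (h : CoreForm L v) (s : C(ℝ,ℝ)) : 0 ≤ (v s 1).im := by
  obtain ⟨M, hM0, hM⟩ := exists_bound L s
  have key : -(v s 1).im ≤ 0 := by
    apply small_le (c := (v (s*s) 1).re) M⁻¹ (by positivity)
    intro l hl hl2
    have := h.basic ((l*l) • (s*s)) (l • s) 0 0 (by
      intro x hx
      have h2 := hM x hx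
      have h3 : |l * s x| ≤ 1 := by
        rw [abs_mul, abs_of_pos hl]
        calc l * |s x| ≤ M⁻¹ * M := by gcongr
          _ = 1 := by field_simp
      have h4 : (l * s x)^2 ≤ 1 := by rwa [sq_le_one_iff_abs_le_one]
      simp
      nlinarith [sq_nonneg (l * s x)]) (by intro x _; simp)
    simp at this
    have h6 : 0 ≤ l * ((v s 1).im + l * (v (s*s) 1).re) := by nlinarith
    have := (mul_nonneg_iff_of_pos_left hl).mp h6
    linarith
  linarith

theorem CoreForm.im_zero (h : CoreForm L v) (s : C(ℝ,ℝ)) : (v s 1).im = 0 := by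
  have h1 := h.im_nonneg s
  have h2 := h.im_nonneg (-s)
  simp at h2
  linarith

theorem CoreForm.re_bound' (h : CoreForm L v) (s s' : C(ℝ,ℝ)) :
    -(v s s').re ≤ (v (s*s) 1).re + (v 1 (s'*s')).re := by
  obtain ⟨M, hM0, hM⟩ := exists_bound L s
  obtain ⟨M', hM0', hM'⟩ := exists_bound L s'
  apply small_le (c := |(v (s*s) (s'*s')).re|) (min 1 (min M⁻¹ M'⁻¹)) (by positivity)
  intro l hl hl2
  have hl3 : l ≤ 1 := hl2.trans (min_le_left _ _)
  have hl4 : l ≤ M⁻¹ := hl2.trans ((min_le_right _ _).trans (min_le_left _ _))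
  have hl5 : l ≤ M'⁻¹ := hl2.trans ((min_le_right _ _).trans (min_le_right _ _))
  have aux : ∀ (s : C(ℝ,ℝ)) (M : ℝ), 0 < M → (∀ x, |x| ≤ L → |s x| ≤ M) → l ≤ M⁻¹ →
     ∀ (e : ℝ), e^2 = 1 → ∀ x, |x| ≤ L → ((l*l) • (s*s)) x ^ 2 + ((e*l) • s) x ^ 2 ≤ 2 * ((l*l) • (s*s)) x := by
    intro s M hM0 hM hl4 e he x hx
    have h2 := hM x hx
    have h3 : |l * s x| ≤ 1 := by
      rw [abs_mul, abs_of_pos hl]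
      calc l * |s x| ≤ M⁻¹ * M := by gcongr
        _ = 1 := by field_simp
    have h4 : (l * s x)^2 ≤ 1 := by rwa [sq_le_one_iff_abs_le_one]
    have h5 : (e * l * s x)^2 = (l * s x)^2 := by rw [mul_assoc, mul_pow, he, one_mul]
    simp
    rw [h5]
    nlinarith [sq_nonneg (l * s x)]
  have b1 := h.basic ((l*l) • (s*s)) (((1:ℝ)*l) • s) ((l*l) • (s'*s')) (((1:ℝ)*l) • s')
    (aux s M hM0 hM hl4 1 (by norm_num)) (aux s' M' hM0' hM' hl5 1 (by norm_num))
  have b2 := h.basic ((l*l) • (s*s)) (((-1:ℝ)*l) • s) ((l*l) • (s'*s')) (((-1:ℝ)*l) • s')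
    (aux s M hM0 hM hl4 (-1) (by norm_num)) (aux s' M' hM0' hM' hl5 (-1) (by norm_num))
  simp at b1 b2
  have c : l^2 * (-(v s s').re) ≤ l^2 * ((v (s*s) 1).re + (v 1 (s'*s')).re - l^2 * (v (s*s) (s'*s')).re) := by
    nlinarith
  have c2 := le_of_mul_le_mul_left c (by positivity)
  have c3 : - (l^2 * (v (s*s) (s'*s')).re) ≤ l * |(v (s*s) (s'*s')).re| := by
    have h1 : -(v (s*s) (s'*s')).re ≤ |(v (s*s) (s'*s')).re| := neg_le_abs _
    have h2 : l^2 ≤ l := by nlinarith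
    have h3 : 0 ≤ |(v (s*s) (s'*s')).re| := abs_nonneg _
    nlinarith [mul_le_mul_of_nonneg_left h1 (sq_nonneg l), mul_le_mul_of_nonneg_right h2 h3]
  linarith

theorem CoreForm.re_bound (h : CoreForm L v) (s s' : C(ℝ,ℝ)) :
    |(v s s').re| ≤ (v (s*s) 1).re + (v 1 (s'*s')).re := by
  rw [abs_le]
  have h1 := h.re_bound' s s'
  have h2 := h.re_bound' (-s) s'
  simp at h2
  constructor <;> linarith

theorem CoreForm.im_bound_one (h : CoreForm L v) (r s : C(ℝ,ℝ))
    (hr : ∀ x, |x| ≤ L → 0 ≤ r x ∧ r x ≤ 1) (hs : ∀ x, |x| ≤ L → |s x| ≤ 1) :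
    (v r s).im ≤ 2 * (v r 1).re + 2 * (v 1 (s*s)).re := by
  have h1 := h.basic r 0 (s*s) s (by
    intro x hx
    obtain ⟨h1, h2⟩ := hr x hx
    simp; nlinarith) (by
    intro x hx
    have h4 : (s x)^2 ≤ 1 := by rw [sq_le_one_iff_abs_le_one]; exact hs x hx
    simp
    nlinarith [sq_nonneg (s x)])
  have h2 := h.flip.im_zero s
  have h3 := h.re_bound r (s*s)
  have h4 := h.mono (r*r) r (by
    intro x hx
    obtain ⟨h1, h2⟩ := hr x hx
    simp; nlinarith)
  have h5 := h.flip.mono ((s*s)*(s*s)) (s*s) (by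
    intro x hx
    have h4 : (s x)^2 ≤ 1 := by rw [sq_le_one_iff_abs_le_one]; exact hs x hx
    simp
    nlinarith [sq_nonneg (s x)])
  simp at h1 h2 h5
  have := abs_le.mp h3
  linarith

theorem CoreForm.im_bound (h : CoreForm L v) (r s : C(ℝ,ℝ)) (R S : ℝ) (hR : 0 < R) (hS : 0 < S)
    (hr : ∀ x, |x| ≤ L → 0 ≤ r x ∧ r x ≤ R) (hs : ∀ x, |x| ≤ L → |s x| ≤ S) :
    |(v r s).im| ≤ 2 * S * (v r 1).re + 2 * R / S * (v 1 (s*s)).re := by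
  have key : ∀ s : C(ℝ,ℝ), (∀ x, |x| ≤ L → |s x| ≤ S) →
      (v r s).im ≤ 2 * S * (v r 1).re + 2 * R / S * (v 1 (s*s)).re := by
    intro s hs
    have h1 := h.im_bound_one (R⁻¹ • r) (S⁻¹ • s) (by
      intro x hx
      obtain ⟨h1, h2⟩ := hr x hx
      simp only [ContinuousMap.smul_apply, smul_eq_mul]
      constructor
      · positivity
      · rw [inv_mul_le_iff₀ hR]; linarith) (by
      intro x hx
      simp only [ContinuousMap.smul_apply, smul_eq_mul]
      rw [abs_mul, abs_of_pos (by positivity : 0 < S⁻¹), inv_mul_le_iff₀ hS]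
      linarith [hs x hx])
    simp at h1
    have h2 := mul_le_mul_of_nonneg_left h1 (by positivity : 0 ≤ R * S)
    calc (v r s).im = R * S * (S⁻¹ * (R⁻¹ * (v r s).im)) := by field_simp
      _ ≤ _ := h2
      _ = _ := by field_simp
  rw [abs_le]
  have h1 := key s hs
  have h2 := key (-s) (by intro x hx; simpa using hs x hx)
  simp at h2
  constructor <;> linarith

/-- clamp function -/
def clampC (m : ℕ) : C(ℝ,ℝ) := ⟨fun x => max (-(2:ℝ)^m) (min x (2^m)), by fun_prop⟩

def posC (f : C(ℝ,ℝ)) : C(ℝ,ℝ) := ⟨fun x => max (f x) 0, by fun_prop⟩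

theorem clamp_layer_pos (m : ℕ) (x : ℝ) : 0 ≤ posC (clampC (m+1) - clampC m) x ∧
    posC (clampC (m+1) - clampC m) x ≤ 2^m ∧ 8^m * posC (clampC (m+1) - clampC m) x ≤ x^4 := by
  have h0 : (0:ℝ) < 2^m := by positivity
  have h8 : (8:ℝ)^m = 2^m * 2^m * 2^m := by rw [← mul_pow, ← mul_pow]; norm_num
  simp only [posC, clampC, ContinuousMap.coe_mk, ContinuousMap.sub_apply, pow_succ]
  rw [h8]
  set t : ℝ := 2^m
  rcases le_total x t with h1 | h1
  · have : max (-(t*2)) (min x (t*2)) - max (-t) (min x t) ≤ 0 := by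
      rw [min_eq_left h1, min_eq_left (by linarith)]
      rcases le_total (-t) x with h2 | h2
      · rw [max_eq_right h2, max_eq_right (by linarith)]; simp
      · rw [max_eq_left h2]; have : max (-(t*2)) x ≤ -t := max_le (by linarith) h2
        linarith
    rw [max_eq_right this]
    refine ⟨le_rfl, h0.le, by rw [mul_zero]; have := sq_nonneg (x^2); nlinarith⟩
  · have e1 : max (-t) (min x t) = t := by rw [min_eq_right h1]; exact max_eq_right (by linarith)
    have e2 : max (-(t*2)) (min x (t*2)) ≤ t*2 ∧ max (-(t*2)) (min x (t*2)) ≤ x := by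
      constructor <;> apply max_le <;> first | linarith | skip
      · exact min_le_right _ _
      · exact min_le_left _ _
    rw [e1]
    refine ⟨le_max_right _ _, max_le (by linarith) h0.le, ?_⟩
    have e3 : max (max (-(t*2)) (min x (t*2)) - t) 0 ≤ x := max_le (by linarith) (by linarith)
    have hx0 : 0 ≤ x := by linarith
    have h3 : t * t * t ≤ x * x * x := by gcongr
    calc t * t * t * max (max (-(t*2)) (min x (t*2)) - t) 0 ≤ x * x * x * x := by
          apply mul_le_mul h3 e3 (le_max_right _ _)
          positivity
      _ = x^4 := by ring

theorem clampC_neg (m : ℕ) (x : ℝ) : clampC m (-x) = - clampC m x := by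
  have h0 : (0:ℝ) < 2^m := by positivity
  simp only [clampC, ContinuousMap.coe_mk]
  rw [← min_neg_neg, ← max_neg_neg, neg_neg, max_comm (-x), max_min_distrib_left]
  rw [max_eq_right (by linarith : -(2:ℝ)^m ≤ 2^m), min_comm]

theorem clampC_abs (m : ℕ) (x : ℝ) : |clampC m x| ≤ 2^m ∧ |clampC m x| ≤ |x| := by
  have h0 : (0:ℝ) < 2^m := by positivity
  simp only [clampC, ContinuousMap.coe_mk, abs_le]
  refine ⟨⟨le_max_left _ _, max_le (by linarith) (min_le_right _ _)⟩, ?_, ?_⟩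
  · rcases le_total x (2^m) with h | h
    · rw [min_eq_left h]; exact (neg_abs_le x).trans (le_max_right _ _)
    · rw [min_eq_right h]
      have := le_max_right (-(2:ℝ)^m) (2^m)
      have := abs_nonneg x
      linarith
  · rcases le_total 0 x with h | h
    · exact max_le (by have := abs_nonneg x; linarith) ((min_le_left _ _).trans (le_abs_self x))
    · exact max_le (by have := abs_nonneg x; linarith) ((min_le_left _ _).trans (le_abs_self x))

theorem clamp_layer_neg (m : ℕ) (x : ℝ) : 0 ≤ posC (-(clampC (m+1) - clampC m)) x ∧
    posC (-(clampC (m+1) - clampC m)) x ≤ 2^m ∧ 8^m * posC (-(clampC (m+1) - clampC m)) x ≤ x^4 := by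
  have h := clamp_layer_pos m (-x)
  have : posC (clampC (m+1) - clampC m) (-x) = posC (-(clampC (m+1) - clampC m)) x := by
    simp only [posC, ContinuousMap.coe_mk, ContinuousMap.sub_apply, ContinuousMap.neg_apply, clampC_neg]
    congr 1
    ring
  rw [this] at h
  simpa [Even.neg_pow (by decide : Even 4)] using h

theorem posC_sub (f : C(ℝ,ℝ)) : f = posC f - posC (-f) := by
  ext x
  simp only [posC, ContinuousMap.coe_mk, ContinuousMap.sub_apply, ContinuousMap.neg_apply]
  rcases le_total (f x) 0 with h | h
  · rw [max_eq_right h, max_eq_left (by linarith)]; ring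
  · rw [max_eq_left h, max_eq_right (by linarith)]; ring

def idC : C(ℝ,ℝ) := ⟨fun x => x, continuous_id⟩

theorem CoreForm.layer_bound (h : CoreForm L v) (h4 : (v (idC^4) 1).re ≤ 2)
    (m : ℕ) (s : C(ℝ,ℝ)) (hs : ∀ x, |x| ≤ L → |s x| ≤ 2^(m+1)) (hs2 : (v 1 (s*s)).re ≤ 2)
    : |(v (clampC (m+1) - clampC m) s).im| ≤ 20 * (1/2)^m := by
  have key : ∀ r : C(ℝ,ℝ), (∀ x, 0 ≤ r x ∧ r x ≤ 2^m ∧ 8^m * r x ≤ x^4) →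
      |(v r s).im| ≤ 10 * (1/2)^m := by
    intro r hr
    have h1 := h.im_bound r s (2^m) (2 * 4^m) (by positivity) (by positivity)
      (fun x _ => ⟨(hr x).1, (hr x).2.1⟩) (fun x hx => (hs x hx).trans (by
        rw [pow_succ, mul_comm]
        gcongr; norm_num))
    have h2 := h.mono ((8:ℝ)^m • r) (idC^4) (by
      intro x _
      simpa [idC] using (hr x).2.2)
    simp only [map_smul, LinearMap.smul_apply, Complex.real_smul] at h2
    rw [show (((8:ℝ)^m : ℝ):ℂ) * v r 1 = (((8:ℝ)^m : ℝ)) • v r 1 by simp, Complex.smul_re, smul_eq_mul] at h2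
    have h3 : (v r 1).re ≤ 2 / 8^m := by
      rw [le_div_iff₀ (by positivity)]; linarith
    have e1 : 2 * (2 * (4:ℝ)^m) * (v r 1).re ≤ 8 * (1/2)^m := by
      calc 2 * (2 * (4:ℝ)^m) * (v r 1).re ≤ 2 * (2 * (4:ℝ)^m) * (2 / 8^m) := by gcongr
        _ = 8 * (4^m / 8^m) := by ring
        _ = 8 * (1/2)^m := by rw [← div_pow]; norm_num
    have e2 : 2 * (2:ℝ)^m / (2 * 4^m) * (v 1 (s*s)).re ≤ 2 * (1/2)^m := by
      calc 2 * (2:ℝ)^m / (2 * 4^m) * (v 1 (s*s)).re ≤ 2 * (2:ℝ)^m / (2 * 4^m) * 2 := by gcongr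
        _ = 2 * (2^m / 4^m) := by ring
        _ = 2 * (1/2)^m := by rw [← div_pow]; norm_num
    linarith
  have k1 := key _ (clamp_layer_pos m)
  have k2 := key _ (clamp_layer_neg m)
  rw [posC_sub (clampC (m+1) - clampC m)]
  simp only [map_sub, LinearMap.sub_apply, Complex.sub_im]
  refine (abs_sub _ _).trans ?_
  linarith

theorem CoreForm.clamp_sq_le (h : CoreForm L v) (h2 : (v 1 (idC^2)).re ≤ 2) (m : ℕ) :
    (v 1 (clampC m * clampC m)).re ≤ 2 := by
  refine (h.flip.mono _ (idC^2) ?_).trans h2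
  intro x _
  have := (clampC_abs m x).2
  simp only [ContinuousMap.mul_apply, ContinuousMap.pow_apply, idC, ContinuousMap.coe_mk]
  rw [← abs_mul_abs_self, ← sq]
  calc |clampC m x|^2 ≤ |x|^2 := by gcongr
    _ = x^2 := sq_abs x

theorem CoreForm.clamp_im (h : CoreForm L v) (h2 : (v (idC^2) 1).re ≤ 2)
    (h4 : (v (idC^4) 1).re ≤ 2) (h2' : (v 1 (idC^2)).re ≤ 2)
    (h4' : (v 1 (idC^4)).re ≤ 2) (m : ℕ) :
    |(v (clampC m) (clampC m)).im| ≤ 81 - 80 * (1/2)^m := by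
  induction m with
  | zero =>
    have := h.bd (clampC 0) (clampC 0) (fun x _ => by simpa using (clampC_abs 0 x).1)
      (fun x _ => by simpa using (clampC_abs 0 x).1)
    norm_num
    exact (Complex.abs_im_le_norm _).trans this
  | succ m ih =>
    have e : v (clampC (m+1)) (clampC (m+1)) = v (clampC (m+1) - clampC m) (clampC (m+1))
        + v.flip (clampC (m+1) - clampC m) (clampC m) + v (clampC m) (clampC m) := by
      simp
    have a1 := h.layer_bound h4 m (clampC (m+1)) (fun x _ => (clampC_abs _ x).1) (h.clamp_sq_le h2' _)
    have a2 := h.flip.layer_bound h4' m (clampC m) (fun x _ => (clampC_abs _ x).1.trans (by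
      gcongr <;> simp)) (h.flip.clamp_sq_le h2 _)
    rw [e, Complex.add_im, Complex.add_im]
    have := abs_add_three (v (clampC (m+1) - clampC m) (clampC (m+1))).im
      (v.flip (clampC (m+1) - clampC m) (clampC m)).im (v (clampC m) (clampC m)).im
    refine this.trans ?_
    rw [pow_succ]
    linarith

theorem CoreForm.congr (h : CoreForm L v) (f f' g : C(ℝ,ℝ)) (hf : ∀ x, |x| ≤ L → f x = f' x) :
    v f g = v f' g := by
  obtain ⟨M, hM0, hM⟩ := exists_bound L g
  by_contra hne
  have hpos : 0 < ‖v (f - f') g‖ := by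
    rw [norm_pos_iff]; simpa [sub_eq_zero] using hne
  have := h.bd ((2 * M / ‖v (f-f') g‖) • (f - f')) (M⁻¹ • g) (by
    intro x hx; simp [hf x hx]) (by
    intro x hx
    simp only [ContinuousMap.smul_apply, smul_eq_mul, abs_mul]
    rw [abs_of_pos (by positivity : 0 < M⁻¹), inv_mul_le_iff₀ hM0]
    simpa using hM x hx)
  rw [map_smul, map_smul, LinearMap.smul_apply, norm_smul, norm_smul, Real.norm_of_nonneg (by positivity),
    Real.norm_of_nonneg (by positivity)] at this
  have e : M⁻¹ * (2 * M / ‖v (f-f') g‖ * ‖v (f-f') g‖) = 2 := by field_simp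
  linarith

theorem CoreForm.main (h : CoreForm L v) (h2 : (v (idC^2) 1).re ≤ 2)
    (h4 : (v (idC^4) 1).re ≤ 2) (h2' : (v 1 (idC^2)).re ≤ 2)
    (h4' : (v 1 (idC^4)).re ≤ 2) : ‖v idC idC‖ ≤ 85 := by
  obtain ⟨m, hm⟩ := pow_unbounded_of_one_lt L (one_lt_two)
  have hc : ∀ x, |x| ≤ L → idC x = clampC m x := by
    intro x hx
    have := abs_le.mp hx
    simp only [idC, clampC, ContinuousMap.coe_mk]
    rw [min_eq_left (by linarith), max_eq_right (by linarith)]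
  have e : v idC idC = v (clampC m) (clampC m) := by
    rw [h.congr _ _ _ hc]
    exact h.flip.congr _ _ (clampC m) hc
  have a := h.clamp_im h2 h4 h2' h4' m
  have b := h.re_bound idC idC
  rw [← e] at a
  have : (0:ℝ) < (1/2)^m := by positivity
  rw [← pow_two] at b
  calc _ ≤ _ := Complex.norm_le_abs_re_add_abs_im _
    _ ≤ _ := by linarith

end TP

namespace TP
open Matrix

section
variable {A : Type*} [Ring A] [StarRing A] [Algebra ℂ A] [StarModule ℂ A]
variable {B : Type*} [Ring B] [StarRing B] [Algebra ℂ B] [StarModule ℂ B]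

/-- weighted trace -/
def wE {I : Type} [Fintype I] (τ : I → ℝ) (m : Matrix I I A) : A := ∑ k, ((τ k ^ 2 : ℝ) : ℂ) • m k k

def wU (u : A →ₗ[ℂ] B →ₗ[ℂ] ℂ) {I : Type} [Fintype I] (τ : I → ℝ) (v : Matrix I I A) (w : Matrix I I B) : ℂ :=
  ∑ k, ∑ l, ((τ k * τ l : ℝ) : ℂ) * u (v k l) (w k l)

theorem wE_add {I : Type} [Fintype I] (τ : I → ℝ) (m n : Matrix I I A) : wE τ (m + n) = wE τ m + wE τ n := by
  simp [wE, Finset.sum_add_distrib]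

theorem wE_zero {I : Type} [Fintype I] (τ : I → ℝ)  : wE τ (0 : Matrix I I A) = 0 := by
  simp [wE]

theorem wE_scalar_mul {I : Type} [Fintype I] [DecidableEq I] (τ : I → ℝ) (c : A) (m : Matrix I I A) :
    wE τ (scalar I c * m) = c * wE τ m := by
  simp [wE, Finset.mul_sum, scalar_apply]

theorem wE_mul_scalar {I : Type} [Fintype I] [DecidableEq I] (τ : I → ℝ) (c : A) (m : Matrix I I A) :
    wE τ (m * scalar I c) = wE τ m * c := by
  simp [wE, Finset.sum_mul, scalar_apply]

theorem wE_scalar {I : Type} [Fintype I] [DecidableEq I] (τ : I → ℝ) (hτ : ∑ k, τ k ^ 2 = 1) (c : A) :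
    wE τ (scalar I c) = c := by
  simp only [wE, scalar_apply, diagonal_apply_eq]
  rw [← Finset.sum_smul, ← Complex.ofReal_sum, hτ]; simp

theorem wE_fromBlocks {I : Type} [Fintype I] (τ : I → ℝ) (α β : ℝ) (hα : 0 ≤ α) (hβ : 0 ≤ β)
    (P Q R S : Matrix I I A) :
    wE (Sum.elim (fun k => √α * τ k) (fun k => √β * τ k)) (fromBlocks P Q R S)
      = (α:ℂ) • wE τ P + (β : ℂ) • wE τ S := by
  simp [wE, mul_pow, Real.sq_sqrt hα, Real.sq_sqrt hβ, Finset.smul_sum, ← mul_smul]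
  simp only [← Complex.ofReal_pow, Real.sq_sqrt hα, Real.sq_sqrt hβ]

theorem conjTranspose_scalar {I : Type} [Fintype I] [DecidableEq I] (c : A) :
    (scalar I c)ᴴ = scalar I (star c) := by
  simp [scalar_apply, diagonal_conjTranspose]

structure Mom {I : Type} [Fintype I] [DecidableEq I] (τ : I → ℝ) (X : Matrix I I A) {n : ℕ} (a : Fin n → A)
    (p : Fin n → ℝ) : Prop where
  e1 : ∀ c, wE τ (X * scalar I c * Xᴴ) = ∑ i, (p i : ℂ) • (a i * c * star (a i))
  e2 : ∀ c, wE τ (Xᴴ * scalar I c * X) = ∑ i, ((1 - p i : ℝ) : ℂ) • (star (a i) * c * (a i))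
  e3 : wE τ (X * Xᴴ * (X * Xᴴ)) = (∑ i, (p i : ℂ) • (a i * star (a i))) * (∑ i, (p i : ℂ) • (a i * star (a i)))
    + ∑ i, (p i : ℂ) • (a i * (∑ i, ((1 - p i : ℝ) : ℂ) • (star (a i) * (a i))) * star (a i))
  e4 : wE τ (Xᴴ * X * (Xᴴ * X)) = (∑ i, ((1 - p i : ℝ) : ℂ) • (star (a i) * a i)) * (∑ i, ((1 - p i : ℝ) : ℂ) • (star (a i) * a i))
    + ∑ i, ((1 - p i : ℝ) : ℂ) • (star (a i) * (∑ i, (p i : ℂ) • (a i * star (a i))) * a i)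

theorem Mom.e1' {I : Type} [Fintype I] [DecidableEq I] {τ : I → ℝ} {X : Matrix I I A} {n : ℕ} {a : Fin n → A}
    {p : Fin n → ℝ} (h : Mom τ X a p) : wE τ (X * Xᴴ) = ∑ i, (p i : ℂ) • (a i * star (a i)) := by
  simpa using h.e1 1
theorem Mom.e2' {I : Type} [Fintype I] [DecidableEq I] {τ : I → ℝ} {X : Matrix I I A} {n : ℕ} {a : Fin n → A}
    {p : Fin n → ℝ} (h : Mom τ X a p) : wE τ (Xᴴ * X) = ∑ i, ((1 - p i : ℝ) : ℂ) • (star (a i) * (a i)) := by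
  simpa using h.e2 1

theorem Mom.step {I : Type} [Fintype I] [DecidableEq I] {τ : I → ℝ} (hτ : ∑ k, τ k ^ 2 = 1)
    {X : Matrix I I A} {n : ℕ} {a : Fin (n+1) → A}
    {p : Fin (n+1) → ℝ} (hp : ∀ i, 0 ≤ p i ∧ p i ≤ 1) (h : Mom τ X (fun i => a i.succ) (fun i => p i.succ)) :
    Mom (Sum.elim (fun k => √(p 0) * τ k) (fun k => √(1 - p 0) * τ k))
      (fromBlocks X (scalar I (a 0)) 0 X) a p := by
  have hα := (hp 0).1
  have hβ : 0 ≤ 1 - p 0 := by linarith [(hp 0).2]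
  have hsc : ∀ c, (scalar (I ⊕ I) c : Matrix _ _ A) = fromBlocks (scalar I c) 0 0 (scalar I c) := by
    intro c; simp [scalar_apply, fromBlocks_diagonal]
  have hsum : ∀ z : A, ((1 - p 0 : ℝ) : ℂ) • z = z - (p 0 : ℂ) • z := by
    intro z; push_cast; rw [sub_smul, one_smul]
  have E1 := h.e1
  have E2 := h.e2
  have E1' := h.e1'
  have E2' := h.e2'
  have E3 := h.e3
  have E4 := h.e4
  constructor
  · intro c
    rw [hsc, fromBlocks_conjTranspose, fromBlocks_multiply, fromBlocks_multiply, wE_fromBlocks _ _ _ hα hβ,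
      Fin.sum_univ_succ]
    simp only [conjTranspose_scalar, zero_mul, mul_zero, add_zero, zero_add, wE_add, ← map_mul, wE_scalar τ hτ,
      conjTranspose_zero, E1, hsum, smul_add, ]
    abel
  · intro c
    rw [hsc, fromBlocks_conjTranspose, fromBlocks_multiply, fromBlocks_multiply, wE_fromBlocks _ _ _ hα hβ,
      Fin.sum_univ_succ]
    simp only [conjTranspose_scalar, zero_mul, mul_zero, add_zero, zero_add, wE_add, ← map_mul, wE_scalar τ hτ,
      conjTranspose_zero, E2, hsum, smul_add, ]
    abel
  · rw [fromBlocks_conjTranspose, fromBlocks_multiply, fromBlocks_multiply, wE_fromBlocks _ _ _ hα hβ]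
    simp only [Fin.sum_univ_succ]
    simp only [conjTranspose_scalar, zero_mul, mul_zero, add_zero, zero_add, conjTranspose_zero, ← map_mul]
    have t1 : wE τ (X * scalar I (star (a 0)) * (scalar I (a 0) * Xᴴ)) = ∑ i : Fin n, (p i.succ : ℂ) • (a i.succ * (star (a 0) * a 0) * star (a i.succ)) := by
      rw [← E1, map_mul]; simp only [mul_assoc]
    have t2 : wE τ (scalar I (a 0) * Xᴴ * (X * scalar I (star (a 0)))) = a 0 * wE τ (Xᴴ * X) * star (a 0) := by
      rw [← wE_scalar_mul, ← wE_mul_scalar]; simp only [mul_assoc]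
    have t3 : ∀ z w : A, ∑ i : Fin n, (p i.succ : ℂ) • (a i.succ * (((1 - p 0 : ℝ) : ℂ) • z + w) * star (a i.succ)) =
      ((1 - p 0 : ℝ) : ℂ) • ∑ i : Fin n, (p i.succ : ℂ) • (a i.succ * z * star (a i.succ)) +
        ∑ i : Fin n, (p i.succ : ℂ) • (a i.succ * w * star (a i.succ)) := by
      intro z w
      rw [Finset.smul_sum, ← Finset.sum_add_distrib]
      refine Finset.sum_congr rfl fun i _ => ?_
      rw [smul_comm _ (p i.succ : ℂ), ← smul_add]
      congr 1
      simp only [mul_add, add_mul, mul_smul_comm, smul_mul_assoc]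
    simp only [t3]
    simp only [mul_add, add_mul, wE_add, wE_scalar_mul, wE_mul_scalar, E1', E3, t1, t2, E2', ← map_mul, wE_scalar τ hτ]
    generalize ∑ i : Fin n, (p i.succ : ℂ) • (a i.succ * (star (a 0) * a 0) * star (a i.succ)) = g1
    generalize ∑ i : Fin n, ((1 - p i.succ : ℝ) : ℂ) • (star (a i.succ) * a i.succ) = g2
    generalize ∑ i : Fin n, (p i.succ : ℂ) • (a i.succ * star (a i.succ)) = g3
    generalize ∑ i : Fin n, (p i.succ : ℂ) • (a i.succ * g2 * star (a i.succ)) = g4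
    simp only [hsum, smul_mul_assoc, mul_smul_comm, mul_sub, sub_mul, mul_assoc]
    module
  · rw [fromBlocks_conjTranspose, fromBlocks_multiply, fromBlocks_multiply, wE_fromBlocks _ _ _ hα hβ]
    simp only [Fin.sum_univ_succ]
    simp only [conjTranspose_scalar, zero_mul, mul_zero, add_zero, zero_add, conjTranspose_zero, ← map_mul]
    have t1 : wE τ (Xᴴ * scalar I (a 0) * (scalar I (star (a 0)) * X)) = ∑ i : Fin n, ((1 - p i.succ : ℝ) : ℂ) • (star (a i.succ) * (a 0 * star (a 0)) * (a i.succ)) := by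
      rw [← E2, map_mul]; simp only [mul_assoc]
    have t2 : wE τ (scalar I (star (a 0)) * X * (Xᴴ * scalar I (a 0))) = star (a 0) * wE τ (X * Xᴴ) * (a 0) := by
      rw [← wE_scalar_mul, ← wE_mul_scalar]; simp only [mul_assoc]
    have t3 : ∀ z w : A, ∑ i : Fin n, ((1 - p i.succ : ℝ) : ℂ) • (star (a i.succ) * ((p 0 : ℂ) • z + w) * (a i.succ)) =
      (p 0 : ℂ) • ∑ i : Fin n, ((1 - p i.succ : ℝ) : ℂ) • (star (a i.succ) * z * (a i.succ)) +
        ∑ i : Fin n, ((1 - p i.succ : ℝ) : ℂ) • (star (a i.succ) * w * (a i.succ)) := by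
      intro z w
      rw [Finset.smul_sum, ← Finset.sum_add_distrib]
      refine Finset.sum_congr rfl fun i _ => ?_
      rw [smul_comm (p 0 : ℂ), ← smul_add]
      congr 1
      simp only [mul_add, add_mul, mul_smul_comm, smul_mul_assoc]
    simp only [t3]
    simp only [mul_add, add_mul, wE_add, wE_scalar_mul, wE_mul_scalar, E2', E4, t1, t2, E1', ← map_mul, wE_scalar τ hτ]
    generalize ∑ i : Fin n, ((1 - p i.succ : ℝ) : ℂ) • (star (a i.succ) * (a 0 * star (a 0)) * (a i.succ)) = g1
    generalize ∑ i : Fin n, ((1 - p i.succ : ℝ) : ℂ) • (star (a i.succ) * a i.succ) = g2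
    generalize ∑ i : Fin n, (p i.succ : ℂ) • (a i.succ * star (a i.succ)) = g3
    generalize ∑ i : Fin n, ((1 - p i.succ : ℝ) : ℂ) • (star (a i.succ) * g3 * (a i.succ)) = g4
    simp only [hsum, smul_mul_assoc, mul_smul_comm, mul_sub, sub_mul, mul_assoc]
    module

theorem wU_step (u : A →ₗ[ℂ] B →ₗ[ℂ] ℂ) {I : Type} [Fintype I] [DecidableEq I] (τ : I → ℝ) (hτ : ∑ k, τ k ^ 2 = 1)
    (X : Matrix I I A) (Y : Matrix I I B) (a : A) (b : B) (α : ℝ) (h0 : 0 ≤ α) (h1 : α ≤ 1) :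
    wU u (Sum.elim (fun k => √α * τ k) (fun k => √(1 - α) * τ k))
      (fromBlocks X (scalar I a) 0 X) (fromBlocks Y (scalar I b) 0 Y) =
      ((√(α * (1 - α)) : ℝ) : ℂ) * u a b + wU u τ X Y := by
  have hβ : 0 ≤ 1 - α := by linarith
  simp only [wU, Fintype.sum_sum_type, Sum.elim_inl, Sum.elim_inr, fromBlocks_apply₁₁, fromBlocks_apply₁₂,
    fromBlocks_apply₂₁, fromBlocks_apply₂₂, Matrix.zero_apply, map_zero, mul_zero, Finset.sum_const_zero, zero_add]
  simp only [Finset.sum_add_distrib]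
  have t : ∀ (α : ℝ), 0 ≤ α → ∑ k, ∑ l, ((√α * τ k * (√α * τ l) : ℝ) : ℂ) * u (X k l) (Y k l) = α * ∑ k, ∑ l, ((τ k * τ l : ℝ) : ℂ) * u (X k l) (Y k l) := by
    intro α h0
    simp only [Finset.mul_sum]
    refine Finset.sum_congr rfl fun k _ => Finset.sum_congr rfl fun l _ => ?_
    have e : (√α*τ k*(√α*τ l):ℝ) = α*(τ k*τ l) := by
      have := Real.mul_self_sqrt h0
      calc _ = (√α * √α) * (τ k * τ l) := by ring
        _ = _ := by rw [this]
    rw [e]; push_cast; ring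
  rw [t _ h0, t _ hβ]
  have t2 : ∑ k, ∑ l, ((√α * τ k * (√(1-α) * τ l) : ℝ) : ℂ) * u ((scalar I a) k l) ((scalar I b) k l) = ((√(α * (1 - α)) : ℝ) : ℂ) * u a b := by
    have : ∀ k, ∑ l, ((√α * τ k * (√(1-α) * τ l) : ℝ) : ℂ) * u ((scalar I a) k l) ((scalar I b) k l) = ((√(α * (1 - α)) * τ k ^ 2 : ℝ) : ℂ) * u a b := by
      intro k
      rw [Finset.sum_eq_single k]
      · simp only [scalar_apply, diagonal_apply_eq]
        rw [Real.sqrt_mul h0]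
        congr 2
        ring
      · intro l _ hl
        simp [scalar_apply, diagonal_apply_ne _ hl.symm]
      · simp
    simp only [this]
    rw [← Finset.sum_mul, ← Complex.ofReal_sum, ← Finset.mul_sum, hτ, mul_one]
  rw [t2]
  push_cast
  ring

theorem exists_mom (n : ℕ) (a : Fin n → A) (b : Fin n → B) (p : Fin n → ℝ) (hp : ∀ i, 0 ≤ p i ∧ p i ≤ 1) :
    ∃ (I : Type) (_ : Fintype I) (_ : DecidableEq I) (τ : I → ℝ) (X : Matrix I I A) (Y : Matrix I I B),
      ∑ k, τ k ^ 2 = 1 ∧ Mom τ X a p ∧ Mom τ Y b p ∧ ∀ u : A →ₗ[ℂ] B →ₗ[ℂ] ℂ,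
        wU u τ X Y = ∑ i, ((√(p i * (1 - p i)) : ℝ) : ℂ) * u (a i) (b i) := by
  induction n with
  | zero =>
    refine ⟨Unit, inferInstance, inferInstance, fun _ => 1, 0, 0, by simp, ?_, ?_, ?_⟩
    · constructor <;> simp [wE]
    · constructor <;> simp [wE]
    · intro u; simp [wU]
  | succ n ih =>
    obtain ⟨I, _, _, τ, X, Y, hτ, hX, hY, hu⟩ := ih (fun i => a i.succ) (fun i => b i.succ) (fun i => p i.succ)
      (fun i => hp i.succ)
    refine ⟨I ⊕ I, inferInstance, inferInstance, Sum.elim (fun k => √(p 0) * τ k) (fun k => √(1 - p 0) * τ k),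
      fromBlocks X (scalar I (a 0)) 0 X, fromBlocks Y (scalar I (b 0)) 0 Y, ?_, hX.step hτ hp, hY.step hτ hp, ?_⟩
    · have hβ : 0 ≤ 1 - p 0 := by linarith [(hp 0).2]
      simp only [Fintype.sum_sum_type, Sum.elim_inl, Sum.elim_inr, mul_pow, ← Finset.mul_sum, hτ,
        Real.sq_sqrt (hp 0).1, Real.sq_sqrt hβ]
      ring
    · intro u
      rw [wU_step u τ hτ X Y (a 0) (b 0) (p 0) (hp 0).1 (hp 0).2, hu, Fin.sum_univ_succ]
end

end TP

namespace TP

section uniq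
variable {D : Type*} [NonUnitalCStarAlgebra D] {N : D → ℝ}

theorem csn_zero (hN : IsCStarNorm N) : N 0 = 0 := by
  have := hN.smul_eq 0 0; simpa using this

theorem csn_nonneg (hN : IsCStarNorm N) (x : D) : 0 ≤ N x := by
  have h1 := hN.smul_eq (-1) x
  have h2 := hN.add_le x (-x)
  simp [csn_zero hN] at h1 h2
  linarith

theorem csn_star (hN : IsCStarNorm N) (x : D) : N (star x) = N x := by
  have key : ∀ x : D, N x ≤ N (star x) := by
    intro x
    by_cases h : N x = 0
    · rw [h]; exact csn_nonneg hN _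
    · have hp := lt_of_le_of_ne (csn_nonneg hN x) (Ne.symm h)
      have := hN.mul_le (star x) x
      rw [hN.star_mul_self] at this
      exact le_of_mul_le_mul_right this hp
  exact le_antisymm (by simpa using key (star x)) (key x)

theorem csn_sa_le_one (hN : IsCStarNorm N) (h : D) (hs : IsSelfAdjoint h) (hn : ‖h‖ ≤ 1) : N h ≤ 1 := by
  set g := cfcₙ (fun t : ℝ => √(1 - t^2) - 1) h with hg
  have hcont : ContinuousOn (fun t : ℝ => √(1 - t^2) - 1) (quasispectrum ℝ h) := by fun_prop
  have hgs : IsSelfAdjoint g := cfcₙ_predicate _ _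
  have hcomm : h * g = g * h := by
    conv_lhs => rw [← cfcₙ_id' ℝ h]
    conv_rhs => rw [← cfcₙ_id' ℝ h]
    rw [hg, cfcₙ_id' ℝ h]
    conv_lhs => enter [1]; rw [← cfcₙ_id' ℝ h]
    conv_rhs => enter [2]; rw [← cfcₙ_id' ℝ h]
    rw [← cfcₙ_mul .., ← cfcₙ_mul ..]
    simp only [mul_comm]
  have hrel : h * h + g * g + g + g = 0 := by
    have : h * h + g * g + g + g = cfcₙ (fun t : ℝ => t * t + (√(1 - t^2) - 1) * (√(1 - t^2) - 1) + (√(1 - t^2) - 1) + (√(1 - t^2) - 1)) h := by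
      rw [cfcₙ_add .., cfcₙ_add .., cfcₙ_add .., cfcₙ_mul .., cfcₙ_mul .., cfcₙ_id' ℝ h]
    rw [this]
    rw [← cfcₙ_zero ℝ h]
    apply cfcₙ_congr
    intro t ht
    have h1 : ‖t‖ ≤ 1 := by
      have := norm_apply_le_norm_cfcₙ (fun t : ℝ => t) h ht
      rw [cfcₙ_id' ℝ h] at this
      exact this.trans hn
    have h2 : t^2 ≤ 1 := by
      rw [Real.norm_eq_abs] at h1; nlinarith [abs_le.mp h1]
    have := Real.mul_self_sqrt (sub_nonneg.2 h2)
    simp only [Pi.zero_apply]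
    nlinarith
  have iso : ∀ (ε : ℂ), ε * ε = -1 → star ε = -ε → ∀ x : D, N (h * x + ε • (x + g * x)) = N x := by
    intro ε hε hε' x
    have e : star (h * x + ε • (x + g * x)) * (h * x + ε • (x + g * x)) = star x * x := by
      simp only [star_add, star_mul, star_smul, hε', hs.star_eq, hgs.star_eq]
      have r2 : star x * (h * (g * x)) = star x * (g * (h * x)) := by
        rw [← mul_assoc h, hcomm, mul_assoc]
      have r1 : star x * (h * (h * x)) + star x * (g * (g * x)) + star x * (g * x) + star x * (g * x) = 0 := by
        have : star x * ((h * h + g * g + g + g) * x) = 0 := by rw [hrel]; simp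
        simpa only [mul_add, add_mul, mul_assoc] using this
      simp only [mul_add, add_mul, mul_assoc, smul_add, smul_mul_assoc, mul_smul_comm, r2, neg_smul, neg_mul,
        smul_neg, smul_smul, hε, one_smul, neg_neg]
      rw [← sub_eq_zero]
      rw [← r1]
      abel
    have := hN.star_mul_self (h * x + ε • (x + g * x))
    rw [e, hN.star_mul_self] at this
    exact ((mul_self_inj (csn_nonneg hN _) (csn_nonneg hN _)).1 this).symm
  have e : (2:ℂ) • (h * h) = (h * h + Complex.I • (h + g * h)) + (h * h + (-Complex.I) • (h + g * h)) := by
    module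
  have i1 := iso Complex.I (by simp) (by simp) h
  have i2 := iso (-Complex.I) (by simp) (by simp) h
  have := hN.add_le (h * h + Complex.I • (h + g * h)) (h * h + (-Complex.I) • (h + g * h))
  rw [← e, hN.smul_eq, i1, i2] at this
  have h3 := hN.star_mul_self h
  rw [hs.star_eq] at h3
  rw [h3] at this
  norm_num at this
  nlinarith [csn_nonneg hN h]

theorem csn_sa_le (hN : IsCStarNorm N) (h : D) (hs : IsSelfAdjoint h) : N h ≤ ‖h‖ := by
  by_cases h0 : h = 0
  · simp [h0, csn_zero hN]
  have hp : 0 < ‖h‖ := norm_pos_iff.2 h0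
  have := csn_sa_le_one hN ((‖h‖⁻¹ : ℝ) • h) (by
    exact IsSelfAdjoint.smul (by simp [IsSelfAdjoint]) hs) (by rw [norm_smul]; simp [hp.ne'])
  rw [show ((‖h‖⁻¹ : ℝ) • h) = ((‖h‖⁻¹ : ℝ) : ℂ) • h from (Complex.coe_smul _ _).symm, hN.smul_eq] at this
  simp at this
  field_simp at this
  exact this

theorem csn_sa_ge (hN : IsCStarNorm N) [PartialOrder D] [StarOrderedRing D] (h : D) (hs : 0 ≤ h) : ‖h‖ ≤ N h := by
  by_contra! hlt
  obtain ⟨c, hc1, hc2⟩ := exists_between hlt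
  have hc : 0 < c := (csn_nonneg hN h).trans_lt hc1
  set m := cfcₙ (fun t : ℝ => c * t / (max t c)^2) h with hm
  set y := cfcₙ (fun t : ℝ => max 0 (t - c)) h with hy
  have hpos : ∀ t : ℝ, 0 < max t c := fun t => lt_max_of_lt_right hc
  have hcm : Continuous (fun t : ℝ => c * t / (max t c)^2) := by
    apply Continuous.div (by fun_prop) (by fun_prop)
    intro t; exact (pow_pos (hpos t) 2).ne'
  have hf0 : (fun t : ℝ => max 0 (t - c)) 0 = 0 := by simp [hc.le]
  have hsa : IsSelfAdjoint h := .of_nonneg hs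
  have e : m * h * y = (c : ℂ) • y := by
    have : m * h * y = cfcₙ (fun t : ℝ => (c * t / (max t c)^2) * t * max 0 (t - c)) h := by
      rw [cfcₙ_mul (fun t : ℝ => (c * t / (max t c)^2) * t) (fun t => max 0 (t - c)) h
          (hcm.mul continuous_id).continuousOn (by simp) (by fun_prop) hf0,
        cfcₙ_mul (fun t : ℝ => (c * t / (max t c)^2)) (fun t => t) h hcm.continuousOn (by simp) (by fun_prop) (by simp), cfcₙ_id' ℝ h]
    rw [this, Complex.coe_smul, hy, ← cfcₙ_smul c _ h (by fun_prop) hf0]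
    congr 1
    ext t
    rcases le_total t c with htc | htc
    · rw [max_eq_left (by linarith : t - c ≤ 0)]; simp
    · rw [max_eq_left htc]
      have : 0 < t := hc.trans_le htc
      simp only [smul_eq_mul]
      field_simp
  have hm1 : N m ≤ 1 := by
    refine (csn_sa_le hN m (cfcₙ_predicate _ _)).trans ?_
    rw [hm]
    refine norm_cfcₙ_le ?_
    intro t ht
    have := hpos t
    have ht0 : 0 ≤ t := quasispectrum_nonneg_of_nonneg h hs t ht
    rw [Real.norm_eq_abs, abs_le]
    constructor
    · have : 0 ≤ c * t / (max t c)^2 := by positivity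
      linarith
    · rw [div_le_iff₀ (by positivity)]
      nlinarith [le_max_left t c, le_max_right t c]
  have k1 : c * N y ≤ N h * N y := by
    have h1 := hN.smul_eq c y
    rw [← e] at h1
    have h2 := hN.mul_le (m * h) y
    have h3 := hN.mul_le m h
    rw [h1, Complex.norm_real, Real.norm_eq_abs, abs_of_pos hc] at h2
    have := csn_nonneg hN h
    have := csn_nonneg hN y
    calc _ ≤ _ := h2
      _ ≤ _ := by
        gcongr
        nlinarith
  have hy0 : y ≠ 0 := by
    intro h0
    have hle : ‖cfcₙ (fun t : ℝ => t) h‖ ≤ c := by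
      refine norm_cfcₙ_le ?_
      intro t ht
      have ht0 : 0 ≤ t := quasispectrum_nonneg_of_nonneg h hs t ht
      have h1 := norm_apply_le_norm_cfcₙ (fun t : ℝ => max 0 (t - c)) h ht (by fun_prop) hf0
      rw [← hy, h0, norm_zero, Real.norm_eq_abs] at h1
      have h2 := (le_abs_self _).trans h1
      have h3 := le_max_right 0 (t - c)
      rw [Real.norm_eq_abs, abs_of_nonneg ht0]
      linarith
    rw [cfcₙ_id' ℝ h] at hle
    linarith
  have hNy : 0 < N y := lt_of_le_of_ne (csn_nonneg hN y) (fun h => hy0 (hN.eq_zero_of _ h.symm))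
  have := le_of_mul_le_mul_right k1 hNy
  linarith

theorem csn_eq (hN : IsCStarNorm N) (x : D) : N x = ‖x‖ := by
  letI := CStarAlgebra.spectralOrder D
  haveI := CStarAlgebra.spectralOrderedRing D
  have h1 := csn_sa_le hN (star x * x) (.star_mul_self x)
  have h2 := csn_sa_ge hN (star x * x) (star_mul_self_nonneg x)
  have h3 := le_antisymm h1 h2
  rw [hN.star_mul_self, CStarRing.norm_star_mul_self] at h3
  exact (mul_self_inj (csn_nonneg hN _) (norm_nonneg _)).1 h3
end uniq

theorem csn_matrix {A : Type*} [NonUnitalCStarAlgebra A] [PartialOrder A] [StarOrderedRing A] {p : ℕ}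
    {N : Matrix (Fin p) (Fin p) A → ℝ} (hN : IsCStarNorm N) (v : Matrix (Fin p) (Fin p) A) :
    N v = ‖CStarMatrix.ofMatrix v‖ := by
  have h : IsCStarNorm (M := CStarMatrix (Fin p) (Fin p) A) (fun v => N (CStarMatrix.ofMatrix.symm v)) :=
    ⟨fun x y => hN.add_le _ _, fun c x => hN.smul_eq _ _, fun x h => hN.eq_zero_of _ h,
      fun x y => hN.mul_le _ _, fun x => hN.star_mul_self _⟩
  exact csn_eq h _
end TP

namespace TP
open Filter Topology

section aform
variable {M W : Type*} [CStarAlgebra M] [CStarAlgebra W]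

def aform (U : M →ₗ[ℂ] W →ₗ[ℂ] ℂ) (V : M) (W0 : W) (H : M) (K : W) : C(ℝ,ℝ) →ₗ[ℝ] C(ℝ,ℝ) →ₗ[ℝ] ℂ :=
  LinearMap.mk₂ ℝ (fun f g => U (cfc f H * V) (cfc g K * W0))
    (by intro f f' g
        have : cfc (⇑(f + f')) H = cfc f H + cfc f' H := by
          rw [← cfc_add ..]; rfl
        rw [this, add_mul, map_add, LinearMap.add_apply])
    (by intro c f g
        have : cfc (⇑(c • f)) H = c • cfc f H := by
          rw [← cfc_smul ..]; rfl
        rw [this, smul_mul_assoc, ← Complex.coe_smul, map_smul, LinearMap.smul_apply, Complex.coe_smul])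
    (by intro f g g'
        have : cfc (⇑(g + g')) K = cfc g K + cfc g' K := by
          rw [← cfc_add ..]; rfl
        rw [this, add_mul, map_add])
    (by intro c f g
        have : cfc (⇑(c • g)) K = c • cfc g K := by
          rw [← cfc_smul ..]; rfl
        rw [this, smul_mul_assoc, ← Complex.coe_smul, map_smul, Complex.coe_smul])

theorem aform_apply (U : M →ₗ[ℂ] W →ₗ[ℂ] ℂ) (V : M) (W0 : W) (H : M) (K : W) (f g : C(ℝ,ℝ)) :
    aform U V W0 H K f g = U (cfc f H * V) (cfc g K * W0) := rfl

theorem mem_le {H : M} {L : ℝ} (hn : ‖H‖ ≤ L) {x : ℝ} (hx : x ∈ spectrum ℝ H) : |x| ≤ L := by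
  rcases subsingleton_or_nontrivial M with h | h
  · simp at hx
  · exact (spectrum.norm_le_norm_of_mem hx).trans hn

theorem aform_bd (U : M →ₗ[ℂ] W →ₗ[ℂ] ℂ) (hU : ∀ x y, ‖U x y‖ ≤ ‖x‖ * ‖y‖) {V : M} {W0 : W} (hV : ‖V‖ ≤ 1)
    (hW : ‖W0‖ ≤ 1) {H : M} {K : W} {L : ℝ} (hH : ‖H‖ ≤ L) (hK : ‖K‖ ≤ L) (f g : C(ℝ,ℝ)) {a b : ℝ} (ha : 0 ≤ a) (hb : 0 ≤ b)
    (hf : ∀ x, |x| ≤ L → |f x| ≤ a) (hg : ∀ x, |x| ≤ L → |g x| ≤ b) : ‖aform U V W0 H K f g‖ ≤ a * b := by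
  rw [aform_apply]
  have h1 : ‖cfc f H * V‖ ≤ a := by
    have : ‖cfc f H‖ ≤ a := norm_cfc_le ha fun x hx => hf x (mem_le hH hx)
    calc _ ≤ _ := norm_mul_le _ _
      _ ≤ a * 1 := by gcongr
      _ = a := mul_one _
  have h2 : ‖cfc g K * W0‖ ≤ b := by
    have : ‖cfc g K‖ ≤ b := norm_cfc_le hb fun x hx => hg x (mem_le hK hx)
    calc _ ≤ _ := norm_mul_le _ _
      _ ≤ b * 1 := by gcongr
      _ = b := mul_one _
  exact (hU _ _).trans (by gcongr)

theorem disk_norm {H : M} (hs : IsSelfAdjoint H) {L : ℝ} (hH : ‖H‖ ≤ L) (r s : C(ℝ,ℝ)) (h : ∀ x, |x| ≤ L → r x ^ 2 + s x ^ 2 ≤ 2 * r x) :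
    ‖1 - cfc r H + Complex.I • cfc s H‖ ≤ 1 := by
  set z := 1 - cfc r H + Complex.I • cfc s H
  have hr : IsSelfAdjoint (cfc r H) := cfc_predicate _ _
  have hss : IsSelfAdjoint (cfc s H) := cfc_predicate _ _
  have hc : cfc r H * cfc s H = cfc s H * cfc r H := by
    rw [← cfc_mul .., ← cfc_mul ..]; simp only [mul_comm]
  have e : star z * z = cfc (fun x => (1 - r x) * (1 - r x) + s x * s x) H := by
    rw [cfc_add .., cfc_mul .., cfc_mul .., cfc_sub .., cfc_const_one ..]
    simp only [z, star_add, star_sub, star_one, hr.star_eq, star_smul, hss.star_eq]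
    simp only [mul_add, add_mul, mul_sub, sub_mul, mul_one, one_mul, smul_mul_assoc, mul_smul_comm, hc, smul_smul,
      smul_sub]
    simp only [RCLike.star_def, Complex.conj_I]
    match_scalars <;> simp <;> ring
  have h2 : ‖z‖ * ‖z‖ ≤ 1 := by
    rw [← CStarRing.norm_star_mul_self, e]
    refine norm_cfc_le zero_le_one fun x hx => ?_
    have := h x (mem_le hH hx)
    rw [Real.norm_eq_abs, abs_le]
    constructor <;> nlinarith [sq_nonneg (1 - r x), sq_nonneg (s x)]
  nlinarith [norm_nonneg z]

theorem aform_basic (U : M →ₗ[ℂ] W →ₗ[ℂ] ℂ) (hU : ∀ x y, ‖U x y‖ ≤ ‖x‖ * ‖y‖) {V : M} {W0 : W} (hV : ‖V‖ ≤ 1)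
    (hW : ‖W0‖ ≤ 1) {H : M} {K : W} (hHs : IsSelfAdjoint H) (hKs : IsSelfAdjoint K) {L : ℝ} (hH : ‖H‖ ≤ L) (hK : ‖K‖ ≤ L)
    {ε : ℝ} (hε : 1 - ε ≤ (U V W0).re)
    (r s r' s' : C(ℝ,ℝ)) (h : ∀ x, |x| ≤ L → r x ^ 2 + s x ^ 2 ≤ 2 * r x)
    (h' : ∀ x, |x| ≤ L → r' x ^ 2 + s' x ^ 2 ≤ 2 * r' x) :
    (aform U V W0 H K r r').re - (aform U V W0 H K s s').re + (aform U V W0 H K r s').im + (aform U V W0 H K s r').im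
      ≤ (aform U V W0 H K r 1).re + (aform U V W0 H K s 1).im + (aform U V W0 H K 1 r').re + (aform U V W0 H K 1 s').im + ε := by
  have h1 := disk_norm hHs hH r s h
  have h2 := disk_norm hKs hK r' s' h'
  have b : ‖U ((1 - cfc r H + Complex.I • cfc s H) * V) ((1 - cfc r' K + Complex.I • cfc s' K) * W0)‖ ≤ 1 := by
    refine (hU _ _).trans ?_
    have b1 : ‖(1 - cfc r H + Complex.I • cfc s H) * V‖ ≤ 1 := (norm_mul_le _ _).trans (mul_le_one₀ h1 (norm_nonneg _) hV)
    have b2 : ‖(1 - cfc r' K + Complex.I • cfc s' K) * W0‖ ≤ 1 := (norm_mul_le _ _).trans (mul_le_one₀ h2 (norm_nonneg _) hW)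
    exact mul_le_one₀ b1 (norm_nonneg _) b2
  have b' := (Complex.re_le_norm _).trans b
  have c1 : cfc (⇑(1 : C(ℝ,ℝ))) H = 1 := cfc_one ℝ H
  have c2 : cfc (⇑(1 : C(ℝ,ℝ))) K = 1 := cfc_one ℝ K
  simp only [aform_apply, c1, c2, one_mul]
  simp only [add_mul, sub_mul, one_mul, smul_mul_assoc, map_add, map_sub, map_smul, LinearMap.add_apply,
    LinearMap.sub_apply, LinearMap.smul_apply, smul_eq_mul] at b'
  simp at b'
  linarith
end aform

theorem core_limit {L : ℝ} (v : ℕ → C(ℝ,ℝ) →ₗ[ℝ] C(ℝ,ℝ) →ₗ[ℝ] ℂ)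
    (bd : ∀ n (f g : C(ℝ,ℝ)) (a b : ℝ), 0 ≤ a → 0 ≤ b → (∀ x, |x| ≤ L → |f x| ≤ a) → (∀ x, |x| ≤ L → |g x| ≤ b) → ‖v n f g‖ ≤ a * b)
    (ε : ℕ → ℝ) (hε : Tendsto ε atTop (𝓝 0))
    (basic : ∀ n (r s r' s' : C(ℝ,ℝ)), (∀ x, |x| ≤ L → r x ^ 2 + s x ^ 2 ≤ 2 * r x) →
      (∀ x, |x| ≤ L → r' x ^ 2 + s' x ^ 2 ≤ 2 * r' x) →
      (v n r r').re - (v n s s').re + (v n r s').im + (v n s r').im ≤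
        (v n r 1).re + (v n s 1).im + (v n 1 r').re + (v n 1 s').im + ε n)
    (m1 : ∀ n, (v n (idC^2) 1).re ≤ 2) (m2 : ∀ n, (v n (idC^4) 1).re ≤ 2)
    (m3 : ∀ n, (v n 1 (idC^2)).re ≤ 2) (m4 : ∀ n, (v n 1 (idC^4)).re ≤ 2) :
    ∀ᶠ n in (hyperfilter ℕ : Filter ℕ), ‖v n idC idC‖ ≤ 86 := by
  have hb : ∀ f : C(ℝ,ℝ), ∃ a : ℝ, 0 ≤ a ∧ ∀ x, |x| ≤ L → |f x| ≤ a := by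
    intro f
    obtain ⟨a, ha⟩ := (isCompact_Icc (a := -L) (b := L)).exists_bound_of_continuousOn f.continuous.continuousOn
    exact ⟨max a 0, le_max_right _ _, fun x hx => (ha x (abs_le.1 hx)).trans (le_max_left _ _)⟩
  have hlim : ∀ f g, ∃ z : ℂ, Tendsto (fun n => v n f g) (hyperfilter ℕ : Filter ℕ) (𝓝 z) := by
    intro f g
    obtain ⟨a, ha, hfa⟩ := hb f
    obtain ⟨b, hb, hgb⟩ := hb g
    have hc := isCompact_closedBall (0:ℂ) (a * b)
    obtain ⟨z, _, hz⟩ := hc.ultrafilter_le_nhds' ((hyperfilter ℕ).map (fun n => v n f g)) (by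
      rw [Ultrafilter.mem_map]
      exact Filter.univ_mem' fun n => by simpa using bd n f g a b ha hb hfa hgb)
    exact ⟨z, hz⟩
  choose w hw using hlim
  let V : C(ℝ,ℝ) →ₗ[ℝ] C(ℝ,ℝ) →ₗ[ℝ] ℂ := LinearMap.mk₂ ℝ w
    (fun f f' g => tendsto_nhds_unique (hw _ _) (by simpa using (hw f g).add (hw f' g)))
    (fun c f g => tendsto_nhds_unique (hw _ _) (by simpa using (hw f g).const_smul c))
    (fun f g g' => tendsto_nhds_unique (hw _ _) (by simpa using (hw f g).add (hw f g')))
    (fun c f g => tendsto_nhds_unique (hw _ _) (by simpa using (hw f g).const_smul c))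
  have hV : ∀ f g, V f g = w f g := fun f g => rfl
  have hre : ∀ f g, Tendsto (fun n => (v n f g).re) (hyperfilter ℕ : Filter ℕ) (𝓝 (w f g).re) := fun f g =>
    (Complex.continuous_re.tendsto _).comp (hw f g)
  have him : ∀ f g, Tendsto (fun n => (v n f g).im) (hyperfilter ℕ : Filter ℕ) (𝓝 (w f g).im) := fun f g =>
    (Complex.continuous_im.tendsto _).comp (hw f g)
  have hε' : Tendsto ε (hyperfilter ℕ : Filter ℕ) (𝓝 0) := hε.mono_left (Nat.hyperfilter_le_atTop)
  have hc : CoreForm L V := by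
    constructor
    · intro f g hf hg
      rw [hV]
      refine le_of_tendsto (hw f g).norm (Eventually.of_forall fun n => ?_)
      simpa using bd n f g 1 1 zero_le_one zero_le_one hf hg
    · intro r s r' s' h h'
      simp only [hV]
      have := le_of_tendsto_of_tendsto' ((((hre r r').sub (hre s s')).add (him r s')).add (him s r'))
        (((((hre r 1).add (him s 1)).add (hre 1 r')).add (him 1 s')).add hε') (fun n => basic n r s r' s' h h')
      linarith
  have hm := hc.main (le_of_tendsto' (hre _ _) m1) (le_of_tendsto' (hre _ _) m2) (le_of_tendsto' (hre _ _) m3)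
    (le_of_tendsto' (hre _ _) m4)
  exact ((hw idC idC).norm.eventually_lt_const (show ‖w idC idC‖ < 86 by rw [← hV]; linarith)).mono fun n h => h.le
end TP

namespace TP
open Matrix

section alg
variable {A : Type*} [Ring A] [StarRing A] [Algebra ℂ A] [StarModule ℂ A]
variable {B : Type*} [Ring B] [StarRing B] [Algebra ℂ B] [StarModule ℂ B]
variable {κ I : Type} [Fintype κ] [DecidableEq κ] [Fintype I] [DecidableEq I]

theorem wU_flip (u : A →ₗ[ℂ] B →ₗ[ℂ] ℂ) (σ : κ → ℝ) (v : Matrix κ κ A) (w : Matrix κ κ B) :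
    wU u.flip σ w v = wU u σ v w := rfl

def wUl (u : A →ₗ[ℂ] B →ₗ[ℂ] ℂ) (σ : κ → ℝ) : Matrix κ κ A →ₗ[ℂ] Matrix κ κ B →ₗ[ℂ] ℂ :=
  LinearMap.mk₂ ℂ (wU u σ)
    (by intros; simp [wU, Finset.sum_add_distrib, mul_add])
    (by intro c x y; simp only [wU, Matrix.smul_apply, map_smul, LinearMap.smul_apply, smul_eq_mul, Finset.mul_sum]
        refine Finset.sum_congr rfl fun k _ => Finset.sum_congr rfl fun l _ => ?_
        ring)
    (by intros; simp [wU, Finset.sum_add_distrib, mul_add])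
    (by intro c x y; simp only [wU, Matrix.smul_apply, map_smul, LinearMap.smul_apply, smul_eq_mul, Finset.mul_sum]
        refine Finset.sum_congr rfl fun k _ => Finset.sum_congr rfl fun l _ => ?_
        ring)

theorem wUl_apply (u : A →ₗ[ℂ] B →ₗ[ℂ] ℂ) (σ : κ → ℝ) (v w) : wUl u σ v w = wU u σ v w := rfl

variable (I) in
def tl (v : Matrix κ κ A) : Matrix (κ × I) (κ × I) A := fun p q => if p.2 = q.2 then v p.1 q.1 else 0
variable (κ) in
def tr (m : Matrix I I A) : Matrix (κ × I) (κ × I) A := fun p q => if p.1 = q.1 then m p.2 q.2 else 0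

theorem tl_eq (v : Matrix κ κ A) : tl I v = blockDiagonal (fun _ : I => v) := by
  ext p q; rw [blockDiagonal_apply]; rfl
theorem tr_eq (m : Matrix I I A) : tr κ m = (blockDiagonal (fun _ : κ => m)).submatrix (Equiv.prodComm κ I) (Equiv.prodComm κ I) := by
  ext p q; rw [submatrix_apply, blockDiagonal_apply]; rfl

theorem tl_mul (v w : Matrix κ κ A) : tl I (v * w) = tl I v * tl I w := by
  simp only [tl_eq]; rw [← blockDiagonal_mul]
theorem tr_mul (v w : Matrix I I A) : tr κ (v * w) = tr κ v * tr κ w := by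
  simp only [tr_eq]; rw [submatrix_mul_equiv, ← blockDiagonal_mul]
theorem tl_one : tl I (1 : Matrix κ κ A) = 1 := by
  simp only [tl_eq]; exact blockDiagonal_one
theorem tl_star (v : Matrix κ κ A) : tl I (vᴴ) = (tl I v)ᴴ := by
  simp only [tl_eq]; rw [blockDiagonal_conjTranspose]
theorem tr_star (v : Matrix I I A) : tr κ (vᴴ) = (tr κ v)ᴴ := by
  simp only [tr_eq]; rw [conjTranspose_submatrix, blockDiagonal_conjTranspose]

def pw (σ : κ → ℝ) (τ : I → ℝ) : κ × I → ℝ := fun p => σ p.1 * τ p.2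

theorem pw_sum (σ : κ → ℝ) (τ : I → ℝ) (h : ∑ k, σ k ^ 2 = 1) (h' : ∑ k, τ k ^ 2 = 1) : ∑ k, pw σ τ k ^ 2 = 1 := by
  simp only [pw, Fintype.sum_prod_type, mul_pow, ← Finset.mul_sum, h', mul_one, h]

theorem tr_tl_apply (m : Matrix I I A) (v : Matrix κ κ A) (p q : κ × I) : (tr κ m * tl I v) p q = m p.2 q.2 * v p.1 q.1 := by
  rw [Matrix.mul_apply, Fintype.sum_prod_type, Finset.sum_eq_single p.1, Finset.sum_eq_single q.2]
  · simp [tr, tl]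
  · intro j _ hj; simp [tl, hj]
  · simp
  · intro k _ hk; simp [tr, hk.symm]
  · simp
theorem tl_tr_apply (m : Matrix I I A) (v : Matrix κ κ A) (p q : κ × I) : (tl I v * tr κ m) p q = v p.1 q.1 * m p.2 q.2 := by
  rw [Matrix.mul_apply, Fintype.sum_prod_type, Finset.sum_eq_single q.1, Finset.sum_eq_single p.2]
  · simp [tr, tl]
  · intro j _ hj; simp [tl, hj.symm]
  · simp
  · intro k _ hk; simp [tr, hk]
  · simp

theorem wU_diag (u : A →ₗ[ℂ] B →ₗ[ℂ] ℂ) (σ : κ → ℝ) (τ : I → ℝ) (z : Matrix (κ × I) (κ × I) A) (w : Matrix κ κ B) :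
    wU u (pw σ τ) z (tl I w) = wU u σ (fun k l => ∑ i, ((τ i ^ 2 : ℝ) : ℂ) • z (k, i) (l, i)) w := by
  simp only [wU, Fintype.sum_prod_type, map_sum, LinearMap.sum_apply, Finset.mul_sum]
  refine Finset.sum_congr rfl fun k _ => ?_
  rw [Finset.sum_comm]
  refine Finset.sum_congr rfl fun l _ => ?_
  refine Finset.sum_congr rfl fun i _ => ?_
  rw [Finset.sum_eq_single i]
  · simp only [pw, tl, if_true, map_smul, LinearMap.smul_apply, smul_eq_mul]
    push_cast; ring
  · intro j _ hj; simp [tl, hj.symm]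
  · simp

theorem wU_tl_tl (u : A →ₗ[ℂ] B →ₗ[ℂ] ℂ) (σ : κ → ℝ) (τ : I → ℝ) (h' : ∑ k, τ k ^ 2 = 1) (v : Matrix κ κ A) (w : Matrix κ κ B) :
    wU u (pw σ τ) (tl I v) (tl I w) = wU u σ v w := by
  rw [wU_diag]; congr 1
  ext k l
  simp only [tl, if_true]
  rw [← Finset.sum_smul, ← Complex.ofReal_sum, h']; simp

theorem wU_trtl (u : A →ₗ[ℂ] B →ₗ[ℂ] ℂ) (σ : κ → ℝ) (τ : I → ℝ) (m : Matrix I I A) (v : Matrix κ κ A) (w : Matrix κ κ B) :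
    wU u (pw σ τ) (tr κ m * tl I v) (tl I w) = wU u σ (scalar κ (wE τ m) * v) w := by
  rw [wU_diag]; congr 1
  ext k l
  simp only [tr_tl_apply, scalar_apply, diagonal_mul, wE, Finset.sum_mul, smul_mul_assoc]

theorem wU_tltr (u : A →ₗ[ℂ] B →ₗ[ℂ] ℂ) (σ : κ → ℝ) (τ : I → ℝ) (m : Matrix I I A) (v : Matrix κ κ A) (w : Matrix κ κ B) :
    wU u (pw σ τ) (tl I v * tr κ m) (tl I w) = wU u σ (v * scalar κ (wE τ m)) w := by
  rw [wU_diag]; congr 1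
  ext k l
  simp only [tl_tr_apply, scalar_apply, mul_diagonal, wE, Finset.mul_sum, mul_smul_comm]

theorem wU_tr_tr (u : A →ₗ[ℂ] B →ₗ[ℂ] ℂ) (σ : κ → ℝ) (τ : I → ℝ) (h : ∑ k, σ k ^ 2 = 1) (X : Matrix I I A) (Y : Matrix I I B) :
    wU u (pw σ τ) (tr κ X) (tr κ Y) = wU u τ X Y := by
  have : ∀ k i, ∑ q, ((pw σ τ (k, i) * pw σ τ q : ℝ) : ℂ) * u (tr κ X (k, i) q) (tr κ Y (k, i) q) =
      ((σ k ^ 2 : ℝ) : ℂ) * ∑ j, ((τ i * τ j : ℝ) : ℂ) * u (X i j) (Y i j) := by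
    intro k i
    rw [Fintype.sum_prod_type, Finset.sum_eq_single k, Finset.mul_sum]
    · refine Finset.sum_congr rfl fun j _ => ?_
      simp only [pw, tr, if_true]
      push_cast; ring
    · intro l _ hl; simp [tr, hl.symm]
    · simp
  simp only [wU]
  rw [Fintype.sum_prod_type]
  simp only [this]
  simp only [← Finset.mul_sum]
  rw [← Finset.sum_mul, ← Complex.ofReal_sum, h]; simp

/-- doubled weights -/
def dw (σ : κ → ℝ) : κ ⊕ κ → ℝ := Sum.elim (fun k => √(1/2) * σ k) (fun k => √(1/2) * σ k)

theorem dw_sum (σ : κ → ℝ) (h : ∑ k, σ k ^ 2 = 1) : ∑ k, dw σ k ^ 2 = 1 := by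
  simp only [dw, Fintype.sum_sum_type, Sum.elim_inl, Sum.elim_inr, mul_pow, ← Finset.mul_sum, h]
  rw [Real.sq_sqrt (by norm_num)]; norm_num

theorem wU_dw (u : A →ₗ[ℂ] B →ₗ[ℂ] ℂ) (σ : κ → ℝ) (a b c d : Matrix κ κ A) (a' b' c' d' : Matrix κ κ B) :
    wU u (dw σ) (fromBlocks a b c d) (fromBlocks a' b' c' d') =
      (1/2) * (wU u σ a a' + wU u σ b b' + wU u σ c c' + wU u σ d d') := by
  simp only [wU, dw, Fintype.sum_sum_type, Sum.elim_inl, Sum.elim_inr, fromBlocks_apply₁₁, fromBlocks_apply₁₂,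
    fromBlocks_apply₂₁, fromBlocks_apply₂₂]
  have e : ∀ k l, (√(1/2) * σ k * (√(1/2) * σ l):ℝ) = (1/2) * (σ k * σ l) := by
    intro k l
    have := Real.mul_self_sqrt (show (0:ℝ) ≤ 1/2 by norm_num)
    calc _ = (√(1/2) * √(1/2)) * (σ k * σ l) := by ring
      _ = _ := by rw [this]
  simp only [e]
  push_cast
  simp only [Finset.sum_add_distrib, mul_assoc, ← Finset.mul_sum]
  ring

theorem wU_zero_weight (u : A →ₗ[ℂ] B →ₗ[ℂ] ℂ) (σ : κ → ℝ) (a b c d : Matrix κ κ A) (a' b' c' d' : Matrix κ κ B) :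
    wU u (Sum.elim σ (fun _ => 0)) (fromBlocks a b c d) (fromBlocks a' b' c' d') = wU u σ a a' := by
  simp [wU]

theorem wU_zero_left (u : A →ₗ[ℂ] B →ₗ[ℂ] ℂ) (σ : κ → ℝ) (w : Matrix κ κ B) : wU u σ 0 w = 0 := by simp [wU]
theorem wU_zero_right (u : A →ₗ[ℂ] B →ₗ[ℂ] ℂ) (σ : κ → ℝ) (w : Matrix κ κ A) : wU u σ w 0 = 0 := by simp [wU]
end alg
end TP

namespace TP
open Matrix CStarMatrix

section norms
variable {A : Type*} [CStarAlgebra A] [PartialOrder A] [StarOrderedRing A]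
variable {B : Type*} [CStarAlgebra B] [PartialOrder B] [StarOrderedRing B]
variable {κ I : Type} [Fintype κ] [DecidableEq κ] [Fintype I] [DecidableEq I]

/-- matrix norm -/
def mn (v : Matrix κ κ A) : ℝ := ‖ofMatrix v‖

theorem mn_nonneg (v : Matrix κ κ A) : 0 ≤ mn v := norm_nonneg _
theorem mn_mul (v w : Matrix κ κ A) : mn (v * w) ≤ mn v * mn w := norm_mul_le (ofMatrix v) (ofMatrix w)
theorem mn_star_mul (v : Matrix κ κ A) : mn (vᴴ * v) = mn v * mn v := CStarRing.norm_star_mul_self (x := ofMatrix v)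
theorem mn_star (v : Matrix κ κ A) : mn (vᴴ) = mn v := norm_star (ofMatrix v)
theorem mn_smul (c : ℂ) (v : Matrix κ κ A) : mn (c • v) = ‖c‖ * mn v := norm_smul c (ofMatrix v)
theorem mn_zero : mn (0 : Matrix κ κ A) = 0 := norm_zero (E := CStarMatrix κ κ A)

theorem mn_one : mn (1 : Matrix κ κ A) ≤ 1 := by
  have := mn_star_mul (1 : Matrix κ κ A)
  simp only [conjTranspose_one, mul_one] at this
  nlinarith [mn_nonneg (1 : Matrix κ κ A)]

theorem mn_unitary {v : Matrix κ κ A} (h : vᴴ * v = 1) : mn v ≤ 1 := by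
  have := mn_star_mul v
  rw [h] at this
  nlinarith [mn_nonneg v, mn_one (A := A) (κ := κ)]

theorem mn_hom {D : Type*} [NonUnitalCStarAlgebra D] (φ : D → Matrix κ κ A) (hadd : ∀ x y, φ (x + y) = φ x + φ y)
    (hmul : ∀ x y, φ (x * y) = φ x * φ y) (hstar : ∀ x, φ (star x) = (φ x)ᴴ) (hsmul : ∀ (c : ℂ) x, φ (c • x) = c • φ x)
    (x : D) : mn (φ x) ≤ ‖x‖ := by
  let ψ : D →⋆ₙₐ[ℂ] CStarMatrix κ κ A :=
    { toFun := fun x => ofMatrix (φ x)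
      map_smul' := fun c x => hsmul c x
      map_zero' := by have := hsmul 0 0; rw [zero_smul, zero_smul] at this; exact this
      map_add' := fun x y => hadd x y
      map_mul' := fun x y => hmul x y
      map_star' := fun x => hstar x }
  exact NonUnitalStarAlgHom.norm_apply_le ψ x

theorem mn_scalar (c : A) : mn (scalar κ c) ≤ ‖c‖ := by
  have h1 : ∀ x y : A, diagonal (fun _ : κ => x + y) = diagonal (fun _ : κ => x) + diagonal (fun _ : κ => y) := by
    intro x y; rw [Matrix.diagonal_add]
  have h2 : ∀ x y : A, diagonal (fun _ : κ => x * y) = diagonal (fun _ : κ => x) * diagonal (fun _ : κ => y) := by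
    intro x y; rw [Matrix.diagonal_mul_diagonal]
  have h3 : ∀ x : A, diagonal (fun _ : κ => star x) = (diagonal (fun _ : κ => x))ᴴ := by
    intro x; rw [Matrix.diagonal_conjTranspose]; rfl
  have h4 : ∀ (c : ℂ) (x : A), diagonal (fun _ : κ => c • x) = c • (diagonal (fun _ : κ => x)) := by
    intro c x; rw [← Matrix.diagonal_smul]; rfl
  exact mn_hom (fun c : A => diagonal (fun _ : κ => c)) h1 h2 h3 h4 c

theorem mn_tr (m : Matrix I I A) : mn (tr κ m) ≤ mn m := by
  refine mn_hom (D := CStarMatrix I I A) (fun c => tr κ (ofMatrix.symm c)) (fun x y => ?_) (fun x y => tr_mul _ _)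
    (fun x => tr_star _) (fun c x => ?_) (ofMatrix m)
  · ext p q; simp only [tr, Matrix.add_apply]; split_ifs <;> simp
  · ext p q; simp only [tr, Matrix.smul_apply]; split_ifs <;> simp

theorem mn_diag (v w : Matrix κ κ A) : mn (fromBlocks v 0 0 w) ≤ max (mn v) (mn w) := by
  refine mn_hom (D := CStarMatrix κ κ A × CStarMatrix κ κ A)
    (fun c => fromBlocks (ofMatrix.symm c.1) 0 0 (ofMatrix.symm c.2)) (fun x y => ?_) (fun x y => ?_)
    (fun x => ?_) (fun c x => ?_) (ofMatrix v, ofMatrix w)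
  · rw [fromBlocks_add]; simp; first | done | exact ⟨rfl, rfl⟩ | rfl
  · rw [fromBlocks_multiply]; simp; first | done | exact ⟨rfl, rfl⟩ | rfl
  · rw [fromBlocks_conjTranspose]; simp; first | done | exact ⟨rfl, rfl⟩ | rfl
  · rw [fromBlocks_smul]; simp; first | done | exact ⟨rfl, rfl⟩ | rfl

theorem mn_off (v : Matrix κ κ A) : mn (fromBlocks 0 v vᴴ 0) ≤ mn v := by
  have h := mn_star_mul (fromBlocks 0 v vᴴ 0)
  rw [fromBlocks_conjTranspose, fromBlocks_multiply] at h
  simp only [Matrix.conjTranspose_zero, Matrix.conjTranspose_conjTranspose, zero_mul, mul_zero, zero_add, add_zero] at h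
  have h2 := mn_diag (v * vᴴ) (vᴴ * v)
  rw [h] at h2
  have h3 : mn (v * vᴴ) = mn v * mn v := by
    have := mn_star_mul (vᴴ); rwa [Matrix.conjTranspose_conjTranspose, mn_star] at this
  rw [h3, mn_star_mul, max_self] at h2
  exact abs_le_of_sq_le_sq' (by nlinarith) (mn_nonneg v) |>.2

/-- matricial boundedness -/
def MB (u : A →ₗ[ℂ] B →ₗ[ℂ] ℂ) (N : ℝ) : Prop :=
  ∀ (κ : Type) [Fintype κ] [DecidableEq κ] (σ : κ → ℝ), ∑ k, σ k ^ 2 = 1 → ∀ (v : Matrix κ κ A) (w : Matrix κ κ B),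
    ‖wU u σ v w‖ ≤ N * mn v * mn w

theorem MB.flip {u : A →ₗ[ℂ] B →ₗ[ℂ] ℂ} {N : ℝ} (h : MB u N) : MB u.flip N := by
  intro κ _ _ σ hσ v w
  rw [wU_flip]
  have := h κ σ hσ w v
  rwa [mul_right_comm]

def IsU (v : Matrix κ κ A) : Prop := vᴴ * v = 1 ∧ v * vᴴ = 1

theorem IsU.dbl {v : Matrix κ κ A} (h : IsU v) : IsU (fromBlocks v 0 0 v) := by
  constructor
  · rw [fromBlocks_conjTranspose, fromBlocks_multiply]; simp [h.1]
  · rw [fromBlocks_conjTranspose, fromBlocks_multiply]; simp [h.2]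

theorem unitarize (u : A →ₗ[ℂ] B →ₗ[ℂ] ℂ) (σ : κ → ℝ) (hσ : ∑ k, σ k ^ 2 = 1) (v : Matrix κ κ A) (w : Matrix κ κ B)
    (hv : mn v ≤ 1) (t : ℝ) (ht : t < (wU u σ v w).re) :
    ∃ (σ' : κ ⊕ κ → ℝ) (v' : Matrix (κ ⊕ κ) (κ ⊕ κ) A), ∑ k, σ' k ^ 2 = 1 ∧ IsU v' ∧
      t < (wU u σ' v' (fromBlocks w 0 0 w)).re := by
  let s : CStarMatrix (κ ⊕ κ) (κ ⊕ κ) A := ofMatrix (fromBlocks 0 v vᴴ 0)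
  have hs : IsSelfAdjoint s := by
    show (fromBlocks 0 v vᴴ 0)ᴴ = fromBlocks 0 v vᴴ 0
    rw [fromBlocks_conjTranspose]; simp
  have hn : ‖s‖ ≤ 1 := (mn_off v).trans hv
  let U := selfAdjoint.unitarySelfAddISMul ⟨s, hs⟩ hn
  let F : Matrix (κ ⊕ κ) (κ ⊕ κ) A := fromBlocks 0 1 1 0
  have hF : F * F = 1 := by simp [F, fromBlocks_multiply]
  have hF' : Fᴴ = F := by simp [F, fromBlocks_conjTranspose]
  let U1 : Matrix (κ ⊕ κ) (κ ⊕ κ) A := ofMatrix.symm (U : CStarMatrix (κ ⊕ κ) (κ ⊕ κ) A)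
  have hU1 : U1ᴴ * U1 = 1 := Unitary.coe_star_mul_self U
  have hU2 : U1 * U1ᴴ = 1 := Unitary.coe_mul_star_self U
  have hsum : U1 + U1ᴴ = (2:ℂ) • fromBlocks 0 v vᴴ 0 := by
    have h1 : (U : CStarMatrix (κ ⊕ κ) (κ ⊕ κ) A) + star (U : CStarMatrix (κ ⊕ κ) (κ ⊕ κ) A) = (2:ℂ) • s := by
      have e1 := selfAdjoint.star_coe_unitarySelfAddISMul ⟨s, hs⟩ hn
      have e2 := selfAdjoint.unitarySelfAddISMul_coe ⟨s, hs⟩ hn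
      simp only [U]
      rw [e1, e2]
      module
    exact h1
  let σ' : κ ⊕ κ → ℝ := Sum.elim σ (fun _ => 0)
  have hσ' : ∑ k, σ' k ^ 2 = 1 := by simp [σ', hσ]
  have hsF : U1 * F + U1ᴴ * F = (2:ℂ) • fromBlocks v 0 0 vᴴ := by
    rw [← add_mul, hsum, smul_mul_assoc]
    simp [F, fromBlocks_multiply]
  have key : (2:ℂ) * wU u σ v w = wU u σ' (U1 * F) (fromBlocks w 0 0 w) + wU u σ' (U1ᴴ * F) (fromBlocks w 0 0 w) := by
    simp only [← wUl_apply]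
    rw [← LinearMap.add_apply, ← map_add, hsF, map_smul, LinearMap.smul_apply, wUl_apply, wUl_apply, wU_zero_weight]
    rfl
  have k2 := congrArg Complex.re key
  simp at k2
  by_cases h : t < (wU u σ' (U1 * F) (fromBlocks w 0 0 w)).re
  · refine ⟨σ', U1 * F, hσ', ⟨?_, ?_⟩, h⟩
    · rw [conjTranspose_mul, hF', mul_assoc, ← mul_assoc _ U1, hU1, one_mul, hF]
    · rw [conjTranspose_mul, hF', mul_assoc, ← mul_assoc F F, hF, one_mul, hU2]
  · refine ⟨σ', U1ᴴ * F, hσ', ⟨?_, ?_⟩, by linarith⟩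
    · rw [conjTranspose_mul, hF', Matrix.conjTranspose_conjTranspose, mul_assoc, ← mul_assoc _ U1ᴴ, hU2, one_mul, hF]
    · rw [conjTranspose_mul, hF', Matrix.conjTranspose_conjTranspose, mul_assoc, ← mul_assoc F F, hF, one_mul, hU1]

theorem near_max (u : A →ₗ[ℂ] B →ₗ[ℂ] ℂ) (N t : ℝ) (hN : MB u N) (hnt : ¬ MB u t) :
    ∃ (κ : Type) (_ : Fintype κ) (_ : DecidableEq κ) (σ : κ → ℝ) (v : Matrix κ κ A) (w : Matrix κ κ B),
      ∑ k, σ k ^ 2 = 1 ∧ IsU v ∧ IsU w ∧ t < (wU u σ v w).re := by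
  unfold MB at hnt
  push Not at hnt
  obtain ⟨κ, _, _, σ, hσ, v, w, h⟩ := hnt
  have hv : mn v ≠ 0 := by
    intro h0
    have := hN κ σ hσ v w
    simp [h0] at this h
    simp [this] at h
  have hw : mn w ≠ 0 := by
    intro h0
    have := hN κ σ hσ v w
    simp [h0] at this h
    simp [this] at h
  have hv' := lt_of_le_of_ne (mn_nonneg v) hv.symm
  have hw' := lt_of_le_of_ne (mn_nonneg w) hw.symm
  obtain ⟨c, hc, hc'⟩ : ∃ c : ℂ, ‖c‖ = 1 ∧ c * wU u σ v w = ‖wU u σ v w‖ := by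
    by_cases h0 : wU u σ v w = 0
    · exact ⟨1, by simp, by simp [h0]⟩
    · refine ⟨‖wU u σ v w‖ / wU u σ v w, by simp [h0], by field_simp⟩
  let v1 : Matrix κ κ A := (c * ((mn v)⁻¹ : ℝ)) • v
  let w1 : Matrix κ κ B := (((mn w)⁻¹ : ℝ) : ℂ) • w
  have hv1 : mn v1 ≤ 1 := by
    simp only [v1, mn_smul, norm_mul, hc, Complex.norm_real, Real.norm_eq_abs, abs_inv, abs_of_pos hv']
    field_simp; rfl
  have hw1 : mn w1 ≤ 1 := by
    simp only [w1, mn_smul, norm_mul, hc, Complex.norm_real, Real.norm_eq_abs, abs_inv, abs_of_pos hw']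
    field_simp; rfl
  have hval : t < (wU u σ v1 w1).re := by
    have : wU u σ v1 w1 = (((mn v)⁻¹ * (mn w)⁻¹ * ‖wU u σ v w‖ : ℝ) : ℂ) := by
      simp only [← wUl_apply, v1, w1, map_smul, LinearMap.smul_apply, smul_eq_mul]
      simp only [wUl_apply]
      push_cast
      rw [← hc']; ring
    rw [this, Complex.ofReal_re]
    have : t = (mn v)⁻¹ * (mn w)⁻¹ * (t * mn v * mn w) := by field_simp
    rw [this]
    gcongr
  obtain ⟨σ', v', hσ', hv', ht'⟩ := unitarize u σ hσ v1 w1 hv1 t hval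
  obtain ⟨sig2, w2, hsig2, hw2, ht2⟩ := unitarize u.flip σ' hσ' (fromBlocks w1 0 0 w1) v'
    ((mn_diag _ _).trans (by simpa using hw1)) t ht'
  exact ⟨_, inferInstance, inferInstance, sig2, _, w2, hsig2, hv'.dbl, hw2, ht2⟩
end norms
end TP

namespace TP
open Matrix CStarMatrix Filter Topology

section ab
variable {M W : Type*} [CStarAlgebra M] [CStarAlgebra W]
theorem cf1 {H : M} (hH : IsSelfAdjoint H) : cfc (⇑(1 : C(ℝ,ℝ))) H = 1 := cfc_const_one ℝ H
theorem cfi {H : M} (hH : IsSelfAdjoint H) : cfc (⇑idC) H = H := cfc_id' ℝ H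
theorem cf2 {H : M} (hH : IsSelfAdjoint H) : cfc (⇑(idC ^ 2)) H = H * H := by
  have := cfc_pow_id (R := ℝ) H 2; rw [pow_two] at this; exact this
theorem cf4 {H : M} (hH : IsSelfAdjoint H) : cfc (⇑(idC ^ 4)) H = H * H * (H * H) := by
  have := cfc_pow_id (R := ℝ) H 4; rw [show H ^ 4 = H * H * (H * H) by noncomm_ring] at this; exact this
variable (U : M →ₗ[ℂ] W →ₗ[ℂ] ℂ) (V : M) (W0 : W) {H : M} {K : W} (hH : IsSelfAdjoint H) (hK : IsSelfAdjoint K)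
theorem aform_21 (hH : IsSelfAdjoint H) (hK : IsSelfAdjoint K) : aform U V W0 H K (idC^2) 1 = U (H * H * V) W0 := by
  rw [aform_apply, cf2 hH, cf1 hK, one_mul]
theorem aform_41 (hH : IsSelfAdjoint H) (hK : IsSelfAdjoint K) : aform U V W0 H K (idC^4) 1 = U (H * H * (H * H) * V) W0 := by
  rw [aform_apply, cf4 hH, cf1 hK, one_mul]
theorem aform_12 (hH : IsSelfAdjoint H) (hK : IsSelfAdjoint K) : aform U V W0 H K 1 (idC^2) = U V (K * K * W0) := by
  rw [aform_apply, cf1 hH, cf2 hK, one_mul]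
theorem aform_14 (hH : IsSelfAdjoint H) (hK : IsSelfAdjoint K) : aform U V W0 H K 1 (idC^4) = U V (K * K * (K * K) * W0) := by
  rw [aform_apply, cf1 hH, cf4 hK, one_mul]
theorem aform_11 (hH : IsSelfAdjoint H) (hK : IsSelfAdjoint K) : aform U V W0 H K idC idC = U (H * V) (K * W0) := by
  rw [aform_apply, cfi hH, cfi hK]
end ab

section gt
variable {A : Type*} [CStarAlgebra A] [PartialOrder A] [StarOrderedRing A]
variable {B : Type*} [CStarAlgebra B] [PartialOrder B] [StarOrderedRing B]
variable {κ I : Type} [Fintype κ] [DecidableEq κ] [Fintype I] [DecidableEq I]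

structure MomB (τ : I → ℝ) (X : Matrix I I A) : Prop where
  m1 : ‖wE τ (X * Xᴴ)‖ ≤ 1
  m2 : ‖wE τ (Xᴴ * X)‖ ≤ 1
  m3 : ‖wE τ ((X * Xᴴ) * (X * Xᴴ))‖ ≤ 2
  m4 : ‖wE τ ((Xᴴ * X) * (Xᴴ * X))‖ ≤ 2

def Hm (v : Matrix κ κ A) (X : Matrix I I A) : Matrix (κ × I ⊕ κ × I) (κ × I ⊕ κ × I) A :=
  fromBlocks 0 (tr κ X * (tl I v)ᴴ) (tl I v * (tr κ X)ᴴ) 0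

def Vm (I : Type) [Fintype I] [DecidableEq I] (v : Matrix κ κ A) : Matrix (κ × I ⊕ κ × I) (κ × I ⊕ κ × I) A :=
  fromBlocks (tl I v) 0 0 (tl I v)

theorem Hm_star (v : Matrix κ κ A) (X : Matrix I I A) : (Hm v X)ᴴ = Hm v X := by
  simp [Hm, fromBlocks_conjTranspose]

theorem tl_U {v : Matrix κ κ A} (hv : IsU v) : (tl I v)ᴴ * tl I v = 1 ∧ tl I v * (tl I v)ᴴ = 1 := by
  rw [← tl_star, ← tl_mul, ← tl_mul, hv.1, hv.2, tl_one]; simp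

theorem Hm_norm {v : Matrix κ κ A} (hv : IsU v) (X : Matrix I I A) : mn (Hm v X) ≤ mn X := by
  have h : Hm v X = fromBlocks 0 (tr κ X * (tl I v)ᴴ) (tr κ X * (tl I v)ᴴ)ᴴ 0 := by
    simp [Hm]
  rw [h]
  refine (mn_off _).trans ((mn_mul _ _).trans ?_)
  have h1 : mn ((tl I v)ᴴ) ≤ 1 := by rw [mn_star]; exact mn_unitary (tl_U hv).1
  calc _ ≤ mn X * 1 := mul_le_mul (mn_tr X) h1 (mn_nonneg _) (mn_nonneg _)
    _ = _ := mul_one _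

theorem Vm_norm {v : Matrix κ κ A} (hv : IsU v) : mn (Vm I v) ≤ 1 := by
  refine (mn_diag _ _).trans ?_
  simpa using mn_unitary (tl_U hv).1

theorem HV {v : Matrix κ κ A} (hv : IsU v) (X : Matrix I I A) :
    Hm v X * Vm I v = fromBlocks 0 (tr κ X) (tl I v * (tr κ X)ᴴ * tl I v) 0 := by
  simp [Hm, Vm, fromBlocks_multiply, mul_assoc, (tl_U hv).1]

theorem H2 {v : Matrix κ κ A} (hv : IsU v) (X : Matrix I I A) :
    Hm v X * Hm v X = fromBlocks (tr κ (X * Xᴴ)) 0 0 (tl I v * tr κ (Xᴴ * X) * (tl I v)ᴴ) := by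
  have := (tl_U (I := I) hv).1
  simp only [Hm, fromBlocks_multiply, tr_mul, tr_star]
  congr 1
  · simp only [zero_mul, zero_add]
    rw [mul_assoc, ← mul_assoc _ (tl I v), this, one_mul]
  · simp
  · simp
  · simp [mul_assoc]

theorem H2V {v : Matrix κ κ A} (hv : IsU v) (X : Matrix I I A) :
    Hm v X * Hm v X * Vm I v = fromBlocks (tr κ (X * Xᴴ) * tl I v) 0 0 (tl I v * tr κ (Xᴴ * X)) := by
  rw [H2 hv]
  simp [Vm, fromBlocks_multiply, mul_assoc, (tl_U hv).1]

theorem H4V {v : Matrix κ κ A} (hv : IsU v) (X : Matrix I I A) :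
    (Hm v X * Hm v X) * (Hm v X * Hm v X) * Vm I v =
      fromBlocks (tr κ (X * Xᴴ * (X * Xᴴ)) * tl I v) 0 0 (tl I v * tr κ (Xᴴ * X * (Xᴴ * X))) := by
  rw [mul_assoc, H2V hv, H2 hv, fromBlocks_multiply]
  simp only [tr_mul, mul_zero, zero_mul, add_zero, zero_add, fromBlocks_inj, mul_assoc, true_and]
  rw [← mul_assoc (tl I v)ᴴ (tl I v), (tl_U hv).1, one_mul]

theorem diag_bound {u : A →ₗ[ℂ] B →ₗ[ℂ] ℂ} {N : ℝ} (hN0 : 0 < N) (hN : MB u N) {σ : κ → ℝ} (hσ : ∑ k, σ k ^ 2 = 1) (τ : I → ℝ)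
    {v : Matrix κ κ A} {w : Matrix κ κ B} (hv : IsU v) (hw : IsU w) (m m' : Matrix I I A) {c : ℝ}
    (h1 : ‖wE τ m‖ ≤ c) (h2 : ‖wE τ m'‖ ≤ c) :
    ‖wU u (dw (pw σ τ)) (fromBlocks (tr κ m * tl I v) 0 0 (tl I v * tr κ m')) (Vm I w)‖ ≤ N * c := by
  rw [Vm, wU_dw, wU_trtl, wU_tltr, wU_zero_left]
  have hv1 := mn_unitary hv.1
  have hw1 := mn_unitary hw.1
  have a1 : ‖wU u σ (scalar κ (wE τ m) * v) w‖ ≤ N * c := by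
    refine (hN κ σ hσ _ _).trans ?_
    have : mn (scalar κ (wE τ m) * v) ≤ c * 1 := (mn_mul _ _).trans
      (mul_le_mul ((mn_scalar _).trans h1) hv1 (mn_nonneg _) ((norm_nonneg _).trans h1))
    have hc : 0 ≤ c := (norm_nonneg _).trans h1
    calc _ ≤ N * (c * 1) * 1 := mul_le_mul (by gcongr) hw1 (mn_nonneg _) (by positivity)
      _ = _ := by ring
  have a2 : ‖wU u σ (v * scalar κ (wE τ m')) w‖ ≤ N * c := by
    refine (hN κ σ hσ _ _).trans ?_
    have : mn (v * scalar κ (wE τ m')) ≤ 1 * c := (mn_mul _ _).trans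
      (mul_le_mul hv1 ((mn_scalar _).trans h2) (mn_nonneg _) zero_le_one)
    have hc : 0 ≤ c := (norm_nonneg _).trans h1
    calc _ ≤ N * (1 * c) * 1 := mul_le_mul (by gcongr) hw1 (mn_nonneg _) (by positivity)
      _ = _ := by ring
  rw [norm_mul]
  have : ‖(1/2:ℂ)‖ = 1/2 := by norm_num
  rw [this]
  have := norm_add_le (wU u σ (scalar κ (wE τ m) * v) w) (wU u σ (v * scalar κ (wE τ m')) w)
  simp only [add_zero]
  linarith

def Uf (u : A →ₗ[ℂ] B →ₗ[ℂ] ℂ) (N : ℝ) (σ : κ → ℝ) : CStarMatrix κ κ A →ₗ[ℂ] CStarMatrix κ κ B →ₗ[ℂ] ℂ :=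
  LinearMap.mk₂ ℂ (fun v w => ((N⁻¹ : ℝ) : ℂ) * wUl u σ (ofMatrix.symm v) (ofMatrix.symm w))
    (by intro x y z; rw [← mul_add]; congr 1
        exact (LinearMap.congr_fun (map_add (wUl u σ) (ofMatrix.symm x) (ofMatrix.symm y)) (ofMatrix.symm z)))
    (by intro c x z
        have := (LinearMap.congr_fun (map_smul (wUl u σ) c (ofMatrix.symm x)) (ofMatrix.symm z))
        rw [LinearMap.smul_apply] at this
        rw [show ofMatrix.symm (c • x) = c • ofMatrix.symm x from rfl, this, smul_eq_mul, smul_eq_mul]; ring)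
    (by intro x y z; rw [← mul_add]; congr 1
        exact (map_add (wUl u σ (ofMatrix.symm x)) (ofMatrix.symm y) (ofMatrix.symm z)))
    (by intro c x z
        have := (map_smul (wUl u σ (ofMatrix.symm x)) c (ofMatrix.symm z))
        rw [show ofMatrix.symm (c • z) = c • ofMatrix.symm z from rfl, this, smul_eq_mul, smul_eq_mul]; ring)

theorem Uf_apply (u : A →ₗ[ℂ] B →ₗ[ℂ] ℂ) (N : ℝ) (σ : κ → ℝ) (v : Matrix κ κ A) (w : Matrix κ κ B) :
    Uf u N σ (ofMatrix v) (ofMatrix w) = ((N⁻¹ : ℝ) : ℂ) * wU u σ v w := rfl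

theorem form_exists {u : A →ₗ[ℂ] B →ₗ[ℂ] ℂ} {N : ℝ} (hN0 : 0 < N) (hN : MB u N) {σ : κ → ℝ} (hσ : ∑ k, σ k ^ 2 = 1) {τ : I → ℝ}
    (hτ : ∑ k, τ k ^ 2 = 1)
    {v : Matrix κ κ A} {w : Matrix κ κ B} (hv : IsU v) (hw : IsU w) {X : Matrix I I A} {Y : Matrix I I B} (hX : MomB τ X)
    (hY : MomB τ Y) {L : ℝ} (hXL : mn X ≤ L) (hYL : mn Y ≤ L) {ε : ℝ} (hε : N * (1 - ε) ≤ (wU u σ v w).re) :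
    ∃ φ : C(ℝ,ℝ) →ₗ[ℝ] C(ℝ,ℝ) →ₗ[ℝ] ℂ,
    (∀ (f g : C(ℝ,ℝ)) (a b : ℝ), 0 ≤ a → 0 ≤ b → (∀ x, |x| ≤ L → |f x| ≤ a) → (∀ x, |x| ≤ L → |g x| ≤ b) → ‖φ f g‖ ≤ a * b) ∧
    (∀ (r s r' s' : C(ℝ,ℝ)), (∀ x, |x| ≤ L → r x ^ 2 + s x ^ 2 ≤ 2 * r x) →
      (∀ x, |x| ≤ L → r' x ^ 2 + s' x ^ 2 ≤ 2 * r' x) →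
      (φ r r').re - (φ s s').re + (φ r s').im + (φ s r').im ≤
        (φ r 1).re + (φ s 1).im + (φ 1 r').re + (φ 1 s').im + ε) ∧
    (φ (idC^2) 1).re ≤ 2 ∧ (φ (idC^4) 1).re ≤ 2 ∧ (φ 1 (idC^2)).re ≤ 2 ∧ (φ 1 (idC^4)).re ≤ 2 ∧
    φ idC idC = ((N⁻¹ : ℝ) : ℂ) * ((1/2) * (wU u τ X Y + wU u (pw σ τ) (tl I v * (tr κ X)ᴴ * tl I v) (tl I w * (tr κ Y)ᴴ * tl I w))) := by
  have hω := dw_sum _ (pw_sum σ τ hσ hτ)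
  let U := Uf u N (dw (pw σ τ))
  let H : CStarMatrix _ _ A := ofMatrix (Hm v X)
  let K : CStarMatrix _ _ B := ofMatrix (Hm w Y)
  let V : CStarMatrix (κ × I ⊕ κ × I) (κ × I ⊕ κ × I) A := ofMatrix (Vm I v)
  let W : CStarMatrix (κ × I ⊕ κ × I) (κ × I ⊕ κ × I) B := ofMatrix (Vm I w)
  have hU : ∀ x y, ‖U x y‖ ≤ ‖x‖ * ‖y‖ := by
    intro x y
    have h1 := hN _ _ hω (ofMatrix.symm x) (ofMatrix.symm y)
    have h2 : U x y = ((N⁻¹ : ℝ) : ℂ) * wU u (dw (pw σ τ)) (ofMatrix.symm x) (ofMatrix.symm y) := rfl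
    rw [h2, norm_mul, Complex.norm_real, Real.norm_eq_abs, abs_inv, abs_of_pos hN0]
    have h3 : mn (ofMatrix.symm x) = ‖x‖ := rfl
    have h4 : mn (ofMatrix.symm y) = ‖y‖ := rfl
    rw [h3, h4] at h1
    calc _ ≤ N⁻¹ * (N * ‖x‖ * ‖y‖) := by gcongr
      _ = _ := by field_simp
  have hV : ‖V‖ ≤ 1 := Vm_norm hv
  have hW : ‖W‖ ≤ 1 := Vm_norm hw
  have hH : ‖H‖ ≤ L := (Hm_norm hv X).trans hXL
  have hK : ‖K‖ ≤ L := (Hm_norm hw Y).trans hYL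
  have hHs : IsSelfAdjoint H := Hm_star v X
  have hKs : IsSelfAdjoint K := Hm_star w Y
  have hUVW : 1 - ε ≤ (U V W).re := by
    have : U V W = ((N⁻¹ : ℝ) : ℂ) * wU u σ v w := by
      simp only [U, V, W, Uf_apply, Vm, wU_dw, wU_tl_tl u σ τ hτ, wU_zero_left]
      ring
    rw [this, Complex.re_ofReal_mul]
    calc 1 - ε = N⁻¹ * (N * (1 - ε)) := by field_simp
      _ ≤ _ := by gcongr
  have fin : ∀ z : ℂ, ‖z‖ ≤ N * 2 → (((N⁻¹ : ℝ) : ℂ) * z).re ≤ 2 := by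
    intro z hz
    rw [Complex.re_ofReal_mul]
    calc _ ≤ N⁻¹ * (N * 2) := by gcongr; exact (Complex.re_le_norm z).trans hz
      _ = 2 := by field_simp
  refine ⟨aform U V W H K, fun f g a b ha hb hf hg => aform_bd U hU hV hW hH hK f g ha hb hf hg,
    fun r s r' s' h h' => aform_basic U hU hV hW hHs hKs hH hK hUVW r s r' s' h h', ?_, ?_, ?_, ?_, ?_⟩
  · rw [aform_21 U V W hHs hKs]
    have e : H * H * V = ofMatrix (fromBlocks (tr κ (X * Xᴴ) * tl I v) 0 0 (tl I v * tr κ (Xᴴ * X))) := H2V hv X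
    rw [e, Uf_apply]
    exact fin _ (diag_bound hN0 hN hσ τ hv hw _ _ (hX.m1.trans (by norm_num)) (hX.m2.trans (by norm_num)))
  · rw [aform_41 U V W hHs hKs]
    have e : H * H * (H * H) * V = _ := congrArg ofMatrix (H4V hv X)
    rw [e, Uf_apply]
    exact fin _ (diag_bound hN0 hN hσ τ hv hw _ _ hX.m3 hX.m4)
  · rw [aform_12 U V W hHs hKs]
    have e : K * K * W = _ := congrArg ofMatrix (H2V hw Y)
    rw [e, Uf_apply, ← wU_flip]
    exact fin _ (diag_bound hN0 hN.flip hσ τ hw hv _ _ (hY.m1.trans (by norm_num)) (hY.m2.trans (by norm_num)))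
  · rw [aform_14 U V W hHs hKs]
    have e : K * K * (K * K) * W = _ := congrArg ofMatrix (H4V hw Y)
    rw [e, Uf_apply, ← wU_flip]
    exact fin _ (diag_bound hN0 hN.flip hσ τ hw hv _ _ hY.m3 hY.m4)
  · rw [aform_11 U V W hHs hKs]
    have e : H * V = _ := congrArg ofMatrix (HV hv X)
    have e' : K * W = _ := congrArg ofMatrix (HV hw Y)
    rw [e, e', Uf_apply, wU_dw, wU_tr_tr u σ τ hσ, wU_zero_left]
    ring
end gt
end TP

namespace TP
open Matrix CStarMatrix Filter Topology

section gt
variable {A : Type*} [CStarAlgebra A] [PartialOrder A] [StarOrderedRing A]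
variable {B : Type*} [CStarAlgebra B] [PartialOrder B] [StarOrderedRing B]
variable {κ I : Type} [Fintype κ] [DecidableEq κ] [Fintype I] [DecidableEq I]

theorem MomB.Ismul {τ : I → ℝ} {X : Matrix I I A} (h : MomB τ X) : MomB τ (Complex.I • X) := by
  have e1 : (Complex.I • X) * (Complex.I • X)ᴴ = X * Xᴴ := by
    rw [conjTranspose_smul, smul_mul_smul_comm]; simp
  have e2 : (Complex.I • X)ᴴ * (Complex.I • X) = Xᴴ * X := by
    rw [conjTranspose_smul, smul_mul_smul_comm]; simp
  constructor
  · rw [e1]; exact h.m1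
  · rw [e2]; exact h.m2
  · rw [e1]; exact h.m3
  · rw [e2]; exact h.m4

theorem gt1 {u : A →ₗ[ℂ] B →ₗ[ℂ] ℂ} {N : ℝ} (hN0 : 0 < N) (hN : MB u N) (hmin : ∀ t < N, ¬ MB u t) {τ : I → ℝ}
    (hτ : ∑ k, τ k ^ 2 = 1) {X : Matrix I I A} {Y : Matrix I I B} (hX : MomB τ X) (hY : MomB τ Y) :
    ‖wU u τ X Y‖ ≤ 172 * N := by
  have hnm : ∀ n : ℕ, ∃ (κ : Type) (_ : Fintype κ) (_ : DecidableEq κ) (σ : κ → ℝ) (v : Matrix κ κ A) (w : Matrix κ κ B),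
      ∑ k, σ k ^ 2 = 1 ∧ IsU v ∧ IsU w ∧ N * (1 - 1 / ((n:ℝ) + 1)) < (wU u σ v w).re := by
    intro n
    refine near_max u N _ hN (hmin _ ?_)
    have : (0:ℝ) < 1 / ((n:ℝ) + 1) := by positivity
    nlinarith
  choose κ f1 f2 σ v w hσ hv hw hre using hnm
  let L := max (mn X) (mn Y)
  have hYI : mn (Complex.I • Y) ≤ L := by rw [mn_smul]; simp [L]
  have h1 := fun n => form_exists hN0 hN (hσ n) hτ (hv n) (hw n) hX hY (L := L) (le_max_left _ _) (le_max_right _ _) (hre n).le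
  have h2 := fun n => form_exists hN0 hN (hσ n) hτ (hv n) (hw n) hX hY.Ismul (L := L) (le_max_left _ _) hYI (hre n).le
  choose φ b1 b2 b3 b4 b5 b6 b7 using h1
  choose ψ c1 c2 c3 c4 c5 c6 c7 using h2
  have ht : Tendsto (fun n : ℕ => 1 / ((n:ℝ) + 1)) atTop (𝓝 0) := tendsto_one_div_add_atTop_nhds_zero_nat
  have r1 := core_limit φ b1 _ ht b2 b3 b4 b5 b6
  have r2 := core_limit ψ c1 _ ht c2 c3 c4 c5 c6
  obtain ⟨n, hn1, hn2⟩ := (r1.and r2).exists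
  have key : wU u τ X Y = (N : ℂ) * (φ n idC idC - Complex.I * ψ n idC idC) := by
    rw [b7, c7]
    have q1 : wU u τ X (Complex.I • Y) = Complex.I * wU u τ X Y := by
      simp only [← wUl_apply, map_smul, smul_eq_mul]
    have q2 : tl I (w n) * (tr (κ n) (Complex.I • Y))ᴴ * tl I (w n) = (-Complex.I) • (tl I (w n) * (tr (κ n) Y)ᴴ * tl I (w n)) := by
      have : tr (κ n) (Complex.I • Y) = Complex.I • tr (κ n) Y := by
        ext p q; simp only [tr, Matrix.smul_apply]; split_ifs <;> simp
      rw [this, conjTranspose_smul]; simp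
    rw [q2]
    simp only [← wUl_apply, map_smul, smul_eq_mul] at q1 ⊢
    have hN' : (N : ℂ) ≠ 0 := by exact_mod_cast hN0.ne'
    push_cast
    field_simp
    ring_nf
    simp only [Complex.I_sq]
    ring
  rw [key, norm_mul, Complex.norm_real, Real.norm_eq_abs, abs_of_pos hN0]
  have : ‖φ n idC idC - Complex.I * ψ n idC idC‖ ≤ 86 + 86 := by
    refine (norm_sub_le _ _).trans ?_
    rw [norm_mul]; simp; linarith
  nlinarith

theorem MB.nonneg_case {u : A →ₗ[ℂ] B →ₗ[ℂ] ℂ} {N : ℝ} (hN : MB u N) (h : N ≤ 0) (τ : I → ℝ) (hτ : ∑ k, τ k ^ 2 = 1)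
    (X : Matrix I I A) (Y : Matrix I I B) : wU u τ X Y = 0 := by
  have := hN I τ hτ X Y
  have h2 : N * mn X * mn Y ≤ 0 := mul_nonpos_of_nonpos_of_nonneg (mul_nonpos_of_nonpos_of_nonneg h (mn_nonneg _)) (mn_nonneg _)
  exact norm_le_zero_iff.1 (this.trans h2)

theorem gt2 {u : A →ₗ[ℂ] B →ₗ[ℂ] ℂ} {N : ℝ} (hN0 : 0 ≤ N) (hN : MB u N) {τ : I → ℝ}
    (hτ : ∑ k, τ k ^ 2 = 1) {X : Matrix I I A} {Y : Matrix I I B} (hX : MomB τ X) (hY : MomB τ Y) :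
    ‖wU u τ X Y‖ ≤ 172 * N := by
  let S := {t : ℝ | 0 ≤ t ∧ MB u t}
  have hS : BddBelow S := ⟨0, fun t ht => ht.1⟩
  have hNS : N ∈ S := ⟨hN0, hN⟩
  let M := sInf S
  have hM0 : 0 ≤ M := le_csInf ⟨N, hNS⟩ fun t ht => ht.1
  have hMN : M ≤ N := csInf_le hS hNS
  have hM : MB u M := by
    intro κ _ _ σ hσ v w
    rcases eq_or_ne (mn v * mn w) 0 with h0 | h0
    · have := hN κ σ hσ v w
      rw [mul_assoc, h0, mul_zero] at this ⊢
      exact this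
    · have hp : 0 < mn v * mn w := lt_of_le_of_ne (mul_nonneg (mn_nonneg _) (mn_nonneg _)) h0.symm
      rw [mul_assoc, ← div_le_iff₀ hp]
      refine le_csInf ⟨N, hNS⟩ fun t ht => ?_
      rw [div_le_iff₀ hp, ← mul_assoc]
      exact ht.2 κ σ hσ v w
  have hmin : ∀ t, t < M → 0 ≤ t → ¬ MB u t := fun t ht h0 hMB => not_lt.2 (csInf_le hS ⟨h0, hMB⟩) ht
  rcases hM0.eq_or_lt with h | h
  · rw [hM.nonneg_case h.symm.le τ hτ]; simp; positivity
  · refine (gt1 h hM (fun t ht hMB => ?_) hτ hX hY).trans (by linarith)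
    rcases lt_or_ge t 0 with h0 | h0
    · refine hmin 0 h le_rfl ?_
      intro κ _ _ σ hσ v w
      rw [hMB.nonneg_case h0.le σ hσ]; simp
    · exact hmin t ht h0 hMB

theorem sum_conj_le {n : ℕ} (a : Fin n → A) (p : Fin n → ℝ) (hp : ∀ i, 0 ≤ p i) {T : A} (hT : 0 ≤ T) (hT1 : ‖T‖ ≤ 1)
    (hS : ‖∑ i, (p i : ℂ) • (a i * star (a i))‖ ≤ 1) : ‖∑ i, (p i : ℂ) • (a i * T * star (a i))‖ ≤ 1 := by
  have hsm : ∀ i (x : A), 0 ≤ x → 0 ≤ (p i : ℂ) • x := fun i x hx => by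
    rw [Complex.coe_smul]; exact smul_nonneg (hp i) hx
  have h0 : 0 ≤ ∑ i, (p i : ℂ) • (a i * T * star (a i)) :=
    Finset.sum_nonneg fun i _ => hsm i _ (star_right_conjugate_nonneg hT _)
  refine (CStarAlgebra.norm_le_norm_of_nonneg_of_le h0 ?_).trans hS
  refine Finset.sum_le_sum fun i _ => ?_
  rw [Complex.coe_smul, Complex.coe_smul]
  refine smul_le_smul_of_nonneg_left ?_ (hp i)
  have : T ≤ 1 := (CStarAlgebra.norm_le_one_iff_of_nonneg T).1 hT1
  simpa using star_right_conjugate_le_conjugate this (a i)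

theorem Mom.toB {n : ℕ} {a : Fin n → A} {p : Fin n → ℝ} (hp : ∀ i, 0 ≤ p i ∧ p i ≤ 1) {τ : I → ℝ} {X : Matrix I I A}
    (h : Mom τ X a p) (h1 : ‖∑ i, (p i : ℂ) • (a i * star (a i))‖ ≤ 1)
    (h2 : ‖∑ i, ((1 - p i : ℝ) : ℂ) • (star (a i) * a i)‖ ≤ 1) : MomB τ X := by
  have hS : 0 ≤ ∑ i, (p i : ℂ) • (a i * star (a i)) := Finset.sum_nonneg fun i _ => by
    rw [Complex.coe_smul]; exact smul_nonneg (hp i).1 (mul_star_self_nonneg _)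
  have hT : 0 ≤ ∑ i, ((1 - p i : ℝ) : ℂ) • (star (a i) * a i) := Finset.sum_nonneg fun i _ => by
    rw [Complex.coe_smul]; exact smul_nonneg (by linarith [(hp i).2]) (star_mul_self_nonneg _)
  constructor
  · rw [h.e1']; exact h1
  · rw [h.e2']; exact h2
  · rw [h.e3]
    refine (norm_add_le _ _).trans ?_
    have q1 := norm_mul_le (∑ i, (p i : ℂ) • (a i * star (a i))) (∑ i, (p i : ℂ) • (a i * star (a i)))
    have q2 := sum_conj_le a p (fun i => (hp i).1) hT h2 h1
    nlinarith [norm_nonneg (∑ i, (p i : ℂ) • (a i * star (a i)))]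
  · rw [h.e4]
    refine (norm_add_le _ _).trans ?_
    have q1 := norm_mul_le (∑ i, ((1 - p i : ℝ) : ℂ) • (star (a i) * a i)) (∑ i, ((1 - p i : ℝ) : ℂ) • (star (a i) * a i))
    have q2 := sum_conj_le (fun i => star (a i)) (fun i => 1 - p i) (fun i => by linarith [(hp i).2]) hS h1 (by simpa using h2)
    simp only [star_star] at q2
    nlinarith [norm_nonneg (∑ i, ((1 - p i : ℝ) : ℂ) • (star (a i) * a i))]

theorem gt_unital {u : A →ₗ[ℂ] B →ₗ[ℂ] ℂ} {N : ℝ} (hN0 : 0 ≤ N) (hN : MB u N) {n : ℕ} (a : Fin n → A) (b : Fin n → B)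
    (t : Fin n → ℝ) (ht : ∀ i, 0 < t i)
    (h1 : ‖∑ i, a i * star (a i)‖ ≤ 1) (h2 : ‖∑ i, ((t i ^ 2 : ℝ) : ℂ) • (star (a i) * a i)‖ ≤ 1)
    (h3 : ‖∑ i, star (b i) * b i‖ ≤ 1) (h4 : ‖∑ i, (((t i ^ 2)⁻¹ : ℝ) : ℂ) • (b i * star (b i))‖ ≤ 1) :
    ‖∑ i, u (a i) (b i)‖ ≤ 172 * N := by
  let p : Fin n → ℝ := fun i => (1 + t i ^ 2)⁻¹
  have hp0 : ∀ i, 0 < p i := fun i => by have := ht i; positivity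
  have hp' : ∀ i, 1 - p i = t i ^ 2 * p i := fun i => by
    have : (1 + t i ^ 2) ≠ 0 := by positivity
    simp only [p]; field_simp; ring
  have hq0 : ∀ i, 0 < 1 - p i := fun i => by have := ht i; have := hp0 i; rw [hp']; positivity
  have hp : ∀ i, 0 ≤ p i ∧ p i ≤ 1 := fun i => ⟨(hp0 i).le, by linarith [hq0 i]⟩
  let a' : Fin n → A := fun i => (((√(p i))⁻¹ : ℝ) : ℂ) • a i
  let b' : Fin n → B := fun i => (((√(1 - p i))⁻¹ : ℝ) : ℂ) • b i
  have hs : ∀ i, (√(p i))⁻¹ * (√(p i))⁻¹ = (p i)⁻¹ := fun i => by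
    rw [← mul_inv, Real.mul_self_sqrt (hp0 i).le]
  have hs' : ∀ i, (√(1 - p i))⁻¹ * (√(1 - p i))⁻¹ = (1 - p i)⁻¹ := fun i => by
    rw [← mul_inv, Real.mul_self_sqrt (hq0 i).le]
  obtain ⟨I, _, _, τ, X, Y, hτ, hX, hY, hXY⟩ := exists_mom n a' b' p hp
  have g1 : ‖∑ i, (p i : ℂ) • (a' i * star (a' i))‖ ≤ 1 := by
    refine le_of_eq_of_le (congrArg norm (Finset.sum_congr rfl fun i _ => ?_)) h1
    simp only [a', star_smul, RCLike.star_def, Complex.conj_ofReal, smul_mul_smul_comm, ← Complex.ofReal_mul, hs, smul_smul]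
    rw [mul_inv_cancel₀ (hp0 i).ne']; simp
  have g2 : ‖∑ i, ((1 - p i : ℝ) : ℂ) • (star (a' i) * a' i)‖ ≤ 1 := by
    refine le_of_eq_of_le (congrArg norm (Finset.sum_congr rfl fun i _ => ?_)) h2
    simp only [a', star_smul, RCLike.star_def, Complex.conj_ofReal, smul_mul_smul_comm, ← Complex.ofReal_mul, hs, smul_smul]
    rw [hp', mul_assoc, mul_inv_cancel₀ (hp0 i).ne', mul_one]
  have g3 : ‖∑ i, (p i : ℂ) • (b' i * star (b' i))‖ ≤ 1 := by
    refine le_of_eq_of_le (congrArg norm (Finset.sum_congr rfl fun i _ => ?_)) h4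
    simp only [b', star_smul, RCLike.star_def, Complex.conj_ofReal, smul_mul_smul_comm, ← Complex.ofReal_mul, hs', smul_smul]
    rw [hp', mul_inv, mul_left_comm, mul_inv_cancel₀ (hp0 i).ne', mul_one]
  have g4 : ‖∑ i, ((1 - p i : ℝ) : ℂ) • (star (b' i) * b' i)‖ ≤ 1 := by
    refine le_of_eq_of_le (congrArg norm (Finset.sum_congr rfl fun i _ => ?_)) h3
    simp only [b', star_smul, RCLike.star_def, Complex.conj_ofReal, smul_mul_smul_comm, ← Complex.ofReal_mul, hs', smul_smul]
    rw [mul_inv_cancel₀ (hq0 i).ne']; simp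
  have := gt2 hN0 hN hτ (hX.toB hp g1 g2) (hY.toB hp g3 g4)
  rw [hXY] at this
  refine le_of_eq_of_le (congrArg norm ?_) this
  refine Finset.sum_congr rfl fun i _ => ?_
  simp only [a', b', map_smul, LinearMap.smul_apply, smul_eq_mul]
  rw [← mul_assoc, ← mul_assoc, ← Complex.ofReal_mul, ← Complex.ofReal_mul, Real.sqrt_mul (hp0 i).le]
  have : √(p i) ≠ 0 := (Real.sqrt_pos.2 (hp0 i)).ne'
  have : √(1 - p i) ≠ 0 := (Real.sqrt_pos.2 (hq0 i)).ne'
  have : √(p i) * √(1 - p i) * (√(1 - p i))⁻¹ * (√(p i))⁻¹ = 1 := by field_simp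
  first | rw [this]; simp | (rw [show √(p i) * √(1 - p i) * (√(p i))⁻¹ * (√(1 - p i))⁻¹ = 1 by field_simp]; simp)
end gt
end TP

namespace TP
open Matrix CStarMatrix Filter Topology

theorem exists_au (A : Type*) [NonUnitalCStarAlgebra A] :
    ∃ l : Filter A, l.IsApproximateUnit ∧ (∀ᶠ x in l, ‖x‖ ≤ 1) ∧ (∀ᶠ x in l, IsSelfAdjoint x) := by
  letI := CStarAlgebra.spectralOrder A
  haveI := CStarAlgebra.spectralOrderedRing A
  have h := CStarAlgebra.increasingApproximateUnit A
  exact ⟨_, h.toIsApproximateUnit, h.eventually_norm, h.eventually_nonneg.mono fun x hx => IsSelfAdjoint.of_nonneg hx⟩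

/-- cut-off function -/
def gcut (s x : ℝ) : ℝ := max 0 (min 1 ((1 - x) / (1 - s)))

theorem gcut_cont (s : ℝ) : Continuous (gcut s) := by unfold gcut; fun_prop
theorem gcut_one {s x : ℝ} (hs : s < 1) (hx : x ≤ s) : gcut s x = 1 := by
  have : 1 ≤ (1 - x) / (1 - s) := by rw [le_div_iff₀ (by linarith)]; linarith
  simp [gcut, this]
theorem gcut_zero {s x : ℝ} (hs : s < 1) (hx : 1 ≤ x) : gcut s x = 0 := by
  have : (1 - x) / (1 - s) ≤ 0 := div_nonpos_of_nonpos_of_nonneg (by linarith) (by linarith)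
  simp [gcut, this]
theorem gcut_nonneg (s x : ℝ) : 0 ≤ gcut s x := le_max_left _ _
theorem gcut_le (s x : ℝ) : gcut s x ≤ 1 := by simp [gcut]

section cut
variable {D : Type*} [CStarAlgebra D] [PartialOrder D] [StarOrderedRing D]
variable {L : Type*} [CStarAlgebra L]

theorem cut_exists (Φ : D →⋆ₐ[ℂ] L) {S : D} (hS : 0 ≤ S) (h : ‖Φ S‖ < 1) :
    ∃ c : D, IsSelfAdjoint c ∧ 0 ≤ c * c ∧ c * c ≤ 1 ∧ Φ c = 1 ∧ ‖c * S * c‖ ≤ 1 := by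
  have hSs : IsSelfAdjoint S := IsSelfAdjoint.of_nonneg hS
  have hg := gcut_cont ‖Φ S‖
  have hcs : IsSelfAdjoint (cfc (gcut ‖Φ S‖) S) := cfc_predicate _ _
  refine ⟨cfc (gcut ‖Φ S‖) S, hcs, ?_, ?_, ?_, ?_⟩
  · nth_rewrite 1 [← hcs.star_eq]; exact star_mul_self_nonneg _
  · rw [← cfc_mul _ _ _ hg.continuousOn hg.continuousOn]
    refine cfc_le_one _ _ fun x _ => ?_
    have := gcut_nonneg ‖Φ S‖ x; have := gcut_le ‖Φ S‖ x; nlinarith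
  · have hP : IsSelfAdjoint (Φ S) := hSs.map Φ
    rw [StarAlgHom.map_cfc Φ (gcut ‖Φ S‖) S (hg.continuousOn) (by
      exact AddMonoidHomClass.continuous_of_bound Φ 1 (fun x => by simpa using NonUnitalStarAlgHom.norm_apply_le Φ x)) hSs hP]
    have : cfc (gcut ‖Φ S‖) (Φ S) = cfc (fun _ : ℝ => (1:ℝ)) (Φ S) := by
      refine cfc_congr fun x hx => ?_
      exact gcut_one h ((le_abs_self x).trans (mem_le le_rfl hx))
    rw [this, cfc_const_one ℝ (Φ S)]
  · have : cfc (gcut ‖Φ S‖) S * S * cfc (gcut ‖Φ S‖) S = cfc (fun x => gcut ‖Φ S‖ x * x * gcut ‖Φ S‖ x) S := by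
      rw [cfc_mul (fun x => gcut ‖Φ S‖ x * x) _ S, cfc_mul (gcut ‖Φ S‖) (fun x => x) S, cfc_id' ℝ S]
    rw [this]
    refine norm_cfc_le zero_le_one fun x hx => ?_
    have hx0 : 0 ≤ x := spectrum_nonneg_of_nonneg hS hx
    have h1 := gcut_nonneg ‖Φ S‖ x
    have h2 := gcut_le ‖Φ S‖ x
    rw [Real.norm_eq_abs, abs_of_nonneg (by positivity)]
    rcases le_total x 1 with h3 | h3
    · have : gcut ‖Φ S‖ x * x ≤ 1 := by nlinarith
      nlinarith [mul_nonneg h1 hx0]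
    · rw [gcut_zero h h3]; simp

theorem cut_pair (Φ : D →⋆ₐ[ℂ] L) {n : ℕ} (a : Fin n → D) (r s : Fin n → ℝ) (hr : ∀ i, 0 ≤ r i) (hs : ∀ i, 0 ≤ s i)
    (h1 : ‖Φ (∑ i, (r i : ℂ) • (a i * star (a i)))‖ < 1) (h2 : ‖Φ (∑ i, (s i : ℂ) • (star (a i) * a i))‖ < 1) :
    ∃ c d : D, Φ c = 1 ∧ Φ d = 1 ∧ ‖∑ i, (r i : ℂ) • ((c * a i * d) * star (c * a i * d))‖ ≤ 1 ∧
      ‖∑ i, (s i : ℂ) • (star (c * a i * d) * (c * a i * d))‖ ≤ 1 := by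
  have hS : 0 ≤ ∑ i, (r i : ℂ) • (a i * star (a i)) := Finset.sum_nonneg fun i _ => by
    rw [Complex.coe_smul]; exact smul_nonneg (hr i) (mul_star_self_nonneg _)
  have hT : 0 ≤ ∑ i, (s i : ℂ) • (star (a i) * a i) := Finset.sum_nonneg fun i _ => by
    rw [Complex.coe_smul]; exact smul_nonneg (hs i) (star_mul_self_nonneg _)
  obtain ⟨c, hc, hc0, hc1, hcΦ, hcn⟩ := cut_exists Φ hS h1
  obtain ⟨d, hd, hd0, hd1, hdΦ, hdn⟩ := cut_exists Φ hT h2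
  refine ⟨c, d, hcΦ, hdΦ, ?_, ?_⟩
  · refine (CStarAlgebra.norm_le_norm_of_nonneg_of_le (Finset.sum_nonneg fun i _ => ?_) ?_).trans hcn
    · rw [Complex.coe_smul]; exact smul_nonneg (hr i) (mul_star_self_nonneg _)
    · rw [Finset.mul_sum, Finset.sum_mul]
      refine Finset.sum_le_sum fun i _ => ?_
      rw [mul_smul_comm, smul_mul_assoc, Complex.coe_smul, Complex.coe_smul]
      refine smul_le_smul_of_nonneg_left ?_ (hr i)
      have := star_right_conjugate_le_conjugate hd1 (c * a i)
      simp only [star_mul, hc.star_eq, hd.star_eq, mul_one, mul_assoc] at this ⊢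
      exact this
  · refine (CStarAlgebra.norm_le_norm_of_nonneg_of_le (Finset.sum_nonneg fun i _ => ?_) ?_).trans hdn
    · rw [Complex.coe_smul]; exact smul_nonneg (hs i) (star_mul_self_nonneg _)
    · rw [Finset.mul_sum, Finset.sum_mul]
      refine Finset.sum_le_sum fun i _ => ?_
      rw [mul_smul_comm, smul_mul_assoc, Complex.coe_smul, Complex.coe_smul]
      refine smul_le_smul_of_nonneg_left ?_ (hs i)
      have := star_left_conjugate_le_conjugate hc1 (a i * d)
      simp only [star_mul, hc.star_eq, hd.star_eq, mul_one, mul_assoc] at this ⊢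
      exact this
end cut

section nonunital
variable {A : Type*} [NonUnitalCStarAlgebra A] {B : Type*} [NonUnitalCStarAlgebra B]
variable {NA : ∀ p : ℕ, Matrix (Fin p) (Fin p) A → ℝ} {NB : ∀ q : ℕ, Matrix (Fin q) (Fin q) B → ℝ}

/-- matricial bound in terms of the given norms -/
def MBn (NA : ∀ p : ℕ, Matrix (Fin p) (Fin p) A → ℝ) (NB : ∀ q : ℕ, Matrix (Fin q) (Fin q) B → ℝ)
    (u : A →ₗ[ℂ] B →ₗ[ℂ] ℂ) (N : ℝ) : Prop :=
  ∀ (p : ℕ) (σ : Fin p → ℝ), ∑ k, σ k ^ 2 = 1 → ∀ (v : Matrix (Fin p) (Fin p) A) (w : Matrix (Fin p) (Fin p) B),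
    ‖∑ k, ∑ l, ((σ k * σ l : ℝ) : ℂ) * u (v k l) (w k l)‖ ≤ N * NA p v * NB p w

theorem NA_unit [PartialOrder (Unitization ℂ A)] [StarOrderedRing (Unitization ℂ A)] (hNA : ∀ p, IsCStarNorm (NA p)) {p : ℕ}
    (v : Matrix (Fin p) (Fin p) A) : NA p v = mn (v.map (fun a => (a : Unitization ℂ A))) := by
  letI := CStarAlgebra.spectralOrder A
  haveI := CStarAlgebra.spectralOrderedRing A
  have h : IsCStarNorm (fun v : Matrix (Fin p) (Fin p) A => mn (v.map (fun a => (a : Unitization ℂ A)))) := by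
    have hmul : ∀ x y : Matrix (Fin p) (Fin p) A, (x * y).map (fun a => (a : Unitization ℂ A)) =
        x.map (fun a => (a : Unitization ℂ A)) * y.map (fun a => (a : Unitization ℂ A)) := by
      intro x y; apply Matrix.ext; intro i j
      rw [Matrix.map_apply, Matrix.mul_apply, Matrix.mul_apply]
      exact map_sum (Unitization.inrNonUnitalStarAlgHom ℂ A) (fun k => x i k * y k j) Finset.univ |>.trans
        (Finset.sum_congr rfl fun k _ => map_mul (Unitization.inrNonUnitalStarAlgHom ℂ A) _ _)
    constructor
    · intro x y
      have : (x + y).map (fun a => (a : Unitization ℂ A)) =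
        x.map (fun a => (a : Unitization ℂ A)) + y.map (fun a => (a : Unitization ℂ A)) := by ext i j <;> simp
      rw [this]; exact norm_add_le (ofMatrix _) (ofMatrix _)
    · intro c x
      have : (c • x).map (fun a => (a : Unitization ℂ A)) =
        c • x.map (fun a => (a : Unitization ℂ A)) := by ext i j <;> simp
      rw [this]; exact mn_smul _ _
    · intro x hx
      have : ofMatrix (x.map (fun a => (a : Unitization ℂ A))) = 0 := norm_eq_zero.1 hx
      ext i j
      have h2 : ((x i j : A) : Unitization ℂ A) = 0 := congrFun (congrFun this i) j
      exact Unitization.inr_injective (R := ℂ) (h2.trans (Unitization.inr_zero ℂ).symm)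
    · intro x y; rw [hmul]; exact mn_mul _ _
    · intro x
      rw [hmul, ← mn_star_mul]
      congr 2
      ext i j <;> simp [Matrix.star_apply]
  rw [csn_matrix (hNA p), csn_matrix h]
end nonunital
end TP

namespace TP
open Matrix CStarMatrix Filter Topology

section nonunital
variable {A : Type*} [NonUnitalCStarAlgebra A] {B : Type*} [NonUnitalCStarAlgebra B]
variable {NA : ∀ p : ℕ, Matrix (Fin p) (Fin p) A → ℝ} {NB : ∀ q : ℕ, Matrix (Fin q) (Fin q) B → ℝ}

def lm (e : A) : Unitization ℂ A →ₗ[ℂ] A :=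
  Unitization.sndHom ℂ ℂ A ∘ₗ LinearMap.mulLeft ℂ (e : Unitization ℂ A)

theorem inr_lm (e : A) (x : Unitization ℂ A) : ((lm e x : A) : Unitization ℂ A) = (e : Unitization ℂ A) * x := by
  apply Unitization.ext
  · simp [lm, Unitization.fst_mul]
  · rw [Unitization.snd_inr]; rfl

theorem lm_inr (e a : A) : lm e (a : Unitization ℂ A) = e * a :=
  Unitization.inr_injective (R := ℂ) (by rw [inr_lm, Unitization.inr_mul])

theorem mn_reindex {D : Type*} [CStarAlgebra D] [PartialOrder D] [StarOrderedRing D] {κ κ' : Type} [Fintype κ] [DecidableEq κ]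
    [Fintype κ'] [DecidableEq κ'] (e : κ' ≃ κ) (v : Matrix κ κ D) : mn (v.submatrix e e) ≤ mn v := by
  refine mn_hom (D := CStarMatrix κ κ D) (fun c => (ofMatrix.symm c).submatrix e e) (fun x y => rfl) (fun x y => ?_)
    (fun x => rfl) (fun c x => rfl) (ofMatrix v)
  exact (submatrix_mul_equiv (ofMatrix.symm x) (ofMatrix.symm y) e e e).symm

def uef (u : A →ₗ[ℂ] B →ₗ[ℂ] ℂ) (e : A) (f : B) : Unitization ℂ A →ₗ[ℂ] Unitization ℂ B →ₗ[ℂ] ℂ :=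
  u.compl₁₂ (lm e) (lm f)

theorem NA_nonneg (hNA : ∀ p, IsCStarNorm (NA p)) {p : ℕ} (v : Matrix (Fin p) (Fin p) A) : 0 ≤ NA p v := by
  letI := CStarAlgebra.spectralOrder A
  haveI := CStarAlgebra.spectralOrderedRing A
  rw [csn_matrix (hNA p)]; exact norm_nonneg _

theorem NA_lm [PartialOrder (Unitization ℂ A)] [StarOrderedRing (Unitization ℂ A)] (hNA : ∀ p, IsCStarNorm (NA p)) {e : A}
    (he : ‖e‖ ≤ 1) {p : ℕ} (v : Matrix (Fin p) (Fin p) (Unitization ℂ A)) : NA p (v.map (lm e)) ≤ mn v := by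
  rw [NA_unit hNA]
  have : (v.map (lm e)).map (fun a => (a : Unitization ℂ A)) = scalar (Fin p) (e : Unitization ℂ A) * v := by
    apply Matrix.ext; intro i j
    rw [Matrix.map_apply, Matrix.map_apply, inr_lm, scalar_apply, diagonal_mul]
  rw [this]
  refine (mn_mul _ _).trans ?_
  have h1 : mn (scalar (Fin p) (e : Unitization ℂ A)) ≤ 1 := (mn_scalar _).trans (by rw [Unitization.norm_inr]; exact he)
  nlinarith [mn_nonneg v]

theorem uef_MB [PartialOrder (Unitization ℂ A)] [StarOrderedRing (Unitization ℂ A)]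
    [PartialOrder (Unitization ℂ B)] [StarOrderedRing (Unitization ℂ B)] (hNA : ∀ p, IsCStarNorm (NA p)) (hNB : ∀ p, IsCStarNorm (NB p))
    {u : A →ₗ[ℂ] B →ₗ[ℂ] ℂ} {N : ℝ} (hN0 : 0 ≤ N) (hu : MBn NA NB u N) {e : A} {f : B} (he : ‖e‖ ≤ 1) (hf : ‖f‖ ≤ 1) :
    MB (uef u e f) N := by
  intro κ _ _ σ hσ v w
  let ε := (Fintype.equivFin κ).symm
  have h := hu _ (σ ∘ ε) (by rw [← hσ]; exact Equiv.sum_comp ε (fun k => σ k ^ 2)) ((v.submatrix ε ε).map (lm e)) ((w.submatrix ε ε).map (lm f))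
  have e1 : wU (uef u e f) σ v w = ∑ k, ∑ l, (((σ ∘ ε) k * (σ ∘ ε) l : ℝ) : ℂ) * u (((v.submatrix ε ε).map (lm e)) k l)
      (((w.submatrix ε ε).map (lm f)) k l) := by
    rw [wU, ← Equiv.sum_comp ε]
    refine Finset.sum_congr rfl fun k _ => ?_
    rw [← Equiv.sum_comp ε]; rfl
  rw [e1]
  refine h.trans ?_
  have q1 := (NA_lm hNA he (v.submatrix ε ε)).trans (mn_reindex ε v)
  have q2 := (NA_lm hNB hf (w.submatrix ε ε)).trans (mn_reindex ε w)
  have := NA_nonneg hNA ((v.submatrix ε ε).map (lm e))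
  have := NA_nonneg hNB ((w.submatrix ε ε).map (lm f))
  have := mn_nonneg v
  gcongr

theorem NA_one (hNA : ∀ p, IsCStarNorm (NA p)) (a : A) : NA 1 (fun _ _ => a) = ‖a‖ := by
  refine csn_eq (N := fun a : A => NA 1 (fun _ _ => a)) ⟨fun x y => (hNA 1).add_le _ _, fun c x => (hNA 1).smul_eq c _, fun x hx => ?_, fun x y => ?_, fun x => ?_⟩ a
  · exact congrFun (congrFun ((hNA 1).eq_zero_of _ hx) 0) 0
  · refine le_of_eq_of_le ?_ ((hNA 1).mul_le _ _)
    show NA 1 _ = NA 1 _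
    congr 1; funext i j
    show x * y = ∑ k : Fin 1, x * y
    simp
  · refine Eq.trans ?_ ((hNA 1).star_mul_self _)
    show NA 1 _ = NA 1 _
    congr 1; funext i j
    show star x * x = ∑ k : Fin 1, star x * x
    simp

theorem MBn.bound (hNA : ∀ p, IsCStarNorm (NA p)) (hNB : ∀ p, IsCStarNorm (NB p)) {u : A →ₗ[ℂ] B →ₗ[ℂ] ℂ} {N : ℝ}
    (hu : MBn NA NB u N) (a : A) (b : B) : ‖u a b‖ ≤ N * ‖a‖ * ‖b‖ := by
  have h := hu 1 (fun _ => 1) (by simp) (fun _ _ => a) (fun _ _ => b)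
  rw [NA_one hNA a, NA_one hNB b] at h
  simpa using h

theorem u_tendsto {u : A →ₗ[ℂ] B →ₗ[ℂ] ℂ} {N : ℝ} (hb : ∀ a b, ‖u a b‖ ≤ N * ‖a‖ * ‖b‖) {γ : Type*} {l : Filter γ}
    {x : γ → A} {y : γ → B} {a : A} {b : B} (hx : Tendsto x l (𝓝 a)) (hy : Tendsto y l (𝓝 b)) :
    Tendsto (fun t => u (x t) (y t)) l (𝓝 (u a b)) := by
  let u' : A →L[ℂ] B →L[ℂ] ℂ := u.mkContinuous₂ N hb
  have : Tendsto (fun t => u' (x t) (y t)) l (𝓝 (u' a b)) :=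
    (u'.isBoundedBilinearMap.continuous.tendsto (a, b)).comp (hx.prodMk_nhds hy)
  exact this

theorem gt_quot (hNA : ∀ p, IsCStarNorm (NA p)) (hNB : ∀ p, IsCStarNorm (NB p))
    {u : A →ₗ[ℂ] B →ₗ[ℂ] ℂ} {N : ℝ} (hN0 : 0 ≤ N) (hu : MBn NA NB u N)
    {L1 L2 : Type*} [CStarAlgebra L1] [CStarAlgebra L2] (π1 : A →⋆ₙₐ[ℂ] L1) (π2 : B →⋆ₙₐ[ℂ] L2)
    (hu1 : ∀ a b, π1 a = 0 → u a b = 0) (hu2 : ∀ a b, π2 b = 0 → u a b = 0)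
    {n : ℕ} (a : Fin n → A) (b : Fin n → B)
    (t : Fin n → ℝ) (ht : ∀ i, 0 < t i)
    (h1 : ‖π1 (∑ i, a i * star (a i))‖ < 1) (h2 : ‖π1 (∑ i, ((t i ^ 2 : ℝ) : ℂ) • (star (a i) * a i))‖ < 1)
    (h3 : ‖π2 (∑ i, star (b i) * b i)‖ < 1) (h4 : ‖π2 (∑ i, (((t i ^ 2)⁻¹ : ℝ) : ℂ) • (b i * star (b i)))‖ < 1) :
    ‖∑ i, u (a i) (b i)‖ ≤ 172 * N := by
  letI := CStarAlgebra.spectralOrder (Unitization ℂ A)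
  haveI := CStarAlgebra.spectralOrderedRing (Unitization ℂ A)
  letI := CStarAlgebra.spectralOrder (Unitization ℂ B)
  haveI := CStarAlgebra.spectralOrderedRing (Unitization ℂ B)
  let Φ1 := Unitization.starLift π1
  let Φ2 := Unitization.starLift π2
  have hΦ1 : ∀ x : A, Φ1 (x : Unitization ℂ A) = π1 x := fun x => DFunLike.congr_fun (Unitization.starLift.symm_apply_apply π1) x
  have hΦ2 : ∀ x : B, Φ2 (x : Unitization ℂ B) = π2 x := fun x => DFunLike.congr_fun (Unitization.starLift.symm_apply_apply π2) x
  let jA := Unitization.inrNonUnitalStarAlgHom ℂ A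
  let jB := Unitization.inrNonUnitalStarAlgHom ℂ B
  obtain ⟨c, d, hc, hd, k1, k2⟩ := cut_pair Φ1 (fun i => jA (a i)) (fun _ => 1) (fun i => t i ^ 2) (fun i => zero_le_one)
    (fun i => by positivity) (by
      have : (∑ i, ((1:ℝ):ℂ) • (jA (a i) * star (jA (a i)))) = jA (∑ i, a i * star (a i)) := by
        simp only [map_sum, map_mul, map_star, Complex.ofReal_one, one_smul]
      rw [this]; exact lt_of_eq_of_lt (congrArg norm (hΦ1 _)) h1) (by
      have : (∑ i, ((t i ^ 2 : ℝ):ℂ) • (star (jA (a i)) * jA (a i))) = jA (∑ i, ((t i ^ 2 : ℝ) : ℂ) • (star (a i) * a i)) := by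
        simp only [map_sum, map_smul, map_mul, map_star]
      rw [this]; exact lt_of_eq_of_lt (congrArg norm (hΦ1 _)) h2)
  obtain ⟨c', d', hc', hd', k3, k4⟩ := cut_pair Φ2 (fun i => jB (b i)) (fun i => (t i ^ 2)⁻¹) (fun i => 1)
    (fun i => by positivity) (fun i => zero_le_one) (by
      have : (∑ i, (((t i ^ 2)⁻¹ : ℝ):ℂ) • (jB (b i) * star (jB (b i)))) = jB (∑ i, (((t i ^ 2)⁻¹ : ℝ) : ℂ) • (b i * star (b i))) := by
        simp only [map_sum, map_smul, map_mul, map_star]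
      rw [this]; exact lt_of_eq_of_lt (congrArg norm (hΦ2 _)) h4) (by
      have : (∑ i, ((1:ℝ):ℂ) • (star (jB (b i)) * jB (b i))) = jB (∑ i, star (b i) * b i) := by
        simp only [map_sum, map_mul, map_star, Complex.ofReal_one, one_smul]
      rw [this]; exact lt_of_eq_of_lt (congrArg norm (hΦ2 _)) h3)
  simp only [Complex.ofReal_one, one_smul] at k1 k4
  obtain ⟨lA, hlA, hA1, -⟩ := exists_au A
  obtain ⟨lB, hlB, hB1, -⟩ := exists_au B
  haveI := hlA.neBot
  haveI := hlB.neBot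
  have hb := hu.bound hNA hNB
  have hbound : ∀ᶠ z in lA ×ˢ lB, ‖∑ i, u (z.1 * a i) (z.2 * b i)‖ ≤ 172 * N := by
    filter_upwards [hA1.prod_mk hB1] with z hz
    have hg := gt_unital hN0 (uef_MB hNA hNB hN0 hu hz.1 hz.2) (fun i => c * jA (a i) * d) (fun i => c' * jB (b i) * d') t ht k1 k2 k4 k3
    refine le_of_eq_of_le (congrArg norm (Finset.sum_congr rfl fun i _ => ?_)) hg
    show _ = u (lm z.1 (c * jA (a i) * d)) (lm z.2 (c' * jB (b i) * d'))
    have r1 : π1 (z.1 * a i - lm z.1 (c * jA (a i) * d)) = 0 := by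
      rw [map_sub, map_mul, ← hΦ1 (lm _ _), inr_lm, map_mul, map_mul, map_mul, hc, hd, hΦ1, one_mul, mul_one]
      rw [show Φ1 (jA (a i)) = π1 (a i) from hΦ1 _, sub_self]
    have r2 : π2 (z.2 * b i - lm z.2 (c' * jB (b i) * d')) = 0 := by
      rw [map_sub, map_mul, ← hΦ2 (lm _ _), inr_lm, map_mul, map_mul, map_mul, hc', hd', hΦ2, one_mul, mul_one]
      rw [show Φ2 (jB (b i)) = π2 (b i) from hΦ2 _, sub_self]
    have s1 := hu1 _ (z.2 * b i) r1
    have s2 := hu2 (lm z.1 (c * jA (a i) * d)) _ r2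
    rw [map_sub, LinearMap.sub_apply, sub_eq_zero] at s1
    rw [map_sub, sub_eq_zero] at s2
    rw [s1, s2]
  have hlim : Tendsto (fun z : A × B => ∑ i, u (z.1 * a i) (z.2 * b i)) (lA ×ˢ lB) (𝓝 (∑ i, u (a i) (b i))) :=
    tendsto_finset_sum _ fun i _ => u_tendsto hb ((hlA.tendsto_mul_right (a i)).comp tendsto_fst)
      ((hlB.tendsto_mul_right (b i)).comp tendsto_snd)
  exact le_of_tendsto hlim.norm hbound
end nonunital
end TP

namespace TP
open Filter Topology

theorem fan {ι : Type*} {E : Type*} [AddCommGroup E] [Module ℝ E] [TopologicalSpace E] {S : Set E} (hS : IsCompact S) (hc : Convex ℝ S)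
    (L : ι → E →L[ℝ] ℝ) (c : ι → ℝ)
    (h : ∀ (t : Finset ι) (w : ι → ℝ), (∀ i, 0 ≤ w i) → ∃ s ∈ S, 0 ≤ ∑ i ∈ t, w i * (L i s - c i)) :
    ∃ s ∈ S, ∀ i, c i ≤ L i s := by
  classical
  have key := hS.inter_iInter_nonempty (fun i => {s | c i ≤ L i s}) (fun i => isClosed_le continuous_const (L i).continuous) ?_
  · obtain ⟨s, hs, hs'⟩ := key
    exact ⟨s, hs, fun i => Set.mem_iInter.1 hs' i⟩
  intro t
  by_contra hne
  rw [Set.not_nonempty_iff_eq_empty] at hne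
  let P : E →L[ℝ] (t → ℝ) := ContinuousLinearMap.pi fun i => L i
  let Z : Set (t → ℝ) := {y | ∀ i : t, c i ≤ y i}
  have hZ : IsClosed Z := by
    have : Z = ⋂ i : t, {y | c i ≤ y i} := by ext; simp [Z]
    rw [this]
    exact isClosed_iInter fun i => isClosed_le continuous_const (continuous_apply i)
  have hZc : Convex ℝ Z := by
    intro x hx y hy a b ha hb hab i
    have h1 := hx i
    have h2 := hy i
    show c i ≤ a * x i + b * y i
    have : c i = a * c i + b * c i := by rw [← add_mul, hab, one_mul]
    rw [this]; gcongr
  have hd : Disjoint (P '' S) Z := by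
    rw [Set.disjoint_left]
    rintro _ ⟨s, hs, rfl⟩ hz
    have : s ∈ S ∩ ⋂ i ∈ t, {s | c i ≤ L i s} := ⟨hs, by
      simp only [Set.mem_iInter]; intro i hi; exact hz ⟨i, hi⟩⟩
    rw [hne] at this; exact this
  obtain ⟨f, a, b, hfa, hab, hfb⟩ := geometric_hahn_banach_compact_closed (hc.linear_image P.toLinearMap) (hS.image P.continuous) hZc hZ hd
  have hf : ∀ y : t → ℝ, f y = ∑ i, y i * f (Pi.single i 1) := by
    intro y
    conv_lhs => rw [pi_eq_sum_univ' y]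
    rw [map_sum]
    refine Finset.sum_congr rfl fun i _ => ?_
    rw [map_smul, smul_eq_mul]
  have hw : ∀ i : t, 0 ≤ f (Pi.single i 1) := by
    intro i
    by_contra hneg
    push Not at hneg
    have hmem : ∀ n : ℝ, 0 ≤ n → (fun i : t => c i) + n • Pi.single i 1 ∈ Z := by
      intro n hn j
      show c j ≤ c j + n * (Pi.single i 1 : t → ℝ) j
      have : (0:ℝ) ≤ (Pi.single i 1 : t → ℝ) j := by
        rw [Pi.single_apply]; split_ifs <;> norm_num
      nlinarith [mul_nonneg hn this]
    have h0 := hfb _ (hmem 0 le_rfl)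
    have h1 := hfb _ (hmem ((f (fun i : t => c i) - b) / (- f (Pi.single i 1))) (by
      simp only [zero_smul, add_zero] at h0
      apply div_nonneg <;> linarith))
    rw [map_add, map_smul, smul_eq_mul, div_mul_eq_mul_div, mul_div_assoc, div_neg, div_self hneg.ne] at h1
    linarith
  obtain ⟨s, hs, hsum⟩ := h t (fun i => if hi : i ∈ t then f (Pi.single ⟨i, hi⟩ 1) else 0) (fun i => by
    split_ifs with hi
    · exact hw _
    · exact le_rfl)
  have h1 := hfa _ ⟨s, hs, rfl⟩
  have h2 := hfb (fun i : t => c i) (fun i => le_rfl)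
  rw [hf] at h1 h2
  rw [← Finset.sum_coe_sort] at hsum
  have : ∑ i : t, (if hi : (i:ι) ∈ t then f (Pi.single ⟨i, hi⟩ 1) else 0) * (L i s - c i) = ∑ i : t, (P s) i * f (Pi.single i 1) - ∑ i : t, c i * f (Pi.single i 1) := by
    rw [← Finset.sum_sub_distrib]
    refine Finset.sum_congr rfl fun i _ => ?_
    rw [dif_pos i.2]
    show _ * (L i s - c i) = L i s * _ - _
    ring
  change ∑ i : t, (P s) i * f (Pi.single i 1) < a at h1
  linarith

open ComplexOrder in
/-- positive contractive functionals -/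
def PS (L : Type*) [CStarAlgebra L] : Set (WeakDual ℂ L) :=
  {f | (∀ x, ‖f x‖ ≤ ‖x‖) ∧ (∀ x, f (star x) = star (f x)) ∧ ∀ x, 0 ≤ (f (star x * x)).re}

section
variable {L : Type*} [CStarAlgebra L]

theorem PS_compact : IsCompact (PS L) := by
  have h := WeakDual.isCompact_closedBall (𝕜 := ℂ) (E := L) 0 1
  refine h.of_isClosed_subset ?_ ?_
  · have e : PS L = (⋂ x, {f | ‖f x‖ ≤ ‖x‖}) ∩ ((⋂ x, {f | f (star x) = star (f x)}) ∩ ⋂ x, {f | 0 ≤ (f (star x * x)).re}) := by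
      ext f; simp [PS]
    rw [e]
    refine (isClosed_iInter fun x => ?_).inter ((isClosed_iInter fun x => ?_).inter (isClosed_iInter fun x => ?_))
    · exact isClosed_le (WeakDual.eval_continuous x).norm continuous_const
    · exact isClosed_eq (WeakDual.eval_continuous _) (WeakDual.eval_continuous x).star
    · exact isClosed_le continuous_const (Complex.continuous_re.comp (WeakDual.eval_continuous _))
  · intro f hf
    rw [Set.mem_preimage, mem_closedBall_zero_iff]
    exact ContinuousLinearMap.opNorm_le_bound _ zero_le_one (fun x => by rw [one_mul]; exact hf.1 x)

theorem PS_convex : Convex ℝ (PS L) := by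
  intro f hf g hg a b ha hb hab
  have e : ∀ x, (a • f + b • g) x = a • f x + b • g x := fun x => rfl
  refine ⟨fun x => ?_, fun x => ?_, fun x => ?_⟩
  · rw [e]
    refine (norm_add_le _ _).trans ?_
    rw [norm_smul, norm_smul, Real.norm_of_nonneg ha, Real.norm_of_nonneg hb]
    have h1 := hf.1 x
    have h2 := hg.1 x
    calc _ ≤ a * ‖x‖ + b * ‖x‖ := by gcongr
      _ = _ := by rw [← add_mul, hab, one_mul]
  · rw [e, e, hf.2.1, hg.2.1]; simp
  · rw [e]
    have h1 := hf.2.2 x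
    have h2 := hg.2.2 x
    rw [Complex.add_re, Complex.real_smul, Complex.real_smul, Complex.re_ofReal_mul, Complex.re_ofReal_mul]
    positivity
end

section
variable {H : Type*} [NormedAddCommGroup H] [InnerProductSpace ℂ H] [CompleteSpace H]

def vecS (v w : H) : (H →L[ℂ] H) →L[ℂ] ℂ := (innerSL ℂ v) ∘L (ContinuousLinearMap.apply ℂ H w)

theorem vecS_apply (v w : H) (T : H →L[ℂ] H) : vecS v w T = inner ℂ v (T w) := rfl

theorem vecS_PS {v : H} (hv : ‖v‖ ≤ 1) : (StrongDual.toWeakDual (vecS v v) : WeakDual ℂ (H →L[ℂ] H)) ∈ PS (H →L[ℂ] H) := by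
  refine ⟨fun x => ?_, fun x => ?_, fun x => ?_⟩
  · show ‖inner ℂ v (x v)‖ ≤ _
    calc _ ≤ ‖v‖ * ‖x v‖ := norm_inner_le_norm _ _
      _ ≤ 1 * (‖x‖ * 1) := by
        gcongr
        exact (x.le_opNorm v).trans (by gcongr)
      _ = _ := by ring
  · show inner ℂ v (star x v) = star (inner ℂ v (x v))
    rw [ContinuousLinearMap.star_eq_adjoint, ContinuousLinearMap.adjoint_inner_right]
    exact (inner_conj_symm _ _).symm
  · show 0 ≤ (inner ℂ v ((star x * x) v)).re
    rw [ContinuousLinearMap.star_eq_adjoint, ContinuousLinearMap.mul_apply, ContinuousLinearMap.adjoint_inner_right]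
    exact inner_self_nonneg (𝕜 := ℂ)

theorem vec_exists {T : H →L[ℂ] H} (hT : 0 ≤ T) : ∃ f ∈ PS (H →L[ℂ] H), ‖T‖ ≤ 2 * (f T).re := by
  obtain ⟨R, rfl⟩ := CStarAlgebra.nonneg_iff_eq_star_mul_self.1 hT
  have hn : ‖star R * R‖ = ‖R‖ * ‖R‖ := CStarRing.norm_star_mul_self
  have hf : ∀ v : H, (inner ℂ v ((star R * R) v)).re = ‖R v‖ ^ 2 := by
    intro v
    rw [ContinuousLinearMap.star_eq_adjoint, ContinuousLinearMap.mul_apply, ContinuousLinearMap.adjoint_inner_right]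
    exact inner_self_eq_norm_sq (𝕜 := ℂ) _
  rcases eq_or_lt_of_le (norm_nonneg R) with h0 | h0
  · refine ⟨_, vecS_PS (v := (0:H)) (by simp), ?_⟩
    rw [hn, ← h0]
    show _ ≤ 2 * (inner ℂ (0:H) ((star R * R) 0)).re
    rw [hf]; simp
  · obtain ⟨v, hv, hv'⟩ := ContinuousLinearMap.exists_lt_apply_of_lt_opNorm R (show 3/4 * ‖R‖ < ‖R‖ by linarith)
    refine ⟨_, vecS_PS hv.le, ?_⟩
    show _ ≤ 2 * (inner ℂ v ((star R * R) v)).re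
    rw [hf, hn]
    nlinarith
end
end TP

namespace TP
open Filter Topology

section mm
variable {A : Type*} [NonUnitalCStarAlgebra A] {B : Type*} [NonUnitalCStarAlgebra B]
variable {NA : ∀ p : ℕ, Matrix (Fin p) (Fin p) A → ℝ} {NB : ∀ q : ℕ, Matrix (Fin q) (Fin q) B → ℝ}

theorem gt_sum (hNA : ∀ p, IsCStarNorm (NA p)) (hNB : ∀ p, IsCStarNorm (NB p))
    {u : A →ₗ[ℂ] B →ₗ[ℂ] ℂ} {N : ℝ} (hN0 : 0 ≤ N) (hu : MBn NA NB u N)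
    {L1 L2 : Type*} [CStarAlgebra L1] [CStarAlgebra L2] (π1 : A →⋆ₙₐ[ℂ] L1) (π2 : B →⋆ₙₐ[ℂ] L2)
    (hu1 : ∀ a b, π1 a = 0 → u a b = 0) (hu2 : ∀ a b, π2 b = 0 → u a b = 0)
    {n : ℕ} (w : Fin n → ℝ) (hw : ∀ i, 0 ≤ w i) (a : Fin n → A) (b : Fin n → B)
    (t : Fin n → ℝ) (ht : ∀ i, 0 < t i) :
    ‖∑ i, (w i : ℂ) * u (a i) (b i)‖ ≤ 172 * N * (‖∑ i, (w i : ℂ) • (π1 (a i) * star (π1 (a i)))‖ +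
      ‖∑ i, ((w i * t i ^ 2 : ℝ) : ℂ) • (star (π1 (a i)) * π1 (a i))‖ + ‖∑ i, (w i : ℂ) • (star (π2 (b i)) * π2 (b i))‖ +
      ‖∑ i, ((w i * (t i ^ 2)⁻¹ : ℝ) : ℂ) • (π2 (b i) * star (π2 (b i)))‖) := by
  set P := ‖∑ i, (w i : ℂ) • (π1 (a i) * star (π1 (a i)))‖ with hP
  set Q := ‖∑ i, ((w i * t i ^ 2 : ℝ) : ℂ) • (star (π1 (a i)) * π1 (a i))‖ with hQ
  set R := ‖∑ i, (w i : ℂ) • (star (π2 (b i)) * π2 (b i))‖ with hR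
  set S := ‖∑ i, ((w i * (t i ^ 2)⁻¹ : ℝ) : ℂ) • (π2 (b i) * star (π2 (b i)))‖ with hS
  have P0 : 0 ≤ P := norm_nonneg _
  have Q0 : 0 ≤ Q := norm_nonneg _
  have R0 : 0 ≤ R := norm_nonneg _
  have S0 : 0 ≤ S := norm_nonneg _
  have main : ∀ ε > 0, ‖∑ i, (w i : ℂ) * u (a i) (b i)‖ ≤ 172 * N * (P + Q + R + S + ε) := by
    intro ε hε
    set M := P + Q + R + S + ε with hM
    have hM0 : 0 < M := by positivity
    let r : Fin n → ℝ := fun i => √(w i / M)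
    have hr : ∀ i, r i * r i = w i / M := fun i => Real.mul_self_sqrt (div_nonneg (hw i) hM0.le)
    have sc : ∀ {D : Type _} [NonUnitalCStarAlgebra D] (i : Fin n) (x : D), ((r i : ℂ) • x) * star ((r i : ℂ) • x) = ((w i / M : ℝ) : ℂ) • (x * star x) := by
      intro D _ i x
      rw [star_smul, smul_mul_smul_comm, Complex.star_def, Complex.conj_ofReal, ← Complex.ofReal_mul, hr]
    have sc1 : ∀ {D : Type _} [NonUnitalCStarAlgebra D] (i : Fin n) (x : D), star ((r i : ℂ) • x) * ((r i : ℂ) • x) = ((w i / M : ℝ) : ℂ) • (star x * x) := by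
      intro D _ i x
      rw [star_smul, smul_mul_smul_comm, Complex.star_def, Complex.conj_ofReal, ← Complex.ofReal_mul, hr]
    have sc' : ∀ {D : Type _} [NonUnitalCStarAlgebra D] (i : Fin n) (x : D), ((r i : ℂ) • x) * star ((r i : ℂ) • x) = ((w i / M : ℝ) : ℂ) • (x * star x) := by
      intro D _ i x
      rw [star_smul, smul_mul_smul_comm, Complex.star_def, Complex.conj_ofReal, ← Complex.ofReal_mul, hr]
    have sc1' : ∀ {D : Type _} [NonUnitalCStarAlgebra D] (i : Fin n) (x : D), star ((r i : ℂ) • x) * ((r i : ℂ) • x) = ((w i / M : ℝ) : ℂ) • (star x * x) := by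
      intro D _ i x
      rw [star_smul, smul_mul_smul_comm, Complex.star_def, Complex.conj_ofReal, ← Complex.ofReal_mul, hr]
    have nrm : ∀ {D : Type _} [CStarAlgebra D] (x : D), ‖x‖ < M → ‖((M⁻¹ : ℝ) : ℂ) • x‖ < 1 := by
      intro D _ x hx
      rw [norm_smul, Complex.norm_real, Real.norm_of_nonneg (by positivity), inv_mul_lt_iff₀ hM0, mul_one]; exact hx
    have nrm' : ∀ {D : Type _} [CStarAlgebra D] (x : D), ‖x‖ < M → ‖((M⁻¹ : ℝ) : ℂ) • x‖ < 1 := by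
      intro D _ x hx
      rw [norm_smul, Complex.norm_real, Real.norm_of_nonneg (by positivity), inv_mul_lt_iff₀ hM0, mul_one]; exact hx
    have h := gt_quot hNA hNB hN0 hu π1 π2 hu1 hu2 (fun i => (r i : ℂ) • a i) (fun i => (r i : ℂ) • b i) t ht ?_ ?_ ?_ ?_
    · have e : ∑ i, u ((r i : ℂ) • a i) ((r i : ℂ) • b i) = ((M⁻¹ : ℝ) : ℂ) * ∑ i, (w i : ℂ) * u (a i) (b i) := by
        rw [Finset.mul_sum]
        refine Finset.sum_congr rfl fun i _ => ?_
        rw [map_smul, map_smul, LinearMap.smul_apply, smul_eq_mul, smul_eq_mul, ← mul_assoc, ← mul_assoc, ← Complex.ofReal_mul, hr, ← Complex.ofReal_mul, div_eq_inv_mul]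
      rw [e, norm_mul, Complex.norm_real, Real.norm_of_nonneg (by positivity), inv_mul_le_iff₀ hM0] at h
      linarith
    · have e : π1 (∑ i, ((r i : ℂ) • a i) * star ((r i : ℂ) • a i)) = ((M⁻¹ : ℝ) : ℂ) • ∑ i, (w i : ℂ) • (π1 (a i) * star (π1 (a i))) := by
        rw [map_sum, Finset.smul_sum]
        refine Finset.sum_congr rfl fun i _ => ?_
        rw [sc, map_smul, map_mul, map_star, smul_smul, ← Complex.ofReal_mul, div_eq_inv_mul]
      rw [e]; exact nrm _ (by linarith)
    · have e : π1 (∑ i, ((t i ^ 2 : ℝ) : ℂ) • (star ((r i : ℂ) • a i) * ((r i : ℂ) • a i))) = ((M⁻¹ : ℝ) : ℂ) • ∑ i, ((w i * t i ^ 2 : ℝ) : ℂ) • (star (π1 (a i)) * π1 (a i)) := by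
        rw [map_sum, Finset.smul_sum]
        refine Finset.sum_congr rfl fun i _ => ?_
        rw [sc1, map_smul, map_smul, map_mul, map_star, smul_smul, smul_smul, ← Complex.ofReal_mul, ← Complex.ofReal_mul]
        congr 2; ring
      rw [e]; exact nrm _ (by linarith)
    · have e : π2 (∑ i, star ((r i : ℂ) • b i) * ((r i : ℂ) • b i)) = ((M⁻¹ : ℝ) : ℂ) • ∑ i, (w i : ℂ) • (star (π2 (b i)) * π2 (b i)) := by
        rw [map_sum, Finset.smul_sum]
        refine Finset.sum_congr rfl fun i _ => ?_
        rw [sc1', map_smul, map_mul, map_star, smul_smul, ← Complex.ofReal_mul, div_eq_inv_mul]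
      rw [e]; exact nrm' _ (by linarith)
    · have e : π2 (∑ i, (((t i ^ 2)⁻¹ : ℝ) : ℂ) • (((r i : ℂ) • b i) * star ((r i : ℂ) • b i))) = ((M⁻¹ : ℝ) : ℂ) • ∑ i, ((w i * (t i ^ 2)⁻¹ : ℝ) : ℂ) • (π2 (b i) * star (π2 (b i))) := by
        rw [map_sum, Finset.smul_sum]
        refine Finset.sum_congr rfl fun i _ => ?_
        rw [sc', map_smul, map_smul, map_mul, map_star, smul_smul, smul_smul, ← Complex.ofReal_mul, ← Complex.ofReal_mul]
        congr 2; ring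
      rw [e]; exact nrm' _ (by linarith)
  have hl : Tendsto (fun ε : ℝ => 172 * N * (P + Q + R + S + ε)) (𝓝[>] 0) (𝓝 (172 * N * (P + Q + R + S + 0))) := by
    refine Tendsto.mono_left ?_ nhdsWithin_le_nhds
    exact (Continuous.tendsto (by fun_prop) 0)
  rw [add_zero] at hl
  exact ge_of_tendsto hl (by filter_upwards [self_mem_nhdsWithin] with ε hε using main ε hε)

def evR {L : Type*} [CStarAlgebra L] (x : L) : WeakDual ℂ L →L[ℝ] ℝ where
  toFun f := (f x).re
  map_add' f g := by
    show (f x + g x).re = _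
    simp
  map_smul' c f := by
    show (c • f x).re = _
    simp
  cont := Complex.continuous_re.comp (WeakDual.eval_continuous x)

theorem sum_pos_op {H : Type*} [NormedAddCommGroup H] [InnerProductSpace ℂ H] [CompleteSpace H] {n : ℕ} (w : Fin n → ℝ) (hw : ∀ i, 0 ≤ w i)
    (x : Fin n → (H →L[ℂ] H)) : ∃ f ∈ PS (H →L[ℂ] H), ‖∑ i, (w i : ℂ) • (star (x i) * x i)‖ ≤ 2 * ∑ i, w i * (f (star (x i) * x i)).re := by
  have h0 : 0 ≤ ∑ i, (w i : ℂ) • (star (x i) * x i) := Finset.sum_nonneg fun i _ => by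
    have : (w i : ℂ) • (star (x i) * x i) = star ((√(w i) : ℂ) • x i) * ((√(w i) : ℂ) • x i) := by
      rw [star_smul, smul_mul_smul_comm, Complex.star_def, Complex.conj_ofReal, ← Complex.ofReal_mul, Real.mul_self_sqrt (hw i)]
    rw [this]; exact star_mul_self_nonneg _
  obtain ⟨f, hf, hf'⟩ := vec_exists h0
  refine ⟨f, hf, hf'.trans (le_of_eq ?_)⟩
  congr 1
  rw [map_sum, Complex.re_sum]
  refine Finset.sum_congr rfl fun i _ => ?_
  rw [map_smul, smul_eq_mul, Complex.re_ofReal_mul]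

theorem opt_lem {K F G R : ℝ} (hF : 0 ≤ F) (hG : 0 ≤ G) (h : ∀ x > 0, K ≤ x * F + x⁻¹ * G + R) : K ≤ 2 * (√F * √G) + R := by
  have main : ∀ ε > 0, K ≤ (√G + ε) * √F + (√F + ε) * √G + R := by
    intro ε hε
    have f0 := Real.sqrt_nonneg F
    have g0 := Real.sqrt_nonneg G
    have f1 := Real.mul_self_sqrt hF
    have g1 := Real.mul_self_sqrt hG
    refine (h ((√G + ε) / (√F + ε)) (by positivity)).trans ?_
    have e1 : (√G + ε) / (√F + ε) * F ≤ (√G + ε) * √F := by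
      rw [div_mul_eq_mul_div, div_le_iff₀ (by positivity)]
      have : F ≤ √F * (√F + ε) := by nlinarith
      calc _ ≤ (√G + ε) * (√F * (√F + ε)) := by gcongr
        _ = _ := by ring
    have e2 : ((√G + ε) / (√F + ε))⁻¹ * G ≤ (√F + ε) * √G := by
      rw [inv_div, div_mul_eq_mul_div, div_le_iff₀ (by positivity)]
      have : G ≤ √G * (√G + ε) := by nlinarith
      calc _ ≤ (√F + ε) * (√G * (√G + ε)) := by gcongr
        _ = _ := by ring
    linarith
  have hl : Tendsto (fun ε : ℝ => (√G + ε) * √F + (√F + ε) * √G + R) (𝓝[>] 0) (𝓝 ((√G + 0) * √F + (√F + 0) * √G + R)) := by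
    refine Tendsto.mono_left ?_ nhdsWithin_le_nhds
    exact (Continuous.tendsto (f := fun ε : ℝ => (√G + ε) * √F + (√F + ε) * √G + R) (by fun_prop) 0)
  have := ge_of_tendsto hl (by filter_upwards [self_mem_nhdsWithin] with ε hε using main ε hε)
  linarith

theorem minimax_aux (hNA : ∀ p, IsCStarNorm (NA p)) (hNB : ∀ p, IsCStarNorm (NB p))
    {u : A →ₗ[ℂ] B →ₗ[ℂ] ℂ} {N : ℝ} (hN0 : 0 ≤ N) (hu : MBn NA NB u N)
    {H1 : Type*} [NormedAddCommGroup H1] [InnerProductSpace ℂ H1] [CompleteSpace H1]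
    {H2 : Type*} [NormedAddCommGroup H2] [InnerProductSpace ℂ H2] [CompleteSpace H2]
    (π1 : A →⋆ₙₐ[ℂ] (H1 →L[ℂ] H1)) (π2 : B →⋆ₙₐ[ℂ] (H2 →L[ℂ] H2))
    (hu1 : ∀ a b, π1 a = 0 → u a b = 0) (hu2 : ∀ a b, π2 b = 0 → u a b = 0) :
    ∃ f1 ∈ PS (H1 →L[ℂ] H1), ∃ f2 ∈ PS (H1 →L[ℂ] H1), ∃ g1 ∈ PS (H2 →L[ℂ] H2), ∃ g2 ∈ PS (H2 →L[ℂ] H2),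
      ∀ a b τ, (u a b).re ≤ 344 * N * ((f1 (π1 a * star (π1 a))).re + Real.exp τ ^ 2 * (f2 (star (π1 a) * π1 a)).re +
      (g1 (star (π2 b) * π2 b)).re + (Real.exp τ ^ 2)⁻¹ * (g2 (π2 b * star (π2 b))).re) := by
  let E := (WeakDual ℂ (H1 →L[ℂ] H1) × WeakDual ℂ (H1 →L[ℂ] H1)) × (WeakDual ℂ (H2 →L[ℂ] H2) × WeakDual ℂ (H2 →L[ℂ] H2))
  let SS : Set E := (PS _ ×ˢ PS _) ×ˢ (PS _ ×ˢ PS _)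
  let Lf : A × B × ℝ → E →L[ℝ] ℝ := fun i => (344 * N) •
    ((evR (π1 i.1 * star (π1 i.1))).comp ((ContinuousLinearMap.fst ℝ _ _).comp (ContinuousLinearMap.fst ℝ _ _)) +
     (Real.exp i.2.2 ^ 2) • (evR (star (π1 i.1) * π1 i.1)).comp ((ContinuousLinearMap.snd ℝ _ _).comp (ContinuousLinearMap.fst ℝ _ _)) +
     (evR (star (π2 i.2.1) * π2 i.2.1)).comp ((ContinuousLinearMap.fst ℝ _ _).comp (ContinuousLinearMap.snd ℝ _ _)) +
     (Real.exp i.2.2 ^ 2)⁻¹ • (evR (π2 i.2.1 * star (π2 i.2.1))).comp ((ContinuousLinearMap.snd ℝ _ _).comp (ContinuousLinearMap.snd ℝ _ _)))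
  have hLf : ∀ i s, Lf i s = 344 * N * ((s.1.1 (π1 i.1 * star (π1 i.1))).re + Real.exp i.2.2 ^ 2 * (s.1.2 (star (π1 i.1) * π1 i.1)).re +
      (s.2.1 (star (π2 i.2.1) * π2 i.2.1)).re + (Real.exp i.2.2 ^ 2)⁻¹ * (s.2.2 (π2 i.2.1 * star (π2 i.2.1))).re) := fun i s => rfl
  obtain ⟨s, ⟨⟨hs1, hs2⟩, hs3, hs4⟩, hs⟩ := fan (S := SS) ((PS_compact.prod PS_compact).prod (PS_compact.prod PS_compact))
    ((PS_convex.prod PS_convex).prod (PS_convex.prod PS_convex)) Lf (fun i => (u i.1 i.2.1).re) (by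
      intro t w hw
      let ε := t.equivFin.symm
      have h := gt_sum hNA hNB hN0 hu π1 π2 hu1 hu2 (fun k => w (ε k)) (fun k => hw _) (fun k => (ε k : A × B × ℝ).1) (fun k => (ε k : A × B × ℝ).2.1)
        (fun k => Real.exp (ε k : A × B × ℝ).2.2) (fun k => Real.exp_pos _)
      obtain ⟨f1, hf1, k1⟩ := sum_pos_op (fun k => w (ε k)) (fun k => hw _) (fun k => star (π1 (ε k : A × B × ℝ).1))
      obtain ⟨f2, hf2, k2⟩ := sum_pos_op (fun k => w (ε k) * Real.exp (ε k : A × B × ℝ).2.2 ^ 2) (fun k => mul_nonneg (hw _) (by positivity)) (fun k => π1 (ε k : A × B × ℝ).1)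
      obtain ⟨g1, hg1, k3⟩ := sum_pos_op (fun k => w (ε k)) (fun k => hw _) (fun k => π2 (ε k : A × B × ℝ).2.1)
      obtain ⟨g2, hg2, k4⟩ := sum_pos_op (fun k => w (ε k) * (Real.exp (ε k : A × B × ℝ).2.2 ^ 2)⁻¹) (fun k => mul_nonneg (hw _) (by positivity)) (fun k => star (π2 (ε k : A × B × ℝ).2.1))
      simp only [star_star] at k1 k4
      refine ⟨((f1, f2), (g1, g2)), ⟨⟨hf1, hf2⟩, hg1, hg2⟩, ?_⟩
      rw [← Finset.sum_coe_sort, ← Equiv.sum_comp ε]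
      have h' := (Complex.re_le_norm _).trans h
      rw [Complex.re_sum] at h'
      simp only [Complex.re_ofReal_mul] at h'
      have h'' := h'.trans (mul_le_mul_of_nonneg_left (add_le_add (add_le_add (add_le_add k1 k2) k3) k4) (by positivity))
      simp only [mul_sub, Finset.sum_sub_distrib]
      rw [sub_nonneg]
      refine h''.trans (le_of_eq ?_)
      rw [← mul_add, ← mul_add, ← mul_add, ← Finset.sum_add_distrib, ← Finset.sum_add_distrib, ← Finset.sum_add_distrib, Finset.mul_sum, Finset.mul_sum]
      refine Finset.sum_congr rfl fun k _ => ?_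
      refine Eq.trans ?_ (congrArg (fun z => w (ε k) * z) (hLf (ε k) ((f1, f2), (g1, g2)))).symm
      dsimp only; ring)
  exact ⟨_, hs1, _, hs2, _, hs3, _, hs4, fun a b τ => (hs (a, b, τ)).trans_eq (hLf _ s)⟩

theorem minimax (hNA : ∀ p, IsCStarNorm (NA p)) (hNB : ∀ p, IsCStarNorm (NB p))
    {u : A →ₗ[ℂ] B →ₗ[ℂ] ℂ} {N : ℝ} (hN0 : 0 ≤ N) (hu : MBn NA NB u N)
    {H1 : Type*} [NormedAddCommGroup H1] [InnerProductSpace ℂ H1] [CompleteSpace H1]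
    {H2 : Type*} [NormedAddCommGroup H2] [InnerProductSpace ℂ H2] [CompleteSpace H2]
    (π1 : A →⋆ₙₐ[ℂ] (H1 →L[ℂ] H1)) (π2 : B →⋆ₙₐ[ℂ] (H2 →L[ℂ] H2))
    (hu1 : ∀ a b, π1 a = 0 → u a b = 0) (hu2 : ∀ a b, π2 b = 0 → u a b = 0) :
    ∃ f1 ∈ PS (H1 →L[ℂ] H1), ∃ f2 ∈ PS (H1 →L[ℂ] H1), ∃ g1 ∈ PS (H2 →L[ℂ] H2), ∃ g2 ∈ PS (H2 →L[ℂ] H2),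
      ∀ a b, ‖u a b‖ ≤ 688 * N * (√((f1 (π1 a * star (π1 a))).re) * √((g1 (star (π2 b) * π2 b)).re) +
        √((f2 (star (π1 a) * π1 a)).re) * √((g2 (π2 b * star (π2 b))).re)) := by
  obtain ⟨f1, hs1, f2, hs2, g1, hs3, g2, hs4, hs⟩ := minimax_aux hNA hNB hN0 hu π1 π2 hu1 hu2
  refine ⟨_, hs1, _, hs2, _, hs3, _, hs4, fun a b => ?_⟩
  have F1 : ∀ (x : H1 →L[ℂ] H1), 0 ≤ (f1 (x * star x)).re := fun x => by simpa using hs1.2.2 (star x)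
  have G2 : ∀ (x : H2 →L[ℂ] H2), 0 ≤ (g2 (x * star x)).re := fun x => by simpa using hs4.2.2 (star x)
  have step : ∀ x > 0, ∀ y > 0, ‖u a b‖ ≤ 344 * N * ((x * (f1 (π1 a * star (π1 a))).re + x⁻¹ * (g1 (star (π2 b) * π2 b)).re) +
      (y * (f2 (star (π1 a) * π1 a)).re + y⁻¹ * (g2 (π2 b * star (π2 b))).re)) := by
    intro x hx y hy
    obtain ⟨c, hc, hc'⟩ : ∃ c : ℂ, ‖c‖ = 1 ∧ c * u a b = ‖u a b‖ := by
      by_cases h0 : u a b = 0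
      · exact ⟨1, by simp, by simp [h0]⟩
      · refine ⟨‖u a b‖ / u a b, ?_, ?_⟩
        · simp [h0]
        · field_simp
    have h := hs ((c * (√x : ℂ)) • a) (((√x : ℂ)⁻¹) • b) (Real.log (y / x) / 2)
    have hx0 : (√x : ℂ) ≠ 0 := by simpa using (Real.sqrt_pos.2 hx).ne'
    have e0 : u ((c * (√x : ℂ)) • a) (((√x : ℂ)⁻¹) • b) = ‖u a b‖ := by
      rw [map_smul, map_smul, LinearMap.smul_apply, smul_eq_mul, smul_eq_mul, ← hc']
      field_simp
    have ec : c * (√x : ℂ) * star (c * (√x : ℂ)) = (x : ℂ) := by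
      rw [Complex.star_def, Complex.mul_conj, Complex.normSq_eq_norm_sq, norm_mul, hc, one_mul, Complex.norm_real, Real.norm_of_nonneg (Real.sqrt_nonneg _), Real.sq_sqrt hx.le]
    have ec' : (√x : ℂ)⁻¹ * star ((√x : ℂ)⁻¹) = ((x⁻¹ : ℝ) : ℂ) := by
      rw [Complex.star_def, Complex.mul_conj, Complex.normSq_eq_norm_sq, norm_inv, Complex.norm_real, Real.norm_of_nonneg (Real.sqrt_nonneg _), inv_pow, Real.sq_sqrt hx.le]
    have ee : Real.exp (Real.log (y / x) / 2) ^ 2 = y / x := by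
      rw [← Real.exp_nat_mul]; push_cast; rw [mul_div_cancel₀ _ (by norm_num), Real.exp_log (by positivity)]
    rw [e0, ee, map_smul, map_smul, star_smul, star_smul, smul_mul_smul_comm, smul_mul_smul_comm, smul_mul_smul_comm, smul_mul_smul_comm,
      mul_comm (star _) (c * _), mul_comm (star _) ((√x : ℂ)⁻¹), ec, ec', map_smul, map_smul, map_smul, map_smul, smul_eq_mul, smul_eq_mul, smul_eq_mul, smul_eq_mul,
      Complex.re_ofReal_mul, Complex.re_ofReal_mul, Complex.re_ofReal_mul, Complex.re_ofReal_mul, Complex.ofReal_re] at h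
    refine h.trans (le_of_eq ?_)
    congr 1
    field_simp
    ring
  have h1 : ∀ y > 0, ‖u a b‖ ≤ y * (344 * N * (f2 (star (π1 a) * π1 a)).re) + y⁻¹ * (344 * N * (g2 (π2 b * star (π2 b))).re) +
      2 * (√(344 * N * (f1 (π1 a * star (π1 a))).re) * √(344 * N * (g1 (star (π2 b) * π2 b)).re)) := by
    intro y hy
    rw [add_comm]
    refine opt_lem (mul_nonneg (by positivity) (F1 _)) (mul_nonneg (by positivity) (hs3.2.2 _)) fun x hx => ?_
    refine (step x hx y hy).trans (le_of_eq ?_)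
    ring
  have h2 := opt_lem (mul_nonneg (by positivity) (hs2.2.2 _)) (mul_nonneg (by positivity) (G2 _)) h1
  have sq : ∀ r, √(344 * N * r) = √(344 * N) * √r := fun r => Real.sqrt_mul (by positivity) r
  simp only [sq] at h2
  have hq : √(344 * N) * √(344 * N) = 344 * N := Real.mul_self_sqrt (by positivity)
  refine h2.trans (le_of_eq ?_)
  linear_combination (2 * (√((f2 (star (π1 a) * π1 a)).re) * √((g2 (π2 b * star (π2 b))).re)) + 2 * (√((f1 (π1 a * star (π1 a))).re) * √((g1 (star (π2 b) * π2 b)).re))) * hq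
end mm
end TP

namespace TP
open Filter Topology

section hilb
variable {V : Type*} [AddCommGroup V] [Module ℂ V]

theorem exists_hilb {V : Type u} [AddCommGroup V] [Module ℂ V] (q : V → V → ℂ)
    (h1 : ∀ x y, (starRingEnd ℂ) (q y x) = q x y) (h2 : ∀ x, 0 ≤ (q x x).re)
    (h3 : ∀ x y z, q (x + y) z = q x z + q y z) (h4 : ∀ x y (r : ℂ), q (r • x) y = (starRingEnd ℂ) r * q x y) :
    ∃ (H : Type u) (_ : NormedAddCommGroup H) (_ : InnerProductSpace ℂ H) (_ : CompleteSpace H) (S : V →ₗ[ℂ] H),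
      DenseRange S ∧ ∀ a b, inner ℂ (S a) (S b) = q a b := by
  let c : PreInnerProductSpace.Core ℂ V :=
    { inner := q, conj_inner_symm := h1, re_inner_nonneg := h2, add_left := h3, smul_left := h4 }
  letI i1 : SeminormedAddCommGroup V := InnerProductSpace.Core.toSeminormedAddCommGroup (c := c)
  letI i2 : InnerProductSpace ℂ V := InnerProductSpace.ofCore c
  refine ⟨UniformSpace.Completion V, inferInstance, inferInstance, inferInstance,
    (UniformSpace.Completion.toComplL (𝕜 := ℂ) (E := V)).toLinearMap, UniformSpace.Completion.denseRange_coe, ?_⟩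
  intro a b
  exact UniformSpace.Completion.inner_coe a b

variable {H1 H2 H : Type*} [NormedAddCommGroup H1] [InnerProductSpace ℂ H1] [CompleteSpace H1]
  [NormedAddCommGroup H2] [InnerProductSpace ℂ H2] [CompleteSpace H2]
  [NormedAddCommGroup H] [InnerProductSpace ℂ H] [CompleteSpace H]

structure Reg (T1 : H →L[ℂ] H1) (T2 : H →L[ℂ] H2) (Q : H →L[ℂ] H) (g : ℕ → H →L[ℂ] H) : Prop where
  q1 : ∀ x, T1 (Q x) = 0
  q2 : ∀ x, ‖T2 (Q x)‖ ≤ ‖T2 x‖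
  g1 : ∀ n x, ‖T1 (g n x)‖ ≤ 2 * ‖T1 x‖
  g2 : ∀ n x, ‖T2 (g n x)‖ ≤ 2 * ‖T2 x‖
  gc : ∀ n, ∃ c, 0 ≤ c ∧ ∀ x, ‖g n x‖ ≤ c * ‖T1 x‖
  gl : ∀ x, Tendsto (fun n => g n x) atTop (𝓝 (x - Q x))

theorem avg_bound (D : H →L[ℂ] H) (T : H →L[ℂ] H1) (hk : ∀ (k : ℕ) x, ‖T ((D ^ k) x)‖ ≤ ‖T x‖) (n : ℕ) (x : H) :
    ‖T ((((n + 1 : ℕ) : ℂ)⁻¹ • ∑ k ∈ Finset.range (n + 1), D ^ k) x)‖ ≤ ‖T x‖ := by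
  have hav : ‖((n + 1 : ℕ) : ℂ)⁻¹‖ * ((n + 1 : ℕ) : ℝ) = 1 := by
    rw [norm_inv, Complex.norm_natCast]; field_simp
  have : T ((((n + 1 : ℕ) : ℂ)⁻¹ • ∑ k ∈ Finset.range (n + 1), D ^ k) x) = ((n + 1 : ℕ) : ℂ)⁻¹ • ∑ k ∈ Finset.range (n + 1), T ((D ^ k) x) := by
    rw [ContinuousLinearMap.smul_apply, ContinuousLinearMap.sum_apply, map_smul, map_sum]
  rw [this, norm_smul]
  calc _ ≤ ‖((n + 1 : ℕ) : ℂ)⁻¹‖ * (∑ k ∈ Finset.range (n + 1), ‖T x‖) := by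
        gcongr; exact (norm_sum_le _ _).trans (Finset.sum_le_sum fun k _ => hk k x)
    _ = _ := by rw [Finset.sum_const, Finset.card_range, nsmul_eq_mul, ← mul_assoc, hav, one_mul]

theorem exists_reg (T1 : H →L[ℂ] H1) (T2 : H →L[ℂ] H2) (hT : ∀ x, ‖x‖ ^ 2 = ‖T1 x‖ ^ 2 + ‖T2 x‖ ^ 2) :
    ∃ Q g, Reg T1 T2 Q g := by
  have n1 : ∀ x, ‖T1 x‖ ≤ ‖x‖ := fun x => by
    have := hT x; exact le_of_sq_le_sq (by nlinarith [sq_nonneg ‖T2 x‖]) (norm_nonneg _)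
  have n2 : ∀ x, ‖T2 x‖ ≤ ‖x‖ := fun x => by
    have := hT x; exact le_of_sq_le_sq (by nlinarith [sq_nonneg ‖T1 x‖]) (norm_nonneg _)
  have o1 : ‖T1‖ ≤ 1 := T1.opNorm_le_bound zero_le_one (by simpa using n1)
  have o2 : ‖T2‖ ≤ 1 := T2.opNorm_le_bound zero_le_one (by simpa using n2)
  have a1 : ∀ y, ‖(ContinuousLinearMap.adjoint T1) y‖ ≤ ‖y‖ := fun y => by
    have := (ContinuousLinearMap.adjoint T1).le_opNorm y
    rw [LinearIsometryEquiv.norm_map] at this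
    nlinarith [norm_nonneg y]
  have a2 : ∀ y, ‖(ContinuousLinearMap.adjoint T2) y‖ ≤ ‖y‖ := fun y => by
    have := (ContinuousLinearMap.adjoint T2).le_opNorm y
    rw [LinearIsometryEquiv.norm_map] at this
    nlinarith [norm_nonneg y]
  let D : H →L[ℂ] H := 1 - (ContinuousLinearMap.adjoint T1) ∘L T1
  have hD : D = (ContinuousLinearMap.adjoint T2) ∘L T2 := by
    have : (ContinuousLinearMap.adjoint T1) ∘L T1 + (ContinuousLinearMap.adjoint T2) ∘L T2 = 1 := by
      rw [← ContinuousLinearMap.coe_inj, ← sub_eq_zero]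
      rw [← ContinuousLinearMap.coe_sub]
      refine (inner_map_self_eq_zero _).1 fun x => ?_
      have e1 := hT x
      simp only [ContinuousLinearMap.coe_coe, ContinuousLinearMap.sub_apply, ContinuousLinearMap.add_apply, ContinuousLinearMap.comp_apply, inner_sub_left, inner_add_left,
        ContinuousLinearMap.adjoint_inner_left, inner_self_eq_norm_sq_to_K, ContinuousLinearMap.one_apply]
      have e2 : ((‖x‖ ^ 2 : ℝ) : ℂ) = ((‖T1 x‖ ^ 2 + ‖T2 x‖ ^ 2 : ℝ) : ℂ) := by rw [e1]
      push_cast at e2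
      simp only [Complex.coe_algebraMap]
      rw [e2]; ring
    have h9 : D = 1 - (ContinuousLinearMap.adjoint T1) ∘L T1 := rfl
    rw [h9, ← this, add_sub_cancel_left]
  have d0 : ∀ x, ‖D x‖ ≤ ‖x‖ := fun x => by rw [hD]; exact (a2 _).trans (n2 _)
  have d2 : ∀ x, ‖T2 (D x)‖ ≤ ‖T2 x‖ := fun x => by rw [hD]; exact (n2 _).trans (a2 _)
  have d1 : ∀ x, ‖T1 (D x)‖ ≤ ‖T1 x‖ := fun x => by
    have e : T1 (D x) = T1 x - T1 ((ContinuousLinearMap.adjoint T1) (T1 x)) := by simp [D]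
    rw [e]
    refine le_of_sq_le_sq ?_ (norm_nonneg _)
    rw [@norm_sub_sq ℂ]
    rw [← ContinuousLinearMap.adjoint_inner_left, inner_self_eq_norm_sq_to_K]
    have := n1 ((ContinuousLinearMap.adjoint T1) (T1 x))
    have h2 : RCLike.re (((‖(ContinuousLinearMap.adjoint T1) (T1 x)‖ : ℂ)) ^ 2) = ‖(ContinuousLinearMap.adjoint T1) (T1 x)‖ ^ 2 := by
      rw [← Complex.ofReal_pow]; exact Complex.ofReal_re _
    simp only [Complex.coe_algebraMap]
    rw [h2]
    nlinarith [norm_nonneg (T1 ((ContinuousLinearMap.adjoint T1) (T1 x)))]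
  have dk : ∀ k : ℕ, ∀ x, ‖(D ^ k) x‖ ≤ ‖x‖ ∧ ‖T1 ((D ^ k) x)‖ ≤ ‖T1 x‖ ∧ ‖T2 ((D ^ k) x)‖ ≤ ‖T2 x‖ ∧ ‖x - (D ^ k) x‖ ≤ k * ‖T1 x‖ := by
    intro k
    induction k with
    | zero => intro x; simp
    | succ k ih =>
      intro x
      obtain ⟨i0, i1, i2, i3⟩ := ih x
      rw [pow_succ', ContinuousLinearMap.mul_apply]
      refine ⟨(d0 _).trans i0, (d1 _).trans i1, (d2 _).trans i2, ?_⟩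
      have e : x - D ((D ^ k) x) = (x - (D ^ k) x) + (ContinuousLinearMap.adjoint T1) (T1 ((D ^ k) x)) := by
        have hDx : ∀ y, D y = y - (ContinuousLinearMap.adjoint T1) (T1 y) := fun y => by simp [D]
        rw [hDx]; abel
      rw [e]
      refine (norm_add_le _ _).trans ?_
      have := (a1 (T1 ((D ^ k) x))).trans i1
      rw [Nat.cast_succ]; linarith
  let S : Submodule ℂ H := D.eqLocus (1 : H →L[ℂ] H)
  have hDn : ‖D‖ ≤ 1 := D.opNorm_le_bound zero_le_one (by simpa using d0)
  let Av : ℕ → H →L[ℂ] H := fun n => ((n + 1 : ℕ) : ℂ)⁻¹ • ∑ k ∈ Finset.range (n + 1), D ^ k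
  have hav : ∀ (n : ℕ), ‖((n + 1 : ℕ) : ℂ)⁻¹‖ * ((n + 1 : ℕ) : ℝ) = 1 := by
    intro n; rw [norm_inv, Complex.norm_natCast]; field_simp
  have hge : ∀ n x, x - Av n x = ((n + 1 : ℕ) : ℂ)⁻¹ • ∑ k ∈ Finset.range (n + 1), (x - (D ^ k) x) := by
    intro n x
    rw [Finset.sum_sub_distrib, smul_sub]
    congr 1
    · rw [Finset.sum_const, Finset.card_range, ← Nat.cast_smul_eq_nsmul ℂ, smul_smul, inv_mul_cancel₀ (by exact_mod_cast Nat.succ_ne_zero n), one_smul]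
    · simp [Av]
  have av1 := avg_bound D T1 (fun k x => (dk k x).2.1)
  have av2 := avg_bound D T2 (fun k x => (dk k x).2.2.1)
  obtain ⟨Q, hQ1, hQ2⟩ : ∃ Q : H →L[ℂ] H, (∀ x, T1 (Q x) = 0) ∧ ∀ x, Tendsto (fun n => Av n x) atTop (𝓝 (Q x)) := by
    have key := fun x => D.tendsto_birkhoffAverage_orthogonalProjection hDn x
    refine ⟨(Submodule.subtypeL _) ∘L (D.eqLocus (1 : H →L[ℂ] H)).orthogonalProjectionOnto, fun x => ?_, fun x => ?_⟩
    · have := ((D.eqLocus (1 : H →L[ℂ] H)).orthogonalProjectionOnto x).2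
      replace this : D _ = (1 : H →L[ℂ] H) _ := this
      rw [ContinuousLinearMap.comp_apply]
      set z := (Submodule.subtypeL _) ((D.eqLocus (1 : H →L[ℂ] H)).orthogonalProjectionOnto x)
      have hz : D z = z := this
      have hz2 : (ContinuousLinearMap.adjoint T1) (T1 z) = 0 := by
        have : D z = z - (ContinuousLinearMap.adjoint T1) (T1 z) := by simp [D]
        rw [this] at hz; simpa using hz
      have : inner ℂ (T1 z) (T1 z) = 0 := by
        rw [← ContinuousLinearMap.adjoint_inner_left, hz2, inner_zero_left]
      exact inner_self_eq_zero.1 this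
    · refine ((key x).comp (tendsto_add_atTop_nat 1)).congr fun n => ?_
      simp only [Function.comp, birkhoffAverage, birkhoffSum, Av]
      simp [ContinuousLinearMap.coe_pow']
  refine ⟨Q, fun n => 1 - Av n, hQ1, fun x => ?_, fun n x => ?_, fun n x => ?_, fun n => ?_, fun x => ?_⟩
  · exact le_of_tendsto ((T2.continuous.tendsto _).comp (hQ2 x)).norm (Eventually.of_forall fun n => av2 n x)
  · rw [ContinuousLinearMap.sub_apply, map_sub]
    refine (norm_sub_le _ _).trans ?_
    have := av1 n x; simp only [ContinuousLinearMap.one_apply]; linarith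
  · rw [ContinuousLinearMap.sub_apply, map_sub]
    refine (norm_sub_le _ _).trans ?_
    have := av2 n x; simp only [ContinuousLinearMap.one_apply]; linarith
  · refine ⟨‖((n + 1 : ℕ) : ℂ)⁻¹‖ * ∑ k ∈ Finset.range (n + 1), (k : ℝ), by positivity, fun x => ?_⟩
    rw [ContinuousLinearMap.sub_apply, ContinuousLinearMap.one_apply, hge, norm_smul, mul_assoc, Finset.sum_mul]
    gcongr
    exact (norm_sum_le _ _).trans (Finset.sum_le_sum fun k _ => (dk k x).2.2.2)
  · simpa using tendsto_const_nhds.sub (hQ2 x)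

theorem side (S1 : V →ₗ[ℂ] H1) (S2 : V →ₗ[ℂ] H2) :
    ∃ (K : Submodule ℂ (WithLp 2 (H1 × H2))) (_ : CompleteSpace K) (j : V →ₗ[ℂ] K) (T1 : K →L[ℂ] H1) (T2 : K →L[ℂ] H2),
      DenseRange j ∧ (∀ x, ‖x‖ ^ 2 = ‖T1 x‖ ^ 2 + ‖T2 x‖ ^ 2) ∧ (∀ a, T1 (j a) = S1 a) ∧ (∀ a, T2 (j a) = S2 a) := by
  let j0 : V →ₗ[ℂ] WithLp 2 (H1 × H2) := (WithLp.linearEquiv 2 ℂ (H1 × H2)).symm.toLinearMap ∘ₗ (S1.prod S2)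
  let K := (LinearMap.range j0).topologicalClosure
  have hK : IsClosed (K : Set (WithLp 2 (H1 × H2))) := Submodule.isClosed_topologicalClosure _
  refine ⟨K, hK.completeSpace_coe, j0.codRestrict K (fun a => Submodule.le_topologicalClosure _ ⟨a, rfl⟩),
    (WithLp.fstL 2 ℂ H1 H2) ∘L K.subtypeL, (WithLp.sndL 2 ℂ H1 H2) ∘L K.subtypeL, ?_, ?_, ?_, ?_⟩
  · intro x
    rw [closure_subtype]
    have : (Subtype.val '' Set.range (j0.codRestrict K (fun a => Submodule.le_topologicalClosure _ ⟨a, rfl⟩))) = (LinearMap.range j0 : Set _) := by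
      ext y; constructor
      · rintro ⟨_, ⟨a, rfl⟩, rfl⟩; exact ⟨a, rfl⟩
      · rintro ⟨a, rfl⟩; exact ⟨_, ⟨a, rfl⟩, rfl⟩
    rw [this]
    exact x.2
  · intro x
    exact WithLp.prod_norm_sq_eq_of_L2 _
  · intro a; rfl
  · intro a; rfl

end hilb
end TP

namespace TP
open Filter Topology

section dec
variable {V W : Type*} [AddCommGroup V] [Module ℂ V] [AddCommGroup W] [Module ℂ W]
variable {H1 H2 H K1 K2 K : Type*} [NormedAddCommGroup H1] [InnerProductSpace ℂ H1] [CompleteSpace H1]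
  [NormedAddCommGroup H2] [InnerProductSpace ℂ H2] [CompleteSpace H2]
  [NormedAddCommGroup H] [InnerProductSpace ℂ H] [CompleteSpace H]
  [NormedAddCommGroup K1] [InnerProductSpace ℂ K1] [CompleteSpace K1]
  [NormedAddCommGroup K2] [InnerProductSpace ℂ K2] [CompleteSpace K2]
  [NormedAddCommGroup K] [InnerProductSpace ℂ K] [CompleteSpace K]

theorem ext_bil (j : V →ₗ[ℂ] H) (k : W →ₗ[ℂ] K) (hj : DenseRange j) (hk : DenseRange k) (u : V →ₗ[ℂ] W →ₗ[ℂ] ℂ) (C : ℝ)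
    (hu : ∀ a b, ‖u a b‖ ≤ C * ‖j a‖ * ‖k b‖) : ∃ U : H →L[ℂ] K →L[ℂ] ℂ, ∀ a b, U (j a) (k b) = u a b := by
  let u1 : V →ₗ[ℂ] (K →L[ℂ] ℂ) :=
    { toFun := fun a => (u a).extendOfNorm k
      map_add' := fun a a' => by
        refine LinearMap.extendOfNorm_unique hk (C * ‖j (a + a')‖) (hu _) _ ?_
        ext b
        simp only [LinearMap.comp_apply, ContinuousLinearMap.coe_coe, ContinuousLinearMap.add_apply]
        rw [LinearMap.extendOfNorm_eq hk ⟨_, hu a⟩, LinearMap.extendOfNorm_eq hk ⟨_, hu a'⟩]; simp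
      map_smul' := fun c a => by
        refine LinearMap.extendOfNorm_unique hk (C * ‖j (c • a)‖) (hu _) _ ?_
        ext b
        simp only [LinearMap.comp_apply, ContinuousLinearMap.coe_coe, ContinuousLinearMap.smul_apply, RingHom.id_apply]
        rw [LinearMap.extendOfNorm_eq hk ⟨_, hu a⟩]; simp }
  have h1 : ∀ a b, u1 a (k b) = u a b := fun a b => LinearMap.extendOfNorm_eq hk ⟨_, hu a⟩ b
  have h2 : ∀ a, ‖u1 a‖ ≤ |C| * ‖j a‖ := fun a => by
    refine LinearMap.opNorm_extendOfNorm_le hk (by positivity) fun b => (hu a b).trans ?_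
    gcongr; exact le_abs_self C
  refine ⟨u1.extendOfNorm j, fun a b => ?_⟩
  rw [LinearMap.extendOfNorm_eq hj ⟨_, h2⟩, h1]

theorem tend_bil {γ : Type*} {l : Filter γ} (U : H →L[ℂ] K →L[ℂ] ℂ) {x : γ → H} {y : γ → K} {a : H} {b : K} (hx : Tendsto x l (𝓝 a))
    (hy : Tendsto y l (𝓝 b)) : Tendsto (fun n => U (x n) (y n)) l (𝓝 (U a b)) := by
  have : Continuous (fun p : H × K => U p.1 p.2) := by fun_prop
  exact (this.tendsto (a, b)).comp (hx.prodMk_nhds hy)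

theorem decomp (S1 : V →ₗ[ℂ] H1) (S2 : V →ₗ[ℂ] H2) (R1 : W →ₗ[ℂ] K1) (R2 : W →ₗ[ℂ] K2) (u : V →ₗ[ℂ] W →ₗ[ℂ] ℂ) {C : ℝ} (hC : 0 ≤ C)
    (hu : ∀ a b, ‖u a b‖ ≤ C * (‖S1 a‖ * ‖R1 b‖ + ‖S2 a‖ * ‖R2 b‖)) :
    ∃ (t : V →ₗ[ℂ] W →ₗ[ℂ] ℂ) (θ : ℕ → V →ₗ[ℂ] W →ₗ[ℂ] ℂ),
      (∀ a b, ‖t a b‖ ≤ 3 * C * (‖S2 a‖ * ‖R2 b‖)) ∧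
      (∀ n a b, ‖θ n a b‖ ≤ 4 * C * (‖S1 a‖ * ‖R1 b‖ + ‖S2 a‖ * ‖R2 b‖)) ∧
      (∀ n, ∃ c, 0 ≤ c ∧ ∀ a b, ‖θ n a b‖ ≤ c * (‖S1 a‖ * ‖R1 b‖)) ∧
      (∀ a b, Tendsto (fun n => t a b + θ n a b) atTop (𝓝 (u a b))) := by
  obtain ⟨H, _, j, T1, T2, hj, hT, hT1, hT2⟩ := side S1 S2
  obtain ⟨K, _, k, M1, M2, hk, hM, hM1, hM2⟩ := side R1 R2
  obtain ⟨Q, g, hg⟩ := exists_reg T1 T2 hT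
  obtain ⟨P, h, hh⟩ := exists_reg M1 M2 hM
  have n1 : ∀ x, ‖T1 x‖ ≤ ‖x‖ := fun x => by
    have := hT x; exact le_of_sq_le_sq (by nlinarith [sq_nonneg ‖T2 x‖]) (norm_nonneg _)
  have n2 : ∀ x, ‖T2 x‖ ≤ ‖x‖ := fun x => by
    have := hT x; exact le_of_sq_le_sq (by nlinarith [sq_nonneg ‖T1 x‖]) (norm_nonneg _)
  have m1 : ∀ x, ‖M1 x‖ ≤ ‖x‖ := fun x => by
    have := hM x; exact le_of_sq_le_sq (by nlinarith [sq_nonneg ‖M2 x‖]) (norm_nonneg _)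
  have m2 : ∀ x, ‖M2 x‖ ≤ ‖x‖ := fun x => by
    have := hM x; exact le_of_sq_le_sq (by nlinarith [sq_nonneg ‖M1 x‖]) (norm_nonneg _)
  have gb : ∀ x y, C * (‖T1 x‖ * ‖M1 y‖ + ‖T2 x‖ * ‖M2 y‖) ≤ 2 * C * ‖x‖ * ‖y‖ := by
    intro x y
    have a1 := mul_le_mul (n1 x) (m1 y) (norm_nonneg _) (norm_nonneg _)
    have a2 := mul_le_mul (n2 x) (m2 y) (norm_nonneg _) (norm_nonneg _)
    nlinarith
  obtain ⟨U, hU⟩ := ext_bil j k hj hk u (2 * C) (fun a b => by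
    refine (hu a b).trans ?_
    have := gb (j a) (k b)
    rwa [hT1, hT2, hM1, hM2] at this)
  have hb : ∀ x y, ‖U x y‖ ≤ C * (‖T1 x‖ * ‖M1 y‖ + ‖T2 x‖ * ‖M2 y‖) := by
    intro x y
    have hcl : IsClosed {p : H × K | ‖U p.1 p.2‖ ≤ C * (‖T1 p.1‖ * ‖M1 p.2‖ + ‖T2 p.1‖ * ‖M2 p.2‖)} :=
      isClosed_le (by fun_prop) (by fun_prop)
    have hd : DenseRange (Prod.map j k) := hj.prodMap hk
    have : (x, y) ∈ closure (Set.range (Prod.map j k)) := hd _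
    refine closure_minimal ?_ hcl this
    rintro _ ⟨⟨a, b⟩, rfl⟩
    show ‖U (j a) (k b)‖ ≤ _
    rw [hU]
    simpa [hT1, hT2, hM1, hM2] using hu a b
  have t1 : ∀ x, ‖T2 (x - Q x)‖ ≤ 2 * ‖T2 x‖ := fun x => by
    rw [map_sub]; have := norm_sub_le (T2 x) (T2 (Q x)); linarith [hg.q2 x]
  have t2 : ∀ x, ‖U (Q x) 0‖ = 0 := by simp
  let t : V →ₗ[ℂ] W →ₗ[ℂ] ℂ := LinearMap.mk₂ ℂ (fun a b => U (Q (j a)) (k b) + U (j a - Q (j a)) (P (k b)))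
    (by intros; simp; ring) (by intros; simp; ring) (by intros; simp; ring) (by intros; simp; ring)
  let θ : ℕ → V →ₗ[ℂ] W →ₗ[ℂ] ℂ := fun n => LinearMap.mk₂ ℂ (fun a b => U (g n (j a)) (h n (k b)))
    (by intros; simp) (by intros; simp) (by intros; simp) (by intros; simp)
  refine ⟨t, θ, fun a b => ?_, fun n a b => ?_, fun n => ?_, fun a b => ?_⟩
  · show ‖U (Q (j a)) (k b) + U (j a - Q (j a)) (P (k b))‖ ≤ _
    have e1 := hb (Q (j a)) (k b)
    have e2 := hb (j a - Q (j a)) (P (k b))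
    rw [hg.q1, norm_zero, zero_mul, zero_add] at e1
    rw [hh.q1, norm_zero, mul_zero, zero_add] at e2
    have e3 := mul_le_mul (hg.q2 (j a)) le_rfl (norm_nonneg (M2 (k b))) (norm_nonneg _)
    have e4 := mul_le_mul (t1 (j a)) (hh.q2 (k b)) (norm_nonneg _) (by positivity)
    rw [← hT2, ← hM2]
    refine (norm_add_le _ _).trans ?_
    nlinarith
  · show ‖U (g n (j a)) (h n (k b))‖ ≤ _
    refine (hb _ _).trans ?_
    have e3 := mul_le_mul (hg.g1 n (j a)) (hh.g1 n (k b)) (norm_nonneg _) (by positivity)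
    have e4 := mul_le_mul (hg.g2 n (j a)) (hh.g2 n (k b)) (norm_nonneg _) (by positivity)
    rw [← hT2, ← hM2, ← hT1, ← hM1]
    nlinarith
  · obtain ⟨c, hc0, hc⟩ := hg.gc n
    obtain ⟨d, hd0, hd⟩ := hh.gc n
    refine ⟨2 * C * (c * d), by positivity, fun a b => ?_⟩
    show ‖U (g n (j a)) (h n (k b))‖ ≤ _
    refine ((hb _ _).trans (gb _ _)).trans ?_
    rw [← hT1, ← hM1]
    have := mul_le_mul (hc (j a)) (hd (k b)) (norm_nonneg _) (by positivity)
    nlinarith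
  · have : Tendsto (fun n => U (g n (j a)) (h n (k b))) atTop (𝓝 (U (j a - Q (j a)) (k b - P (k b)))) :=
      tend_bil U (hg.gl (j a)) (hh.gl (k b))
    have h3 := (tendsto_const_nhds (x := t a b)).add this
    have e : t a b + U (j a - Q (j a)) (k b - P (k b)) = u a b := by
      show U (Q (j a)) (k b) + U (j a - Q (j a)) (P (k b)) + _ = _
      rw [← hU]; simp; ring
    rw [e] at h3
    exact h3

theorem fin_approx (S : V →ₗ[ℂ] H) (θ : V →ₗ[ℂ] W →ₗ[ℂ] ℂ) (r : W → ℝ) {c : ℝ} (hc : 0 ≤ c) (hr : ∀ b, 0 ≤ r b)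
    (hθ : ∀ a b, ‖θ a b‖ ≤ c * (‖S a‖ * r b)) (s : Finset V) :
    ∃ (n : ℕ) (x : Fin n → V), (∀ a b, ‖∑ k, inner ℂ (S (x k)) (S a) * θ (x k) b‖ ≤ c * (‖S a‖ * r b)) ∧
      ∀ a ∈ s, ∀ b, ∑ k, inner ℂ (S (x k)) (S a) * θ (x k) b = θ a b := by
  classical
  let U : Submodule ℂ H := (Submodule.span ℂ (s : Set V)).map S
  haveI : FiniteDimensional ℂ (Submodule.span ℂ (s : Set V)) := FiniteDimensional.span_finset ℂ s
  haveI : FiniteDimensional ℂ U := inferInstance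
  let e := stdOrthonormalBasis ℂ U
  have hx : ∀ k, ∃ x, S x = (e k : H) := fun k => by
    obtain ⟨x, _, hx⟩ := (e k).2; exact ⟨x, hx⟩
  choose x hx using hx
  let P : V →ₗ[ℂ] V := ∑ k, LinearMap.toSpanSingleton ℂ V (x k) ∘ₗ (innerSL ℂ (e k : H)).toLinearMap ∘ₗ S
  have hP : ∀ a, P a = ∑ k, (inner ℂ (S (x k)) (S a)) • x k := by
    intro a; simp [P, hx, LinearMap.sum_apply]
  have hθP : ∀ a b, ∑ k, inner ℂ (S (x k)) (S a) * θ (x k) b = θ (P a) b := by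
    intro a b; rw [hP]; simp [map_sum, LinearMap.sum_apply]
  have hSP : ∀ a, S (P a) = (U.orthogonalProjectionOnto (S a) : H) := by
    intro a
    rw [hP, map_sum]
    simp only [map_smul]
    rw [← e.sum_repr (U.orthogonalProjectionOnto (S a))]
    simp only [Submodule.coe_sum, Submodule.coe_smul, hx]
    refine Finset.sum_congr rfl fun k _ => ?_
    congr 1
    rw [OrthonormalBasis.repr_apply_apply]
    simp
  refine ⟨_, x, fun a b => ?_, fun a ha b => ?_⟩
  · rw [hθP]
    refine (hθ _ _).trans ?_
    gcongr
    · exact hr b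
    · rw [hSP]; exact (U.orthogonalProjectionOnto).le_of_opNorm_le (Submodule.orthogonalProjectionOnto_norm_le U) (S a) |>.trans (by simp)
  · rw [hθP]
    have h0 : S (P a - a) = 0 := by
      rw [map_sub, hSP, sub_eq_zero]
      have : S a ∈ U := ⟨a, Submodule.subset_span ha, rfl⟩
      exact congrArg Subtype.val (U.orthogonalProjectionOnto_mem_subspace_eq_self ⟨S a, this⟩)
    have := hθ (P a - a) b
    rw [h0, norm_zero, zero_mul, mul_zero, norm_le_zero_iff, map_sub, LinearMap.sub_apply, sub_eq_zero] at this
    exact this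
end dec
end TP

namespace TP
open Filter Topology Matrix
open scoped ComplexOrder

section mat
variable {D : Type*} [CStarAlgebra D] [PartialOrder D] [StarOrderedRing D]

def cmat {p : ℕ} (y : Fin (p+1) → ℂ) : Matrix (Fin (p+1)) (Fin (p+1)) D :=
  Matrix.of fun j j' => if j' = 0 then algebraMap ℂ D (y j) else 0

theorem mn_cmat {p : ℕ} (y : Fin (p+1) → ℂ) : mn (cmat y : Matrix _ _ D) ≤ √(∑ j, ‖y j‖ ^ 2) := by
  let E : Matrix (Fin (p+1)) (Fin (p+1)) D := Matrix.of fun i j => if i = 0 then (if j = 0 then 1 else 0) else 0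
  have hE : Eᴴ * E = E := by
    ext i j
    simp only [E, Matrix.mul_apply, conjTranspose_apply, of_apply]
    by_cases hi : i = 0 <;> by_cases hj : j = 0 <;> simp [hi, hj, apply_ite star, Finset.sum_ite_eq]
  have hE1 : mn E ≤ 1 := by
    have := mn_star_mul E
    rw [hE] at this
    nlinarith [mn_nonneg E]
  have h : (cmat y : Matrix _ _ D)ᴴ * cmat y = ((∑ j, ‖y j‖ ^ 2 : ℝ) : ℂ) • E := by
    ext i j
    simp only [E, Matrix.mul_apply, conjTranspose_apply, of_apply, cmat, Matrix.smul_apply]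
    by_cases hi : i = 0 <;> by_cases hj : j = 0 <;> simp [hi, hj, Algebra.smul_def, -algebraMap_smul]
    simp only [← algebraMap_star_comm]
    simp only [← map_mul, ← map_pow, ← map_sum]
    congr 1
    refine Finset.sum_congr rfl fun k _ => ?_
    rw [mul_comm, Complex.star_def, Complex.mul_conj, Complex.normSq_eq_norm_sq]; simp
  have h2 := mn_star_mul (cmat y : Matrix _ _ D)
  rw [h, mn_smul, Complex.norm_real, Real.norm_of_nonneg (Finset.sum_nonneg fun _ _ => sq_nonneg _)] at h2
  refine Real.le_sqrt_of_sq_le ?_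
  rw [sq, ← h2]
  exact mul_le_of_le_one_right (Finset.sum_nonneg fun _ _ => sq_nonneg _) hE1

theorem mn_entry {p : ℕ} (v : Matrix (Fin p) (Fin p) D) (i j : Fin p) : ‖v i j‖ ≤ mn v :=
  CStarMatrix.norm_entry_le_norm (M := CStarMatrix.ofMatrix v)

theorem mul_cmat {p : ℕ} (v : Matrix (Fin (p+1)) (Fin (p+1)) D) (y : Fin (p+1) → ℂ) (i : Fin (p+1)) :
    (v * cmat y : Matrix _ _ D) i 0 = ∑ j, y j • v i j := by
  simp only [Matrix.mul_apply, cmat, of_apply, if_true]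
  refine Finset.sum_congr rfl fun j _ => ?_
  rw [Algebra.smul_def, Algebra.commutes]
end mat

section nu
variable {A : Type*} [NonUnitalCStarAlgebra A] {B : Type*} [NonUnitalCStarAlgebra B]
variable {NA : ∀ p : ℕ, Matrix (Fin p) (Fin p) A → ℝ} {NB : ∀ q : ℕ, Matrix (Fin q) (Fin q) B → ℝ}

theorem inr_sum' {ι : Type*} (s : Finset ι) (f : ι → A) : ((∑ i ∈ s, f i : A) : Unitization ℂ A) = ∑ i ∈ s, (f i : Unitization ℂ A) :=
  map_sum (Unitization.inrHom ℂ ℂ A) f s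

theorem NA_bil (hNA : ∀ p, IsCStarNorm (NA p)) {p : ℕ} (v : Matrix (Fin p) (Fin p) A) (x y : Fin p → ℂ) :
    ‖∑ i, ∑ j, (x i * y j) • v i j‖ ≤ √(∑ i, ‖x i‖ ^ 2) * NA p v * √(∑ j, ‖y j‖ ^ 2) := by
  letI := CStarAlgebra.spectralOrder (Unitization ℂ A)
  haveI := CStarAlgebra.spectralOrderedRing (Unitization ℂ A)
  rcases p with _ | p
  · simp
  rw [NA_unit hNA]
  set V := v.map (fun a => (a : Unitization ℂ A))
  let R : Matrix (Fin (p+1)) (Fin (p+1)) (Unitization ℂ A) := (cmat (fun i => star (x i)))ᴴ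
  have hR : mn R ≤ √(∑ i, ‖x i‖ ^ 2) := by
    show mn (cmat _)ᴴ ≤ _
    rw [mn_star]; refine (mn_cmat _).trans (le_of_eq ?_); simp
  have he : (R * (V * cmat y) : Matrix (Fin (p+1)) (Fin (p+1)) (Unitization ℂ A)) 0 0 = ((∑ i, ∑ j, (x i * y j) • v i j : A) : Unitization ℂ A) := by
    rw [Matrix.mul_apply, inr_sum']
    refine Finset.sum_congr rfl fun i _ => ?_
    rw [mul_cmat, inr_sum', Finset.mul_sum]
    refine Finset.sum_congr rfl fun j _ => ?_
    simp only [R, conjTranspose_apply, cmat, of_apply, if_true]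
    rw [← algebraMap_star_comm, star_star, ← Algebra.smul_def, smul_smul]
    rw [Unitization.inr_smul]; rfl
  rw [← Unitization.norm_inr (𝕜 := ℂ), ← he]
  refine (mn_entry _ _ _).trans ((mn_mul _ _).trans ?_)
  calc _ ≤ mn R * (mn V * mn (cmat y)) := by gcongr; exact mn_nonneg _; exact mn_mul _ _
    _ ≤ √(∑ i, ‖x i‖ ^ 2) * (mn V * √(∑ j, ‖y j‖ ^ 2)) := by
      gcongr
      · exact mul_nonneg (mn_nonneg _) (mn_nonneg _)
      · exact mn_nonneg _
      · exact mn_cmat y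
    _ = _ := by ring

theorem NA_col (hNA : ∀ p, IsCStarNorm (NA p)) {p : ℕ} (v : Matrix (Fin p) (Fin p) A) (y : Fin p → ℂ) :
    ‖∑ i, star (∑ j, y j • v i j) * (∑ j, y j • v i j)‖ ≤ NA p v ^ 2 * (∑ j, ‖y j‖ ^ 2) := by
  letI := CStarAlgebra.spectralOrder (Unitization ℂ A)
  haveI := CStarAlgebra.spectralOrderedRing (Unitization ℂ A)
  rcases p with _ | p
  · simp
  rw [NA_unit hNA]
  set V := v.map (fun a => (a : Unitization ℂ A))
  have he : ((V * cmat y)ᴴ * (V * cmat y) : Matrix (Fin (p+1)) (Fin (p+1)) (Unitization ℂ A)) 0 0 = ((∑ i, star (∑ j, y j • v i j) * (∑ j, y j • v i j) : A) : Unitization ℂ A) := by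
    rw [Matrix.mul_apply, inr_sum']
    refine Finset.sum_congr rfl fun i _ => ?_
    rw [conjTranspose_apply, mul_cmat, Unitization.inr_mul, Unitization.inr_star, inr_sum']
    simp [V]
  rw [← Unitization.norm_inr (𝕜 := ℂ), ← he]
  refine (mn_entry _ _ _).trans ?_
  rw [mn_star_mul]
  have h1 := (mn_mul V (cmat y)).trans (mul_le_mul_of_nonneg_left (mn_cmat y) (mn_nonneg _))
  have h2 := mul_le_mul h1 h1 (mn_nonneg _) (mul_nonneg (mn_nonneg _) (Real.sqrt_nonneg _))
  refine h2.trans (le_of_eq ?_)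
  have := Real.mul_self_sqrt (show 0 ≤ ∑ j, ‖y j‖ ^ 2 from Finset.sum_nonneg fun _ _ => sq_nonneg _)
  linear_combination (mn V) ^ 2 * this

theorem NA_star (hNA : ∀ p, IsCStarNorm (NA p)) {p : ℕ} (v : Matrix (Fin p) (Fin p) A) : NA p vᴴ = NA p v := by
  letI := CStarAlgebra.spectralOrder (Unitization ℂ A)
  haveI := CStarAlgebra.spectralOrderedRing (Unitization ℂ A)
  rw [NA_unit hNA, NA_unit hNA, ← mn_star]
  congr 1
  ext i j <;> simp

theorem NA_row (hNA : ∀ p, IsCStarNorm (NA p)) {p : ℕ} (v : Matrix (Fin p) (Fin p) A) (x : Fin p → ℂ) :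
    ‖∑ j, (∑ i, x i • v i j) * star (∑ i, x i • v i j)‖ ≤ NA p v ^ 2 * (∑ j, ‖x j‖ ^ 2) := by
  have := NA_col hNA vᴴ (fun i => star (x i))
  rw [NA_star hNA] at this
  simpa [star_sum, star_smul] using this
end nu

section svd
def ONZ {p q : ℕ} (U : Fin p → Fin q → ℂ) : Prop :=
  ∃ ε : Fin q → ℝ, (∀ s, 0 ≤ ε s ∧ ε s ≤ 1) ∧ ∀ s t, ∑ j, star (U j s) * U j t = if s = t then (ε s : ℂ) else 0

theorem ONZ.le {p q : ℕ} {U : Fin p → Fin q → ℂ} (h : ONZ U) (r : Fin q) : ∑ i, ‖U i r‖ ^ 2 ≤ 1 := by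
  obtain ⟨ε, hε, h⟩ := h
  have := h r r
  rw [if_pos rfl] at this
  have h2 : ((∑ i, ‖U i r‖ ^ 2 : ℝ) : ℂ) = ε r := by
    rw [← this]; push_cast
    refine Finset.sum_congr rfl fun i _ => ?_
    rw [mul_comm, Complex.star_def, Complex.mul_conj, Complex.normSq_eq_norm_sq]; simp
  rw [Complex.ofReal_inj.1 h2]; exact (hε r).2

theorem ONZ.bess {p q : ℕ} {U : Fin p → Fin q → ℂ} (h : ONZ U) {H : Type*} [NormedAddCommGroup H] [InnerProductSpace ℂ H]
    (x : Fin p → H) : ∑ s, ‖∑ j, U j s • x j‖ ^ 2 ≤ ∑ j, ‖x j‖ ^ 2 := by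
  obtain ⟨ε, hε, h⟩ := h
  set k : Fin q → H := fun s => ∑ j, U j s • x j
  set z : Fin p → H := fun j => ∑ s, star (U j s) • k s
  -- ∑ ‖x j - z j‖² ≥ 0
  have h1 : ∑ j, inner ℂ (z j) (x j) = ((∑ s, ‖k s‖ ^ 2 : ℝ) : ℂ) := by
    have : ∀ j, inner ℂ (z j) (x j) = ∑ s, inner ℂ (k s) (U j s • x j) := by
      intro j; simp only [z, sum_inner, inner_smul_left, inner_smul_right]; simp
    simp only [this]
    rw [Finset.sum_comm]; push_cast
    refine Finset.sum_congr rfl fun s _ => ?_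
    rw [← inner_sum]
    exact inner_self_eq_norm_sq_to_K (𝕜 := ℂ) (k s)
  have h2 : ∑ j, inner ℂ (z j) (z j) = ((∑ s, ε s * ‖k s‖ ^ 2 : ℝ) : ℂ) := by
    have : ∀ j, inner ℂ (z j) (z j) = ∑ s, ∑ t, (star (U j t) * U j s) * inner ℂ (k s) (k t) := by
      intro j
      simp only [z]
      rw [sum_inner]
      refine Finset.sum_congr rfl fun s _ => ?_
      rw [inner_sum]
      refine Finset.sum_congr rfl fun t _ => ?_
      rw [inner_smul_left, inner_smul_right, ← Complex.star_def, star_star]; ring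
    simp only [this]
    rw [Finset.sum_comm]
    push_cast
    refine Finset.sum_congr rfl fun s _ => ?_
    rw [Finset.sum_comm]
    simp only [← Finset.sum_mul, h]
    rw [Finset.sum_eq_single s (by intro b _ hb; simp [hb]) (by simp)]
    simp only [if_true]
    rw [inner_self_eq_norm_sq_to_K]; simp
  have h3 : ∑ j, ‖x j - z j‖ ^ 2 = ∑ j, ‖x j‖ ^ 2 - 2 * ∑ s, ‖k s‖ ^ 2 + ∑ s, ε s * ‖k s‖ ^ 2 := by
    have e1 : ∀ j, ‖x j - z j‖ ^ 2 = ‖x j‖ ^ 2 - 2 * (inner ℂ (z j) (x j)).re + (inner ℂ (z j) (z j)).re := by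
      intro j; rw [← norm_neg, neg_sub, @norm_sub_sq ℂ, ← inner_self_eq_norm_sq (𝕜 := ℂ) (z j)]; simp; ring
    simp only [e1]
    rw [Finset.sum_add_distrib, Finset.sum_sub_distrib, ← Finset.mul_sum, ← Complex.re_sum, ← Complex.re_sum, h1, h2, Complex.ofReal_re, Complex.ofReal_re]
  have h4 : 0 ≤ ∑ j, ‖x j - z j‖ ^ 2 := Finset.sum_nonneg fun _ _ => sq_nonneg _
  have h5 : ∑ s, ε s * ‖k s‖ ^ 2 ≤ ∑ s, ‖k s‖ ^ 2 := Finset.sum_le_sum fun s _ => mul_le_of_le_one_left (sq_nonneg _) (hε s).2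
  linarith

theorem svd {p q : ℕ} (α : Fin p → Fin q → ℂ) : ∃ (σ : Fin q → ℝ) (U : Fin p → Fin q → ℂ) (W : Fin q → Fin q → ℂ),
    ONZ U ∧ ONZ W ∧ (∀ r, 0 ≤ σ r) ∧ (∑ r, σ r ^ 2 = ∑ i, ∑ k, ‖α i k‖ ^ 2) ∧ ∀ i k, α i k = ∑ r, (σ r : ℂ) * (U i r * W k r) := by
  let a : Matrix (Fin p) (Fin q) ℂ := Matrix.of α
  have hps : (aᴴ * a).PosSemidef := Matrix.posSemidef_conjTranspose_mul_self a
  let hM := hps.1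
  let V : Matrix (Fin q) (Fin q) ℂ := hM.eigenvectorUnitary
  have hV1 : Vᴴ * V = 1 := (Unitary.mem_iff.1 hM.eigenvectorUnitary.2).1
  have hV2 : V * Vᴴ = 1 := (Unitary.mem_iff.1 hM.eigenvectorUnitary.2).2
  have hl : ∀ r, 0 ≤ hM.eigenvalues r := fun r => hps.eigenvalues_nonneg r
  have hd : (a * V)ᴴ * (a * V) = diagonal (fun r => ((hM.eigenvalues r : ℝ) : ℂ)) := by
    have := hM.conjStarAlgAut_star_eigenvectorUnitary
    rw [Unitary.conjStarAlgAut_apply] at this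
    rw [conjTranspose_mul, Matrix.mul_assoc, ← Matrix.mul_assoc aᴴ, ← Matrix.mul_assoc]
    convert this using 1
    · simp [V]; rfl
    · rfl
  set Y := a * V
  have hYn : ∀ r, ((∑ i, ‖Y i r‖ ^ 2 : ℝ) : ℂ) = hM.eigenvalues r := by
    intro r
    have := congrFun (congrFun hd r) r
    rw [Matrix.mul_apply, diagonal_apply_eq] at this
    rw [← this]; push_cast
    refine Finset.sum_congr rfl fun i _ => ?_
    rw [conjTranspose_apply, mul_comm, Complex.star_def, Complex.mul_conj, Complex.normSq_eq_norm_sq]; simp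
  have hs : ∀ r, √(hM.eigenvalues r) ^ 2 = hM.eigenvalues r := fun r => Real.sq_sqrt (hl r)
  refine ⟨fun r => √(hM.eigenvalues r), fun i r => Y i r / (√(hM.eigenvalues r) : ℂ), fun k r => star (V k r), ?_, ?_, fun r => Real.sqrt_nonneg _, ?_, ?_⟩
  · refine ⟨fun s => if hM.eigenvalues s = 0 then 0 else 1, fun s => by by_cases h : hM.eigenvalues s = 0 <;> simp [h], fun s t => ?_⟩
    have h1 := congrFun (congrFun hd s) t
    rw [Matrix.mul_apply] at h1
    have : ∀ j, star (Y j s / (√(hM.eigenvalues s) : ℂ)) * (Y j t / (√(hM.eigenvalues t) : ℂ)) = (Yᴴ s j * Y j t) / ((√(hM.eigenvalues s) : ℂ) * (√(hM.eigenvalues t) : ℂ)) := by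
      intro j; simp [div_mul_div_comm]
    simp only [this]
    rw [← Finset.sum_div, h1]
    by_cases hst : s = t
    · subst hst
      rw [diagonal_apply_eq, if_pos rfl, ← Complex.ofReal_mul, ← sq, hs]
      by_cases h0 : hM.eigenvalues s = 0
      · simp [h0]
      · rw [if_neg h0, div_self]; · simp
        exact_mod_cast h0
    · rw [diagonal_apply_ne _ hst, if_neg hst, zero_div]
  · refine ⟨fun s => 1, fun s => by simp, fun s t => ?_⟩
    have h1 := congrFun (congrFun hV1 t) s
    rw [Matrix.mul_apply, Matrix.one_apply] at h1
    simp only [star_star]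
    simp only [conjTranspose_apply] at h1
    rw [show (∑ j, V j s * star (V j t)) = ∑ j, star (V j t) * V j s from Finset.sum_congr rfl fun j _ => mul_comm _ _, h1]
    simp [eq_comm]
  · simp only [hs]
    have h1 := hM.trace_eq_sum_eigenvalues
    rw [Matrix.trace] at h1
    have h2 : ((∑ r, hM.eigenvalues r : ℝ) : ℂ) = ((∑ i, ∑ k, ‖α i k‖ ^ 2 : ℝ) : ℂ) := by
      push_cast
      rw [Finset.sum_comm]
      refine Eq.trans h1.symm (Finset.sum_congr rfl fun k _ => ?_)
      rw [Matrix.diag_apply, Matrix.mul_apply]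
      refine Finset.sum_congr rfl fun i _ => ?_
      rw [conjTranspose_apply, mul_comm, Complex.star_def, Complex.mul_conj, Complex.normSq_eq_norm_sq]; simp [a]
    exact Complex.ofReal_inj.1 h2
  · intro i k
    have e : α i k = (Y * Vᴴ) i k := by
      show a i k = _
      rw [Matrix.mul_assoc, hV2, Matrix.mul_one]
    rw [e, Matrix.mul_apply]
    refine Finset.sum_congr rfl fun r _ => ?_
    rw [conjTranspose_apply, ← mul_assoc]
    congr 1
    by_cases h0 : hM.eigenvalues r = 0
    · have h1 := hYn r
      rw [h0] at h1
      have h2 : ∑ i, ‖Y i r‖ ^ 2 = 0 := by exact_mod_cast h1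
      have := (Finset.sum_eq_zero_iff_of_nonneg (fun _ _ => sq_nonneg _)).1 h2 i (Finset.mem_univ _)
      have : Y i r = 0 := by simpa using this
      simp [this]
    · have : (√(hM.eigenvalues r) : ℂ) ≠ 0 := by
        have := Real.sqrt_pos.2 (lt_of_le_of_ne (hl r) (Ne.symm h0)); exact_mod_cast this.ne'
      field_simp
end svd
end TP

namespace TP
open Filter Topology Matrix

section fb
variable {A : Type*} [NonUnitalCStarAlgebra A] {B : Type*} [NonUnitalCStarAlgebra B]
variable {NA : ∀ p : ℕ, Matrix (Fin p) (Fin p) A → ℝ} {NB : ∀ q : ℕ, Matrix (Fin q) (Fin q) B → ℝ}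
variable {H1 H2 H K1 K2 K : Type*} [NormedAddCommGroup H1] [InnerProductSpace ℂ H1]
  [NormedAddCommGroup H2] [InnerProductSpace ℂ H2]
  [NormedAddCommGroup H] [InnerProductSpace ℂ H]
  [NormedAddCommGroup K1] [InnerProductSpace ℂ K1]
  [NormedAddCommGroup K2] [InnerProductSpace ℂ K2]

def RowP (S : A →ₗ[ℂ] H) : Prop := ∀ (n : ℕ) (x : Fin n → A), ∑ j, ‖S (x j)‖ ^ 2 ≤ ‖∑ j, x j * star (x j)‖
def ColP (S : A →ₗ[ℂ] H) : Prop := ∀ (n : ℕ) (x : Fin n → A), ∑ j, ‖S (x j)‖ ^ 2 ≤ ‖∑ j, star (x j) * x j‖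

def tw {p q q' : ℕ} (v : Matrix (Fin p) (Fin p) A) (U : Fin p → Fin q → ℂ) (U' : Fin p → Fin q' → ℂ) (r : Fin q) (s : Fin q') : A :=
  ∑ i, ∑ j, (U i r * U' j s) • v i j

theorem tw_row (hNA : ∀ p, IsCStarNorm (NA p)) {S : A →ₗ[ℂ] H} (hS : RowP S) {p q q' : ℕ} (v : Matrix (Fin p) (Fin p) A)
    {U : Fin p → Fin q → ℂ} {U' : Fin p → Fin q' → ℂ} (hU : ONZ U) (hU' : ONZ U') (r : Fin q) :
    ∑ s, ‖S (tw v U U' r s)‖ ^ 2 ≤ NA p v ^ 2 := by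
  have e : ∀ s, S (tw v U U' r s) = ∑ j, U' j s • S (∑ i, U i r • v i j) := by
    intro s
    rw [tw, Finset.sum_comm, map_sum]
    refine Finset.sum_congr rfl fun j _ => ?_
    rw [← map_smul, Finset.smul_sum]
    congr 1
    refine Finset.sum_congr rfl fun i _ => ?_
    rw [smul_smul, mul_comm]
  simp only [e]
  refine (hU'.bess _).trans ((hS _ _).trans ((NA_row hNA v (fun i => U i r)).trans ?_))
  exact mul_le_of_le_one_right (sq_nonneg _) (hU.le r)

theorem tw_col (hNA : ∀ p, IsCStarNorm (NA p)) {S : A →ₗ[ℂ] H} (hS : ColP S) {p q q' : ℕ} (v : Matrix (Fin p) (Fin p) A)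
    {U : Fin p → Fin q → ℂ} {U' : Fin p → Fin q' → ℂ} (hU : ONZ U) (hU' : ONZ U') (s : Fin q') :
    ∑ r, ‖S (tw v U U' r s)‖ ^ 2 ≤ NA p v ^ 2 := by
  have e : ∀ r, S (tw v U U' r s) = ∑ i, U i r • S (∑ j, U' j s • v i j) := by
    intro r
    rw [tw, map_sum]
    refine Finset.sum_congr rfl fun j _ => ?_
    rw [← map_smul, Finset.smul_sum]
    congr 1
    refine Finset.sum_congr rfl fun i _ => ?_
    rw [smul_smul]
  simp only [e]
  refine (hU.bess _).trans ((hS _ _).trans ((NA_col hNA v (fun i => U' i s)).trans ?_))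
  exact mul_le_of_le_one_right (sq_nonneg _) (hU'.le s)

theorem cs2 {m n : ℕ} (σ : Fin m → ℝ) (τ : Fin n → ℝ) (x y : Fin m → Fin n → ℝ) {M N : ℝ} (hM : 0 ≤ M) (hN : 0 ≤ N)
    (hx : ∀ r, ∑ s, x r s ^ 2 ≤ M ^ 2) (hy : ∀ s, ∑ r, y r s ^ 2 ≤ N ^ 2) :
    ∑ r, ∑ s, σ r * τ s * (x r s * y r s) ≤ √(∑ r, σ r ^ 2) * M * N * √(∑ s, τ s ^ 2) := by
  have h1 : ∑ r, ∑ s, σ r * τ s * (x r s * y r s) = ∑ p : Fin m × Fin n, (σ p.1 * x p.1 p.2) * (τ p.2 * y p.1 p.2) := by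
    rw [Fintype.sum_prod_type]
    exact Finset.sum_congr rfl fun r _ => Finset.sum_congr rfl fun s _ => by ring
  rw [h1]
  have hc := Real.sum_mul_le_sqrt_mul_sqrt (Finset.univ : Finset (Fin m × Fin n)) (fun p => σ p.1 * x p.1 p.2) (fun p => τ p.2 * y p.1 p.2)
  refine hc.trans ?_
  have e1 : √(∑ p : Fin m × Fin n, (σ p.1 * x p.1 p.2) ^ 2) ≤ √(∑ r, σ r ^ 2) * M := by
    rw [← Real.sqrt_sq hM, ← Real.sqrt_mul (Finset.sum_nonneg fun _ _ => sq_nonneg _)]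
    refine Real.sqrt_le_sqrt ?_
    rw [Fintype.sum_prod_type, Finset.sum_mul]
    refine Finset.sum_le_sum fun r _ => ?_
    simp only [mul_pow]
    rw [← Finset.mul_sum]
    exact mul_le_mul_of_nonneg_left (hx r) (sq_nonneg _)
  have e2 : √(∑ p : Fin m × Fin n, (τ p.2 * y p.1 p.2) ^ 2) ≤ N * √(∑ r, τ r ^ 2) := by
    rw [mul_comm, ← Real.sqrt_sq hN, ← Real.sqrt_mul (Finset.sum_nonneg fun _ _ => sq_nonneg _)]
    refine Real.sqrt_le_sqrt ?_
    rw [Fintype.sum_prod_type, Finset.sum_comm, Finset.sum_mul]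
    refine Finset.sum_le_sum fun r _ => ?_
    simp only [mul_pow]
    rw [← Finset.mul_sum]
    exact mul_le_mul_of_nonneg_left (hy r) (sq_nonneg _)
  refine (mul_le_mul e1 e2 (Real.sqrt_nonneg _) (mul_nonneg (Real.sqrt_nonneg _) hM)).trans (le_of_eq (by ring))

theorem bil4 {I J K L : Type*} [Fintype I] [Fintype J] [Fintype K] [Fintype L] (θ : A →ₗ[ℂ] B →ₗ[ℂ] ℂ) (c : I → J → ℂ) (d : K → L → ℂ)
    (v : I → J → A) (w : K → L → B) :
    θ (∑ i, ∑ j, c i j • v i j) (∑ k, ∑ l, d k l • w k l) = ∑ i, ∑ j, ∑ k, ∑ l, c i j * d k l * θ (v i j) (w k l) := by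
  rw [map_sum θ, LinearMap.sum_apply]
  refine Finset.sum_congr rfl fun i _ => ?_
  rw [map_sum θ, LinearMap.sum_apply]
  refine Finset.sum_congr rfl fun j _ => ?_
  rw [map_sum]
  refine Finset.sum_congr rfl fun k _ => ?_
  rw [map_sum]
  refine Finset.sum_congr rfl fun l _ => ?_
  rw [map_smul, map_smul, LinearMap.smul_apply, smul_eq_mul, smul_eq_mul]
  ring

theorem sum4 {I J R S : Type*} [Fintype I] [Fintype J] [Fintype R] [Fintype S] (a : R → I → ℂ) (b : S → J → ℂ) (T : I → J → ℂ) :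
    ∑ i, ∑ j, (∑ r, a r i) * (∑ s, b s j) * T i j = ∑ r, ∑ s, ∑ i, ∑ j, a r i * b s j * T i j := by
  calc _ = ∑ i, ∑ j, ∑ r, ∑ s, a r i * b s j * T i j := by
        simp only [Finset.mul_sum, Finset.sum_mul]
        exact Finset.sum_congr rfl fun i _ => Finset.sum_congr rfl fun j _ => Finset.sum_comm
    _ = ∑ i, ∑ r, ∑ j, ∑ s, a r i * b s j * T i j := Finset.sum_congr rfl fun i _ => Finset.sum_comm
    _ = ∑ r, ∑ i, ∑ j, ∑ s, a r i * b s j * T i j := Finset.sum_comm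
    _ = ∑ r, ∑ i, ∑ s, ∑ j, a r i * b s j * T i j := Finset.sum_congr rfl fun r _ => Finset.sum_congr rfl fun i _ => Finset.sum_comm
    _ = _ := Finset.sum_congr rfl fun r _ => Finset.sum_comm

theorem form_bound (hNA : ∀ p, IsCStarNorm (NA p)) (hNB : ∀ p, IsCStarNorm (NB p)) {S1 : A →ₗ[ℂ] H1} {S2 : A →ₗ[ℂ] H2} {R1 : B →ₗ[ℂ] K1} {R2 : B →ₗ[ℂ] K2}
    (hS1 : RowP S1) (hS2 : ColP S2) (hR1 : ColP R1) (hR2 : RowP R2) {C : ℝ} (hC : 0 ≤ C) (θ : A →ₗ[ℂ] B →ₗ[ℂ] ℂ)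
    (hθ : ∀ a b, ‖θ a b‖ ≤ C * (‖S1 a‖ * ‖R1 b‖ + ‖S2 a‖ * ‖R2 b‖))
    {p q : ℕ} (α : Fin p × Fin q → ℂ) (v : Matrix (Fin p) (Fin p) A) (w : Matrix (Fin q) (Fin q) B) (β : Fin p × Fin q → ℂ) :
    ‖TensorProduct.lift θ (∑ ik : Fin p × Fin q, ∑ jl : Fin p × Fin q, (α ik * β jl) • (v ik.1 jl.1 ⊗ₜ[ℂ] w ik.2 jl.2))‖ ≤
      2 * C * (√(∑ ik, ‖α ik‖ ^ 2) * NA p v * NB q w * √(∑ jl, ‖β jl‖ ^ 2)) := by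
  obtain ⟨σ, U, W, hU, hW, hσ, hσ2, hα⟩ := svd (fun i k => α (i, k))
  obtain ⟨τ, U', W', hU', hW', hτ, hτ2, hβ⟩ := svd (fun i k => β (i, k))
  have key : TensorProduct.lift θ (∑ ik : Fin p × Fin q, ∑ jl : Fin p × Fin q, (α ik * β jl) • (v ik.1 jl.1 ⊗ₜ[ℂ] w ik.2 jl.2)) =
      ∑ r, ∑ s, ((σ r : ℂ) * (τ s : ℂ)) * θ (tw v U U' r s) (tw w W W' r s) := by
    have e1 : ∀ r s, θ (tw v U U' r s) (tw w W W' r s) = ∑ ik : Fin p × Fin q, ∑ jl : Fin p × Fin q, (U ik.1 r * U' jl.1 s) * (W ik.2 r * W' jl.2 s) * θ (v ik.1 jl.1) (w ik.2 jl.2) := by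
      intro r s
      rw [tw, tw, bil4 θ (fun i j => U i r * U' j s) (fun i j => W i r * W' j s) (fun i j => v i j) (fun i j => w i j)]
      simp only [Fintype.sum_prod_type]
      refine Finset.sum_congr rfl fun i _ => ?_
      rw [Finset.sum_comm]
    simp only [e1]
    have ha : ∀ ik : Fin p × Fin q, α ik = ∑ r, (σ r : ℂ) * (U ik.1 r * W ik.2 r) := fun ik => hα ik.1 ik.2
    have hb : ∀ ik : Fin p × Fin q, β ik = ∑ r, (τ r : ℂ) * (U' ik.1 r * W' ik.2 r) := fun ik => hβ ik.1 ik.2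
    simp only [map_sum, map_smul, TensorProduct.lift.tmul, smul_eq_mul]
    simp only [ha, hb]
    rw [sum4]
    refine Finset.sum_congr rfl fun r _ => Finset.sum_congr rfl fun s _ => ?_
    rw [Finset.mul_sum]
    refine Finset.sum_congr rfl fun i _ => ?_
    rw [Finset.mul_sum]
    exact Finset.sum_congr rfl fun j _ => by ring
  rw [key]
  have hM := NA_nonneg hNA v
  have hN := NA_nonneg hNB w
  have c1 := cs2 σ τ (fun r s => ‖S1 (tw v U U' r s)‖) (fun r s => ‖R1 (tw w W W' r s)‖) hM hN
    (fun r => tw_row hNA hS1 v hU hU' r) (fun s => tw_col hNB hR1 w hW hW' s)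
  have c2 := cs2 τ σ (fun s r => ‖S2 (tw v U U' r s)‖) (fun s r => ‖R2 (tw w W W' r s)‖) hM hN
    (fun s => tw_col hNA hS2 v hU hU' s) (fun r => tw_row hNB hR2 w hW hW' r)
  rw [Finset.sum_comm] at c2
  have ea : √(∑ r, σ r ^ 2) = √(∑ ik, ‖α ik‖ ^ 2) := by rw [hσ2, Fintype.sum_prod_type]
  have eb : √(∑ r, τ r ^ 2) = √(∑ ik, ‖β ik‖ ^ 2) := by rw [hτ2, Fintype.sum_prod_type]
  rw [ea, eb] at c1 c2
  calc _ ≤ ∑ r, ∑ s, (σ r * τ s) * (C * (‖S1 (tw v U U' r s)‖ * ‖R1 (tw w W W' r s)‖ + ‖S2 (tw v U U' r s)‖ * ‖R2 (tw w W W' r s)‖)) := by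
        refine (norm_sum_le _ _).trans (Finset.sum_le_sum fun r _ => (norm_sum_le _ _).trans (Finset.sum_le_sum fun s _ => ?_))
        rw [norm_mul, norm_mul, Complex.norm_real, Complex.norm_real, Real.norm_of_nonneg (hσ r), Real.norm_of_nonneg (hτ s)]
        exact mul_le_mul_of_nonneg_left (hθ _ _) (mul_nonneg (hσ r) (hτ s))
    _ = C * (∑ r, ∑ s, σ r * τ s * (‖S1 (tw v U U' r s)‖ * ‖R1 (tw w W W' r s)‖)) + C * (∑ r, ∑ s, τ s * σ r * (‖S2 (tw v U U' r s)‖ * ‖R2 (tw w W W' r s)‖)) := by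
        simp only [Finset.mul_sum, ← Finset.sum_add_distrib]
        exact Finset.sum_congr rfl fun r _ => Finset.sum_congr rfl fun s _ => by ring
    _ ≤ _ := by
        have d1 := mul_le_mul_of_nonneg_left c1 hC
        have d2 := mul_le_mul_of_nonneg_left c2 hC
        linarith
end fb
end TP

namespace TP
open Filter Topology Matrix

section os
variable {A B : Type u} [NonUnitalCStarAlgebra A] [NonUnitalCStarAlgebra B]
variable {NA : ∀ p : ℕ, Matrix (Fin p) (Fin p) A → ℝ} {NB : ∀ q : ℕ, Matrix (Fin q) (Fin q) B → ℝ}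

def rep {p q : ℕ} (α : Fin p × Fin q → ℂ) (v : Matrix (Fin p) (Fin p) A) (w : Matrix (Fin q) (Fin q) B) (β : Fin p × Fin q → ℂ) : A ⊗[ℂ] B :=
  ∑ ik : Fin p × Fin q, ∑ jl : Fin p × Fin q, (α ik * β jl) • (v ik.1 jl.1 ⊗ₜ[ℂ] w ik.2 jl.2)

theorem delta_sum {M : Type*} [AddCommMonoid M] {n : ℕ} (f : Fin n → Fin n → M) :
    ∑ ik : Fin n × Fin n, (if ik.1 = ik.2 then f ik.1 ik.2 else 0) = ∑ i, f i i := by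
  rw [Fintype.sum_prod_type]
  exact Finset.sum_congr rfl fun i _ => by simp

theorem rep_diag {n : ℕ} (σ τ : Fin n → ℂ) (v : Matrix (Fin n) (Fin n) A) (w : Matrix (Fin n) (Fin n) B) :
    rep (fun ik => if ik.1 = ik.2 then σ ik.1 else 0) v w (fun ik => if ik.1 = ik.2 then τ ik.1 else 0) =
      ∑ k, ∑ l, (σ k * τ l) • (v k l ⊗ₜ[ℂ] w k l) := by
  unfold rep
  have e : ∀ ik : Fin n × Fin n, (∑ jl : Fin n × Fin n, ((if ik.1 = ik.2 then σ ik.1 else 0) * (if jl.1 = jl.2 then τ jl.1 else 0)) • (v ik.1 jl.1 ⊗ₜ[ℂ] w ik.2 jl.2)) =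
      if ik.1 = ik.2 then (fun i k => ∑ l, (σ i * τ l) • (v i l ⊗ₜ[ℂ] w k l)) ik.1 ik.2 else 0 := by
    intro ik
    by_cases h : ik.1 = ik.2
    · simp only [h, if_true]
      rw [← delta_sum (fun j l => (σ ik.2 * τ j) • (v ik.2 j ⊗ₜ[ℂ] w ik.2 l))]
      refine Finset.sum_congr rfl fun jl _ => ?_
      split_ifs <;> simp
    · simp [h]
  exact (Finset.sum_congr rfl fun ik _ => e ik).trans (delta_sum (fun i k => ∑ l, (σ i * τ l) • (v i l ⊗ₜ[ℂ] w k l)))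

theorem rep_exists (z : A ⊗[ℂ] B) : ∃ (p q : ℕ) (α : Fin p × Fin q → ℂ) (v : Matrix (Fin p) (Fin p) A) (w : Matrix (Fin q) (Fin q) B) (β : Fin p × Fin q → ℂ), z = rep α v w β := by
  obtain ⟨n, a, b, h⟩ := TensorProduct.exists_sum_tmul_eq z
  refine ⟨n, n, fun ik => if ik.1 = ik.2 then 1 else 0, Matrix.diagonal a, Matrix.diagonal b, fun ik => if ik.1 = ik.2 then 1 else 0, ?_⟩
  · rw [rep_diag (fun _ => 1) (fun _ => 1), h]
    refine Finset.sum_congr rfl fun k _ => ?_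
    rw [Finset.sum_eq_single k]
    · simp
    · intro l _ hl; simp [Matrix.diagonal_apply, hl.symm]
    · simp

theorem os_ge (hNA : ∀ p, IsCStarNorm (NA p)) (hNB : ∀ p, IsCStarNorm (NB p)) {p q : ℕ} (α : Fin p × Fin q → ℂ) (v : Matrix (Fin p) (Fin p) A) (w : Matrix (Fin q) (Fin q) B) (β : Fin p × Fin q → ℂ) :
    osProjNorm NA NB (rep α v w β) ≤ √(∑ ik, ‖α ik‖ ^ 2) * NA p v * NB q w * √(∑ jl, ‖β jl‖ ^ 2) := by
  refine csInf_le ⟨0, ?_⟩ ⟨p, q, α, v, w, β, rfl, rfl⟩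
  rintro r ⟨p, q, α, v, w, β, -, rfl⟩
  have := NA_nonneg hNA v
  have := NA_nonneg hNB w
  positivity

theorem os_le {E : Type*} [SeminormedAddCommGroup E] [Module ℂ E] (f : A ⊗[ℂ] B →ₗ[ℂ] E) {C : ℝ} (hC : 0 ≤ C)
    (hf : ∀ {p q : ℕ} (α : Fin p × Fin q → ℂ) (v : Matrix (Fin p) (Fin p) A) (w : Matrix (Fin q) (Fin q) B) (β : Fin p × Fin q → ℂ),
      ‖f (rep α v w β)‖ ≤ C * (√(∑ ik, ‖α ik‖ ^ 2) * NA p v * NB q w * √(∑ jl, ‖β jl‖ ^ 2))) (z : A ⊗[ℂ] B) :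
    ‖f z‖ ≤ C * osProjNorm NA NB z := by
  unfold osProjNorm
  rw [← smul_eq_mul, ← Real.sInf_smul_of_nonneg hC]
  refine le_csInf ?_ ?_
  · refine Set.Nonempty.smul_set ?_
    obtain ⟨p, q, α, v, w, β, h⟩ := rep_exists z
    exact ⟨_, p, q, α, v, w, β, h, rfl⟩
  · rintro _ ⟨r, ⟨p, q, α, v, w, β, h, rfl⟩, rfl⟩
    have := hf α v w β
    rw [show z = rep α v w β from h]
    simpa using this

variable {X : Type u} [NonUnitalNormedRing X] [StarRing X] [NormedSpace ℂ X] [CompleteSpace X] {ι : A ⊗[ℂ] B →ₗ[ℂ] X}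

theorem ext_lin (hX : IsTensorCompletion (osProjNorm NA NB) X ι) {E : Type*} [NormedAddCommGroup E] [NormedSpace ℂ E] [CompleteSpace E] (f : A ⊗[ℂ] B →ₗ[ℂ] E) {C : ℝ} (hC : 0 ≤ C)
    (hf : ∀ {p q : ℕ} (α : Fin p × Fin q → ℂ) (v : Matrix (Fin p) (Fin p) A) (w : Matrix (Fin q) (Fin q) B) (β : Fin p × Fin q → ℂ),
      ‖f (rep α v w β)‖ ≤ C * (√(∑ ik, ‖α ik‖ ^ 2) * NA p v * NB q w * √(∑ jl, ‖β jl‖ ^ 2))) :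
    ∃ g : X →L[ℂ] E, (∀ z, g (ι z) = f z) ∧ ∀ x, ‖g x‖ ≤ C * ‖x‖ := by
  have hb : ∀ z, ‖f z‖ ≤ C * ‖ι z‖ := fun z => by rw [hX.norm_eq]; exact os_le f hC hf z
  exact ⟨f.extendOfNorm ι, LinearMap.extendOfNorm_eq hX.dense ⟨C, hb⟩, LinearMap.norm_extendOfNorm_apply_le hX.dense C hb⟩

theorem X_closed_ind (hX : IsTensorCompletion (osProjNorm NA NB) X ι) (S : Submodule ℂ X) (hS : IsClosed (S : Set X))
    (h : ∀ a b, ι (a ⊗ₜ b) ∈ S) (x : X) : x ∈ S := by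
  have : (S : Set X) = Set.univ := by
    rw [← hS.closure_eq]
    refine Set.eq_univ_of_univ_subset ?_
    rw [← hX.dense.closure_range]
    refine closure_mono ?_
    rintro _ ⟨z, rfl⟩
    induction z with
    | zero => simp
    | tmul a b => exact h a b
    | add x y hx hy => rw [map_add]; exact S.add_mem hx hy
  have h : x ∈ (S : Set X) := this ▸ Set.mem_univ x
  exact h

theorem X_ext (hX : IsTensorCompletion (osProjNorm NA NB) X ι) {E : Type*} [NormedAddCommGroup E] [NormedSpace ℂ E] {f g : X →L[ℂ] E}
    (h : ∀ a b, f (ι (a ⊗ₜ b)) = g (ι (a ⊗ₜ b))) : f = g := by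
  ext x
  have := X_closed_ind hX (LinearMap.ker (f - g).toLinearMap) ((f - g).isClosed_ker) (fun a b => by simp [h, sub_eq_zero]) x
  simpa [sub_eq_zero] using this

theorem X_lim (hX : IsTensorCompletion (osProjNorm NA NB) X ι) {γ : Type*} {l : Filter γ} [l.NeBot] (g : γ → X →L[ℂ] ℂ) (g0 : X →L[ℂ] ℂ) {C : ℝ}
    (hC : ∀ i x, ‖g i x‖ ≤ C * ‖x‖) (h : ∀ a b, Tendsto (fun i => g i (ι (a ⊗ₜ b))) l (𝓝 (g0 (ι (a ⊗ₜ b))))) (z : X) (hz : ∀ i, g i z = 0) : g0 z = 0 := by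
  let S : Submodule ℂ X :=
    { carrier := {x | Tendsto (fun i => g i x) l (𝓝 (g0 x))}
      add_mem' := fun {x y} hx hy => by
        simp only [Set.mem_setOf_eq, map_add] at *; exact hx.add hy
      zero_mem' := by simp
      smul_mem' := fun c x hx => by
        simp only [Set.mem_setOf_eq, map_smul] at *; exact hx.const_smul c }
  have hS : IsClosed (S : Set X) := by
    refine isClosed_of_closure_subset fun x hx => ?_
    show Tendsto (fun i => g i x) l (𝓝 (g0 x))
    rw [Metric.tendsto_nhds]
    intro ε hε
    have hd : 0 < ε / (|C| + ‖g0‖ + 1) / 2 := by positivity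
    obtain ⟨y, hy, hxy⟩ := Metric.mem_closure_iff.1 hx _ hd
    have hy' : Tendsto (fun i => g i y) l (𝓝 (g0 y)) := hy
    filter_upwards [Metric.tendsto_nhds.1 hy' (ε / 2) (half_pos hε)] with i hi
    rw [dist_eq_norm] at *
    have e : g i x - g0 x = g i (x - y) - g0 (x - y) + (g i y - g0 y) := by simp [map_sub]; ring
    rw [e]
    have h1 := hC i (x - y)
    have h2 := g0.le_opNorm (x - y)
    have h3 : C * ‖x - y‖ ≤ |C| * ‖x - y‖ := mul_le_mul_of_nonneg_right (le_abs_self C) (norm_nonneg _)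
    have h4 : (|C| + ‖g0‖ + 1) * ‖x - y‖ < ε / 2 := by
      have := mul_lt_mul_of_pos_left hxy (show (0:ℝ) < |C| + ‖g0‖ + 1 by positivity)
      refine this.trans_eq ?_
      field_simp
    have h5 := norm_add_le (g i (x - y) - g0 (x - y)) (g i y - g0 y)
    have h6 := norm_sub_le (g i (x - y)) (g0 (x - y))
    nlinarith [norm_nonneg (x - y)]
  have hm : Tendsto (fun i => g i z) l (𝓝 (g0 z)) := X_closed_ind hX S hS h z
  simp only [hz] at hm
  exact (tendsto_nhds_unique hm tendsto_const_nhds)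

end os
end TP

namespace TP
open Filter Topology Matrix

section os
variable {A B : Type u} [NonUnitalCStarAlgebra A] [NonUnitalCStarAlgebra B]
variable {NA : ∀ p : ℕ, Matrix (Fin p) (Fin p) A → ℝ} {NB : ∀ q : ℕ, Matrix (Fin q) (Fin q) B → ℝ}

theorem le_sq_of_le_mul_sqrt {x M : ℝ} (hx : 0 ≤ x) (hM : 0 ≤ M) (h : x ≤ M * √x) : x ≤ M ^ 2 := by
  have h1 : √x * √x = x := Real.mul_self_sqrt hx
  rcases eq_or_lt_of_le (Real.sqrt_nonneg x) with h0 | h0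
  · rw [← h0] at h; nlinarith
  · have : √x ≤ M := by
      by_contra hc
      push Not at hc
      nlinarith
    nlinarith

theorem sum_norm_sq_conj {n : ℕ} (d : Fin n → ℂ) : ((∑ j, ‖d j‖ ^ 2 : ℝ) : ℂ) = ∑ j, (starRingEnd ℂ) (d j) * d j := by
  push_cast
  refine Finset.sum_congr rfl fun j _ => ?_
  rw [mul_comm, Complex.mul_conj, Complex.normSq_eq_norm_sq]; push_cast; rfl

theorem phi_row (hNA : ∀ p, IsCStarNorm (NA p)) (φ : A →L[ℂ] ℂ) {p : ℕ} (v : Matrix (Fin p) (Fin p) A) (c : Fin p → ℂ) :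
    ∑ j, ‖∑ i, c i * φ (v i j)‖ ^ 2 ≤ (‖φ‖ * NA p v) ^ 2 * ∑ i, ‖c i‖ ^ 2 := by
  set d : Fin p → ℂ := fun j => ∑ i, c i * φ (v i j) with hd
  have hx : 0 ≤ ∑ j, ‖d j‖ ^ 2 := Finset.sum_nonneg fun _ _ => sq_nonneg _
  have hN := NA_nonneg hNA v
  have e : ((∑ j, ‖d j‖ ^ 2 : ℝ) : ℂ) = φ (∑ i, ∑ j, (c i * (starRingEnd ℂ) (d j)) • v i j) := by
    rw [sum_norm_sq_conj, Finset.sum_comm, map_sum]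
    refine Finset.sum_congr rfl fun j _ => ?_
    show (starRingEnd ℂ) (d j) * (∑ i, c i * φ (v i j)) = _
    rw [map_sum φ, Finset.mul_sum]
    refine Finset.sum_congr rfl fun i _ => ?_
    rw [map_smul, smul_eq_mul]; ring
  have h1 : ∑ j, ‖d j‖ ^ 2 = ‖φ (∑ i, ∑ j, (c i * (starRingEnd ℂ) (d j)) • v i j)‖ := by
    rw [← e, Complex.norm_real, Real.norm_of_nonneg hx]
  have h2 := (φ.le_opNorm (∑ i, ∑ j, (c i * (starRingEnd ℂ) (d j)) • v i j)).trans (mul_le_mul_of_nonneg_left (NA_bil hNA v c (fun j => (starRingEnd ℂ) (d j))) (norm_nonneg _))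
  rw [← h1] at h2
  simp only [RCLike.norm_conj] at h2
  have h3 := le_sq_of_le_mul_sqrt (M := ‖φ‖ * NA p v * √(∑ i, ‖c i‖ ^ 2)) hx (by positivity) (h2.trans_eq (by ring))
  rw [mul_pow, Real.sq_sqrt (Finset.sum_nonneg fun _ _ => sq_nonneg _)] at h3
  exact h3

theorem phi_col (hNA : ∀ p, IsCStarNorm (NA p)) (φ : A →L[ℂ] ℂ) {p : ℕ} (v : Matrix (Fin p) (Fin p) A) (c : Fin p → ℂ) :
    ∑ i, ‖∑ j, c j * φ (v i j)‖ ^ 2 ≤ (‖φ‖ * NA p v) ^ 2 * ∑ i, ‖c i‖ ^ 2 := by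
  set d : Fin p → ℂ := fun i => ∑ j, c j * φ (v i j) with hd
  have hx : 0 ≤ ∑ j, ‖d j‖ ^ 2 := Finset.sum_nonneg fun _ _ => sq_nonneg _
  have hN := NA_nonneg hNA v
  have e : ((∑ j, ‖d j‖ ^ 2 : ℝ) : ℂ) = φ (∑ i, ∑ j, ((starRingEnd ℂ) (d i) * c j) • v i j) := by
    rw [sum_norm_sq_conj, map_sum]
    refine Finset.sum_congr rfl fun j _ => ?_
    show (starRingEnd ℂ) (d j) * (∑ i, c i * φ (v j i)) = _
    rw [map_sum φ, Finset.mul_sum]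
    refine Finset.sum_congr rfl fun i _ => ?_
    rw [map_smul, smul_eq_mul]; ring
  have h1 : ∑ j, ‖d j‖ ^ 2 = ‖φ (∑ i, ∑ j, ((starRingEnd ℂ) (d i) * c j) • v i j)‖ := by
    rw [← e, Complex.norm_real, Real.norm_of_nonneg hx]
  have h2 := (φ.le_opNorm (∑ i, ∑ j, ((starRingEnd ℂ) (d i) * c j) • v i j)).trans (mul_le_mul_of_nonneg_left (NA_bil hNA v (fun j => (starRingEnd ℂ) (d j)) c) (norm_nonneg _))
  rw [← h1] at h2
  simp only [RCLike.norm_conj] at h2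
  have h3 := le_sq_of_le_mul_sqrt (M := ‖φ‖ * NA p v * √(∑ i, ‖c i‖ ^ 2)) hx (by positivity) (h2.trans_eq (by ring))
  rw [mul_pow, Real.sq_sqrt (Finset.sum_nonneg fun _ _ => sq_nonneg _)] at h3
  exact h3

theorem prod_bound (hNA : ∀ p, IsCStarNorm (NA p)) (hNB : ∀ p, IsCStarNorm (NB p)) (φ : A →L[ℂ] ℂ) (ψ : B →L[ℂ] ℂ)
    {p q : ℕ} (α : Fin p × Fin q → ℂ) (v : Matrix (Fin p) (Fin p) A) (w : Matrix (Fin q) (Fin q) B) (β : Fin p × Fin q → ℂ) :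
    ‖∑ ik : Fin p × Fin q, ∑ jl : Fin p × Fin q, (α ik * β jl) * (φ (v ik.1 jl.1) * ψ (w ik.2 jl.2))‖ ≤
      ‖φ‖ * ‖ψ‖ * (√(∑ ik, ‖α ik‖ ^ 2) * NA p v * NB q w * √(∑ jl, ‖β jl‖ ^ 2)) := by
  have hv := NA_nonneg hNA v
  have hw := NA_nonneg hNB w
  set γ : Fin p × Fin q → ℂ := fun x => ∑ i, α (i, x.2) * φ (v i x.1) with hγ
  set δ : Fin p × Fin q → ℂ := fun x => ∑ l, β (x.1, l) * ψ (w x.2 l) with hδ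
  have e : ∑ ik : Fin p × Fin q, ∑ jl : Fin p × Fin q, (α ik * β jl) * (φ (v ik.1 jl.1) * ψ (w ik.2 jl.2)) = ∑ x, γ x * δ x := by
    simp only [Fintype.sum_prod_type, hγ, hδ, Finset.sum_mul_sum]
    calc _ = ∑ i : Fin p, ∑ j : Fin p, ∑ k : Fin q, ∑ l : Fin q, α (i, k) * φ (v i j) * (β (j, l) * ψ (w k l)) := by
          refine Finset.sum_congr rfl fun i _ => ?_
          rw [Finset.sum_comm]
          exact Finset.sum_congr rfl fun j _ => Finset.sum_congr rfl fun k _ => Finset.sum_congr rfl fun l _ => by ring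
      _ = ∑ j : Fin p, ∑ i : Fin p, ∑ k : Fin q, ∑ l : Fin q, α (i, k) * φ (v i j) * (β (j, l) * ψ (w k l)) := Finset.sum_comm
      _ = _ := Finset.sum_congr rfl fun j _ => Finset.sum_comm
  rw [e]
  have hγ2 : ∑ x, ‖γ x‖ ^ 2 ≤ (‖φ‖ * NA p v) ^ 2 * ∑ ik, ‖α ik‖ ^ 2 := by
    rw [Fintype.sum_prod_type, Finset.sum_comm, Fintype.sum_prod_type, Finset.sum_comm (f := fun i k => ‖α (i, k)‖ ^ 2), Finset.mul_sum]
    exact Finset.sum_le_sum fun k _ => phi_row hNA φ v (fun i => α (i, k))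
  have hδ2 : ∑ x, ‖δ x‖ ^ 2 ≤ (‖ψ‖ * NB q w) ^ 2 * ∑ ik, ‖β ik‖ ^ 2 := by
    rw [Fintype.sum_prod_type, Fintype.sum_prod_type, Finset.mul_sum]
    exact Finset.sum_le_sum fun k _ => phi_col hNB ψ w (fun i => β (k, i))
  have hγ3 := Real.sqrt_le_sqrt hγ2
  have hδ3 := Real.sqrt_le_sqrt hδ2
  rw [Real.sqrt_mul (sq_nonneg _), Real.sqrt_sq (by positivity)] at hγ3 hδ3
  calc ‖∑ x, γ x * δ x‖ ≤ ∑ x, ‖γ x‖ * ‖δ x‖ := (norm_sum_le _ _).trans_eq (by simp)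
    _ ≤ √(∑ x, ‖γ x‖ ^ 2) * √(∑ x, ‖δ x‖ ^ 2) := Real.sum_mul_le_sqrt_mul_sqrt _ _ _
    _ ≤ _ := mul_le_mul hγ3 hδ3 (Real.sqrt_nonneg _) (by positivity)
    _ = _ := by ring

variable {X : Type u} [NonUnitalNormedRing X] [StarRing X] [NormedSpace ℂ X] [CompleteSpace X] {ι : A ⊗[ℂ] B →ₗ[ℂ] X}

theorem ft_exists (hNA : ∀ p, IsCStarNorm (NA p)) (hNB : ∀ p, IsCStarNorm (NB p)) (hX : IsTensorCompletion (osProjNorm NA NB) X ι) (φ : A →L[ℂ] ℂ) (ψ : B →L[ℂ] ℂ) :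
    ∃ g : X →L[ℂ] ℂ, ∀ a b, g (ι (a ⊗ₜ b)) = φ a * ψ b := by
  obtain ⟨g, hg, -⟩ := ext_lin hX (TensorProduct.lift ((LinearMap.mul ℂ ℂ).compl₁₂ φ.toLinearMap ψ.toLinearMap)) (C := ‖φ‖ * ‖ψ‖) (by positivity)
    (fun α v w β => by
      refine le_trans (le_of_eq ?_) (prod_bound hNA hNB φ ψ α v w β)
      simp [rep])
  exact ⟨g, fun a b => by rw [hg]; simp⟩

theorem slB_exists (hNA : ∀ p, IsCStarNorm (NA p)) (hNB : ∀ p, IsCStarNorm (NB p)) (hX : IsTensorCompletion (osProjNorm NA NB) X ι) (φ : A →L[ℂ] ℂ) :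
    ∃ g : X →L[ℂ] B, ∀ a b, g (ι (a ⊗ₜ b)) = φ a • b := by
  obtain ⟨g, hg, -⟩ := ext_lin hX (TensorProduct.lift ((LinearMap.lsmul ℂ B).comp φ.toLinearMap)) (C := ‖φ‖) (by positivity)
    (fun {p q} α v w β => by
      have hv := NA_nonneg hNA v
      have hw := NA_nonneg hNB w
      refine NormedSpace.norm_le_dual_bound ℂ _ (by positivity) fun ψ => ?_
      refine le_trans (le_of_eq ?_) ((prod_bound hNA hNB φ ψ α v w β).trans_eq (by ring))
      simp [rep, mul_assoc])
  exact ⟨g, fun a b => by rw [hg]; simp⟩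

theorem slA_exists (hNA : ∀ p, IsCStarNorm (NA p)) (hNB : ∀ p, IsCStarNorm (NB p)) (hX : IsTensorCompletion (osProjNorm NA NB) X ι) (ψ : B →L[ℂ] ℂ) :
    ∃ g : X →L[ℂ] A, ∀ a b, g (ι (a ⊗ₜ b)) = ψ b • a := by
  obtain ⟨g, hg, -⟩ := ext_lin hX (TensorProduct.lift ((LinearMap.lsmul ℂ A).comp ψ.toLinearMap).flip) (C := ‖ψ‖) (by positivity)
    (fun {p q} α v w β => by
      have hv := NA_nonneg hNA v
      have hw := NA_nonneg hNB w
      refine NormedSpace.norm_le_dual_bound ℂ _ (by positivity) fun φ => ?_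
      refine le_trans (le_of_eq ?_) ((prod_bound hNA hNB φ ψ α v w β).trans_eq (by ring))
      simp [rep, mul_assoc, mul_comm])
  exact ⟨g, fun a b => by rw [hg]; simp⟩

theorem MBn_of (hNA : ∀ p, IsCStarNorm (NA p)) (hNB : ∀ p, IsCStarNorm (NB p)) (hX : IsTensorCompletion (osProjNorm NA NB) X ι) (g : X →L[ℂ] ℂ) :
    MBn NA NB (TensorProduct.curry (g.toLinearMap ∘ₗ ι)) ‖g‖ := by
  intro p σ hσ v w
  have h := os_ge hNA hNB (fun ik : Fin p × Fin p => if ik.1 = ik.2 then (σ ik.1 : ℂ) else 0) v w (fun ik : Fin p × Fin p => if ik.1 = ik.2 then (σ ik.1 : ℂ) else 0)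
  rw [← hX.norm_eq, rep_diag (fun i => (σ i : ℂ)) (fun i => (σ i : ℂ))] at h
  have e : ∑ ik : Fin p × Fin p, ‖(if ik.1 = ik.2 then (σ ik.1 : ℂ) else 0)‖ ^ 2 = 1 := by
    rw [← hσ, ← delta_sum (fun i j => σ i ^ 2)]
    refine Finset.sum_congr rfl fun ik _ => ?_
    split_ifs <;> simp
  rw [e] at h
  have h2 := (g.le_opNorm _).trans (mul_le_mul_of_nonneg_left h (norm_nonneg g))
  refine le_trans (le_of_eq ?_) (h2.trans_eq (by simp; ring))
  simp

theorem func_exists (hNA : ∀ p, IsCStarNorm (NA p)) (hNB : ∀ p, IsCStarNorm (NB p)) (hX : IsTensorCompletion (osProjNorm NA NB) X ι)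
    {H1 H2 K1 K2 : Type*} [NormedAddCommGroup H1] [InnerProductSpace ℂ H1]
    [NormedAddCommGroup H2] [InnerProductSpace ℂ H2] [NormedAddCommGroup K1] [InnerProductSpace ℂ K1]
    [NormedAddCommGroup K2] [InnerProductSpace ℂ K2] {S1 : A →ₗ[ℂ] H1} {S2 : A →ₗ[ℂ] H2} {R1 : B →ₗ[ℂ] K1} {R2 : B →ₗ[ℂ] K2}
    (hS1 : RowP S1) (hS2 : ColP S2) (hR1 : ColP R1) (hR2 : RowP R2) {C : ℝ} (hC : 0 ≤ C) (θ : A →ₗ[ℂ] B →ₗ[ℂ] ℂ)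
    (hθ : ∀ a b, ‖θ a b‖ ≤ C * (‖S1 a‖ * ‖R1 b‖ + ‖S2 a‖ * ‖R2 b‖)) :
    ∃ g : X →L[ℂ] ℂ, (∀ a b, g (ι (a ⊗ₜ b)) = θ a b) ∧ ∀ x, ‖g x‖ ≤ 2 * C * ‖x‖ := by
  obtain ⟨g, hg, hb⟩ := ext_lin hX (TensorProduct.lift θ) (C := 2 * C) (by positivity)
    (fun α v w β => form_bound hNA hNB hS1 hS2 hR1 hR2 hC θ hθ α v w β)
  exact ⟨g, fun a b => by rw [hg]; simp, hb⟩

end os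
end TP

namespace TP
open Filter Topology Matrix

section km
variable {A : Type u} [NonUnitalCStarAlgebra A] {H : Type u} [NormedAddCommGroup H] [InnerProductSpace ℂ H] [CompleteSpace H]

theorem pi_le (π : A →⋆ₙₐ[ℂ] (H →L[ℂ] H)) (a : A) : ‖π a‖ ≤ ‖a‖ := NonUnitalStarAlgHom.norm_apply_le π a

def vf (π : A →⋆ₙₐ[ℂ] (H →L[ℂ] H)) (ξ η : H) : A →L[ℂ] ℂ :=
  LinearMap.mkContinuous
    { toFun := fun a => inner ℂ ξ (π a η)
      map_add' := fun a b => by simp [inner_add_right]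
      map_smul' := fun c a => by simp [inner_smul_right] } (‖ξ‖ * ‖η‖) (fun a => by
      refine (norm_inner_le_norm ξ (π a η)).trans ?_
      have := (π a).le_opNorm η
      have h2 := mul_le_mul_of_nonneg_right (pi_le π a) (norm_nonneg η)
      nlinarith [norm_nonneg ξ])

@[simp] theorem vf_apply (π : A →⋆ₙₐ[ℂ] (H →L[ℂ] H)) (ξ η : H) (a : A) : vf π ξ η a = inner ℂ ξ (π a η) := rfl

theorem vf_zero (π : A →⋆ₙₐ[ℂ] (H →L[ℂ] H)) {a : A} (h : ∀ ξ η, vf π ξ η a = 0) : π a = 0 := by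
  ext η
  have := h (π a η) η
  simpa using this

theorem PS_re_le {L : Type*} [CStarAlgebra L] {f : WeakDual ℂ L} (hf : f ∈ PS L) (x : L) : (f x).re ≤ ‖x‖ :=
  (Complex.re_le_norm _).trans (hf.1 x)

theorem col_map (π : A →⋆ₙₐ[ℂ] (H →L[ℂ] H)) {f : WeakDual ℂ (H →L[ℂ] H)} (hf : f ∈ PS (H →L[ℂ] H)) :
    ∃ (K : Type u) (_ : NormedAddCommGroup K) (_ : InnerProductSpace ℂ K) (_ : CompleteSpace K) (S : A →ₗ[ℂ] K), ColP S ∧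
      (∀ a, ‖S a‖ = √((f (star (π a) * π a)).re)) := by
  obtain ⟨K, _, _, _, S, -, hS⟩ := exists_hilb (fun a b : A => f (star (π a) * π b))
    (fun a b => by
      show star _ = _
      rw [← hf.2.1, star_mul, star_star]) (fun a => hf.2.2 _)
    (fun a b c => by simp [add_mul]) (fun a b r => by simp [smul_mul_assoc])
  have hn : ∀ a, ‖S a‖ ^ 2 = (f (star (π a) * π a)).re := fun a => by
    rw [← hS, inner_self_eq_norm_sq_to_K]; norm_cast
  refine ⟨K, _, _, inferInstance, S, fun n x => ?_, fun a => by rw [← hn, Real.sqrt_sq (norm_nonneg _)]⟩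
  simp only [hn]
  rw [← Complex.re_sum, ← map_sum]
  refine (PS_re_le hf _).trans ?_
  refine le_trans (le_of_eq ?_) (pi_le π _)
  simp only [map_sum, map_mul, map_star]

theorem row_map (π : A →⋆ₙₐ[ℂ] (H →L[ℂ] H)) {f : WeakDual ℂ (H →L[ℂ] H)} (hf : f ∈ PS (H →L[ℂ] H)) :
    ∃ (K : Type u) (_ : NormedAddCommGroup K) (_ : InnerProductSpace ℂ K) (_ : CompleteSpace K) (S : A →ₗ[ℂ] K), RowP S ∧
      (∀ a, ‖S a‖ = √((f (π a * star (π a))).re)) := by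
  obtain ⟨K, _, _, _, S, -, hS⟩ := exists_hilb (fun a b : A => f (π b * star (π a)))
    (fun a b => by
      show star _ = _
      rw [← hf.2.1, star_mul, star_star]) (fun a => by simpa using hf.2.2 (star (π a)))
    (fun a b c => by simp [mul_add]) (fun a b r => by simp [mul_smul_comm])
  have hn : ∀ a, ‖S a‖ ^ 2 = (f (π a * star (π a))).re := fun a => by
    rw [← hS, inner_self_eq_norm_sq_to_K]; norm_cast
  refine ⟨K, _, _, inferInstance, S, fun n x => ?_, fun a => by rw [← hn, Real.sqrt_sq (norm_nonneg _)]⟩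
  simp only [hn]
  rw [← Complex.re_sum, ← map_sum]
  refine (PS_re_le hf _).trans ?_
  refine le_trans (le_of_eq ?_) (pi_le π _)
  simp only [map_sum, map_mul, map_star]

theorem ColP.le {K : Type*} [NormedAddCommGroup K] [InnerProductSpace ℂ K] {S : A →ₗ[ℂ] K} (h : ColP S) (a : A) : ‖S a‖ ≤ ‖a‖ := by
  have := h 1 (fun _ => a)
  simp [CStarRing.norm_star_mul_self] at this
  nlinarith [norm_nonneg a, norm_nonneg (S a)]
theorem RowP.le {K : Type*} [NormedAddCommGroup K] [InnerProductSpace ℂ K] {S : A →ₗ[ℂ] K} (h : RowP S) (a : A) : ‖S a‖ ≤ ‖a‖ := by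
  have := h 1 (fun _ => a)
  simp [CStarRing.norm_self_mul_star] at this
  nlinarith [norm_nonneg a, norm_nonneg (S a)]
end km

section main
variable {A B : Type u} [NonUnitalCStarAlgebra A] [NonUnitalCStarAlgebra B]
variable {NA : ∀ p : ℕ, Matrix (Fin p) (Fin p) A → ℝ} {NB : ∀ q : ℕ, Matrix (Fin q) (Fin q) B → ℝ}
variable {X : Type u} [NonUnitalNormedRing X] [StarRing X] [NormedSpace ℂ X] [CompleteSpace X] {ι : A ⊗[ℂ] B →ₗ[ℂ] X}
variable {H1 : Type u} [NormedAddCommGroup H1] [InnerProductSpace ℂ H1] [CompleteSpace H1]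
variable {H2 : Type u} [NormedAddCommGroup H2] [InnerProductSpace ℂ H2] [CompleteSpace H2]

/-- `z` is killed by all product vector functionals. -/
def Kil (ι : A ⊗[ℂ] B →ₗ[ℂ] X) (π1 : A →⋆ₙₐ[ℂ] (H1 →L[ℂ] H1)) (π2 : B →⋆ₙₐ[ℂ] (H2 →L[ℂ] H2)) (z : X) : Prop :=
  ∀ ξ η ξ' η', ∀ g : X →L[ℂ] ℂ, (∀ a b, g (ι (a ⊗ₜ b)) = vf π1 ξ η a * vf π2 ξ' η' b) → g z = 0

theorem kil_prod (hNA : ∀ p, IsCStarNorm (NA p)) (hNB : ∀ p, IsCStarNorm (NB p)) (hX : IsTensorCompletion (osProjNorm NA NB) X ι)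
    {π1 : A →⋆ₙₐ[ℂ] (H1 →L[ℂ] H1)} {π2 : B →⋆ₙₐ[ℂ] (H2 →L[ℂ] H2)} {z : X} (hz : Kil ι π1 π2 z) (φ : A →L[ℂ] ℂ) (ψ : B →L[ℂ] ℂ)
    (hφ : ∀ a, π1 a = 0 → φ a = 0) (hψ : ∀ b, π2 b = 0 → ψ b = 0) (g : X →L[ℂ] ℂ) (hg : ∀ a b, g (ι (a ⊗ₜ b)) = φ a * ψ b) : g z = 0 := by
  obtain ⟨R, hR⟩ := slB_exists hNA hNB hX φ
  have h1 : g = ψ.comp R := X_ext hX fun a b => by simp [hg, hR]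
  rw [h1]
  refine hψ _ (vf_zero π2 fun ξ' η' => ?_)
  obtain ⟨L, hL⟩ := slA_exists hNA hNB hX (vf π2 ξ' η')
  have h2 : (vf π2 ξ' η').comp R = φ.comp L := X_ext hX fun a b => by simp [hL, hR]; ring
  have h3 : π1 (L z) = 0 := vf_zero π1 fun ξ η =>
    hz ξ η ξ' η' ((vf π1 ξ η).comp L) (fun a b => by simp [hL]; ring)
  have h4 : ((vf π2 ξ' η').comp R) z = φ (L z) := by rw [h2]; rfl
  rw [hφ _ h3] at h4
  exact h4

theorem kil_prods (hNA : ∀ p, IsCStarNorm (NA p)) (hNB : ∀ p, IsCStarNorm (NB p)) (hX : IsTensorCompletion (osProjNorm NA NB) X ι)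
    {π1 : A →⋆ₙₐ[ℂ] (H1 →L[ℂ] H1)} {π2 : B →⋆ₙₐ[ℂ] (H2 →L[ℂ] H2)} {z : X} (hz : Kil ι π1 π2 z) {n : ℕ} (φ : Fin n → A →L[ℂ] ℂ) (ψ : Fin n → B →L[ℂ] ℂ)
    (hφ : ∀ k a, π1 a = 0 → φ k a = 0) (hψ : ∀ k b, π2 b = 0 → ψ k b = 0) (g : X →L[ℂ] ℂ) (hg : ∀ a b, g (ι (a ⊗ₜ b)) = ∑ k, φ k a * ψ k b) : g z = 0 := by
  choose f hf using fun k => ft_exists hNA hNB hX (φ k) (ψ k)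
  have : g = ∑ k, f k := X_ext hX fun a b => by simp [hg, hf]
  rw [this, ContinuousLinearMap.sum_apply]
  exact Finset.sum_eq_zero fun k _ => kil_prod hNA hNB hX hz _ _ (hφ k) (hψ k) _ (hf k)

theorem kil_form (hNA : ∀ p, IsCStarNorm (NA p)) (hNB : ∀ p, IsCStarNorm (NB p)) (hX : IsTensorCompletion (osProjNorm NA NB) X ι)
    {π1 : A →⋆ₙₐ[ℂ] (H1 →L[ℂ] H1)} {π2 : B →⋆ₙₐ[ℂ] (H2 →L[ℂ] H2)} {z : X} (hz : Kil ι π1 π2 z)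
    {H K : Type u} [NormedAddCommGroup H] [InnerProductSpace ℂ H] [CompleteSpace H] [NormedAddCommGroup K] [InnerProductSpace ℂ K]
    {S : A →ₗ[ℂ] H} {R : B →ₗ[ℂ] K} (hS : ∀ a, ‖S a‖ ≤ ‖a‖) (hR : ∀ b, ‖R b‖ ≤ ‖b‖) (hS0 : ∀ a, π1 a = 0 → S a = 0) (hR0 : ∀ b, π2 b = 0 → R b = 0)
    {C : ℝ} (hC : 0 ≤ C)
    (hfe : ∀ θ : A →ₗ[ℂ] B →ₗ[ℂ] ℂ, (∀ a b, ‖θ a b‖ ≤ C * (‖S a‖ * ‖R b‖)) → ∃ g : X →L[ℂ] ℂ, (∀ a b, g (ι (a ⊗ₜ b)) = θ a b) ∧ ∀ x, ‖g x‖ ≤ 2 * C * ‖x‖)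
    (θ : A →ₗ[ℂ] B →ₗ[ℂ] ℂ) (hθ : ∀ a b, ‖θ a b‖ ≤ C * (‖S a‖ * ‖R b‖)) (g0 : X →L[ℂ] ℂ) (hg0 : ∀ a b, g0 (ι (a ⊗ₜ b)) = θ a b) : g0 z = 0 := by
  have key : ∀ s : Finset A, ∃ g : X →L[ℂ] ℂ, (∀ x, ‖g x‖ ≤ 2 * C * ‖x‖) ∧ (∀ a ∈ s, ∀ b, g (ι (a ⊗ₜ b)) = θ a b) ∧ g z = 0 := by
    intro s
    obtain ⟨n, x, h1, h2⟩ := fin_approx S θ (fun b => ‖R b‖) hC (fun _ => norm_nonneg _) hθ s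
    let φ : Fin n → A →L[ℂ] ℂ := fun k => LinearMap.mkContinuous ((innerSL ℂ (S (x k))).toLinearMap ∘ₗ S) ‖S (x k)‖ (fun a => by
      refine (norm_inner_le_norm _ _).trans ?_
      exact mul_le_mul_of_nonneg_left (hS a) (norm_nonneg _))
    let ψ : Fin n → B →L[ℂ] ℂ := fun k => LinearMap.mkContinuous (θ (x k)) (C * ‖S (x k)‖) (fun b => by
      refine (hθ _ _).trans ?_
      rw [← mul_assoc]
      exact mul_le_mul_of_nonneg_left (hR b) (by positivity))
    have eφ : ∀ k a, φ k a = inner ℂ (S (x k)) (S a) := fun k a => rfl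
    have eψ : ∀ k b, ψ k b = θ (x k) b := fun k b => rfl
    let T : A →ₗ[ℂ] B →ₗ[ℂ] ℂ := ∑ k, (LinearMap.mul ℂ ℂ).compl₁₂ (φ k).toLinearMap (ψ k).toLinearMap
    have eT : ∀ a b, T a b = ∑ k, inner ℂ (S (x k)) (S a) * θ (x k) b := fun a b => by
      simp [T, LinearMap.sum_apply, eφ, eψ]
    obtain ⟨g, hg, hb⟩ := hfe T (fun a b => by rw [eT]; exact h1 a b)
    refine ⟨g, hb, fun a ha b => by rw [hg, eT]; exact h2 a ha b, ?_⟩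
    refine kil_prods hNA hNB hX hz φ ψ (fun k a ha => by rw [eφ, hS0 a ha, inner_zero_right]) (fun k b hb => ?_) g (fun a b => by rw [hg, eT]; simp only [eφ, eψ])
    have := hθ (x k) b
    rw [hR0 b hb] at this
    rw [eψ]
    simpa using this
  choose g hg1 hg2 hg3 using key
  refine X_lim hX (l := (atTop : Filter (Finset A))) g g0 hg1 (fun a b => ?_) z hg3
  refine tendsto_const_nhds.congr' ?_
  filter_upwards [eventually_ge_atTop {a}] with s hs
  rw [hg0, hg2 s a (hs (Finset.mem_singleton_self a))]

theorem kil_main (hNA : ∀ p, IsCStarNorm (NA p)) (hNB : ∀ p, IsCStarNorm (NB p)) (hX : IsTensorCompletion (osProjNorm NA NB) X ι)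
    {π1 : A →⋆ₙₐ[ℂ] (H1 →L[ℂ] H1)} {π2 : B →⋆ₙₐ[ℂ] (H2 →L[ℂ] H2)} {z : X} (hz : Kil ι π1 π2 z) (u : X →L[ℂ] ℂ)
    (hu1 : ∀ a b, π1 a = 0 → u (ι (a ⊗ₜ b)) = 0) (hu2 : ∀ a b, π2 b = 0 → u (ι (a ⊗ₜ b)) = 0) : u z = 0 := by
  obtain ⟨f1, hf1, f2, hf2, g1, hg1, g2, hg2, hB⟩ := minimax hNA hNB (norm_nonneg u) (MBn_of hNA hNB hX u) π1 π2
    (fun a b h => by simpa using hu1 a b h) (fun a b h => by simpa using hu2 a b h)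
  obtain ⟨_, _, _, _, S1, hS1, nS1⟩ := row_map π1 hf1
  obtain ⟨_, _, _, _, S2, hS2, nS2⟩ := col_map π1 hf2
  obtain ⟨_, _, _, _, R1, hR1, nR1⟩ := col_map π2 hg1
  obtain ⟨_, _, _, _, R2, hR2, nR2⟩ := row_map π2 hg2
  simp only [← nS1, ← nS2, ← nR1, ← nR2] at hB
  have zS1 : ∀ a, π1 a = 0 → S1 a = 0 := fun a h => by rw [← norm_eq_zero, nS1, h]; simp
  have zS2 : ∀ a, π1 a = 0 → S2 a = 0 := fun a h => by rw [← norm_eq_zero, nS2, h]; simp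
  have zR1 : ∀ a, π2 a = 0 → R1 a = 0 := fun a h => by rw [← norm_eq_zero, nR1, h]; simp
  have zR2 : ∀ a, π2 a = 0 → R2 a = 0 := fun a h => by rw [← norm_eq_zero, nR2, h]; simp
  have hC : 0 ≤ 688 * ‖u‖ := by positivity
  generalize 688 * ‖u‖ = C at hB hC
  obtain ⟨t, θ, ht, hθ, hθ', hlim⟩ := decomp S1 S2 R1 R2 _ hC hB
  have fe := fun {C : ℝ} (hC : 0 ≤ C) θ hθ => func_exists hNA hNB hX hS1 hS2 hR1 hR2 (C := C) hC θ hθ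
  have fe1 : ∀ {C : ℝ} (hC : 0 ≤ C), ∀ θ : A →ₗ[ℂ] B →ₗ[ℂ] ℂ, (∀ a b, ‖θ a b‖ ≤ C * (‖S1 a‖ * ‖R1 b‖)) → ∃ g : X →L[ℂ] ℂ, (∀ a b, g (ι (a ⊗ₜ b)) = θ a b) ∧ ∀ x, ‖g x‖ ≤ 2 * C * ‖x‖ := by
    intro C hC θ hθ
    refine fe hC θ fun a b => (hθ a b).trans (mul_le_mul_of_nonneg_left ?_ hC)
    have : 0 ≤ ‖S2 a‖ * ‖R2 b‖ := by positivity
    linarith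
  have fe2 : ∀ {C : ℝ} (hC : 0 ≤ C), ∀ θ : A →ₗ[ℂ] B →ₗ[ℂ] ℂ, (∀ a b, ‖θ a b‖ ≤ C * (‖S2 a‖ * ‖R2 b‖)) → ∃ g : X →L[ℂ] ℂ, (∀ a b, g (ι (a ⊗ₜ b)) = θ a b) ∧ ∀ x, ‖g x‖ ≤ 2 * C * ‖x‖ := by
    intro C hC θ hθ
    refine fe hC θ fun a b => (hθ a b).trans (mul_le_mul_of_nonneg_left ?_ hC)
    have : 0 ≤ ‖S1 a‖ * ‖R1 b‖ := by positivity
    linarith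
  obtain ⟨gt, hgt, -⟩ := fe2 (by positivity) t ht
  have gt0 : gt z = 0 := kil_form hNA hNB hX hz hS2.le hR2.le zS2 zR2 (by positivity) (fe2 (by positivity)) t ht gt hgt
  choose gθ hgθ bθ using fun n => fe (C := 4 * C) (by positivity) (θ n) (hθ n)
  have gθ0 : ∀ n, gθ n z = 0 := fun n => by
    obtain ⟨c, hc, hb⟩ := hθ' n
    exact kil_form hNA hNB hX hz hS1.le hR1.le zS1 zR1 hc (fe1 hc) (θ n) hb (gθ n) (hgθ n)
  have := X_lim hX (l := atTop) gθ (u - gt) bθ (fun a b => by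
    have h := (hlim a b).sub_const (t a b)
    simp only [add_sub_cancel_left] at h
    simp only [hgθ, ContinuousLinearMap.sub_apply, hgt]
    exact h) z gθ0
  rw [ContinuousLinearMap.sub_apply, gt0, sub_zero] at this
  exact this

end main
end TP

namespace TP
open Filter Topology Matrix

theorem hb_sub {X : Type*} [NormedAddCommGroup X] [NormedSpace ℂ X] (S : Submodule ℂ X) (hS : IsClosed (S : Set X)) {z : X}
    (h : ∀ u : X →L[ℂ] ℂ, (∀ x ∈ S, u x = 0) → u z = 0) : z ∈ S := by
  by_contra hz
  haveI : IsClosed (S : Set X) := hS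
  have hne : S.mkQL z ≠ 0 := by
    rw [Submodule.mkQL_apply]; simpa [Submodule.Quotient.mk_eq_zero] using hz
  obtain ⟨g, -, hg⟩ := exists_dual_vector ℂ (S.mkQL z) (norm_ne_zero_iff.2 hne)
  have := h (g.comp S.mkQL) (fun x hx => by
    have : S.mkQL x = 0 := by rw [Submodule.mkQL_apply]; simpa [Submodule.Quotient.mk_eq_zero] using hx
    simp only [ContinuousLinearMap.comp_apply, this, map_zero])
  rw [ContinuousLinearMap.comp_apply, hg] at this
  exact hne (norm_eq_zero.1 (RCLike.ofReal_eq_zero.1 this))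

theorem sum_closed {X : Type*} [NormedAddCommGroup X] [NormedSpace ℂ X] [CompleteSpace X] (I J : Submodule ℂ X) (hI : IsClosed (I : Set X)) (hJ : IsClosed (J : Set X))
    (h : ∀ i ∈ I, ∀ j ∈ J, ∀ ε > 0, ∃ m : X →ₗ[ℂ] X, (∀ x, ‖m x‖ ≤ ‖x‖) ∧ m i ∈ I ∧ m i ∈ J ∧ ‖m j - j‖ < ε) :
    IsClosed ((I ⊔ J : Submodule ℂ X) : Set X) := by
  haveI := hI.completeSpace_coe
  haveI := hJ.completeSpace_coe
  let f0 : (I × J) →L[ℂ] X := I.subtypeL.coprod J.subtypeL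
  let f : NormedAddGroupHom (I × J) X := ⟨f0, fun x y => map_add f0 x y, ‖f0‖, f0.le_opNorm⟩
  have ef : ∀ p : I × J, f p = (p.1 : X) + p.2 := fun p => by
    show f0 p = _; simp [f0]
  have hs : f.SurjectiveOnWith (I ⊔ J : Submodule ℂ X).toAddSubgroup 4 := by
    intro δ hδ
    obtain ⟨i, hi, j, hj, rfl⟩ := Submodule.mem_sup.1 hδ
    by_cases h0 : i + j = 0
    · exact ⟨0, by simp [h0], by simp [h0]⟩
    obtain ⟨m, hm, mi, mj, he⟩ := h i hi j hj ‖i + j‖ (norm_pos_iff.2 h0)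
    refine ⟨(⟨i - m i, I.sub_mem hi mi⟩, ⟨m i + j, J.add_mem mj hj⟩), ?_, ?_⟩
    · rw [ef]; show i - m i + (m i + j) = i + j; abel
    · have e1 : i - m i = (i + j) - m (i + j) + (m j - j) := by rw [map_add]; abel
      have n1 : ‖i - m i‖ ≤ 3 * ‖i + j‖ := by
        rw [e1]
        have := norm_add_le ((i + j) - m (i + j)) (m j - j)
        have := norm_sub_le (i + j) (m (i + j))
        have := hm (i + j)
        linarith
      have e2 : m i + j = (i + j) - (i - m i) := by abel
      have n2 : ‖m i + j‖ ≤ 4 * ‖i + j‖ := by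
        rw [e2]
        have := norm_sub_le (i + j) (i - m i)
        linarith
      refine max_le ?_ n2
      exact n1.trans (by nlinarith [norm_nonneg (i + j)])
  have h2 := controlled_closure_of_complete (by norm_num) (zero_lt_one) hs
  refine isClosed_of_closure_subset fun x hx => ?_
  obtain ⟨g, hg, -⟩ := h2 x hx
  rw [ef] at hg
  rw [← hg]
  exact Submodule.add_mem_sup g.1.2 g.2.2

section au
variable {A : Type u} [NonUnitalCStarAlgebra A] {H : Type u} [NormedAddCommGroup H] [InnerProductSpace ℂ H] [CompleteSpace H]

theorem pi_cont (π : A →⋆ₙₐ[ℂ] (H →L[ℂ] H)) : Continuous π :=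
  (LinearMap.mkContinuous ({ toFun := π, map_add' := map_add π, map_smul' := map_smul π } : A →ₗ[ℂ] (H →L[ℂ] H)) 1 (fun a => by simpa using pi_le π a)).continuous

theorem ker_au (π : A →⋆ₙₐ[ℂ] (H →L[ℂ] H)) :
    ∃ l : Filter A, l.NeBot ∧ (∀ᶠ x in l, ‖x‖ ≤ 1) ∧ (∀ᶠ x in l, IsSelfAdjoint x) ∧ (∀ᶠ x in l, π x = 0) ∧
      (∀ a, π a = 0 → Tendsto (fun x => x * a) l (𝓝 a)) ∧ (∀ a, π a = 0 → Tendsto (fun x => a * x) l (𝓝 a)) := by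
  let S : NonUnitalStarSubalgebra ℂ A :=
    { carrier := {a | π a = 0}
      add_mem' := fun {a b} ha hb => by simp only [Set.mem_setOf_eq] at *; rw [map_add, ha, hb, add_zero]
      zero_mem' := map_zero π
      mul_mem' := fun {a b} ha hb => by simp only [Set.mem_setOf_eq] at *; rw [map_mul, ha, zero_mul]
      smul_mem' := fun c a ha => by simp only [Set.mem_setOf_eq] at *; rw [map_smul, ha, smul_zero]
      star_mem' := fun {a} ha => by simp only [Set.mem_setOf_eq] at *; rw [map_star, ha, star_zero] }
  have hc : IsClosed (S : Set A) := isClosed_eq (pi_cont π) continuous_const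
  haveI : IsClosed (S : Set A) := hc
  obtain ⟨l, hl, h1, h2⟩ := exists_au S
  haveI := hl.neBot
  refine ⟨l.map Subtype.val, inferInstance, h1, ?_, ?_, fun a ha => ?_, fun a ha => ?_⟩
  · rw [eventually_map]
    filter_upwards [h2] with x hx
    exact congrArg Subtype.val hx
  · rw [eventually_map]; exact Eventually.of_forall fun x => x.2
  · rw [tendsto_map'_iff]
    exact (continuous_subtype_val.tendsto _).comp (hl.tendsto_mul_right (⟨a, ha⟩ : S))
  · rw [tendsto_map'_iff]
    exact (continuous_subtype_val.tendsto _).comp (hl.tendsto_mul_left (⟨a, ha⟩ : S))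

theorem all_au (A : Type u) [NonUnitalCStarAlgebra A] :
    ∃ l : Filter A, l.NeBot ∧ (∀ᶠ x in l, ‖x‖ ≤ 1) ∧ (∀ᶠ x in l, IsSelfAdjoint x) ∧
      (∀ a, Tendsto (fun x => x * a) l (𝓝 a)) ∧ (∀ a, Tendsto (fun x => a * x) l (𝓝 a)) := by
  obtain ⟨l, hl, h1, h2⟩ := exists_au A
  exact ⟨l, hl.neBot, h1, h2, hl.tendsto_mul_right, hl.tendsto_mul_left⟩
end au

section main
variable {A B : Type u} [NonUnitalCStarAlgebra A] [NonUnitalCStarAlgebra B]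
variable {NA : ∀ p : ℕ, Matrix (Fin p) (Fin p) A → ℝ} {NB : ∀ q : ℕ, Matrix (Fin q) (Fin q) B → ℝ}
variable {X : Type u} [NonUnitalNormedRing X] [StarRing X] [NormedSpace ℂ X] [CompleteSpace X] [IsScalarTower ℂ X X] [SMulCommClass ℂ X X] {ι : A ⊗[ℂ] B →ₗ[ℂ] X}

theorem norm_tmul_le (hNA : ∀ p, IsCStarNorm (NA p)) (hNB : ∀ p, IsCStarNorm (NB p)) (hX : IsTensorCompletion (osProjNorm NA NB) X ι) (a : A) (b : B) :
    ‖ι (a ⊗ₜ b)‖ ≤ ‖a‖ * ‖b‖ := by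
  have h := os_ge hNA hNB (fun _ : Fin 1 × Fin 1 => 1) (fun _ _ => a) (fun _ _ => b) (fun _ : Fin 1 × Fin 1 => 1)
  rw [← hX.norm_eq, NA_one hNA, NA_one hNB] at h
  simpa [rep] using h

def tI (ι : A ⊗[ℂ] B →ₗ[ℂ] X) (S : Set A) (T : Set B) : Submodule ℂ X :=
  ((Submodule.span ℂ (Set.image2 (fun a b => a ⊗ₜ[ℂ] b) S T)).map ι).topologicalClosure

theorem tI_coe (S : Set A) (T : Set B) : (tI ι S T : Set X) = tensorIdeal ι S T := by
  simp [tI, tensorIdeal, Submodule.topologicalClosure_coe]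

theorem tI_closed (S : Set A) (T : Set B) : IsClosed (tI ι S T : Set X) := Submodule.isClosed_topologicalClosure _

theorem tI_mem {S : Set A} {T : Set B} {a : A} {b : B} (ha : a ∈ S) (hb : b ∈ T) : ι (a ⊗ₜ b) ∈ tI ι S T :=
  Submodule.le_topologicalClosure _ (Submodule.mem_map_of_mem (Submodule.subset_span ⟨a, ha, b, hb, rfl⟩))

theorem tI_ind {S : Set A} {T : Set B} (P : Submodule ℂ X) (hP : IsClosed (P : Set X)) (h : ∀ a ∈ S, ∀ b ∈ T, ι (a ⊗ₜ b) ∈ P) : tI ι S T ≤ P := by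
  refine Submodule.topologicalClosure_minimal _ ?_ hP
  rw [Submodule.map_le_iff_le_comap, Submodule.span_le]
  rintro _ ⟨a, ha, b, hb, rfl⟩
  exact h a ha b hb

def lm' (m : X) : X →L[ℂ] X := ContinuousLinearMap.mul ℂ X m

theorem lm'_apply (m x : X) : lm' m x = m * x := rfl
def rm' (m : X) : X →L[ℂ] X := (ContinuousLinearMap.mul ℂ X).flip m
theorem rm'_apply (m x : X) : rm' m x = x * m := rfl

theorem au_lim (hNA : ∀ p, IsCStarNorm (NA p)) (hNB : ∀ p, IsCStarNorm (NB p)) (hX : IsTensorCompletion (osProjNorm NA NB) X ι)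
    {lA : Filter A} {lB : Filter B} (h1 : ∀ᶠ x in lA, ‖x‖ ≤ 1) (h2 : ∀ᶠ x in lB, ‖x‖ ≤ 1) {S : Set A} {T : Set B}
    (hS : ∀ a ∈ S, Tendsto (fun x => x * a) lA (𝓝 a)) (hT : ∀ a ∈ T, Tendsto (fun x => x * a) lB (𝓝 a)) (z : X) (hz : z ∈ tI ι S T) :
    Tendsto (fun p : A × B => ι (p.1 ⊗ₜ p.2) * z) (lA ×ˢ lB) (𝓝 z) := by
  let P : Submodule ℂ X :=
    { carrier := {z | Tendsto (fun p : A × B => ι (p.1 ⊗ₜ p.2) * z) (lA ×ˢ lB) (𝓝 z)}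
      add_mem' := fun {x y} hx hy => by
        simp only [Set.mem_setOf_eq, mul_add] at *; exact hx.add hy
      zero_mem' := by simp only [Set.mem_setOf_eq, mul_zero]; exact tendsto_const_nhds
      smul_mem' := fun c x hx => by
        simp only [Set.mem_setOf_eq, mul_smul_comm] at *; exact hx.const_smul c }
  have hb : ∀ᶠ p : A × B in lA ×ˢ lB, ‖ι (p.1 ⊗ₜ[ℂ] p.2)‖ ≤ 1 := by
    filter_upwards [h1.prod_inl lB, h2.prod_inr lA] with p q1 q2
    exact (norm_tmul_le hNA hNB hX _ _).trans (mul_le_one₀ q1 (norm_nonneg _) q2)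
  have hP : IsClosed (P : Set X) := by
    refine isClosed_of_closure_subset fun x hx => ?_
    show Tendsto (fun p : A × B => ι (p.1 ⊗ₜ p.2) * x) (lA ×ˢ lB) (𝓝 x)
    rw [Metric.tendsto_nhds]
    intro ε hε
    obtain ⟨y, hy, hxy⟩ := Metric.mem_closure_iff.1 hx (ε / 3) (by positivity)
    have hy' : Tendsto (fun p : A × B => ι (p.1 ⊗ₜ p.2) * y) (lA ×ˢ lB) (𝓝 y) := hy
    filter_upwards [Metric.tendsto_nhds.1 hy' (ε / 3) (by positivity), hb] with p hp hp1
    rw [dist_eq_norm] at *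
    have e : ι (p.1 ⊗ₜ[ℂ] p.2) * x - x = ι (p.1 ⊗ₜ[ℂ] p.2) * (x - y) + (ι (p.1 ⊗ₜ[ℂ] p.2) * y - y) - (x - y) := by
      rw [mul_sub]; abel
    rw [e]
    have q1 := norm_sub_le (ι (p.1 ⊗ₜ[ℂ] p.2) * (x - y) + (ι (p.1 ⊗ₜ[ℂ] p.2) * y - y)) (x - y)
    have q2 := norm_add_le (ι (p.1 ⊗ₜ[ℂ] p.2) * (x - y)) (ι (p.1 ⊗ₜ[ℂ] p.2) * y - y)
    have q3 := norm_mul_le (ι (p.1 ⊗ₜ[ℂ] p.2)) (x - y)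
    have q4 := mul_le_mul_of_nonneg_right hp1 (norm_nonneg (x - y))
    linarith
  refine tI_ind P hP (fun a ha b hb' => ?_) hz
  show Tendsto (fun p : A × B => ι (p.1 ⊗ₜ p.2) * ι (a ⊗ₜ b)) (lA ×ˢ lB) (𝓝 _)
  simp only [hX.mul_tmul]
  have t1 : Tendsto (fun p : A × B => p.1 * a) (lA ×ˢ lB) (𝓝 a) := (hS a ha).comp tendsto_fst
  have t2 : Tendsto (fun p : A × B => p.2 * b) (lA ×ˢ lB) (𝓝 b) := (hT b hb').comp tendsto_snd
  rw [tendsto_iff_norm_sub_tendsto_zero] at t1 t2 ⊢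
  have hlim : Tendsto (fun p : A × B => ‖p.1 * a - a‖ * (‖p.2 * b - b‖ + ‖b‖) + ‖a‖ * ‖p.2 * b - b‖) (lA ×ˢ lB) (𝓝 0) := by
    have := (t1.mul (t2.add_const ‖b‖)).add (t2.const_mul ‖a‖)
    simpa using this
  refine squeeze_zero (fun _ => norm_nonneg _) (fun p => ?_) hlim
  have e : ι ((p.1 * a) ⊗ₜ[ℂ] (p.2 * b)) - ι (a ⊗ₜ[ℂ] b) = ι ((p.1 * a - a) ⊗ₜ[ℂ] (p.2 * b)) + ι (a ⊗ₜ[ℂ] (p.2 * b - b)) := by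
    rw [← map_sub, ← map_add, TensorProduct.sub_tmul, TensorProduct.tmul_sub]; congr 1; abel
  rw [e]
  refine (norm_add_le _ _).trans (add_le_add ((norm_tmul_le hNA hNB hX _ _).trans ?_) (norm_tmul_le hNA hNB hX _ _))
  refine mul_le_mul_of_nonneg_left ?_ (norm_nonneg _)
  have := norm_add_le (p.2 * b - b) b
  simpa using this

variable {H1 : Type u} [NormedAddCommGroup H1] [InnerProductSpace ℂ H1] [CompleteSpace H1]
variable {H2 : Type u} [NormedAddCommGroup H2] [InnerProductSpace ℂ H2] [CompleteSpace H2]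

theorem kil_iff (hNA : ∀ p, IsCStarNorm (NA p)) (hNB : ∀ p, IsCStarNorm (NB p)) (hX : IsTensorCompletion (osProjNorm NA NB) X ι)
    (π1 : A →⋆ₙₐ[ℂ] (H1 →L[ℂ] H1)) (π2 : B →⋆ₙₐ[ℂ] (H2 →L[ℂ] H2)) (z : X) :
    Kil ι π1 π2 z ↔ z ∈ tensorIdeal ι Set.univ {b | π2 b = 0} + tensorIdeal ι {a | π1 a = 0} Set.univ := by
  rw [← tI_coe, ← tI_coe, ← Submodule.coe_sup]
  constructor
  · intro hz
    refine hb_sub _ ?_ fun u hu => kil_main hNA hNB hX hz u ?_ ?_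
    · refine sum_closed _ _ (tI_closed _ _) (tI_closed _ _) fun i hi j hj ε hε => ?_
      obtain ⟨lA, _, a1, -, a2, a3, -⟩ := ker_au π1
      obtain ⟨lB, _, b1, -, b3, -⟩ := all_au B
      have hl := au_lim hNA hNB hX a1 b1 (S := {a | π1 a = 0}) (T := Set.univ) a3 (fun b _ => b3 b) j hj
      have hev := Metric.tendsto_nhds.1 hl ε hε
      obtain ⟨p, p1, p2, p3, p4⟩ := (hev.and ((a1.prod_inl lB).and ((b1.prod_inr lA).and (a2.prod_inl lB)))).exists
      refine ⟨(lm' (ι (p.1 ⊗ₜ p.2))).toLinearMap, fun x => ?_, ?_, ?_, ?_⟩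
      · show ‖ι (p.1 ⊗ₜ p.2) * x‖ ≤ _
        refine (norm_mul_le _ _).trans (mul_le_of_le_one_left (norm_nonneg _) ?_)
        exact (norm_tmul_le hNA hNB hX _ _).trans (mul_le_one₀ p2 (norm_nonneg _) p3)
      · refine tI_ind ((tI ι Set.univ {b | π2 b = 0}).comap (lm' (ι (p.1 ⊗ₜ p.2))).toLinearMap) ((tI_closed _ _).preimage (lm' (ι (p.1 ⊗ₜ p.2))).continuous) (fun a _ b hb => ?_) hi
        show ι (p.1 ⊗ₜ p.2) * ι (a ⊗ₜ b) ∈ tI ι Set.univ {b | π2 b = 0}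
        rw [hX.mul_tmul]
        refine tI_mem (Set.mem_univ _) ?_
        show π2 _ = 0
        rw [map_mul, show π2 b = 0 from hb, mul_zero]
      · refine X_closed_ind hX ((tI ι {a | π1 a = 0} Set.univ).comap (lm' (ι (p.1 ⊗ₜ p.2))).toLinearMap) ((tI_closed _ _).preimage (lm' (ι (p.1 ⊗ₜ p.2))).continuous) (fun a b => ?_) i
        show ι (p.1 ⊗ₜ p.2) * ι (a ⊗ₜ b) ∈ tI ι {a | π1 a = 0} Set.univ
        rw [hX.mul_tmul]
        refine tI_mem ?_ (Set.mem_univ _)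
        show π1 _ = 0
        rw [map_mul, p4, zero_mul]
      · rw [dist_eq_norm] at p1; exact p1
    · intro a b ha
      exact hu _ (Submodule.mem_sup_right (tI_mem ha (Set.mem_univ _)))
    · intro a b hb
      exact hu _ (Submodule.mem_sup_left (tI_mem (Set.mem_univ _) hb))
  · intro hz ξ η ξ' η' g hg
    have : tI ι Set.univ {b | π2 b = 0} ⊔ tI ι {a | π1 a = 0} Set.univ ≤ LinearMap.ker g.toLinearMap := by
      refine sup_le (tI_ind _ g.isClosed_ker fun a _ b hb => ?_) (tI_ind _ g.isClosed_ker fun a ha b _ => ?_)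
      · show g _ = 0
        rw [hg, vf_apply π2, show π2 b = 0 from hb]; simp
      · show g _ = 0
        rw [hg, vf_apply π1, show π1 a = 0 from ha]; simp
    exact this hz

end main
end TP

namespace TP
open Filter Topology Matrix

theorem op_le_of_unit {H : Type*} [NormedAddCommGroup H] [InnerProductSpace ℂ H] (T : H →L[ℂ] H) {C : ℝ} (hC : 0 ≤ C)
    (h : ∀ ζ ζ' : H, ‖ζ‖ ≤ 1 → ‖ζ'‖ ≤ 1 → ‖inner ℂ ζ (T ζ')‖ ≤ C) : ‖T‖ ≤ C := by
  have key : ∀ x : H, ‖(‖x‖⁻¹ : ℂ) • x‖ ≤ 1 := fun x => by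
    rw [norm_smul, norm_inv, Complex.norm_real, norm_norm]
    exact inv_mul_le_one
  refine T.opNorm_le_bound hC fun x => ?_
  by_cases hx : x = 0
  · simp [hx]
  by_cases hT : T x = 0
  · rw [hT, norm_zero]; positivity
  have h1 := h _ _ (key (T x)) (key x)
  rw [map_smul, inner_smul_left, inner_smul_right, inner_self_eq_norm_sq_to_K] at h1
  simp only [norm_mul, norm_pow, norm_inv, Complex.norm_real, norm_norm, RCLike.norm_conj, Complex.coe_algebraMap] at h1
  have a := norm_pos_iff.2 hx
  have b := norm_pos_iff.2 hT
  have e : ‖T x‖⁻¹ * (‖x‖⁻¹ * ‖T x‖ ^ 2) = ‖T x‖ / ‖x‖ := by field_simp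
  have h2 : ‖T x‖ / ‖x‖ ≤ C := by rw [← e]; simpa using h1
  rwa [div_le_iff₀ a] at h2

section main
variable {A B : Type u} [NonUnitalCStarAlgebra A] [NonUnitalCStarAlgebra B]
variable {NA : ∀ p : ℕ, Matrix (Fin p) (Fin p) A → ℝ} {NB : ∀ q : ℕ, Matrix (Fin q) (Fin q) B → ℝ}
variable {X : Type u} [NonUnitalNormedRing X] [StarRing X] [NormedSpace ℂ X] [CompleteSpace X] [IsScalarTower ℂ X X] [SMulCommClass ℂ X X] {ι : A ⊗[ℂ] B →ₗ[ℂ] X}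
variable {H : Type u} [NormedAddCommGroup H] [InnerProductSpace ℂ H] [CompleteSpace H]

def lin (π : A →⋆ₙₐ[ℂ] (H →L[ℂ] H)) : A →ₗ[ℂ] (H →L[ℂ] H) := { toFun := π, map_add' := map_add π, map_smul' := map_smul π }
theorem lin_apply (π : A →⋆ₙₐ[ℂ] (H →L[ℂ] H)) (a : A) : lin π a = π a := rfl

theorem star_inner (π : A →⋆ₙₐ[ℂ] (H →L[ℂ] H)) (a : A) (x y : H) : inner ℂ (π (star a) x) y = inner ℂ x (π a y) := by
  rw [map_star, ContinuousLinearMap.star_eq_adjoint, ContinuousLinearMap.adjoint_inner_left]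

theorem star_inner' (π : A →⋆ₙₐ[ℂ] (H →L[ℂ] H)) (a : A) (x y : H) : inner ℂ (π a x) y = inner ℂ x (π (star a) y) := by
  rw [← star_inner, star_star]

theorem sum_norm_sq_le (π : A →⋆ₙₐ[ℂ] (H →L[ℂ] H)) {n : ℕ} (x : Fin n → A) (ζ : H) (hζ : ‖ζ‖ ≤ 1) :
    ∑ j, ‖π (x j) ζ‖ ^ 2 ≤ ‖∑ j, star (x j) * x j‖ := by
  have e : ((∑ j, ‖π (x j) ζ‖ ^ 2 : ℝ) : ℂ) = inner ℂ ζ (π (∑ j, star (x j) * x j) ζ) := by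
    rw [map_sum, ContinuousLinearMap.sum_apply, inner_sum]
    push_cast
    refine Finset.sum_congr rfl fun j _ => ?_
    rw [map_mul, ContinuousLinearMap.mul_apply, ← star_inner', inner_self_eq_norm_sq_to_K]; rfl
  have h0 : 0 ≤ ∑ j, ‖π (x j) ζ‖ ^ 2 := Finset.sum_nonneg fun _ _ => sq_nonneg _
  have : ∑ j, ‖π (x j) ζ‖ ^ 2 = ‖((∑ j, ‖π (x j) ζ‖ ^ 2 : ℝ) : ℂ)‖ := by rw [Complex.norm_real, Real.norm_of_nonneg h0]
  rw [this, e]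
  refine (norm_inner_le_norm _ _).trans ?_
  have h1 := (π (∑ j, star (x j) * x j)).le_opNorm ζ
  have h2 := pi_le π (∑ j, star (x j) * x j)
  have h3 := norm_nonneg (∑ j, star (x j) * x j)
  have h4 := norm_nonneg ζ
  have h5 := norm_nonneg (π (∑ j, star (x j) * x j) ζ)
  nlinarith [mul_le_mul_of_nonneg_right h2 h4]

theorem com_rep (hNA : ∀ p, IsCStarNorm (NA p)) (hNB : ∀ p, IsCStarNorm (NB p)) (hX : IsTensorCompletion (osProjNorm NA NB) X ι)
    (π1 : A →⋆ₙₐ[ℂ] (H →L[ℂ] H)) (π2 : B →⋆ₙₐ[ℂ] (H →L[ℂ] H)) :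
    ∃ g : X →L[ℂ] (H →L[ℂ] H), ∀ a b, g (ι (a ⊗ₜ b)) = π1 a * π2 b := by
  obtain ⟨g, hg, -⟩ := ext_lin hX (TensorProduct.lift ((LinearMap.mul ℂ (H →L[ℂ] H)).compl₁₂ (lin π1) (lin π2))) (C := 2) (by positivity)
    (fun {p q} α v w β => by
      have hv := NA_nonneg hNA v
      have hw := NA_nonneg hNB w
      refine op_le_of_unit _ (by positivity) fun ζ ζ' hζ hζ' => ?_
      obtain ⟨K, _, _, _, S, -, hS⟩ := exists_hilb (V := A) (fun x y => inner ℂ (π1 (star y) ζ) (π1 (star x) ζ))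
        (fun x y => inner_conj_symm _ _) (fun x => by
          exact inner_self_nonneg (𝕜 := ℂ))
        (fun x y z => by rw [star_add, map_add, ContinuousLinearMap.add_apply, inner_add_right])
        (fun x y r => by rw [star_smul, map_smul, ContinuousLinearMap.smul_apply, inner_smul_right]; rfl)
      have hn : ∀ a, ‖S a‖ = ‖π1 (star a) ζ‖ := fun a => by
        have := hS a a
        rw [inner_self_eq_norm_sq_to_K, inner_self_eq_norm_sq_to_K] at this
        have h2 : ‖S a‖ ^ 2 = ‖π1 (star a) ζ‖ ^ 2 := by exact_mod_cast this
        exact (pow_left_inj₀ (norm_nonneg _) (norm_nonneg _) (by norm_num)).1 h2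
      let R : B →ₗ[ℂ] H := { toFun := fun b => π2 b ζ', map_add' := by simp, map_smul' := by simp }
      let Φ : (H →L[ℂ] H) →ₗ[ℂ] ℂ := (innerSL ℂ ζ).toLinearMap.comp (ContinuousLinearMap.apply ℂ H ζ').toLinearMap
      have hSr : RowP S := fun n x => by
        simp only [hn]
        simpa using sum_norm_sq_le π1 (fun j => star (x j)) ζ hζ
      have hRc : ColP R := fun n x => sum_norm_sq_le π2 x ζ' hζ'
      have h := form_bound hNA hNB hSr (S2 := (0 : A →ₗ[ℂ] H)) (R1 := R) (R2 := (0 : B →ₗ[ℂ] H)) (fun n x => by simp) hRc (fun n x => by simp) zero_le_one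
        (((LinearMap.mul ℂ (H →L[ℂ] H)).compl₁₂ (lin π1) (lin π2)).compr₂ Φ) (fun a b => ?_) α v w β
      · rw [TensorProduct.lift_compr₂, mul_one] at h
        exact h
      · show ‖inner ℂ ζ ((π1 a * π2 b) ζ')‖ ≤ 1 * (‖S a‖ * ‖π2 b ζ'‖ + ‖(0 : H)‖ * ‖(0 : H)‖)
        rw [hn, ContinuousLinearMap.mul_apply, ← star_inner]
        simpa using norm_inner_le_norm (π1 (star a) ζ) (π2 b ζ'))
  exact ⟨g, fun a b => by rw [hg]; simp [lin_apply]⟩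

end main
end TP

namespace TP
open Filter Topology Matrix

section main
variable {A B : Type u} [NonUnitalCStarAlgebra A] [NonUnitalCStarAlgebra B]
variable {NA : ∀ p : ℕ, Matrix (Fin p) (Fin p) A → ℝ} {NB : ∀ q : ℕ, Matrix (Fin q) (Fin q) B → ℝ}
variable {X : Type u} [NonUnitalNormedRing X] [StarRing X] [NormedSpace ℂ X] [CompleteSpace X] [IsScalarTower ℂ X X] [SMulCommClass ℂ X X] {ι : A ⊗[ℂ] B →ₗ[ℂ] X}

theorem star_rep (hX : IsTensorCompletion (osProjNorm NA NB) X ι) {p q : ℕ} (α : Fin p × Fin q → ℂ) (v : Matrix (Fin p) (Fin p) A) (w : Matrix (Fin q) (Fin q) B) (β : Fin p × Fin q → ℂ) :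
    star (ι (rep α v w β)) = ι (rep (fun x => (starRingEnd ℂ) (β x)) vᴴ wᴴ (fun x => (starRingEnd ℂ) (α x))) := by
  unfold rep
  rw [Finset.sum_comm]
  simp only [map_sum, star_sum]
  refine Finset.sum_congr rfl fun i _ => Finset.sum_congr rfl fun j _ => ?_
  rw [TensorProduct.smul_tmul', hX.star_tmul, star_smul, ← TensorProduct.smul_tmul']
  simp [mul_comm]

theorem star_norm_le (hNA : ∀ p, IsCStarNorm (NA p)) (hNB : ∀ p, IsCStarNorm (NB p)) (hX : IsTensorCompletion (osProjNorm NA NB) X ι) (z : A ⊗[ℂ] B) :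
    ‖star (ι z)‖ ≤ ‖ι z‖ := by
  rw [hX.norm_eq z]
  obtain ⟨p, q, α, v, w, β, h⟩ := rep_exists z
  refine le_csInf ⟨_, p, q, α, v, w, β, h, rfl⟩ ?_
  rintro r ⟨p, q, α, v, w, β, h, rfl⟩
  have e : z = rep α v w β := h
  rw [e, star_rep hX, hX.norm_eq]
  refine (os_ge hNA hNB _ _ _ _).trans (le_of_eq ?_)
  rw [NA_star hNA, NA_star hNB]
  simp only [RCLike.norm_conj]
  ring

variable {H : Type u} [NormedAddCommGroup H] [InnerProductSpace ℂ H] [CompleteSpace H]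

/-- data: a bounded representation of `X` built from commuting representations. -/
structure CRep (ι : A ⊗[ℂ] B →ₗ[ℂ] X) (π1 : A →⋆ₙₐ[ℂ] (H →L[ℂ] H)) (π2 : B →⋆ₙₐ[ℂ] (H →L[ℂ] H)) (P : X →L[ℂ] (H →L[ℂ] H)) : Prop where
  eq : ∀ a b, P (ι (a ⊗ₜ b)) = π1 a * π2 b
  comm : ∀ a b, π1 a * π2 b = π2 b * π1 a
  nd : ∀ T : H →L[ℂ] H, (∀ a b, π1 a * π2 b * T = 0) → T = 0

variable {π1 : A →⋆ₙₐ[ℂ] (H →L[ℂ] H)} {π2 : B →⋆ₙₐ[ℂ] (H →L[ℂ] H)} {P : X →L[ℂ] (H →L[ℂ] H)}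

theorem CRep.mul (hP : CRep ι π1 π2 P) (hX : IsTensorCompletion (osProjNorm NA NB) X ι) (x y : X) : P (x * y) = P x * P y := by
  have h1 : ∀ a b, ∀ y, P (ι (a ⊗ₜ b) * y) = P (ι (a ⊗ₜ b)) * P y := by
    intro a b
    have := X_ext hX (f := P.comp (lm' (ι (a ⊗ₜ b)))) (g := (ContinuousLinearMap.mul ℂ (H →L[ℂ] H) (P (ι (a ⊗ₜ b)))).comp P) (fun c d => by
      show P (ι (a ⊗ₜ b) * ι (c ⊗ₜ d)) = P (ι (a ⊗ₜ b)) * P (ι (c ⊗ₜ d))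
      rw [hX.mul_tmul, hP.eq, hP.eq, hP.eq, map_mul, map_mul, mul_assoc, mul_assoc, ← mul_assoc (π1 c), hP.comm c b, mul_assoc])
    exact fun y => DFunLike.congr_fun this y
  have := X_ext hX (f := P.comp (rm' y)) (g := ((ContinuousLinearMap.mul ℂ (H →L[ℂ] H)).flip (P y)).comp P) (fun a b => h1 a b y)
  exact DFunLike.congr_fun this x

theorem CRep.starD (hP : CRep ι π1 π2 P) (hX : IsTensorCompletion (osProjNorm NA NB) X ι) (z : A ⊗[ℂ] B) : P (star (ι z)) = star (P (ι z)) := by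
  induction z using TensorProduct.induction_on with
  | zero => simp
  | tmul a b => rw [hX.star_tmul, hP.eq, hP.eq, star_mul, map_star, map_star, ← map_star, ← map_star, hP.comm]
  | add x y hx hy => rw [map_add, star_add, map_add, map_add, star_add, hx, hy]

theorem CRep.adj (hP : CRep ι π1 π2 P) (hNA : ∀ p, IsCStarNorm (NA p)) (hNB : ∀ p, IsCStarNorm (NB p)) (hX : IsTensorCompletion (osProjNorm NA NB) X ι) (w : X) :
    ∃ w', P w' = star (P w) := by
  obtain ⟨u, hu⟩ := mem_closure_iff_seq_limit.1 (hX.dense w)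
  obtain ⟨hu1, hu2⟩ := hu
  choose d hd using hu1
  have hc : CauchySeq (fun n => star (u n)) := by
    have h := hu2.cauchySeq
    rw [Metric.cauchySeq_iff] at h ⊢
    intro ε hε
    obtain ⟨N, hN⟩ := h ε hε
    refine ⟨N, fun m hm n hn => lt_of_le_of_lt ?_ (hN m hm n hn)⟩
    rw [dist_eq_norm, dist_eq_norm, ← star_sub, ← hd, ← hd, ← map_sub]
    exact star_norm_le hNA hNB hX _
  obtain ⟨w', hw'⟩ := cauchySeq_tendsto_of_complete hc
  refine ⟨w', tendsto_nhds_unique ((P.continuous.tendsto _).comp hw') ?_⟩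
  have : (⇑P ∘ fun n => star (u n)) = fun n => star (P (u n)) := by
    funext n
    show P (star (u n)) = _
    rw [← hd, hP.starD hX]
  rw [this]
  exact (continuous_star.tendsto _).comp ((P.continuous.tendsto _).comp hu2)

end main
end TP

namespace TP
open Filter Topology Matrix

theorem spec_le {X C : Type*} [NonUnitalNormedRing X] [NormedSpace ℂ X] [CompleteSpace X] [IsScalarTower ℂ X X] [SMulCommClass ℂ X X]
    [NormedRing C] [NormedAlgebra ℂ C] [CompleteSpace C] (Ψ : X →ₙₐ[ℂ] C) (x : X) : spectralRadius ℂ (Ψ x) ≤ ‖x‖₊ := by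
  have h1 : spectrum ℂ (Ψ x) ⊆ spectrum ℂ (WithLp.toLp 1 (x : Unitization ℂ X)) := by
    have := AlgHom.spectrum_apply_subset ((Unitization.lift Ψ).comp (WithLp.unitizationAlgEquiv (𝕜 := ℂ) (A := X) ℂ).toAlgHom) (WithLp.toLp 1 (x : Unitization ℂ X))
    simpa using this
  unfold spectralRadius
  refine iSup₂_le fun k hk => ?_
  have := spectrum.norm_le_norm_mul_of_mem (h1 hk)
  rw [WithLp.unitization_norm_inr, WithLp.unitization_norm_def] at this
  have e1 : (WithLp.ofLp (1 : WithLp 1 (Unitization ℂ X))) = 1 := rfl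
  rw [e1] at this
  simp at this
  exact_mod_cast this

theorem gelf_small {C : Type*} [NormedRing C] [NormedAlgebra ℂ C] [CompleteSpace C] (a : C) {M : ℝ} (hM0 : 0 < M)
    (h : spectralRadius ℂ a < ENNReal.ofReal M) : ∃ k : ℕ, ‖a ^ (2 ^ k)‖ < M ^ (2 ^ k) := by
  have h1 := spectrum.pow_nnnorm_pow_one_div_tendsto_nhds_spectralRadius a
  have h2 : Tendsto (fun k : ℕ => 2 ^ k) atTop (atTop : Filter ℕ) := tendsto_pow_atTop_atTop_of_one_lt (by norm_num)
  obtain ⟨k, hk⟩ := ((h1.comp h2).eventually (gt_mem_nhds h)).exists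
  refine ⟨k, ?_⟩
  simp only [Function.comp] at hk
  rw [← ENNReal.ofReal_coe_nnreal, ENNReal.ofReal_rpow_of_nonneg (by positivity) (by positivity), ENNReal.ofReal_lt_ofReal_iff hM0] at hk
  have h3 := pow_lt_pow_left₀ hk (by positivity) (n := 2 ^ k) (by positivity)
  rw [← Real.rpow_natCast, ← Real.rpow_mul (by positivity)] at h3
  simpa using h3

theorem unif_gelf {C : Type*} [NormedRing C] [NormedAlgebra ℂ C] [CompleteSpace C] (p : ℂ → C) (hp : Continuous p) (K : Set ℂ) (hK : IsCompact K)
    {M : ℝ} (hM0 : 0 < M) (h : ∀ z ∈ K, spectralRadius ℂ (p z) < ENNReal.ofReal M) : ∃ k : ℕ, ∀ z ∈ K, ‖p z ^ (2 ^ k)‖ ≤ M ^ (2 ^ k) := by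
  have hmono : ∀ k z, ‖p z ^ (2 ^ k)‖ < M ^ (2 ^ k) → ‖p z ^ (2 ^ (k+1))‖ < M ^ (2 ^ (k+1)) := by
    intro k z hz
    rw [pow_succ, pow_mul, pow_mul, sq, sq]
    exact (norm_mul_le _ _).trans_lt (mul_lt_mul'' hz hz (norm_nonneg _) (norm_nonneg _))
  have hm : Monotone (fun k : ℕ => {z | ‖p z ^ (2 ^ k)‖ < M ^ (2 ^ k)}) := monotone_nat_of_le_succ fun k z hz => hmono k z hz
  obtain ⟨k, hk⟩ := hK.elim_directed_cover (fun k : ℕ => {z | ‖p z ^ (2 ^ k)‖ < M ^ (2 ^ k)}) (fun k => isOpen_lt (by fun_prop) continuous_const)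
    (fun z hz => by
      obtain ⟨k, hk⟩ := gelf_small (p z) hM0 (h z hz)
      exact Set.mem_iUnion.2 ⟨k, hk⟩) hm.directed_le
  exact ⟨k, fun z hz => (hk hz).le⟩

theorem ransford_step {C : Type*} [CStarAlgebra C] (U V : C) (hU : IsSelfAdjoint U) {R M m : ℝ} (hR : 1 < R) (hM : 0 < M) (hm : 0 ≤ m)
    (h1 : ∀ z : ℂ, ‖z‖ = R → spectralRadius ℂ (z • V + (U - V)) < ENNReal.ofReal M)
    (h2 : ∀ z : ℂ, ‖z‖ = R⁻¹ → ‖z • V + (U - V)‖ ≤ m) : ‖U‖ ^ 2 ≤ M * m := by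
  set p : ℂ → C := fun z => z • V + (U - V) with hp
  have hR0 : 0 < R := by linarith
  have hpc : Differentiable ℂ p := by intro z; simp only [hp]; fun_prop
  obtain ⟨k, hk⟩ := unif_gelf p hpc.continuous (Metric.sphere 0 R) (isCompact_sphere _ _) hM (fun z hz => h1 z (by simpa using hz))
  have hk' : ∀ z : ℂ, ‖z‖ = R → ‖p z ^ (2 ^ k)‖ ≤ M ^ (2 ^ k) := fun z hz => hk z (by simpa using hz)
  have h2' : ∀ z : ℂ, ‖z‖ = R⁻¹ → ‖p z ^ (2 ^ k)‖ ≤ m ^ (2 ^ k) := fun z hz =>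
    (norm_pow_le' _ (by positivity)).trans (pow_le_pow_left₀ (norm_nonneg _) (h2 z hz) _)
  set S : Set ℂ := {z | R⁻¹ < ‖z‖ ∧ ‖z‖ < R} with hS
  have hSo : IsOpen S := (isOpen_lt continuous_const continuous_norm).inter (isOpen_lt continuous_norm continuous_const)
  have hcl : closure S ⊆ {z | R⁻¹ ≤ ‖z‖ ∧ ‖z‖ ≤ R} := closure_minimal (fun z hz => ⟨hz.1.le, hz.2.le⟩)
    ((isClosed_le continuous_const continuous_norm).inter (isClosed_le continuous_norm continuous_const))
  have hRi : R⁻¹ < 1 := inv_lt_one_of_one_lt₀ hR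
  have key := Complex.norm_le_of_forall_mem_frontier_norm_le (f := fun z => p z ^ (2 ^ k) * p z⁻¹ ^ (2 ^ k)) (U := S) (C := M ^ (2 ^ k) * m ^ (2 ^ k)) (z := 1)
    (Metric.isBounded_ball.subset (fun z hz => by simpa using hz.2 : S ⊆ Metric.ball 0 R))
    (DifferentiableOn.diffContOnCl (fun z hz => by
      have hz0 : z ≠ 0 := by
        have := (hcl hz).1
        rw [← norm_pos_iff]; exact lt_of_lt_of_le (by positivity) this
      apply DifferentiableAt.differentiableWithinAt
      have e1 : DifferentiableAt ℂ (fun z : ℂ => p z⁻¹) z := (hpc _).comp z (differentiableAt_inv hz0)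
      exact ((hpc z).pow _).mul (e1.pow _)))
    (fun z hz => by
      have hz1 := hcl (frontier_subset_closure hz)
      have hz2 : z ∉ S := by
        intro h; rw [hSo.frontier_eq] at hz; exact hz.2 h
      have : ‖z‖ = R⁻¹ ∨ ‖z‖ = R := by
        by_contra hcon
        push Not at hcon
        exact hz2 ⟨lt_of_le_of_ne hz1.1 (Ne.symm hcon.1), lt_of_le_of_ne hz1.2 hcon.2⟩
      rcases this with h | h
      · have h' : ‖z⁻¹‖ = R := by rw [norm_inv, h, inv_inv]
        rw [mul_comm (M ^ _)]
        exact (norm_mul_le _ _).trans (mul_le_mul (h2' _ h) (hk' _ h') (norm_nonneg _) (by positivity))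
      · have h' : ‖z⁻¹‖ = R⁻¹ := by rw [norm_inv, h]
        exact (norm_mul_le _ _).trans (mul_le_mul (hk' _ h) (h2' _ h') (norm_nonneg _) (by positivity)))
    (subset_closure ⟨by simpa using hRi, by simpa using hR⟩)
  have e : p 1 = U := by simp [hp]
  simp only [inv_one, e] at key
  rw [← pow_add, ← two_mul, ← pow_succ'] at key
  have e2 := hU.nnnorm_pow_two_pow (k+1)
  have e3 : ‖U ^ 2 ^ (k+1)‖ = ‖U‖ ^ 2 ^ (k+1) := by
    have := congrArg NNReal.toReal e2
    simpa only [NNReal.coe_pow, coe_nnnorm] using this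
  rw [e3, ← mul_pow, pow_succ', pow_mul] at key
  exact (pow_le_pow_iff_left₀ (by positivity) (by positivity) (by positivity)).1 key

theorem ransford {X C : Type*} [NonUnitalNormedRing X] [NormedSpace ℂ X] [CompleteSpace X] [IsScalarTower ℂ X X] [SMulCommClass ℂ X X]
    [CStarAlgebra C] (Ψ : X →ₙₐ[ℂ] C) (U : C) (hU : IsSelfAdjoint U) (y : X) (hy : Ψ y = U)
    (ha : ∀ ε > 0, ∃ a, ‖a‖ ≤ ε ∧ ‖Ψ a - U‖ ≤ ε) : U = 0 := by
  have key : ∀ R : ℝ, 1 < R → ‖U‖ ^ 2 ≤ (4 + ‖y‖) * ((‖U‖ + 2) * R⁻¹) := by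
    intro R hR
    have hR0 : 0 < R := by linarith
    have hRi : R⁻¹ < 1 := inv_lt_one_of_one_lt₀ hR
    have hRi0 : 0 < R⁻¹ := by positivity
    obtain ⟨a, ha1, ha2⟩ := ha (R⁻¹ ^ 2) (by positivity)
    have hRR : R * R⁻¹ ^ 2 = R⁻¹ := by field_simp
    have hR2 : R⁻¹ ^ 2 ≤ R⁻¹ := by nlinarith
    refine ransford_step U (Ψ a) hU hR (by positivity) (by positivity) ?_ ?_
    · intro z hz
      have e : z • Ψ a + (U - Ψ a) = Ψ (z • a + (y - a)) := by simp [hy]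
      rw [e]
      refine (spec_le Ψ _).trans_lt ?_
      rw [← ENNReal.ofReal_coe_nnreal, ENNReal.ofReal_lt_ofReal_iff (by positivity)]
      simp only [coe_nnnorm]
      have := norm_add_le (z • a) (y - a)
      have := norm_sub_le y a
      have h3 : ‖z • a‖ ≤ R⁻¹ := by
        rw [norm_smul, hz, ← hRR]; gcongr
      linarith
    · intro z hz
      have h3 : ‖z • Ψ a‖ ≤ R⁻¹ * (‖U‖ + 1) := by
        rw [norm_smul, hz]
        gcongr
        have : Ψ a = U + (Ψ a - U) := by abel
        rw [this]
        refine (norm_add_le _ _).trans ?_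
        linarith
      have h4 : ‖U - Ψ a‖ ≤ R⁻¹ := by rw [norm_sub_rev]; linarith
      have := norm_add_le (z • Ψ a) (U - Ψ a)
      linarith
  have h0 : ‖U‖ ^ 2 ≤ 0 := by
    have ht : Tendsto (fun R : ℝ => (4 + ‖y‖) * ((‖U‖ + 2) * R⁻¹)) atTop (𝓝 0) := by
      simpa using (tendsto_inv_atTop_zero.const_mul (‖U‖ + 2)).const_mul (4 + ‖y‖)
    exact ge_of_tendsto ht ((eventually_gt_atTop 1).mono key)
  have : ‖U‖ = 0 := by nlinarith [norm_nonneg U]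
  simpa using this

section main
variable {A B : Type u} [NonUnitalCStarAlgebra A] [NonUnitalCStarAlgebra B]
variable {NA : ∀ p : ℕ, Matrix (Fin p) (Fin p) A → ℝ} {NB : ∀ q : ℕ, Matrix (Fin q) (Fin q) B → ℝ}
variable {X : Type u} [NonUnitalNormedRing X] [StarRing X] [NormedSpace ℂ X] [CompleteSpace X] [IsScalarTower ℂ X X] [SMulCommClass ℂ X X] {ι : A ⊗[ℂ] B →ₗ[ℂ] X}
variable {H : Type u} [NormedAddCommGroup H] [InnerProductSpace ℂ H] [CompleteSpace H]
variable {π1 : A →⋆ₙₐ[ℂ] (H →L[ℂ] H)} {π2 : B →⋆ₙₐ[ℂ] (H →L[ℂ] H)} {P : X →L[ℂ] (H →L[ℂ] H)}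

theorem CRep.smul' (hP : CRep ι π1 π2 P) (hX : IsTensorCompletion (osProjNorm NA NB) X ι) (c : ℂ) (x : X) :
    star (P (star (c • x))) = c • star (P (star x)) := by
  rw [← sub_eq_zero]
  apply hP.nd
  intro a b
  have e0 : ∀ z, P (ι z) = star (P (star (ι z))) := fun z => by rw [hP.starD hX, star_star]
  have e1 : ∀ z y, P (ι z) * star (P (star y)) = star (P (star (ι z * y))) := by
    intro z y
    rw [star_mul, hP.mul hX, star_mul, ← e0]
  rw [← hP.eq, mul_sub, sub_eq_zero, e1, mul_smul_comm, mul_smul_comm, ← smul_mul_assoc c (ι _), ← map_smul, ← e1, map_smul, map_smul, smul_mul_assoc]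

/-- the conjugate homomorphism. -/
def CRep.psi (hP : CRep ι π1 π2 P) (hX : IsTensorCompletion (osProjNorm NA NB) X ι) : X →ₙₐ[ℂ] (H →L[ℂ] H) where
  toFun x := star (P (star x))
  map_smul' c x := hP.smul' hX c x
  map_zero' := by simp
  map_add' x y := by simp
  map_mul' x y := by rw [star_mul, hP.mul hX, star_mul]

theorem CRep.star (hP : CRep ι π1 π2 P) (hNA : ∀ p, IsCStarNorm (NA p)) (hNB : ∀ p, IsCStarNorm (NB p)) (hX : IsTensorCompletion (osProjNorm NA NB) X ι) (x : X) :
    P (star x) = star (P x) := by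
  set Ψ := hP.psi hX with hΨ
  have hΨa : ∀ x, Ψ x = Star.star (P (Star.star x)) := fun _ => rfl
  have hD : ∀ z, Ψ (ι z) = P (ι z) := fun z => by rw [hΨa, hP.starD hX, star_star]
  have hPs : ∀ w, ∃ w', P w' = Ψ w := fun w => hP.adj hNA hNB hX _
  obtain ⟨s1, hs1⟩ := hPs x
  set T := P (s1 - x) with hT
  obtain ⟨s', hs'⟩ := hP.adj hNA hNB hX (s1 - x)
  obtain ⟨w, hw⟩ := hP.adj hNA hNB hX (s' * (s1 - x))
  have hU0 : Star.star T * T = 0 := by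
    refine ransford Ψ _ (IsSelfAdjoint.star_mul_self T) (Star.star w) ?_ ?_
    · rw [hΨa, star_star, hw, star_star, hP.mul hX, hs']
    · intro ε hε
      have hPb : 0 ≤ ‖P‖ := norm_nonneg _
      -- choose `d` near `s'`
      set δ1 := ε / (2 * (‖T‖ + 1)) with hδ1
      have hdpos : 0 < δ1 := by positivity
      obtain ⟨d, hd⟩ := hX.dense.exists_dist_lt s' (ε := δ1 / (‖P‖ + 1)) (by positivity)
      set δ2 := ε / (2 * (‖ι d‖ + 1) * (‖P‖ + 1) * (‖P‖ + 1)) with hδ2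
      have hepos : 0 < δ2 := by positivity
      obtain ⟨e, he⟩ := hX.dense.exists_dist_lt x (ε := δ2) hepos
      rw [dist_eq_norm] at hd he
      have hedef : 2 * (‖ι d‖ + 1) * (‖P‖ + 1) * (‖P‖ + 1) * δ2 = ε := by rw [hδ2]; field_simp
      have hb1 : ‖ι d‖ * δ2 * (‖P‖ * ‖P‖) ≤ ε / 2 := by
        rw [← hedef]
        have : ‖ι d‖ * (‖P‖ * ‖P‖) ≤ (‖ι d‖ + 1) * ((‖P‖ + 1) * (‖P‖ + 1)) := by gcongr <;> linarith
        nlinarith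
      refine ⟨ι d * (x - ι e), ?_, ?_⟩
      · refine (norm_mul_le _ _).trans ?_
        have h1 : ‖ι d‖ * ‖x - ι e‖ ≤ ‖ι d‖ * δ2 := by gcongr
        refine h1.trans ?_
        rw [← hedef]
        have h2 : (1:ℝ) ≤ (‖P‖ + 1) * (‖P‖ + 1) := by nlinarith
        have h3 : ‖ι d‖ ≤ 2 * (‖ι d‖ + 1) := by linarith [norm_nonneg (ι d)]
        have h4 : ‖ι d‖ ≤ 2 * (‖ι d‖ + 1) * ((‖P‖ + 1) * (‖P‖ + 1)) := by nlinarith [norm_nonneg (ι d)]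
        nlinarith
      · have hTe : T = Ψ x - P x := by rw [hT, map_sub, hs1]
        have e1 : Ψ (ι d * (x - ι e)) - Star.star T * T = P (ι d - s') * T + P (ι d) * P (x - ι e) := by
          rw [map_mul, map_sub, hD, hD, map_sub P (ι d), map_sub P x, sub_mul, hs', hTe]
          rw [← hT, hTe]
          simp only [mul_sub, sub_mul]
          abel
        rw [e1]
        have b1 : ‖P (ι d - s') * T‖ ≤ ε / 2 := by
          refine (norm_mul_le _ _).trans ?_
          have : ‖P (ι d - s')‖ ≤ δ1 := by
            refine (P.le_opNorm _).trans ?_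
            rw [norm_sub_rev]
            have : (‖P‖ + 1) * (δ1 / (‖P‖ + 1)) = δ1 := by field_simp
            rw [← this]
            gcongr
            linarith
          have h5 : ‖P (ι d - s')‖ * ‖T‖ ≤ δ1 * (‖T‖ + 1) := by gcongr; linarith
          have h6 : δ1 * (‖T‖ + 1) = ε / 2 := by rw [hδ1]; field_simp
          linarith
        have b2 : ‖P (ι d) * P (x - ι e)‖ ≤ ε / 2 := by
          refine (norm_mul_le _ _).trans ?_
          have h1 := P.le_opNorm (ι d)
          have h2 : ‖P (x - ι e)‖ ≤ ‖P‖ * δ2 := (P.le_opNorm _).trans (by gcongr)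
          calc _ ≤ (‖P‖ * ‖ι d‖) * (‖P‖ * δ2) := by gcongr
            _ = ‖ι d‖ * δ2 * (‖P‖ * ‖P‖) := by ring
            _ ≤ _ := hb1
        have := norm_add_le (P (ι d - s') * T) (P (ι d) * P (x - ι e))
        linarith
  have hT0 : T = 0 := by
    have := CStarRing.norm_star_mul_self (x := T)
    rw [hU0, norm_zero] at this
    have : ‖T‖ = 0 := by nlinarith
    simpa using this
  have : Ψ x = P x := by
    rw [← hs1, ← sub_eq_zero, ← map_sub]; exact hT0
  rw [← this, hΨa, star_star]

end main
end TP

namespace TP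
open Filter Topology Matrix

section schur
variable {A : Type*} [NonUnitalNormedRing A] [StarRing A] [NormedSpace ℂ A]
variable {H : Type*} [NormedAddCommGroup H] [InnerProductSpace ℂ H] [CompleteSpace H]

/-- irreducibility of a representation. -/
def Irr (π : A →⋆ₙₐ[ℂ] (H →L[ℂ] H)) : Prop :=
  (∃ y, π y ≠ 0) ∧ ∀ S : Submodule ℂ H, IsClosed (S : Set H) → (∀ y : A, ∀ v ∈ S, π y v ∈ S) → S = ⊥ ∨ S = ⊤

theorem Irr.ran {π : A →⋆ₙₐ[ℂ] (H →L[ℂ] H)} (h : Irr π) (S : Submodule ℂ H) (hS : IsClosed (S : Set H)) (hr : ∀ a v, π a v ∈ S) : S = ⊤ := by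
  rcases h.2 S hS (fun a v _ => hr a v) with h1 | h1
  · exfalso
    obtain ⟨y, hy⟩ := h.1
    apply hy
    ext v
    have := hr y v
    rw [h1] at this
    simpa using this
  · exact h1

theorem Irr.ker {π : A →⋆ₙₐ[ℂ] (H →L[ℂ] H)} (h : Irr π) (T : H →L[ℂ] H) (hT : ∀ a, T * π a = π a * T) : T = 0 ∨ ∀ v, T v = 0 → v = 0 := by
  rcases h.2 (LinearMap.ker T.toLinearMap) T.isClosed_ker (fun a v hv => by
    have := DFunLike.congr_fun (hT a) v
    simp only [ContinuousLinearMap.mul_apply] at this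
    have hv' : T v = 0 := hv
    show T (π a v) = 0
    rw [this, hv', map_zero]) with h1 | h1
  · right
    intro v hv
    have : v ∈ LinearMap.ker T.toLinearMap := hv
    rw [h1] at this
    simpa using this
  · left
    ext v
    have : v ∈ LinearMap.ker T.toLinearMap := by rw [h1]; trivial
    exact this

theorem Irr.schur_sa {π : A →⋆ₙₐ[ℂ] (H →L[ℂ] H)} (h : Irr π) (T : H →L[ℂ] H) (hs : IsSelfAdjoint T) (hT : ∀ a, T * π a = π a * T) : ∃ c : ℂ, T = c • 1 := by
  have hsub : (spectrum ℝ T).Subsingleton := by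
    by_contra hcon
    rw [Set.not_subsingleton_iff] at hcon
    obtain ⟨x, hx, y, hy, hxy⟩ := hcon.exists_lt
    set m := (x + y) / 2
    set f : ℝ → ℝ := fun t => max (t - m) 0
    set g : ℝ → ℝ := fun t => max (m - t) 0
    have hf : Continuous f := by fun_prop
    have hg : Continuous g := by fun_prop
    have hcf : ∀ a, cfc f T * π a = π a * cfc f T := fun a => (Commute.cfc_real (show Commute T (π a) from hT a) f)
    have hfg : cfc f T * cfc g T = 0 := by
      rw [← cfc_mul f g T hf.continuousOn hg.continuousOn, ← cfc_zero ℝ T]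
      apply cfc_congr
      intro t _
      simp only [f, g, Pi.zero_apply]
      rcases le_total t m with h | h
      · rw [max_eq_right (a := t - m) (by linarith)]; simp
      · rw [max_eq_right (a := m - t) (by linarith)]; simp
    have nz : ∀ f : ℝ → ℝ, Continuous f → ∀ t ∈ spectrum ℝ T, cfc f T = 0 → f t = 0 := by
      intro f hf t ht h0
      have : cfc f T = cfc (0 : ℝ → ℝ) T := by rw [h0, cfc_zero]
      exact (cfc_eq_cfc_iff_eqOn (R := ℝ) (a := T) (hf := hf.continuousOn) (hg := continuousOn_const)).1 this ht
    rcases h.ker _ hcf with h1 | h1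
    · have := nz f hf y hy h1
      simp only [f, max_eq_right_iff, m] at this
      linarith
    · have h2 : cfc g T = 0 := by
        ext v
        exact h1 _ (DFunLike.congr_fun hfg v)
      have := nz g hg x hx h2
      simp only [g, max_eq_right_iff, m] at this
      linarith
  rcases hsub.eq_empty_or_singleton with h1 | ⟨c, h1⟩
  · refine ⟨0, ?_⟩
    have : cfc (id : ℝ → ℝ) T = cfc (0 : ℝ → ℝ) T := cfc_congr (by rw [h1]; intro t ht; exact ht.elim)
    rw [cfc_id ℝ T hs, cfc_zero ℝ T] at this
    rw [this, zero_smul]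
  · refine ⟨c, ?_⟩
    have : cfc (id : ℝ → ℝ) T = cfc (fun _ : ℝ => c) T := cfc_congr (by rw [h1]; intro t ht; simpa using ht)
    rw [cfc_id ℝ T hs, cfc_const _ _ hs, Algebra.algebraMap_eq_smul_one] at this
    nth_rw 1 [this]
    rfl

theorem Irr.schur {π : A →⋆ₙₐ[ℂ] (H →L[ℂ] H)} (h : Irr π) (T : H →L[ℂ] H) (hT : ∀ a, T * π a = π a * T) : ∃ c : ℂ, T = c • 1 := by
  have hT' : ∀ a, star T * π a = π a * star T := by
    intro a
    have := congrArg star (hT (star a))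
    rw [star_mul, star_mul, map_star, star_star] at this
    exact this.symm
  obtain ⟨c, hc⟩ := h.schur_sa (realPart T : H →L[ℂ] H) (realPart T).2 (fun a => by
    rw [realPart_apply_coe, smul_mul_assoc, mul_smul_comm, add_mul, mul_add, hT, hT'])
  obtain ⟨d, hd⟩ := h.schur_sa (imaginaryPart T : H →L[ℂ] H) (imaginaryPart T).2 (fun a => by
    rw [imaginaryPart_apply_coe]
    simp only [smul_mul_assoc, mul_smul_comm, sub_mul, mul_sub, hT, hT'])
  refine ⟨c + Complex.I * d, ?_⟩
  conv_lhs => rw [← realPart_add_I_smul_imaginaryPart T, hc, hd]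
  rw [add_smul, mul_smul]

end schur

section ht
variable {H1 H2 : Type u} [NormedAddCommGroup H1] [InnerProductSpace ℂ H1] [NormedAddCommGroup H2] [InnerProductSpace ℂ H2]

/-- Hilbert tensor product. -/
abbrev HT (H1 H2 : Type u) [NormedAddCommGroup H1] [InnerProductSpace ℂ H1] [NormedAddCommGroup H2] [InnerProductSpace ℂ H2] : Type u :=
  UniformSpace.Completion (H1 ⊗[ℂ] H2)

/-- elementary tensors. -/
def tt (ξ : H1) (η : H2) : HT H1 H2 := ((ξ ⊗ₜ[ℂ] η : H1 ⊗[ℂ] H2) : UniformSpace.Completion (H1 ⊗[ℂ] H2))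

/-- bilinear version. -/
def ttL : H1 →L[ℂ] H2 →L[ℂ] HT H1 H2 :=
  (ContinuousLinearMap.compL ℂ H2 (H1 ⊗[ℂ] H2) (HT H1 H2) UniformSpace.Completion.toComplL).comp (TensorProduct.mkL ℂ H1 H2)

theorem ttL_apply (ξ : H1) (η : H2) : ttL ξ η = tt ξ η := rfl

theorem tt_inner (ξ ξ' : H1) (η η' : H2) : inner ℂ (tt ξ η) (tt ξ' η') = inner ℂ ξ ξ' * inner ℂ η η' := by
  unfold tt
  rw [UniformSpace.Completion.inner_coe, TensorProduct.inner_tmul]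

theorem ht_ind (S : Submodule ℂ (HT H1 H2)) (hS : IsClosed (S : Set (HT H1 H2))) (h : ∀ ξ η, tt ξ η ∈ S) : S = ⊤ := by
  rw [eq_top_iff]
  rintro x -
  induction x using UniformSpace.Completion.induction_on with
  | hp => exact hS
  | ih a =>
    induction a using TensorProduct.induction_on with
    | zero => rw [UniformSpace.Completion.coe_zero]; exact S.zero_mem
    | tmul ξ η => exact h ξ η
    | add x y hx hy => rw [UniformSpace.Completion.coe_add]; exact S.add_mem hx hy

theorem ht_ext {E : Type*} [NormedAddCommGroup E] [NormedSpace ℂ E] {f g : HT H1 H2 →L[ℂ] E} (h : ∀ ξ η, f (tt ξ η) = g (tt ξ η)) : f = g := by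
  have := ht_ind (LinearMap.ker (f - g).toLinearMap) (f - g).isClosed_ker (fun ξ η => by
    show (f - g) (tt ξ η) = 0
    simp [h])
  ext x
  have hx : x ∈ LinearMap.ker (f - g).toLinearMap := by rw [this]; trivial
  have hx' : (f - g) x = 0 := hx
  simpa [sub_eq_zero] using hx'

theorem ht_vext {v w : HT H1 H2} (h : ∀ ξ η, inner ℂ (tt ξ η) v = inner ℂ (tt ξ η) w) : v = w := by
  have : innerSL ℂ v = innerSL ℂ w := ht_ext (fun ξ η => by
    simp only [innerSL_apply_apply]
    rw [← inner_conj_symm, h, inner_conj_symm])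
  exact ext_inner_right ℂ fun x => DFunLike.congr_fun this x

theorem ht_opext {S T : HT H1 H2 →L[ℂ] HT H1 H2} (h : ∀ ξ η ξ' η', inner ℂ (tt ξ η) (S (tt ξ' η')) = inner ℂ (tt ξ η) (T (tt ξ' η'))) : S = T :=
  ht_ext fun ξ η => ht_vext fun ξ' η' => h _ _ _ _

/-- extension of operators to the completion. -/
def ht_op (S : H1 ⊗[ℂ] H2 →L[ℂ] H1 ⊗[ℂ] H2) : HT H1 H2 →L[ℂ] HT H1 H2 :=
  (UniformSpace.Completion.toComplL.comp S).extend (UniformSpace.Completion.toComplL : H1 ⊗[ℂ] H2 →L[ℂ] HT H1 H2)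

theorem ht_op_coe (S : H1 ⊗[ℂ] H2 →L[ℂ] H1 ⊗[ℂ] H2) (x : H1 ⊗[ℂ] H2) : ht_op S (x : HT H1 H2) = ((S x : H1 ⊗[ℂ] H2) : HT H1 H2) :=
  ContinuousLinearMap.extend_eq _ UniformSpace.Completion.denseRange_coe (UniformSpace.Completion.isUniformInducing_coe _) x

variable [CompleteSpace H1] [CompleteSpace H2]

theorem amp1_exists : ∃ L : (H1 →L[ℂ] H1) →⋆ₙₐ[ℂ] (HT H1 H2 →L[ℂ] HT H1 H2), ∀ T ξ η, L T (tt ξ η) = tt (T ξ) η := by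
  have hop : ∀ T : H1 →L[ℂ] H1, ∀ ξ η, ht_op (T.rTensor H2) (tt ξ η) = tt (T ξ) η := by
    intro T ξ η
    unfold tt
    rw [ht_op_coe]; rfl
  refine ⟨{ toFun := fun T => ht_op (T.rTensor H2), map_smul' := ?_, map_zero' := ?_, map_add' := ?_, map_mul' := ?_, map_star' := ?_ }, hop⟩
  · intro c T; refine ht_ext fun ξ η => ?_
    rw [hop]
    show tt (c • T ξ) η = c • ht_op (T.rTensor H2) (tt ξ η)
    rw [hop, ← ttL_apply, map_smul]; rfl
  · refine ht_ext fun ξ η => ?_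
    rw [hop, ← ttL_apply]; simp
  · intro S T; refine ht_ext fun ξ η => ?_
    show _ = ht_op (S.rTensor H2) (tt ξ η) + ht_op (T.rTensor H2) (tt ξ η)
    rw [hop, hop, hop, ← ttL_apply, ContinuousLinearMap.add_apply, map_add]; rfl
  · intro S T; refine ht_ext fun ξ η => ?_
    show _ = ht_op (S.rTensor H2) (ht_op (T.rTensor H2) (tt ξ η))
    rw [hop, hop, hop]; rfl
  · intro T; refine ht_opext fun ξ η ξ' η' => ?_
    rw [hop, ContinuousLinearMap.star_eq_adjoint, ContinuousLinearMap.star_eq_adjoint, ContinuousLinearMap.adjoint_inner_right, hop, tt_inner, tt_inner, ContinuousLinearMap.adjoint_inner_right]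

theorem amp2_exists : ∃ L : (H2 →L[ℂ] H2) →⋆ₙₐ[ℂ] (HT H1 H2 →L[ℂ] HT H1 H2), ∀ T ξ η, L T (tt ξ η) = tt ξ (T η) := by
  have hop : ∀ T : H2 →L[ℂ] H2, ∀ ξ η, ht_op (T.lTensor H1) (tt ξ η) = tt ξ (T η) := by
    intro T ξ η
    unfold tt
    rw [ht_op_coe]; rfl
  refine ⟨{ toFun := fun T => ht_op (T.lTensor H1), map_smul' := ?_, map_zero' := ?_, map_add' := ?_, map_mul' := ?_, map_star' := ?_ }, hop⟩
  · intro c T; refine ht_ext fun ξ η => ?_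
    rw [hop]
    show tt ξ (c • T η) = c • ht_op (T.lTensor H1) (tt ξ η)
    rw [hop, ← ttL_apply, map_smul]; rfl
  · refine ht_ext fun ξ η => ?_
    rw [hop, ← ttL_apply]; simp
  · intro S T; refine ht_ext fun ξ η => ?_
    show _ = ht_op (S.lTensor H1) (tt ξ η) + ht_op (T.lTensor H1) (tt ξ η)
    rw [hop, hop, hop, ← ttL_apply, ContinuousLinearMap.add_apply, map_add]; rfl
  · intro S T; refine ht_ext fun ξ η => ?_
    show _ = ht_op (S.lTensor H1) (ht_op (T.lTensor H1) (tt ξ η))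
    rw [hop, hop, hop]; rfl
  · intro T; refine ht_opext fun ξ η ξ' η' => ?_
    rw [hop, ContinuousLinearMap.star_eq_adjoint, ContinuousLinearMap.star_eq_adjoint, ContinuousLinearMap.adjoint_inner_right, hop, tt_inner, tt_inner, ContinuousLinearMap.adjoint_inner_right]

end ht
end TP

namespace TP
open Filter Topology Matrix

section gen
variable {A : Type*} [NonUnitalNormedRing A] [StarRing A] [NormedSpace ℂ A]
variable {H K : Type*} [NormedAddCommGroup H] [InnerProductSpace ℂ H] [CompleteSpace H] [NormedAddCommGroup K] [InnerProductSpace ℂ K] [CompleteSpace K]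

theorem slice_scalar {π : A →⋆ₙₐ[ℂ] (H →L[ℂ] H)} (h : Irr π) (ρ : A →⋆ₙₐ[ℂ] (K →L[ℂ] K)) (V V' : H →L[ℂ] K) (hV : ∀ a ξ, ρ a (V ξ) = V (π a ξ))
    (hV' : ∀ a ξ, ρ a (V' ξ) = V' (π a ξ)) (p : K →L[ℂ] K) (hp : ∀ a, p * ρ a = ρ a * p) : ∃ c : ℂ, ∀ ξ ξ', inner ℂ (V ξ) (p (V' ξ')) = c * inner ℂ ξ ξ' := by
  have si : ∀ a x y, inner ℂ (π (star a) x) y = inner ℂ x (π a y) := fun a x y => by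
    rw [map_star, ContinuousLinearMap.star_eq_adjoint, ContinuousLinearMap.adjoint_inner_left]
  have si' : ∀ a x y, inner ℂ (ρ (star a) x) y = inner ℂ x (ρ a y) := fun a x y => by
    rw [map_star, ContinuousLinearMap.star_eq_adjoint, ContinuousLinearMap.adjoint_inner_left]
  obtain ⟨c, hc⟩ := h.schur ((ContinuousLinearMap.adjoint V).comp (p.comp V')) (fun a => by
    ext1 ξ
    refine ext_inner_left ℂ fun ξ' => ?_
    simp only [ContinuousLinearMap.mul_apply, ContinuousLinearMap.comp_apply]
    rw [ContinuousLinearMap.adjoint_inner_right, ← hV']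
    have := DFunLike.congr_fun (hp a) (V' ξ)
    simp only [ContinuousLinearMap.mul_apply] at this
    rw [this, ← si, ← si', ContinuousLinearMap.adjoint_inner_right, hV])
  refine ⟨c, fun ξ ξ' => ?_⟩
  have h3 := congrArg (inner ℂ ξ) (DFunLike.congr_fun hc ξ')
  simp only [ContinuousLinearMap.comp_apply] at h3
  rw [ContinuousLinearMap.adjoint_inner_right] at h3
  rw [h3]
  simp

theorem proj_comm (ρ : A → (K →L[ℂ] K)) (hs : ∀ a, ρ (star a) = star (ρ a)) (S : Submodule ℂ K) [S.HasOrthogonalProjection] (hinv : ∀ a, ∀ v ∈ S, ρ a v ∈ S) (a : A) :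
    S.starProjection * ρ a = ρ a * S.starProjection := by
  have half : ∀ x, S.starProjection * ρ x * S.starProjection = ρ x * S.starProjection := by
    intro x
    ext1 v
    simp only [ContinuousLinearMap.mul_apply]
    exact Submodule.starProjection_eq_self_iff.2 (hinv x _ (Submodule.starProjection_apply_mem S v))
  have hs' : star S.starProjection = S.starProjection := isSelfAdjoint_starProjection S
  have h3 := congrArg star (half (star a))
  rw [star_mul, star_mul, star_mul, hs', hs, star_star] at h3
  rw [← h3, ← mul_assoc, half]

theorem scalar_proj (S : Submodule ℂ K) [S.HasOrthogonalProjection] (c : ℂ) (hp : ∀ v, S.starProjection v = c • v) : S = ⊥ ∨ S = ⊤ := by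
  by_cases h1 : c = 1
  · right
    rw [eq_top_iff]
    intro v _
    apply Submodule.starProjection_eq_self_iff.1
    rw [hp, h1, one_smul]
  · left
    rw [Submodule.eq_bot_iff]
    intro v hv
    have := Submodule.starProjection_eq_self_iff.2 hv
    rw [hp, ← sub_eq_zero] at this
    have h2 : (c - 1) • v = 0 := by rw [sub_smul, one_smul]; exact this
    exact (smul_eq_zero.1 h2).resolve_left (sub_ne_zero.2 h1)

end gen

section main
variable {A B : Type u} [NonUnitalCStarAlgebra A] [NonUnitalCStarAlgebra B]
variable {NA : ∀ p : ℕ, Matrix (Fin p) (Fin p) A → ℝ} {NB : ∀ q : ℕ, Matrix (Fin q) (Fin q) B → ℝ}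
variable {X : Type u} [NonUnitalNormedRing X] [StarRing X] [NormedSpace ℂ X] [CompleteSpace X] [IsScalarTower ℂ X X] [SMulCommClass ℂ X X] {ι : A ⊗[ℂ] B →ₗ[ℂ] X}
variable {H1 H2 : Type u} [NormedAddCommGroup H1] [InnerProductSpace ℂ H1] [CompleteSpace H1] [NormedAddCommGroup H2] [InnerProductSpace ℂ H2] [CompleteSpace H2]
variable {π1 : A →⋆ₙₐ[ℂ] (H1 →L[ℂ] H1)} {π2 : B →⋆ₙₐ[ℂ] (H2 →L[ℂ] H2)}

theorem tens_clm (hNA : ∀ p, IsCStarNorm (NA p)) (hNB : ∀ p, IsCStarNorm (NB p)) (hX : IsTensorCompletion (osProjNorm NA NB) X ι)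
    (π1 : A →⋆ₙₐ[ℂ] (H1 →L[ℂ] H1)) (π2 : B →⋆ₙₐ[ℂ] (H2 →L[ℂ] H2)) :
    ∃ (ρ1 : A →⋆ₙₐ[ℂ] (HT H1 H2 →L[ℂ] HT H1 H2)) (ρ2 : B →⋆ₙₐ[ℂ] (HT H1 H2 →L[ℂ] HT H1 H2)) (P : X →L[ℂ] (HT H1 H2 →L[ℂ] HT H1 H2)),
      (∀ a ξ η, ρ1 a (tt ξ η) = tt (π1 a ξ) η) ∧ (∀ b ξ η, ρ2 b (tt ξ η) = tt ξ (π2 b η)) ∧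
      (∀ a b, P (ι (a ⊗ₜ b)) = ρ1 a * ρ2 b) ∧ ∀ z, (P z = 0 ↔ Kil ι π1 π2 z) := by
  obtain ⟨L1, hL1⟩ := amp1_exists (H1 := H1) (H2 := H2)
  obtain ⟨L2, hL2⟩ := amp2_exists (H1 := H1) (H2 := H2)
  obtain ⟨P, hP⟩ := com_rep hNA hNB hX (L1.comp π1) (L2.comp π2)
  refine ⟨L1.comp π1, L2.comp π2, P, fun a ξ η => hL1 _ _ _, fun b ξ η => hL2 _ _ _, hP, fun z => ?_⟩
  have hg : ∀ ξ η ξ' η', ∃ g : X →L[ℂ] ℂ, (∀ z, g z = inner ℂ (tt ξ ξ') (P z (tt η η'))) ∧ (∀ a b, g (ι (a ⊗ₜ b)) = vf π1 ξ η a * vf π2 ξ' η' b) := by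
    intro ξ η ξ' η'
    refine ⟨(innerSL ℂ (tt ξ ξ')).comp ((ContinuousLinearMap.apply ℂ (HT H1 H2) (tt η η')).comp P), fun z => rfl, fun a b => ?_⟩
    show inner ℂ (tt ξ ξ') (P (ι (a ⊗ₜ b)) (tt η η')) = _
    rw [hP]
    show inner ℂ (tt ξ ξ') (L1 (π1 a) (L2 (π2 b) (tt η η'))) = _
    rw [hL2, hL1, tt_inner]
    rfl
  constructor
  · intro hz ξ η ξ' η' g hgz
    obtain ⟨g', h1, h2⟩ := hg ξ η ξ' η'
    have : g = g' := X_ext hX fun a b => by rw [hgz, h2]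
    rw [this, h1, hz]; simp
  · intro hz
    refine ht_opext fun ξ ξ' η η' => ?_
    obtain ⟨g', h1, h2⟩ := hg ξ η ξ' η'
    rw [← h1, hz _ _ _ _ g' h2]; simp

theorem tens_rep (hNA : ∀ p, IsCStarNorm (NA p)) (hNB : ∀ p, IsCStarNorm (NB p)) (hX : IsTensorCompletion (osProjNorm NA NB) X ι)
    (h1 : Irr π1) (h2 : Irr π2) :
    ∃ Q : X →⋆ₙₐ[ℂ] (HT H1 H2 →L[ℂ] HT H1 H2), Continuous Q ∧ Irr Q ∧ ∀ z, Q z = 0 ↔ Kil ι π1 π2 z := by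
  obtain ⟨ρ1, ρ2, P, hρ1, hρ2, hP, hK⟩ := tens_clm hNA hNB hX π1 π2
  -- right non-degeneracy
  have hnd : ∀ T : HT H1 H2 →L[ℂ] HT H1 H2, (∀ a b, T * (ρ1 a * ρ2 b) = 0) → T = 0 := by
    intro T hT
    have e1 : ∀ a b ξ η, T (tt (π1 a ξ) (π2 b η)) = 0 := by
      intro a b ξ η
      have := DFunLike.congr_fun (hT a b) (tt ξ η)
      simp only [ContinuousLinearMap.mul_apply] at this
      rw [hρ2, hρ1] at this
      exact this
    have e2 : ∀ b ξ η, T (tt ξ (π2 b η)) = 0 := by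
      intro b ξ η
      let f : H1 →L[ℂ] HT H1 H2 := T.comp (ttL.flip (π2 b η))
      have := h1.ran (LinearMap.ker f.toLinearMap) f.isClosed_ker (fun a ξ => e1 a b ξ η)
      have hx : ξ ∈ LinearMap.ker f.toLinearMap := by rw [this]; trivial
      exact hx
    refine ht_ext fun ξ η => ?_
    let f : H2 →L[ℂ] HT H1 H2 := T.comp (ttL ξ)
    have := h2.ran (LinearMap.ker f.toLinearMap) f.isClosed_ker (fun b η => e2 b ξ η)
    have hx : η ∈ LinearMap.ker f.toLinearMap := by rw [this]; trivial
    exact hx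
  have hcomm : ∀ a b, ρ1 a * ρ2 b = ρ2 b * ρ1 a := by
    intro a b
    refine ht_ext fun ξ η => ?_
    simp only [ContinuousLinearMap.mul_apply]
    rw [hρ2, hρ1, hρ1, hρ2]
  have hC : CRep ι ρ1 ρ2 P := ⟨hP, hcomm, fun T hT => by
    have : star T = 0 := by
      apply hnd
      intro a b
      have := congrArg star (hT (star a) (star b))
      rw [star_mul, star_mul, map_star, map_star, star_star, star_star, star_zero, ← hcomm] at this
      exact this
    rw [← star_star T, this, star_zero]⟩
  let Q : X →⋆ₙₐ[ℂ] (HT H1 H2 →L[ℂ] HT H1 H2) :=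
    { toFun := P, map_smul' := fun c x => by simp, map_zero' := by simp, map_add' := fun x y => by simp,
      map_mul' := hC.mul hX, map_star' := hC.star hNA hNB hX }
  have hQ : ∀ x, Q x = P x := fun _ => rfl
  -- nonzero vectors
  obtain ⟨ξ0, hξ0⟩ : ∃ ξ : H1, ξ ≠ 0 := by
    obtain ⟨a, ha⟩ := h1.1
    by_contra hc
    push Not at hc
    exact ha (by ext v; rw [hc v]; simp)
  obtain ⟨η0, hη0⟩ : ∃ ξ : H2, ξ ≠ 0 := by
    obtain ⟨a, ha⟩ := h2.1
    by_contra hc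
    push Not at hc
    exact ha (by ext v; rw [hc v]; simp)
  have ht0 : tt ξ0 η0 ≠ 0 := by
    intro h0
    have := tt_inner ξ0 ξ0 η0 η0
    rw [h0, inner_zero_left] at this
    rcases mul_eq_zero.1 this.symm with h | h
    · exact hξ0 (inner_self_eq_zero.1 h)
    · exact hη0 (inner_self_eq_zero.1 h)
  refine ⟨Q, P.continuous, ⟨?_, ?_⟩, hK⟩
  · by_contra hc
    push Not at hc
    have : (1 : HT H1 H2 →L[ℂ] HT H1 H2) = 0 := by
      apply hnd
      intro a b
      rw [one_mul, ← hP]; exact hc _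
    exact ht0 (by simpa using DFunLike.congr_fun this (tt ξ0 η0))
  · intro S hS hinv
    haveI : CompleteSpace S := hS.completeSpace_coe
    set p : HT H1 H2 →L[ℂ] HT H1 H2 := S.starProjection with hp
    have hinv' : ∀ x, ∀ v ∈ S, P x v ∈ S := hinv
    have hpc : ∀ x, p * P x = P x * p := fun x => proj_comm (fun x => P x) (hC.star hNA hNB hX) S hinv' x
    have hpq : ∀ a b, p * (ρ1 a * ρ2 b) = ρ1 a * ρ2 b * p := by
      intro a b; rw [← hP]; exact hpc _
    have hp1 : ∀ a, p * ρ1 a = ρ1 a * p := by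
      intro a
      rw [← sub_eq_zero]
      apply hnd
      intro c d
      rw [sub_mul, mul_assoc, ← mul_assoc (ρ1 a), ← map_mul, hpq, map_mul, mul_assoc (ρ1 a) p, hpq]
      simp only [mul_assoc, sub_self]
    have hp2 : ∀ b, p * ρ2 b = ρ2 b * p := by
      intro b
      rw [← sub_eq_zero]
      apply hnd
      intro c d
      have e1 : ρ2 b * (ρ1 c * ρ2 d) = ρ1 c * ρ2 (b * d) := by
        rw [← mul_assoc, ← hcomm, mul_assoc, ← map_mul]
      rw [sub_mul, mul_assoc, e1, mul_assoc, hpq, hpq, ← mul_assoc, e1, sub_self]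
    -- slices are scalar
    have hf : ∀ η η' : H2, ∃ c : ℂ, ∀ ξ ξ', inner ℂ (tt ξ η) (p (tt ξ' η')) = c * inner ℂ ξ ξ' := by
      intro η η'
      exact slice_scalar h1 ρ1 (ttL.flip η) (ttL.flip η') (fun a ξ => hρ1 a ξ η) (fun a ξ => hρ1 a ξ η') p hp1
    have hg : ∀ ξ ξ' : H1, ∃ c : ℂ, ∀ η η', inner ℂ (tt ξ η) (p (tt ξ' η')) = c * inner ℂ η η' := by
      intro ξ ξ'
      exact slice_scalar h2 ρ2 (ttL ξ) (ttL ξ') (fun b η => hρ2 b ξ η) (fun b η => hρ2 b ξ' η) p hp2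
    choose f hf using hf
    choose g hg using hg
    set n : ℂ := inner ℂ ξ0 ξ0 with hn
    have hn0 : n ≠ 0 := fun h => hξ0 (inner_self_eq_zero.1 h)
    have hfe : ∀ η η', f η η' = g ξ0 ξ0 / n * inner ℂ η η' := by
      intro η η'
      have := (hf η η' ξ0 ξ0).symm.trans (hg ξ0 ξ0 η η')
      field_simp
      exact this
    have hps : p = (g ξ0 ξ0 / n) • 1 := by
      refine ht_opext fun ξ η ξ' η' => ?_
      rw [hf, hfe]
      show _ = inner ℂ (tt ξ η) ((g ξ0 ξ0 / n) • (tt ξ' η'))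
      rw [inner_smul_right, tt_inner]
      ring
    exact scalar_proj S (g ξ0 ξ0 / n) fun v => by rw [← hp, hps]; rfl

/-- kernels as two-sided ideals. -/
theorem irr_prim {Y : Type u} [NonUnitalNormedRing Y] [StarRing Y] [NormedSpace ℂ Y] {H : Type u} [NormedAddCommGroup H] [InnerProductSpace ℂ H] [CompleteSpace H]
    (π : Y →⋆ₙₐ[ℂ] (H →L[ℂ] H)) (hc : Continuous π) (h : Irr π) (K : TwoSidedIdeal Y) (hK : ∀ y, y ∈ K ↔ π y = 0) : IsPrimitiveIdeal K :=
  ⟨{ H := H, π := π, continuous := hc, nonzero := h.1, irreducible := h.2 }, hK⟩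

theorem prim_irr {Y : Type u} [NonUnitalNormedRing Y] [StarRing Y] [NormedSpace ℂ Y] {K : TwoSidedIdeal Y} (h : IsPrimitiveIdeal K) :
    ∃ (H : Type u) (_ : NormedAddCommGroup H) (_ : InnerProductSpace ℂ H) (_ : CompleteSpace H) (π : Y →⋆ₙₐ[ℂ] (H →L[ℂ] H)), Continuous π ∧ Irr π ∧ ∀ y, y ∈ K ↔ π y = 0 := by
  obtain ⟨ρ, h⟩ := h
  exact ⟨ρ.H, ρ.normH, ρ.ipsH, ρ.csH, ρ.π, ρ.continuous, ⟨ρ.nonzero, ρ.irreducible⟩, h⟩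

theorem ker_ideal {Y : Type u} [NonUnitalNormedRing Y] [StarRing Y] [NormedSpace ℂ Y] {H : Type u} [NormedAddCommGroup H] [InnerProductSpace ℂ H] [CompleteSpace H]
    (π : Y →⋆ₙₐ[ℂ] (H →L[ℂ] H)) : ∃ K : TwoSidedIdeal Y, ∀ y, y ∈ K ↔ π y = 0 := by
  refine ⟨TwoSidedIdeal.mk' {y | π y = 0} (by simp) (fun {x y} hx hy => ?_) (fun {x} hx => ?_) (fun {x y} hx => ?_) (fun {x y} hx => ?_), fun y => ?_⟩
  · simp only [Set.mem_setOf_eq] at *; rw [map_add, hx, hy, add_zero]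
  · simp only [Set.mem_setOf_eq] at *; rw [map_neg, hx, neg_zero]
  · simp only [Set.mem_setOf_eq] at *; rw [map_mul, hx, mul_zero]
  · simp only [Set.mem_setOf_eq] at *; rw [map_mul, hx, zero_mul]
  · rw [TwoSidedIdeal.mem_mk']; rfl

theorem prim_back (hNA : ∀ p, IsCStarNorm (NA p)) (hNB : ∀ p, IsCStarNorm (NB p)) (hX : IsTensorCompletion (osProjNorm NA NB) X ι) (K : TwoSidedIdeal X)
    (E : TwoSidedIdeal A) (F : TwoSidedIdeal B) (hE : IsPrimitiveIdeal E) (hF : IsPrimitiveIdeal F)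
    (hK : (K : Set X) = tensorIdeal ι Set.univ (F : Set B) + tensorIdeal ι (E : Set A) Set.univ) : IsPrimitiveIdeal K := by
  obtain ⟨H1, _, _, _, π1, -, h1, hE⟩ := prim_irr hE
  obtain ⟨H2, _, _, _, π2, -, h2, hF⟩ := prim_irr hF
  obtain ⟨Q, hc, hi, hk⟩ := tens_rep hNA hNB hX h1 h2
  refine irr_prim Q hc hi K fun y => ?_
  rw [hk, kil_iff hNA hNB hX]
  have e1 : (F : Set B) = {b | π2 b = 0} := by ext b; exact hF b
  have e2 : (E : Set A) = {b | π1 b = 0} := by ext b; exact hE b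
  rw [← e1, ← e2, ← hK]; rfl

end main
end TP

namespace TP
open Filter Topology Matrix

section gen
variable {H : Type*} [NormedAddCommGroup H] [InnerProductSpace ℂ H] [CompleteSpace H]

theorem strong_lim {γ : Type*} {l : Filter γ} [l.NeBot] (T : γ → H →L[ℂ] H) {C : ℝ} (hC0 : 0 ≤ C) (hC : ∀ᶠ i in l, ‖T i‖ ≤ C) (D : Set H)
    (hD : ∀ S : Submodule ℂ H, IsClosed (S : Set H) → D ⊆ S → S = ⊤) (h : ∀ v ∈ D, ∃ w, Tendsto (fun i => T i v) l (𝓝 w)) :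
    ∃ T0 : H →L[ℂ] H, ∀ v, Tendsto (fun i => T i v) l (𝓝 (T0 v)) := by
  let S : Submodule ℂ H :=
    { carrier := {v | ∃ w, Tendsto (fun i => T i v) l (𝓝 w)}
      add_mem' := by
        rintro v v' ⟨w, hw⟩ ⟨w', hw'⟩
        exact ⟨w + w', by simpa using hw.add hw'⟩
      zero_mem' := ⟨0, by simp⟩
      smul_mem' := by
        rintro c v ⟨w, hw⟩
        exact ⟨c • w, by simpa using hw.const_smul c⟩ }
  have hS : IsClosed (S : Set H) := by
    apply isClosed_of_closure_subset
    intro v hv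
    have hcau : Cauchy (map (fun i => T i v) l) := by
      rw [Metric.cauchy_iff]
      refine ⟨inferInstance, fun ε hε => ?_⟩
      obtain ⟨v', hv', hd⟩ := Metric.mem_closure_iff.1 hv (ε / (4 * (C + 1))) (by positivity)
      obtain ⟨w, hw⟩ := hv'
      have hev : ∀ᶠ i in l, dist (T i v) w < ε / 2 := by
        filter_upwards [hC, hw.eventually (Metric.ball_mem_nhds w (show 0 < ε / 4 by positivity))] with i h1 h2
        have h3 : dist (T i v) (T i v') ≤ ε / 4 := by
          rw [dist_eq_norm, ← map_sub]
          refine ((T i).le_opNorm _).trans ?_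
          rw [← dist_eq_norm]
          have : (C + 1) * (ε / (4 * (C + 1))) = ε / 4 := by field_simp
          rw [← this]
          gcongr
          linarith
        have := dist_triangle (T i v) (T i v') w
        linarith
      refine ⟨Metric.ball w (ε / 2), hev, fun x hx y hy => ?_⟩
      have := dist_triangle_right x y w
      rw [Metric.mem_ball] at hx hy
      linarith
    exact CompleteSpace.complete hcau
  have htop := hD S hS h
  have hall : ∀ v, ∃ w, Tendsto (fun i => T i v) l (𝓝 w) := fun v => by
    have : v ∈ S := by rw [htop]; trivial
    exact this
  choose f hf using hall
  refine ⟨LinearMap.mkContinuous { toFun := f, map_add' := fun x y => ?_, map_smul' := fun c x => ?_ } C (fun x => ?_), hf⟩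
  · exact tendsto_nhds_unique (hf _) (by simpa using (hf x).add (hf y))
  · exact tendsto_nhds_unique (hf _) (by simpa using (hf x).const_smul c)
  · refine le_of_tendsto (hf x).norm ?_
    filter_upwards [hC] with i hi
    exact ((T i).le_opNorm x).trans (by gcongr)

variable {A B : Type*} [NonUnitalCStarAlgebra A] [NonUnitalCStarAlgebra B]

theorem split_one (Q : A → B → (H →L[ℂ] H)) (hadd : ∀ a a' b, Q (a + a') b = Q a b + Q a' b) (hsm : ∀ (c : ℂ) a b, Q (c • a) b = c • Q a b)
    {C : ℝ} (hC : 0 ≤ C) (hb : ∀ a b, ‖Q a b‖ ≤ C * (‖a‖ * ‖b‖)) (hcont : ∀ a, Continuous (Q a)) (hmul : ∀ a b c d, Q a b * Q c d = Q (a * c) (b * d))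
    (hst : ∀ a b, Q (star a) (star b) = star (Q a b))
    (hD : ∀ S : Submodule ℂ H, IsClosed (S : Set H) → (∀ a b v, Q a b v ∈ S) → S = ⊤) :
    ∃ ρ : A →⋆ₙₐ[ℂ] (H →L[ℂ] H), ∀ a c d, ρ a * Q c d = Q (a * c) d := by
  obtain ⟨l, hl, hl1, hl2, hl3, hl4⟩ := all_au B
  have hcan : ∀ S T : H →L[ℂ] H, (∀ c d, S * Q c d = T * Q c d) → S = T := by
    intro S T h
    have := hD (LinearMap.ker (S - T).toLinearMap) (S - T).isClosed_ker (fun a b v => by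
      show (S - T) (Q a b v) = 0
      have := DFunLike.congr_fun (h a b) v
      simp only [ContinuousLinearMap.mul_apply] at this
      rw [ContinuousLinearMap.sub_apply, this, sub_self])
    ext v
    have hx : v ∈ LinearMap.ker (S - T).toLinearMap := by rw [this]; trivial
    have hx' : (S - T) v = 0 := hx
    simpa [sub_eq_zero] using hx'
  have hex : ∀ a, ∃ T : H →L[ℂ] H, ∀ c d, T * Q c d = Q (a * c) d := by
    intro a
    have hlim : ∀ c d v, Tendsto (fun f => Q a f (Q c d v)) l (𝓝 (Q (a * c) d v)) := by
      intro c d v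
      have e : ∀ f, Q a f (Q c d v) = Q (a * c) (f * d) v := fun f => by rw [← hmul]; rfl
      simp only [e]
      have h1 : Tendsto (fun f => Q (a * c) (f * d)) l (𝓝 (Q (a * c) d)) := ((hcont (a * c)).tendsto d).comp (hl3 d)
      exact ((ContinuousLinearMap.apply ℂ H v).continuous.tendsto _).comp h1
    obtain ⟨T, hT⟩ := strong_lim (l := l) (fun f => Q a f) (C := C * ‖a‖) (by positivity) (hl1.mono fun f hf => (hb a f).trans (by
        have := norm_nonneg a
        have : ‖a‖ * ‖f‖ ≤ ‖a‖ * 1 := by gcongr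
        rw [mul_one] at this
        gcongr)) {v | ∃ c d w, v = Q c d w}
      (fun S hS h => hD S hS fun a b v => h ⟨a, b, v, rfl⟩) (by
        rintro v ⟨c, d, w, rfl⟩
        exact ⟨_, hlim c d w⟩)
    exact ⟨T, fun c d => by ext v; exact tendsto_nhds_unique (hT _) (hlim c d v)⟩
  choose ρ hρ using hex
  refine ⟨{ toFun := ρ, map_smul' := ?_, map_zero' := ?_, map_add' := ?_, map_mul' := ?_, map_star' := ?_ }, hρ⟩
  · intro c a; apply hcan; intro x y
    simp only [MonoidHom.id_apply]
    rw [hρ, smul_mul_assoc, hsm, smul_mul_assoc, hρ]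
  · apply hcan; intro x y
    rw [hρ, zero_mul, zero_mul]
    have := hsm 0 0 y
    simpa using this
  · intro a a'; apply hcan; intro x y
    rw [hρ, add_mul, hadd, add_mul, hρ, hρ]
  · intro a a'; apply hcan; intro x y
    rw [hρ, mul_assoc (ρ a), hρ, hρ, mul_assoc]
  · intro a
    have h1 : ∀ c d, star (Q c d) * ρ (star a) = star (Q c d) * star (ρ a) := by
      intro c d
      apply hcan
      intro x y
      rw [mul_assoc, hρ, ← star_mul, hρ, ← hst, ← hst, hmul, hmul, star_mul, mul_assoc]
    have h2 : star (ρ (star a)) = ρ a := by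
      apply hcan
      intro x y
      have := congrArg star (h1 x y)
      simpa [star_mul] using this
    show ρ (star a) = star (ρ a)
    rw [← h2, star_star]

/-- primeness of a representation. -/
def Prm (ρ : A →⋆ₙₐ[ℂ] (H →L[ℂ] H)) : Prop := (∃ a, ρ a ≠ 0) ∧ ∀ a a', (∀ c, ρ a * ρ c * ρ a' = 0) → ρ a = 0 ∨ ρ a' = 0

theorem prime_aux (ρ1 : A →⋆ₙₐ[ℂ] (H →L[ℂ] H)) (ρ2 : B →⋆ₙₐ[ℂ] (H →L[ℂ] H)) (hcomm : ∀ a b, ρ1 a * ρ2 b = ρ2 b * ρ1 a)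
    (hir : ∀ S : Submodule ℂ H, IsClosed (S : Set H) → (∀ a b, ∀ v ∈ S, (ρ1 a * ρ2 b) v ∈ S) → S = ⊥ ∨ S = ⊤) (hne : ∃ a b, ρ1 a * ρ2 b ≠ 0)
    (a : A) (ha : ρ1 a ≠ 0) (ζ : H) (hζ : ∀ c, ρ1 a (ρ1 c ζ) = 0) : ζ = 0 := by
  let S : Submodule ℂ H := ⨅ c, LinearMap.ker (ρ1 a * ρ1 c).toLinearMap
  have hmem : ∀ v, v ∈ S ↔ ∀ c, ρ1 a (ρ1 c v) = 0 := by
    intro v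
    simp only [S, Submodule.mem_iInf]
    rfl
  have hS : IsClosed (S : Set H) := by
    have : (S : Set H) = ⋂ c, {v | ρ1 a (ρ1 c v) = 0} := by
      ext v
      simp only [SetLike.mem_coe, hmem, Set.mem_iInter, Set.mem_setOf_eq]
    rw [this]
    exact isClosed_iInter fun c => isClosed_eq (by fun_prop) continuous_const
  have hr : ∀ v, (∀ a' b', (ρ1 a' * ρ2 b') v = 0) → v = 0 := by
    intro v hv
    let S' : Submodule ℂ H := ⨅ c : A × B, LinearMap.ker (ρ1 c.1 * ρ2 c.2).toLinearMap
    have hmem' : ∀ v, v ∈ S' ↔ ∀ a b, (ρ1 a * ρ2 b) v = 0 := by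
      intro v
      simp only [S', Submodule.mem_iInf, Prod.forall]
      rfl
    have hS' : IsClosed (S' : Set H) := by
      have : (S' : Set H) = ⋂ c : A × B, {v | (ρ1 c.1 * ρ2 c.2) v = 0} := by
        ext v
        simp only [SetLike.mem_coe, hmem', Set.mem_iInter, Set.mem_setOf_eq, Prod.forall]
      rw [this]
      exact isClosed_iInter fun c => isClosed_eq (by fun_prop) continuous_const
    rcases hir S' hS' (fun a b v hv => by rw [(hmem' v).1 hv]; exact S'.zero_mem) with h | h
    · have : v ∈ S' := (hmem' v).2 hv
      rw [h] at this; simpa using this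
    · obtain ⟨a, b, hab⟩ := hne
      exfalso; apply hab; ext v
      have : v ∈ S' := by rw [h]; trivial
      exact (hmem' v).1 this a b
  rcases hir S hS (fun a' b' v hv => by
    rw [hmem] at hv ⊢
    intro c
    have e : ρ1 a * (ρ1 c * (ρ1 a' * ρ2 b')) = ρ2 b' * (ρ1 a * ρ1 (c * a')) := by
      simp only [← map_mul, ← mul_assoc]
      rw [hcomm]
    have := DFunLike.congr_fun e v
    simp only [ContinuousLinearMap.mul_apply] at this ⊢
    rw [this, hv, map_zero]) with h | h
  · have : ζ ∈ S := (hmem ζ).2 hζ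
    rw [h] at this; simpa using this
  · exfalso
    apply ha
    have h0 : ∀ c, ρ1 a * ρ1 c = 0 := by
      intro c; ext v
      have : v ∈ S := by rw [h]; trivial
      exact (hmem v).1 this c
    have hst : star (ρ1 a) = 0 := by
      ext v
      apply hr
      intro a' b'
      have : ρ1 a' * ρ2 b' * star (ρ1 a) = 0 := by
        rw [hcomm, mul_assoc]
        have := congrArg star (h0 (star a'))
        rw [star_mul, map_star, star_star, star_zero] at this
        rw [this, mul_zero]
      exact DFunLike.congr_fun this v
    rw [← star_star (ρ1 a), hst, star_zero]

end gen

section main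
variable {A B : Type u} [NonUnitalCStarAlgebra A] [NonUnitalCStarAlgebra B]
variable {NA : ∀ p : ℕ, Matrix (Fin p) (Fin p) A → ℝ} {NB : ∀ q : ℕ, Matrix (Fin q) (Fin q) B → ℝ}
variable {X : Type u} [NonUnitalNormedRing X] [StarRing X] [NormedSpace ℂ X] [CompleteSpace X] [IsScalarTower ℂ X X] [SMulCommClass ℂ X X] {ι : A ⊗[ℂ] B →ₗ[ℂ] X}
variable {H : Type u} [NormedAddCommGroup H] [InnerProductSpace ℂ H] [CompleteSpace H]

theorem split_rep (hNA : ∀ p, IsCStarNorm (NA p)) (hNB : ∀ p, IsCStarNorm (NB p)) (hX : IsTensorCompletion (osProjNorm NA NB) X ι)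
    (π : X →⋆ₙₐ[ℂ] (H →L[ℂ] H)) (hc : Continuous π) (hi : Irr π) :
    ∃ (ρ1 : A →⋆ₙₐ[ℂ] (H →L[ℂ] H)) (ρ2 : B →⋆ₙₐ[ℂ] (H →L[ℂ] H)), (∀ a b, π (ι (a ⊗ₜ b)) = ρ1 a * ρ2 b) ∧ (∀ a b, ρ1 a * ρ2 b = ρ2 b * ρ1 a) ∧
      Prm ρ1 ∧ Prm ρ2 ∧ ∀ a b, ρ1 a * ρ2 b = 0 → ρ1 a = 0 ∨ ρ2 b = 0 := by
  let πL : X →L[ℂ] (H →L[ℂ] H) := { toFun := π, map_add' := map_add π, map_smul' := map_smul π, cont := hc }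
  have hπL : ∀ x, πL x = π x := fun _ => rfl
  -- invariance extends
  have hinv : ∀ S : Submodule ℂ H, IsClosed (S : Set H) → ∀ v, (∀ a b, π (ι (a ⊗ₜ b)) v ∈ S) → ∀ x, π x v ∈ S := by
    intro S hS v h x
    let f : X →L[ℂ] H := (ContinuousLinearMap.apply ℂ H v).comp πL
    exact X_closed_ind hX (S.comap f.toLinearMap) (hS.preimage f.continuous) h x
  let Q : A → B → (H →L[ℂ] H) := fun a b => π (ι (a ⊗ₜ b))
  have hQ : ∀ a b, Q a b = π (ι (a ⊗ₜ b)) := fun _ _ => rfl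
  have hb : ∀ a b, ‖Q a b‖ ≤ ‖πL‖ * (‖a‖ * ‖b‖) := fun a b =>
    (πL.le_opNorm _).trans (mul_le_mul_of_nonneg_left (norm_tmul_le hNA hNB hX a b) (norm_nonneg _))
  have hadd1 : ∀ a a' b, Q (a + a') b = Q a b + Q a' b := fun a a' b => by simp only [hQ, TensorProduct.add_tmul, map_add]
  have hadd2 : ∀ a b b', Q a (b + b') = Q a b + Q a b' := fun a b b' => by simp only [hQ, TensorProduct.tmul_add, map_add]
  have hsm1 : ∀ (c : ℂ) a b, Q (c • a) b = c • Q a b := fun c a b => by simp only [hQ, ← TensorProduct.smul_tmul', map_smul]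
  have hsm2 : ∀ (c : ℂ) a b, Q a (c • b) = c • Q a b := fun c a b => by simp only [hQ, TensorProduct.tmul_smul, map_smul]
  have hmul : ∀ a b c d, Q a b * Q c d = Q (a * c) (b * d) := fun a b c d => by rw [hQ, hQ, hQ, ← map_mul, hX.mul_tmul]
  have hst : ∀ a b, Q (star a) (star b) = star (Q a b) := fun a b => by rw [hQ, hQ, ← map_star, hX.star_tmul]
  have hD : ∀ S : Submodule ℂ H, IsClosed (S : Set H) → (∀ a b v, Q a b v ∈ S) → S = ⊤ := fun S hS h =>
    hi.ran S hS fun x v => hinv S hS v (fun a b => h a b v) x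
  have hc2 : ∀ a, Continuous (Q a) := fun a => by
    let f : B →ₗ[ℂ] (H →L[ℂ] H) := { toFun := Q a, map_add' := hadd2 a, map_smul' := fun c b => hsm2 c a b }
    exact (f.mkContinuous (‖πL‖ * ‖a‖) (fun b => by rw [mul_assoc]; exact hb a b)).continuous
  have hc1 : ∀ b, Continuous (fun a => Q a b) := fun b => by
    let f : A →ₗ[ℂ] (H →L[ℂ] H) := { toFun := fun a => Q a b, map_add' := fun a a' => hadd1 a a' b, map_smul' := fun c a => hsm1 c a b }
    exact (f.mkContinuous (‖πL‖ * ‖b‖) (fun a => by rw [mul_assoc, mul_comm ‖b‖]; exact hb a b)).continuous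
  obtain ⟨ρ1, hρ1⟩ := split_one Q hadd1 hsm1 (norm_nonneg _) hb hc2 hmul hst hD
  obtain ⟨ρ2, hρ2⟩ := split_one (fun b a => Q a b) (fun b b' a => hadd2 a b b') (fun c b a => hsm2 c a b) (norm_nonneg _) (fun b a => by rw [mul_comm ‖b‖]; exact hb a b) hc1
    (fun b a d c => hmul a b c d) (fun b a => hst a b) (fun S hS h => hD S hS fun a b v => h b a v)
  have hcan : ∀ S T : H →L[ℂ] H, (∀ c d, S * Q c d = T * Q c d) → S = T := by
    intro S T h
    have := hD (LinearMap.ker (S - T).toLinearMap) (S - T).isClosed_ker (fun a b v => by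
      show (S - T) (Q a b v) = 0
      have := DFunLike.congr_fun (h a b) v
      simp only [ContinuousLinearMap.mul_apply] at this
      rw [ContinuousLinearMap.sub_apply, this, sub_self])
    ext v
    have hx : v ∈ LinearMap.ker (S - T).toLinearMap := by rw [this]; trivial
    have hx' : (S - T) v = 0 := hx
    simpa [sub_eq_zero] using hx'
  have hρ2' : ∀ b c d, ρ2 b * Q c d = Q c (b * d) := fun b c d => hρ2 b d c
  have e1 : ∀ a b, Q a b = ρ1 a * ρ2 b := fun a b => hcan _ _ fun c d => by rw [mul_assoc, hρ2', hρ1, hmul]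
  have e2 : ∀ a b, Q a b = ρ2 b * ρ1 a := fun a b => hcan _ _ fun c d => by rw [mul_assoc, hρ1, hρ2', hmul]
  have hcomm : ∀ a b, ρ1 a * ρ2 b = ρ2 b * ρ1 a := fun a b => by rw [← e1, e2]
  have hir : ∀ S : Submodule ℂ H, IsClosed (S : Set H) → (∀ a b, ∀ v ∈ S, (ρ1 a * ρ2 b) v ∈ S) → S = ⊥ ∨ S = ⊤ := fun S hS h =>
    hi.2 S hS fun x v hv => hinv S hS v (fun a b => by
      have := h a b v hv
      rw [← e1] at this
      exact this) x
  have hne : ∃ a b, ρ1 a * ρ2 b ≠ 0 := by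
    by_contra hcon
    push Not at hcon
    have : (⊥ : Submodule ℂ H) = ⊤ := hD ⊥ isClosed_singleton fun a b v => by rw [e1, hcon]; simp
    obtain ⟨y, hy⟩ := hi.1
    apply hy; ext v
    have hv : π y v ∈ (⊥ : Submodule ℂ H) := by rw [this]; trivial
    simpa using hv
  have k1 := prime_aux ρ1 ρ2 hcomm hir hne
  have k2 := prime_aux ρ2 ρ1 (fun b a => (hcomm a b).symm) (fun S hS h => hir S hS fun a b v hv => by rw [hcomm]; exact h b a v hv) (by
    obtain ⟨a, b, h⟩ := hne
    exact ⟨b, a, by rw [← hcomm]; exact h⟩)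
  refine ⟨ρ1, ρ2, e1, hcomm, ⟨?_, ?_⟩, ⟨?_, ?_⟩, ?_⟩
  · obtain ⟨a, b, h⟩ := hne
    exact ⟨a, fun h0 => h (by rw [h0, zero_mul])⟩
  · intro a a' h
    by_contra hcon
    push Not at hcon
    exact hcon.2 (by ext v; exact k1 a hcon.1 _ fun c => DFunLike.congr_fun (h c) v)
  · obtain ⟨a, b, h⟩ := hne
    exact ⟨b, fun h0 => h (by rw [h0, mul_zero])⟩
  · intro a a' h
    by_contra hcon
    push Not at hcon
    exact hcon.2 (by ext v; exact k2 a hcon.1 _ fun c => DFunLike.congr_fun (h c) v)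
  · intro a b h
    by_contra hcon
    push Not at hcon
    refine hcon.2 (by
      ext v
      refine k1 a hcon.1 _ fun c => ?_
      have : ρ1 a * (ρ1 c * ρ2 b) = 0 := by rw [hcomm, ← mul_assoc, h, zero_mul]
      exact DFunLike.congr_fun this v)

end main
end TP

namespace TP
open Filter Topology Matrix

/-- truncation vanishing on `[-1/2, 1/2]`. -/
def f2 (t : ℝ) : ℝ := max (|t| - 1/2) 0
/-- truncation equal to one off `[-1/2, 1/2]`. -/
def f1 (t : ℝ) : ℝ := min 1 (max 0 (4 * |t| - 1))
/-- regularised reciprocal. -/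
def ri (t : ℝ) : ℝ := t / max (t ^ 2) (1/16)

theorem f2_cont : Continuous f2 := by unfold f2; fun_prop
theorem f1_cont : Continuous f1 := by unfold f1; fun_prop
theorem ri_cont : Continuous ri := by
  unfold ri
  refine continuous_id.div (by fun_prop) fun t => ?_
  have : (1:ℝ)/16 ≤ max (t ^ 2) (1/16) := le_max_right _ _
  positivity
theorem f2_zero : f2 0 = 0 := by simp [f2]
theorem f1_zero : f1 0 = 0 := by simp [f1]
theorem f1_f2 (t : ℝ) : f1 t * f2 t = f2 t := by
  unfold f1 f2
  rcases le_total (|t|) (1/2) with h | h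
  · rw [max_eq_right (a := |t| - 1/2) (by linarith)]; simp
  · rw [min_eq_left (by rw [le_max_iff]; right; linarith), one_mul]
theorem f1_abs (t : ℝ) : |f1 t| ≤ 1 := by
  unfold f1
  rw [abs_of_nonneg (by positivity)]
  exact min_le_left _ _
theorem f1_fac (t : ℝ) : t * (f1 t * ri t) = f1 t := by
  unfold ri
  rcases le_total (|t|) (1/4) with h | h
  · have : f1 t = 0 := by
      unfold f1
      rw [max_eq_left (by linarith)]; simp
    rw [this]; simp
  · have h2 : (1:ℝ)/16 ≤ t ^ 2 := by
      rw [← sq_abs]; nlinarith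
    rw [max_eq_left h2]
    have : t ≠ 0 := by rintro rfl; norm_num at h2
    field_simp
theorem f2_fac (t : ℝ) : t * (f2 t * ri t) = f2 t := by
  rw [← f1_f2, mul_assoc, mul_comm (f2 t), ← mul_assoc (f1 t), ← mul_assoc, f1_fac]

section exc
variable {A : Type*} [NonUnitalCStarAlgebra A]

theorem norm_le_half {x : A} (hx : IsSelfAdjoint x) (h : cfcₙ f2 x = 0) : ‖x‖ ≤ 1/2 := by
  have h0 : Set.EqOn f2 0 (quasispectrum ℝ x) := by
    have : cfcₙ f2 x = cfcₙ (0 : ℝ → ℝ) x := by rw [h, cfcₙ_zero]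
    exact (cfcₙ_eq_cfcₙ_iff_eqOn (R := ℝ) (a := x) (ha := hx) (hf := f2_cont.continuousOn) (hf0 := f2_zero) (hg := continuousOn_const) (hg0 := rfl)).1 this
  rw [← cfcₙ_id ℝ x hx]
  refine norm_cfcₙ_le fun t ht => ?_
  have := h0 ht
  simp only [f2, Pi.zero_apply, max_eq_right_iff] at this
  simpa using (by linarith : |t| ≤ 1/2)

theorem f2_eq_zero {x : A} (hx : IsSelfAdjoint x) (h : ‖x‖ ≤ 1/2) : cfcₙ f2 x = 0 := by
  rw [← cfcₙ_zero ℝ x]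
  refine cfcₙ_congr fun t ht => ?_
  have h3 : ‖t‖ ≤ ‖x‖ := by
    have := norm_apply_le_norm_cfcₙ (𝕜 := ℝ) id x ht (ha := hx)
    rwa [cfcₙ_id ℝ x hx] at this
  rw [Real.norm_eq_abs] at h3
  simp only [f2, Pi.zero_apply, max_eq_right_iff]
  linarith

theorem pm_exists {W : A} (hW : IsSelfAdjoint W) : ∃ p q : A, IsSelfAdjoint p ∧ IsSelfAdjoint q ∧ W = p * p - q * q ∧ q * p = 0 := by
  set fp : ℝ → ℝ := fun t => Real.sqrt (max t 0)
  set fq : ℝ → ℝ := fun t => Real.sqrt (max (-t) 0)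
  have hp : Continuous fp := by fun_prop
  have hq : Continuous fq := by fun_prop
  have hp0 : fp 0 = 0 := by simp [fp]
  have hq0 : fq 0 = 0 := by simp [fq]
  refine ⟨cfcₙ fp W, cfcₙ fq W, cfcₙ_predicate fp W, cfcₙ_predicate fq W, ?_, ?_⟩
  · rw [← cfcₙ_mul fp fp W hp.continuousOn hp0 hp.continuousOn hp0, ← cfcₙ_mul fq fq W hq.continuousOn hq0 hq.continuousOn hq0,
      ← cfcₙ_sub (fun t => fp t * fp t) (fun t => fq t * fq t) W (by fun_prop) (by simp [hp0]) (by fun_prop) (by simp [hq0])]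
    conv_lhs => rw [← cfcₙ_id ℝ W hW]
    refine cfcₙ_congr fun t _ => ?_
    simp only [id, fp, fq]
    rw [Real.mul_self_sqrt (by positivity), Real.mul_self_sqrt (by positivity)]
    rcases le_total t 0 with h | h
    · rw [max_eq_right h, max_eq_left (by linarith)]; ring
    · rw [max_eq_left h, max_eq_right (by linarith)]; ring
  · rw [← cfcₙ_mul fq fp W hq.continuousOn hq0 hp.continuousOn hp0, ← cfcₙ_zero ℝ W]
    refine cfcₙ_congr fun t _ => ?_
    simp only [fp, fq, Pi.zero_apply]
    rcases le_total t 0 with h | h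
    · rw [max_eq_right h]; simp
    · rw [max_eq_right (a := -t) (by linarith)]; simp

variable {H : Type*} [NormedAddCommGroup H] [InnerProductSpace ℂ H] [CompleteSpace H]

theorem sinner (ρ : A →⋆ₙₐ[ℂ] (H →L[ℂ] H)) (a : A) (x y : H) : inner ℂ (ρ (star a) x) y = inner ℂ x (ρ a y) := by
  rw [map_star, ContinuousLinearMap.star_eq_adjoint, ContinuousLinearMap.adjoint_inner_left]

theorem sinner' (ρ : A →⋆ₙₐ[ℂ] (H →L[ℂ] H)) (a : A) (x y : H) : inner ℂ x (ρ (star a) y) = inner ℂ (ρ a x) y := by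
  rw [← sinner, star_star]

theorem map_mul_apply (ρ : A →⋆ₙₐ[ℂ] (H →L[ℂ] H)) (a b : A) (x : H) : ρ (a * b) x = ρ a (ρ b x) := by rw [map_mul]; rfl

/-- range inclusion. -/
def RI (ρ : A →⋆ₙₐ[ℂ] (H →L[ℂ] H)) (g' g : A) : Prop := ∀ η, ∃ η', ρ g' η = ρ g η'

theorem RI.trans {ρ : A →⋆ₙₐ[ℂ] (H →L[ℂ] H)} {a b c : A} (h : RI ρ a b) (h' : RI ρ b c) : RI ρ a c := by
  intro η
  obtain ⟨η1, h1⟩ := h η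
  obtain ⟨η2, h2⟩ := h' η1
  exact ⟨η2, h1.trans h2⟩

theorem RI.refl (ρ : A →⋆ₙₐ[ℂ] (H →L[ℂ] H)) (a : A) : RI ρ a a := fun η => ⟨η, rfl⟩

theorem RI.mul (ρ : A →⋆ₙₐ[ℂ] (H →L[ℂ] H)) (a b : A) : RI ρ (a * b) a := fun η => ⟨ρ b η, map_mul_apply ρ a b η⟩

theorem sa_sq_zero (ρ : A →⋆ₙₐ[ℂ] (H →L[ℂ] H)) {p : A} (hp : IsSelfAdjoint p) (h : ρ (p * p) = 0) : ρ p = 0 := by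
  have h1 : ρ (star p * p) = 0 := by rw [hp.star_eq]; exact h
  rw [map_mul, map_star] at h1
  exact CStarRing.star_mul_self_eq_zero_iff _ |>.1 h1

theorem cut (ρ : A →⋆ₙₐ[ℂ] (H →L[ℂ] H)) {c : A} (hc : IsSelfAdjoint c) (m : ℝ) (g : A) :
    (∀ η, (inner ℂ (ρ g η) (ρ c (ρ g η))).re ≤ m * ‖ρ g η‖ ^ 2) ∨
    ∃ g', RI ρ g' g ∧ ρ g' ≠ 0 ∧ ∀ η, m * ‖ρ g' η‖ ^ 2 ≤ (inner ℂ (ρ g' η) (ρ c (ρ g' η))).re := by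
  set W : A := star g * c * g - (m : ℂ) • (star g * g) with hWd
  have hW : IsSelfAdjoint W := by
    rw [hWd, IsSelfAdjoint, star_sub, star_smul, star_mul, star_mul, star_mul, star_star, hc.star_eq, mul_assoc]
    simp
  have hWη : ∀ η, (inner ℂ η (ρ W η)).re = (inner ℂ (ρ g η) (ρ c (ρ g η))).re - m * ‖ρ g η‖ ^ 2 := by
    intro η
    rw [hWd, map_sub, map_smul, ContinuousLinearMap.sub_apply, ContinuousLinearMap.smul_apply, inner_sub_right, inner_smul_right, mul_assoc, map_mul_apply, map_mul_apply,
      map_mul_apply, sinner', sinner', inner_self_eq_norm_sq_to_K]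
    simp only [Complex.sub_re, Complex.re_ofReal_mul]
    norm_cast
  obtain ⟨p, q, hp, hq, hpq, hqp⟩ := pm_exists hW
  by_cases h0 : ρ p = 0
  · left
    intro η
    have h1 : (inner ℂ η (ρ W η)).re ≤ 0 := by
      rw [hpq, map_sub, map_mul, h0, zero_mul, zero_sub, ContinuousLinearMap.neg_apply, inner_neg_right, map_mul_apply]
      nth_rw 1 [← hq.star_eq]
      rw [sinner']
      have h3 := inner_self_nonneg (𝕜 := ℂ) (x := ρ q η)
      rw [Complex.neg_re]
      have h4 : 0 ≤ (inner ℂ (ρ q η) (ρ q η)).re := h3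
      linarith
    rw [hWη] at h1
    linarith
  · right
    have hpWp : p * W * p = (p * p) * (p * p) := by
      rw [hpq, mul_sub, sub_mul, mul_assoc p (q * q), mul_assoc q q p, hqp]
      simp [mul_assoc]
    refine ⟨g * p, RI.mul ρ g p, ?_, ?_⟩
    · intro h1
      apply h0
      have h2 : ρ (p * W * p) = 0 := by
        rw [hWd]
        have e : p * (star g * c * g - (m : ℂ) • (star g * g)) * p = p * star g * c * (g * p) - (m : ℂ) • (p * star g * (g * p)) := by
          simp only [mul_sub, sub_mul, mul_smul_comm, smul_mul_assoc, mul_assoc]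
        rw [e, map_sub, map_smul, map_mul, map_mul _ _ (g * p), h1]
        simp
      rw [hpWp] at h2
      have hpp : IsSelfAdjoint (p * p) := by rw [IsSelfAdjoint, star_mul, hp.star_eq]
      exact sa_sq_zero ρ hp (sa_sq_zero ρ hpp h2)
    · intro η
      have h1 := hWη (ρ p η)
      have h2 : 0 ≤ (inner ℂ (ρ p η) (ρ W (ρ p η))).re := by
        have hpp : star (p * p) = p * p := by rw [star_mul, hp.star_eq]
        have h3 : inner ℂ (ρ p η) (ρ W (ρ p η)) = inner ℂ (ρ (p * p) η) (ρ (p * p) η) := by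
          rw [← sinner', ← sinner', hp.star_eq, hpp, ← map_mul_apply, ← map_mul_apply, ← map_mul_apply, ← hpWp, mul_assoc]
        rw [h3]
        exact inner_self_nonneg (𝕜 := ℂ) (x := ρ (p * p) η)
      rw [h1] at h2
      rw [map_mul_apply ρ g p η]
      linarith

theorem task1 (ρ : A →⋆ₙₐ[ℂ] (H →L[ℂ] H)) {c : A} (hc : IsSelfAdjoint c) {ε : ℝ} (hε : 0 < ε) {g : A} (hg : ρ g ≠ 0) :
    ∃ g', RI ρ g' g ∧ ρ g' ≠ 0 ∧ ∃ l : ℝ, ∀ η, |(inner ℂ (ρ g' η) (ρ c (ρ g' η))).re - l * ‖ρ g' η‖ ^ 2| ≤ ε * ‖ρ g' η‖ ^ 2 := by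
  have key : ∀ n : ℕ, ∃ g', RI ρ g' g ∧ ρ g' ≠ 0 ∧ ∃ l : ℝ, ∀ η, l * ‖ρ g' η‖ ^ 2 ≤ (inner ℂ (ρ g' η) (ρ c (ρ g' η))).re ∧
      (inner ℂ (ρ g' η) (ρ c (ρ g' η))).re ≤ (l + 2 * ‖ρ c‖ / 2 ^ n) * ‖ρ g' η‖ ^ 2 := by
    intro n
    induction n with
    | zero =>
      refine ⟨g, RI.refl ρ g, hg, -‖ρ c‖, fun η => ?_⟩
      set v := ρ g η
      have h1 : |(inner ℂ v (ρ c v)).re| ≤ ‖ρ c‖ * ‖v‖ ^ 2 := by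
        refine (Complex.abs_re_le_norm _).trans ((norm_inner_le_norm _ _).trans ?_)
        have := (ρ c).le_opNorm v
        nlinarith [norm_nonneg v]
      rw [abs_le] at h1
      constructor
      · linarith
      · simp only [pow_zero, div_one]; linarith
    | succ n ih =>
      obtain ⟨g1, h1, h2, l, hl⟩ := ih
      have hpow : 2 * ‖ρ c‖ / 2 ^ n = 2 * (2 * ‖ρ c‖ / 2 ^ (n+1)) := by rw [pow_succ]; field_simp
      rcases cut ρ hc (l + 2 * ‖ρ c‖ / 2 ^ (n+1)) g1 with h | ⟨g', h3, h4, h5⟩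
      · exact ⟨g1, h1, h2, l, fun η => ⟨(hl η).1, h η⟩⟩
      · refine ⟨g', h3.trans h1, h4, l + 2 * ‖ρ c‖ / 2 ^ (n+1), fun η => ⟨h5 η, ?_⟩⟩
        obtain ⟨η', hη'⟩ := h3 η
        rw [hη']
        refine (hl η').2.trans (le_of_eq ?_)
        rw [hpow]; ring
  have ht : Tendsto (fun n : ℕ => 2 * ‖ρ c‖ / 2 ^ n) atTop (𝓝 0) := by
    have := (tendsto_pow_atTop_nhds_zero_of_lt_one (r := (1/2 : ℝ)) (by norm_num) (by norm_num)).const_mul (2 * ‖ρ c‖)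
    simp only [mul_zero] at this
    refine this.congr fun n => ?_
    rw [one_div, inv_pow]; rfl
  obtain ⟨n, hn⟩ := (ht.eventually (gt_mem_nhds hε)).exists
  obtain ⟨g', h1, h2, l, hl⟩ := key n
  refine ⟨g', h1, h2, l, fun η => ?_⟩
  obtain ⟨h3, h4⟩ := hl η
  have : (2 * ‖ρ c‖ / 2 ^ n) * ‖ρ g' η‖ ^ 2 ≤ ε * ‖ρ g' η‖ ^ 2 := by gcongr
  have : 0 ≤ ε * ‖ρ g' η‖ ^ 2 := by positivity
  rw [abs_le]
  constructor <;> nlinarith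

theorem task2 (ρ : A →⋆ₙₐ[ℂ] (H →L[ℂ] H)) (hρ : Prm ρ) (h : A) (hh : ρ h ≠ 0) {g : A} (hg : ρ g ≠ 0) :
    ∃ g', RI ρ g' g ∧ ρ g' ≠ 0 ∧ ∃ y : A, ∃ δ > 0, ∀ η, δ * ‖ρ g' η‖ ^ 2 ≤ (inner ℂ (ρ g' η) (ρ (star (h * y) * (h * y)) (ρ g' η))).re := by
  obtain ⟨y, hy⟩ : ∃ y, ρ h * ρ y * ρ g ≠ 0 := by
    by_contra hcon
    push Not at hcon
    rcases hρ.2 h g hcon with h1 | h1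
    · exact hh h1
    · exact hg h1
  obtain ⟨η, hη⟩ : ∃ η, ρ (h * y) (ρ g η) ≠ 0 := by
    by_contra hcon
    push Not at hcon
    apply hy
    ext η
    rw [← map_mul]
    exact hcon η
  set v := ρ g η with hv
  have hv0 : v ≠ 0 := by intro h; rw [h] at hη; simp at hη
  have hv1 : 0 < ‖v‖ ^ 2 := by positivity
  have hw1 : 0 < ‖ρ (h * y) v‖ ^ 2 := by positivity
  have hre : ∀ v, (inner ℂ v (ρ (star (h * y) * (h * y)) v)).re = ‖ρ (h * y) v‖ ^ 2 := by
    intro v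
    rw [map_mul_apply, sinner', inner_self_eq_norm_sq_to_K]
    norm_cast
  rcases cut ρ (IsSelfAdjoint.star_mul_self (h * y)) (‖ρ (h * y) v‖ ^ 2 / (2 * ‖v‖ ^ 2)) g with h1 | ⟨g', h1, h2, h3⟩
  · exfalso
    have := h1 η
    rw [hre, ← hv] at this
    field_simp at this
    linarith
  · exact ⟨g', h1, h2, y, _, by positivity, h3⟩

theorem step0 (ρ : A →⋆ₙₐ[ℂ] (H →L[ℂ] H)) (hcont : Continuous ρ) {g : A} (hg : ρ g ≠ 0) :
    ∃ e g', RI ρ e g ∧ RI ρ g' g ∧ IsSelfAdjoint e ∧ ‖e‖ ≤ 1 ∧ ρ g' ≠ 0 ∧ e * g' = g' := by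
  have hn : ‖ρ (g * star g)‖ ≠ 0 := by
    rw [map_mul, map_star, CStarRing.norm_self_mul_star]
    simpa using hg
  set r : ℝ := ‖ρ (g * star g)‖⁻¹
  set k : A := (r : ℂ) • (g * star g) with hk
  have hk1 : ‖ρ k‖ = 1 := by
    rw [hk, map_smul, norm_smul]
    simp only [r, Complex.norm_real, norm_inv, norm_norm]
    exact inv_mul_cancel₀ hn
  have hks : IsSelfAdjoint k := by
    rw [hk, IsSelfAdjoint, star_smul, star_mul, star_star]; simp
  have hkg : ∀ x, RI ρ (k * x) g := by
    intro x
    have : k * x = g * ((r : ℂ) • (star g * x)) := by rw [hk]; simp only [smul_mul_assoc, mul_smul_comm, mul_assoc]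
    rw [this]; exact RI.mul ρ _ _
  have fac : ∀ f : ℝ → ℝ, Continuous f → f 0 = 0 → (∀ t, t * (f t * ri t) = f t) → cfcₙ f k = k * cfcₙ (fun t => f t * ri t) k := by
    intro f hf hf0 h
    conv_rhs => enter [1]; rw [← cfcₙ_id ℝ k hks]
    rw [← cfcₙ_mul id (fun t => f t * ri t) k continuousOn_id rfl ((hf.mul ri_cont).continuousOn) (by simp [hf0])]
    exact cfcₙ_congr fun t _ => (h t).symm
  refine ⟨cfcₙ f1 k, cfcₙ f2 k, ?_, ?_, cfcₙ_predicate f1 k, norm_cfcₙ_le fun t _ => f1_abs t, ?_, ?_⟩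
  · rw [fac f1 f1_cont f1_zero f1_fac]; exact hkg _
  · rw [fac f2 f2_cont f2_zero f2_fac]; exact hkg _
  · intro h
    have hρk : IsSelfAdjoint (ρ k) := hks.map ρ
    rw [NonUnitalStarAlgHomClass.map_cfcₙ (R := ℝ) (S := ℂ) ρ f2 k (hf := f2_cont.continuousOn) (hf₀ := f2_zero) (hφ := hcont) (ha := hks) (hφa := hρk)] at h
    have := norm_le_half hρk h
    linarith
  · rw [← cfcₙ_mul f1 f2 k f1_cont.continuousOn f1_zero f2_cont.continuousOn f2_zero]
    exact cfcₙ_congr fun t _ => f1_f2 t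

end exc
end TP

namespace TP
open Filter Topology Matrix

section exc2
variable {A : Type u} [NonUnitalCStarAlgebra A]
variable {H : Type u} [NormedAddCommGroup H] [InnerProductSpace ℂ H] [CompleteSpace H]

theorem seq_exists (ρ : A →⋆ₙₐ[ℂ] (H →L[ℂ] H)) (hcont : Continuous ρ) (h0 : ∃ a, ρ a ≠ 0) (T : ℕ → A → Prop)
    (hT : ∀ n g, ρ g ≠ 0 → ∃ g', RI ρ g' g ∧ ρ g' ≠ 0 ∧ T n g') :
    ∃ g e : ℕ → A, (∀ n, ρ (g n) ≠ 0) ∧ (∀ n, RI ρ (g (n+1)) (g n)) ∧ (∀ n, RI ρ (e n) (g n)) ∧ (∀ n, IsSelfAdjoint (e n)) ∧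
      (∀ n, ‖e n‖ ≤ 1) ∧ (∀ n η, ρ (e n) (ρ (g (n+1)) η) = ρ (g (n+1)) η) ∧ ∀ n, T n (g (n+1)) := by
  have key : ∀ n g, ρ g ≠ 0 → ∃ p : A × A, ρ p.1 ≠ 0 ∧ RI ρ p.1 g ∧ RI ρ p.2 g ∧ IsSelfAdjoint p.2 ∧ ‖p.2‖ ≤ 1 ∧
      (∀ η, ρ p.2 (ρ p.1 η) = ρ p.1 η) ∧ T n p.1 := by
    intro n g hg
    obtain ⟨e, g1, h1, h2, h3, h4, h5, h6⟩ := step0 ρ hcont hg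
    obtain ⟨g', h7, h8, h9⟩ := hT n g1 h5
    refine ⟨(g', e), h8, h7.trans h2, h1, h3, h4, fun η => ?_, h9⟩
    obtain ⟨η', hη'⟩ := h7 η
    show ρ e (ρ g' η) = ρ g' η
    rw [hη', ← map_mul_apply, h6]
  choose! F hF using key
  obtain ⟨a, ha⟩ := h0
  let g : ℕ → A := fun n => Nat.rec a (fun n g => (F n g).1) n
  have hg : ∀ n, ρ (g n) ≠ 0 := by
    intro n
    induction n with
    | zero => exact ha
    | succ n ih => exact (hF n (g n) ih).1
  refine ⟨g, fun n => (F n (g n)).2, hg, ?_, ?_, ?_, ?_, ?_, ?_⟩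
  · exact fun n => (hF n (g n) (hg n)).2.1
  · exact fun n => (hF n (g n) (hg n)).2.2.1
  · exact fun n => (hF n (g n) (hg n)).2.2.2.1
  · exact fun n => (hF n (g n) (hg n)).2.2.2.2.1
  · exact fun n => (hF n (g n) (hg n)).2.2.2.2.2.1
  · exact fun n => (hF n (g n) (hg n)).2.2.2.2.2.2

/-- An excising sequence with limit functional. -/
structure Exc (ρ : A →⋆ₙₐ[ℂ] (H →L[ℂ] H)) (g e : ℕ → A) (φ : A → ℂ) : Prop where
  ne : ∀ n, ρ (g n) ≠ 0
  anti : ∀ n m, n ≤ m → RI ρ (g m) (g n)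
  esub : ∀ n, RI ρ (e n) (g n)
  esa : ∀ n, IsSelfAdjoint (e n)
  enorm : ∀ n, ‖e n‖ ≤ 1
  eone : ∀ n m, n < m → ∀ η, ρ (e n) (ρ (g m) η) = ρ (g m) η
  conv : ∀ c, ∀ ε > 0, ∃ N, ∀ n ≥ N, ∀ η, ‖inner ℂ (ρ (g n) η) (ρ c (ρ (g n) η)) - φ c * (‖ρ (g n) η‖ ^ 2 : ℝ)‖ ≤ ε * ‖ρ (g n) η‖ ^ 2
  faith : ∀ x, IsSelfAdjoint x → ‖ρ x‖ = 1 → ∃ x', IsSelfAdjoint x' ∧ ‖x' - x‖ < 1/4 ∧ ∃ y, φ (star (cfcₙ f2 x' * y) * (cfcₙ f2 x' * y)) ≠ 0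

theorem sa_re (ρ : A →⋆ₙₐ[ℂ] (H →L[ℂ] H)) {x : A} (hx : IsSelfAdjoint x) (v : H) : inner ℂ v (ρ x v) = (((inner ℂ v (ρ x v)).re : ℝ) : ℂ) := by
  have h1 : (starRingEnd ℂ) (inner ℂ v (ρ x v)) = inner ℂ v (ρ x v) := by
    rw [inner_conj_symm]
    conv_lhs => rw [← hx.star_eq]
    rw [sinner]
  exact (Complex.conj_eq_iff_re.1 h1).symm

theorem exc_exists [TopologicalSpace.SeparableSpace A] (ρ : A →⋆ₙₐ[ℂ] (H →L[ℂ] H)) (hρ : Prm ρ) :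
    ∃ g e φ, Exc ρ g e φ := by
  have hcont := pi_cont ρ
  let d : ℕ → A := TopologicalSpace.denseSeq A
  have hd : DenseRange d := TopologicalSpace.denseRange_denseSeq A
  let x : ℕ → A := fun k => (realPart (d k) : A)
  have hx : ∀ k, IsSelfAdjoint (x k) := fun k => (realPart (d k)).2
  have hxd : ∀ c : A, IsSelfAdjoint c → ∀ ε > 0, ∃ k, ‖x k - c‖ < ε := by
    intro c hc ε hε
    obtain ⟨k, hk⟩ := hd.exists_dist_lt c hε
    refine ⟨k, ?_⟩
    have h1 : x k - c = ((realPart (d k - c) : selfAdjoint A) : A) := by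
      rw [map_sub, AddSubgroupClass.coe_sub, hc.coe_realPart]
    rw [h1]
    refine lt_of_le_of_lt (realPart.norm_le (d k - c)) ?_
    rwa [← dist_eq_norm, dist_comm]
  let T : ℕ → A → Prop := fun n g =>
    (∃ l : ℝ, ∀ η, |(inner ℂ (ρ g η) (ρ (x n.unpair.1) (ρ g η))).re - l * ‖ρ g η‖ ^ 2| ≤ (1 / ((n.unpair.2 : ℝ) + 1)) * ‖ρ g η‖ ^ 2) ∧
    (ρ (cfcₙ f2 (x n.unpair.1)) ≠ 0 → ∃ y : A, ∃ δ > 0, ∀ η, δ * ‖ρ g η‖ ^ 2 ≤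
      (inner ℂ (ρ g η) (ρ (star (cfcₙ f2 (x n.unpair.1) * y) * (cfcₙ f2 (x n.unpair.1) * y)) (ρ g η))).re)
  obtain ⟨g, e, h1, h2, h3, h4, h5, h6, h7⟩ := seq_exists ρ hcont hρ.1 T (by
    intro n g hg
    obtain ⟨g1, a1, a2, l, a3⟩ := task1 ρ (hx n.unpair.1) (ε := 1 / ((n.unpair.2 : ℝ) + 1)) (by positivity) hg
    by_cases h : ρ (cfcₙ f2 (x n.unpair.1)) ≠ 0
    · obtain ⟨g2, b1, b2, b3⟩ := task2 ρ hρ _ h a2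
      refine ⟨g2, b1.trans a1, b2, ⟨l, fun η => ?_⟩, fun _ => b3⟩
      obtain ⟨η', hη'⟩ := b1 η
      rw [hη']; exact a3 η'
    · exact ⟨g1, a1, a2, ⟨l, a3⟩, fun h' => absurd h' h⟩)
  have hanti : ∀ n m, n ≤ m → RI ρ (g m) (g n) := by
    intro n m hnm
    induction m, hnm using Nat.le_induction with
    | base => exact RI.refl ρ _
    | succ m _ ih => exact (h2 m).trans ih
  -- self-adjoint estimates
  have Qsa : ∀ c : A, IsSelfAdjoint c → ∀ ε > 0, ∃ l : ℝ, ∃ N, ∀ n ≥ N, ∀ η,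
      ‖inner ℂ (ρ (g n) η) (ρ c (ρ (g n) η)) - (l:ℂ) * (‖ρ (g n) η‖ ^ 2 : ℝ)‖ ≤ ε * ‖ρ (g n) η‖ ^ 2 := by
    intro c hc ε hε
    obtain ⟨k, hk⟩ := hxd c hc (ε/2) (by positivity)
    obtain ⟨m, hm⟩ := exists_nat_one_div_lt (show 0 < ε/2 by positivity)
    obtain ⟨l, hl⟩ := (h7 (Nat.pair k m)).1
    simp only [Nat.unpair_pair] at hl
    refine ⟨l, Nat.pair k m + 1, fun n hn η => ?_⟩
    obtain ⟨η', hη'⟩ := hanti _ _ hn η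
    rw [hη']
    have hl' := hl η'
    set v := ρ (g (Nat.pair k m + 1)) η'
    have e1 : inner ℂ v (ρ c v) - (l:ℂ) * (‖v‖ ^ 2 : ℝ) = (((inner ℂ v (ρ (x k) v)).re - l * ‖v‖ ^ 2 : ℝ) : ℂ) - inner ℂ v (ρ (x k - c) v) := by
      rw [map_sub, ContinuousLinearMap.sub_apply, inner_sub_right, Complex.ofReal_sub, ← sa_re ρ (hx k)]
      push_cast; ring
    rw [e1]
    refine (norm_sub_le _ _).trans ?_
    rw [Complex.norm_real, Real.norm_eq_abs]
    have e2 : ‖inner ℂ v (ρ (x k - c) v)‖ ≤ (ε/2) * ‖v‖ ^ 2 := by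
      refine (norm_inner_le_norm _ _).trans ?_
      have a1 := (ρ (x k - c)).le_opNorm v
      have a2 := (pi_le ρ (x k - c)).trans hk.le
      have a3 : ‖ρ (x k - c) v‖ ≤ (ε/2) * ‖v‖ := a1.trans (by gcongr)
      nlinarith [norm_nonneg v]
    have e3 : 1 / ((m:ℝ) + 1) * ‖v‖ ^ 2 ≤ (ε/2) * ‖v‖ ^ 2 := by gcongr
    linarith
  have Q : ∀ c : A, ∀ ε > 0, ∃ l : ℂ, ∃ N, ∀ n ≥ N, ∀ η,
      ‖inner ℂ (ρ (g n) η) (ρ c (ρ (g n) η)) - l * (‖ρ (g n) η‖ ^ 2 : ℝ)‖ ≤ ε * ‖ρ (g n) η‖ ^ 2 := by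
    intro c ε hε
    obtain ⟨l1, N1, a1⟩ := Qsa (realPart c : A) (realPart c).2 (ε/2) (by positivity)
    obtain ⟨l2, N2, a2⟩ := Qsa (imaginaryPart c : A) (imaginaryPart c).2 (ε/2) (by positivity)
    refine ⟨l1 + Complex.I * l2, max N1 N2, fun n hn η => ?_⟩
    have b1 := a1 n ((le_max_left _ _).trans hn) η
    have b2 := a2 n ((le_max_right _ _).trans hn) η
    set v := ρ (g n) η
    have e1 : inner ℂ v (ρ c v) - (l1 + Complex.I * l2) * (‖v‖ ^ 2 : ℝ) = (inner ℂ v (ρ (realPart c : A) v) - (l1:ℂ) * (‖v‖ ^ 2 : ℝ)) +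
        Complex.I * (inner ℂ v (ρ (imaginaryPart c : A) v) - (l2:ℂ) * (‖v‖ ^ 2 : ℝ)) := by
      conv_lhs => rw [← realPart_add_I_smul_imaginaryPart c]
      rw [map_add, map_smul, ContinuousLinearMap.add_apply, ContinuousLinearMap.smul_apply, inner_add_right, inner_smul_right]
      ring
    rw [e1]
    refine (norm_add_le _ _).trans ?_
    rw [norm_mul, Complex.norm_I, one_mul]
    linarith
  have hz : ∀ n, ∃ η, ‖ρ (g n) η‖ = 1 := by
    intro n
    obtain ⟨η, hη⟩ : ∃ η, ρ (g n) η ≠ 0 := by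
      by_contra hcon
      push Not at hcon
      exact h1 n (ContinuousLinearMap.ext hcon)
    refine ⟨((‖ρ (g n) η‖⁻¹ : ℝ) : ℂ) • η, ?_⟩
    rw [map_smul, norm_smul, Complex.norm_real, norm_inv, norm_norm]
    exact inv_mul_cancel₀ (by simpa using hη)
  choose η hη using hz
  have hlim : ∀ c, ∃ l, Tendsto (fun n => inner ℂ (ρ (g n) (η n)) (ρ c (ρ (g n) (η n)))) atTop (𝓝 l) := by
    intro c
    apply cauchySeq_tendsto_of_complete
    rw [Metric.cauchySeq_iff']
    intro ε hε
    obtain ⟨l, N, hN⟩ := Q c (ε/3) (by positivity)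
    refine ⟨N, fun n hn => ?_⟩
    have b1 := hN n hn (η n)
    have b2 := hN N le_rfl (η N)
    rw [hη] at b1 b2
    simp only [one_pow, Complex.ofReal_one, mul_one] at b1 b2
    rw [← dist_eq_norm] at b1 b2
    refine (dist_triangle_right _ _ l).trans_lt ?_
    linarith
  choose φ hφ using hlim
  refine ⟨g, e, φ, h1, hanti, h3, h4, h5, ?_, ?_, ?_⟩
  · intro n m hnm ζ
    obtain ⟨η', hη'⟩ := hanti _ _ hnm ζ
    rw [hη']; exact h6 n η'
  · intro c ε hε
    obtain ⟨l, N, hN⟩ := Q c (ε/2) (by positivity)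
    refine ⟨N, fun n hn ζ => ?_⟩
    have hl : ‖l - φ c‖ ≤ ε/2 := by
      have t1 : Tendsto (fun n => ‖l - inner ℂ (ρ (g n) (η n)) (ρ c (ρ (g n) (η n)))‖) atTop (𝓝 ‖l - φ c‖) := (tendsto_const_nhds.sub (hφ c)).norm
      refine le_of_tendsto t1 ?_
      filter_upwards [eventually_ge_atTop N] with k hk
      have b1 := hN k hk (η k)
      rw [hη] at b1
      simp only [one_pow, Complex.ofReal_one, mul_one] at b1
      rwa [norm_sub_rev]
    have b := hN n hn ζ
    set v := ρ (g n) ζ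
    have e1 : inner ℂ v (ρ c v) - φ c * (‖v‖ ^ 2 : ℝ) = (inner ℂ v (ρ c v) - l * (‖v‖ ^ 2 : ℝ)) + (l - φ c) * (‖v‖ ^ 2 : ℝ) := by ring
    rw [e1]
    refine (norm_add_le _ _).trans ?_
    rw [norm_mul, Complex.norm_real, norm_pow, norm_norm]
    have : ‖l - φ c‖ * ‖v‖ ^ 2 ≤ ε/2 * ‖v‖ ^ 2 := by gcongr
    linarith
  · intro c hc hc1
    obtain ⟨k, hk⟩ := hxd c hc (1/4) (by norm_num)
    refine ⟨x k, hx k, hk, ?_⟩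
    have hne : ρ (cfcₙ f2 (x k)) ≠ 0 := by
      intro h
      have hρk : IsSelfAdjoint (ρ (x k)) := (hx k).map ρ
      rw [NonUnitalStarAlgHomClass.map_cfcₙ (R := ℝ) (S := ℂ) ρ f2 (x k) (hf := f2_cont.continuousOn) (hf₀ := f2_zero) (hφ := hcont) (ha := hx k) (hφa := hρk)] at h
      have a1 := norm_le_half hρk h
      have a2 := pi_le ρ (x k - c)
      rw [map_sub] at a2
      have a3 := norm_sub_norm_le (ρ c) (ρ (x k))
      rw [norm_sub_rev] at a3
      linarith
    have a := (h7 (Nat.pair k 0)).2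
    simp only [Nat.unpair_pair] at a
    obtain ⟨y, δ, hδ, hy⟩ := a hne
    refine ⟨y, fun h0 => ?_⟩
    have t := hφ (star (cfcₙ f2 (x k) * y) * (cfcₙ f2 (x k) * y))
    rw [h0] at t
    have t2 := (Complex.continuous_re.tendsto _).comp t
    have : δ ≤ (0:ℂ).re := by
      refine ge_of_tendsto t2 ?_
      filter_upwards [eventually_ge_atTop (Nat.pair k 0 + 1)] with n hn
      obtain ⟨η', hη'⟩ := hanti _ _ hn (η n)
      have b := hy η'
      rw [← hη', hη] at b
      simpa using b
    simp at this
    linarith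

end exc2
end TP

namespace TP
open Filter Topology Matrix

section gnssec
variable {A : Type u} [NonUnitalCStarAlgebra A]

open scoped ComplexOrder in
theorem gns (φ : A →ₗ[ℂ] ℂ) (hpos : ∀ a, 0 ≤ φ (star a * a)) :
    ∃ (H : Type u) (_ : NormedAddCommGroup H) (_ : InnerProductSpace ℂ H) (_ : CompleteSpace H) (σ : A →⋆ₙₐ[ℂ] (H →L[ℂ] H)) (S : A →ₗ[ℂ] H),
      DenseRange S ∧ (∀ a b, inner ℂ (S a) (S b) = φ (star a * b)) ∧ ∀ a b, σ a (S b) = S (a * b) := by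
  letI : PartialOrder A := CStarAlgebra.spectralOrder A
  haveI : StarOrderedRing A := CStarAlgebra.spectralOrderedRing A
  let f : A →ₚ[ℂ] ℂ := PositiveLinearMap.mk₀ φ (by
    intro a ha
    obtain ⟨b, rfl⟩ := CStarAlgebra.nonneg_iff_eq_star_mul_self.1 ha
    exact hpos b)
  refine ⟨f.GNS, inferInstance, inferInstance, inferInstance, f.gnsNonUnitalStarAlgHom,
    (UniformSpace.Completion.toComplL (𝕜 := ℂ) (E := f.PreGNS)).toLinearMap ∘ₗ f.toPreGNS.toLinearMap, ?_, ?_, ?_⟩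
  · exact UniformSpace.Completion.denseRange_coe (α := f.PreGNS)
  · intro a b
    exact UniformSpace.Completion.inner_coe (f.toPreGNS a) (f.toPreGNS b)
  · intro a b
    exact f.gnsNonUnitalStarAlgHom_apply_coe (a := a) (b := f.toPreGNS b)

variable {H : Type u} [NormedAddCommGroup H] [InnerProductSpace ℂ H] [CompleteSpace H]
variable {ρ : A →⋆ₙₐ[ℂ] (H →L[ℂ] H)} {g e : ℕ → A} {φ : A → ℂ}

theorem unit_ran {T : H →L[ℂ] H} (h : T ≠ 0) : ∃ η, ‖T η‖ = 1 := by
  obtain ⟨η, hη⟩ : ∃ η, T η ≠ 0 := by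
    by_contra hcon
    push Not at hcon
    exact h (ContinuousLinearMap.ext hcon)
  refine ⟨((‖T η‖⁻¹ : ℝ) : ℂ) • η, ?_⟩
  rw [map_smul, norm_smul, Complex.norm_real, norm_inv, norm_norm]
  exact inv_mul_cancel₀ (by simpa using hη)

theorem Exc.lim (E : Exc ρ g e φ) (η : ℕ → H) (hη : ∀ n, ‖ρ (g n) (η n)‖ = 1) (c : A) :
    Tendsto (fun n => inner ℂ (ρ (g n) (η n)) (ρ c (ρ (g n) (η n)))) atTop (𝓝 (φ c)) := by
  rw [Metric.tendsto_atTop]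
  intro ε hε
  obtain ⟨N, hN⟩ := E.conv c (ε/2) (by positivity)
  refine ⟨N, fun n hn => ?_⟩
  have := hN n hn (η n)
  rw [hη] at this
  simp only [one_pow, Complex.ofReal_one, mul_one] at this
  rw [dist_eq_norm]
  linarith

theorem polar (T : H →L[ℂ] H) (c : ℂ) (V : Submodule ℂ H) {ε : ℝ} (h : ∀ v ∈ V, ‖inner ℂ v (T v) - c * (‖v‖ ^ 2 : ℝ)‖ ≤ ε * ‖v‖ ^ 2)
    (hε : 0 ≤ ε) (v w : H) (hv : v ∈ V) (hw : w ∈ V) : ‖inner ℂ v (T w) - c * inner ℂ v w‖ ≤ ε * (‖v‖ + ‖w‖) ^ 2 := by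
  set T' : H →L[ℂ] H := T - c • 1 with hT
  have hq : ∀ v w, inner ℂ v (T' w) = inner ℂ v (T w) - c * inner ℂ v w := by
    intro v w
    simp [hT, inner_sub_right, inner_smul_right]
  have h' : ∀ v ∈ V, ‖inner ℂ v (T' v)‖ ≤ ε * ‖v‖ ^ 2 := by
    intro v hv
    rw [hq, inner_self_eq_norm_sq_to_K]
    convert h v hv using 3
    push_cast
    rfl
  rw [← hq]
  have pol : 4 * inner ℂ v (T' w) = inner ℂ (v + w) (T' (v + w)) - inner ℂ (v - w) (T' (v - w))
      - Complex.I * inner ℂ (v + Complex.I • w) (T' (v + Complex.I • w)) + Complex.I * inner ℂ (v - Complex.I • w) (T' (v - Complex.I • w)) := by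
    simp only [map_add, map_sub, map_smul, inner_add_left, inner_add_right, inner_sub_left, inner_sub_right, inner_smul_left, inner_smul_right, Complex.conj_I]
    ring_nf
    simp only [Complex.I_sq, pow_succ, pow_zero, one_mul, Complex.I_mul_I]
    ring
  have b : ∀ x ∈ V, ‖x‖ ≤ ‖v‖ + ‖w‖ → ‖inner ℂ x (T' x)‖ ≤ ε * (‖v‖ + ‖w‖) ^ 2 := by
    intro x hx hn
    refine (h' x hx).trans ?_
    gcongr
  have nI : ‖Complex.I • w‖ = ‖w‖ := by rw [norm_smul, Complex.norm_I, one_mul]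
  have hIw := V.smul_mem Complex.I hw
  have b1 := b _ (V.add_mem hv hw) (norm_add_le _ _)
  have b2 := b _ (V.sub_mem hv hw) (norm_sub_le _ _)
  have b3 := b _ (V.add_mem hv hIw) ((norm_add_le _ _).trans (by rw [nI]))
  have b4 := b _ (V.sub_mem hv hIw) ((norm_sub_le _ _).trans (by rw [nI]))
  have n4 : ‖(4:ℂ) * inner ℂ v (T' w)‖ = 4 * ‖inner ℂ v (T' w)‖ := by rw [norm_mul]; norm_num
  have : 4 * ‖inner ℂ v (T' w)‖ ≤ 4 * (ε * (‖v‖ + ‖w‖) ^ 2) := by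
    rw [← n4, pol]
    refine (norm_add_le _ _).trans ?_
    rw [norm_mul, Complex.norm_I, one_mul]
    have c1 := norm_sub_le (inner ℂ (v + w) (T' (v + w)) - inner ℂ (v - w) (T' (v - w))) (Complex.I * inner ℂ (v + Complex.I • w) (T' (v + Complex.I • w)))
    rw [norm_mul, Complex.norm_I, one_mul] at c1
    have c2 := norm_sub_le (inner ℂ (v + w) (T' (v + w))) (inner ℂ (v - w) (T' (v - w)))
    linarith
  linarith

theorem Exc.polar (E : Exc ρ g e φ) (c : A) {ε : ℝ} (hε : 0 < ε) : ∃ N, ∀ n ≥ N, ∀ η η',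
    ‖inner ℂ (ρ (g n) η) (ρ c (ρ (g n) η')) - φ c * inner ℂ (ρ (g n) η) (ρ (g n) η')‖ ≤ ε * (‖ρ (g n) η‖ + ‖ρ (g n) η'‖) ^ 2 := by
  obtain ⟨N, hN⟩ := E.conv c ε hε
  refine ⟨N, fun n hn η η' => ?_⟩
  refine TP.polar (ρ c) (φ c) (LinearMap.range (ρ (g n)).toLinearMap) ?_ hε.le _ _ ⟨η, rfl⟩ ⟨η', rfl⟩
  rintro _ ⟨ζ, rfl⟩
  exact hN n hn ζ

open scoped ComplexOrder in
theorem exc_gns (E : Exc ρ g e φ) :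
    ∃ (K : Type u) (_ : NormedAddCommGroup K) (_ : InnerProductSpace ℂ K) (_ : CompleteSpace K) (σ : A →⋆ₙₐ[ℂ] (K →L[ℂ] K)) (ξ : K),
      Irr σ ∧ (∀ a, σ a = 0 ↔ ρ a = 0) ∧ DenseRange (fun a => σ a ξ) ∧ ∀ a, inner ℂ ξ (σ a ξ) = φ a := by
  have hz := fun n => unit_ran (E.ne n)
  choose η hη using hz
  have L := E.lim η hη
  -- basic properties of the functional
  have Ladd : ∀ a b, φ (a + b) = φ a + φ b := by
    intro a b
    refine tendsto_nhds_unique (L (a + b)) (((L a).add (L b)).congr fun n => ?_)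
    rw [map_add, ContinuousLinearMap.add_apply, inner_add_right]
  have Lsmul : ∀ (r : ℂ) a, φ (r • a) = r • φ a := by
    intro r a
    refine tendsto_nhds_unique (L (r • a)) (((L a).const_mul r).congr fun n => ?_)
    rw [map_smul, ContinuousLinearMap.smul_apply, inner_smul_right]
  let φl : A →ₗ[ℂ] ℂ := { toFun := φ, map_add' := Ladd, map_smul' := Lsmul }
  have Lpos : ∀ a, 0 ≤ φl (star a * a) := by
    intro a
    refine ge_of_tendsto' (L (star a * a)) fun n => ?_
    rw [map_mul_apply, sinner', inner_self_eq_norm_sq_to_K]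
    have h1 : (0:ℝ) ≤ ‖ρ a (ρ (g n) (η n))‖ ^ 2 := by positivity
    convert Complex.zero_le_real.2 h1 using 1
    simp
  have Lle : ∀ a, ‖φ (star a * a)‖ ≤ ‖ρ a‖ ^ 2 := by
    intro a
    refine le_of_tendsto' (L (star a * a)).norm fun n => ?_
    rw [map_mul_apply, sinner']
    refine (norm_inner_le_norm _ _).trans ?_
    have := (ρ a).le_opNorm (ρ (g n) (η n))
    rw [hη, mul_one] at this
    rw [sq]
    gcongr
  have Lzero : ∀ a, ρ a = 0 → φ a = 0 := by
    intro a ha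
    refine tendsto_nhds_unique (L a) ?_
    simp [ha]
  have ee : ∀ n, ∀ᶠ m in atTop, ρ (e n) (ρ (g m) (η m)) = ρ (g m) (η m) := by
    intro n
    filter_upwards [eventually_gt_atTop n] with m hm using E.eone n m hm _
  have Ler : ∀ n a, φ (a * e n) = φ a := by
    intro n a
    refine tendsto_nhds_unique (L (a * e n)) ((L a).congr' ?_)
    filter_upwards [ee n] with m hm
    rw [map_mul_apply, hm]
  have Lel : ∀ n a, φ (e n * a) = φ a := by
    intro n a
    refine tendsto_nhds_unique (L (e n * a)) ((L a).congr' ?_)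
    filter_upwards [ee n] with m hm
    have : star (e n) = e n := (E.esa n).star_eq
    rw [map_mul_apply, ← this, sinner', hm]
  obtain ⟨K, i1, i2, i3, σ, S, hS, hSi, hσ⟩ := gns φl Lpos
  have hSi' : ∀ a b, inner ℂ (S a) (S b) = φ (star a * b) := hSi
  have sd : ∀ v w : K, (∀ a, inner ℂ (S a) v = inner ℂ (S a) w) → v = w := by
    intro v w h
    rw [← sub_eq_zero]
    have hc : ∀ u : K, inner ℂ u (v - w) = 0 := by
      intro u
      refine hS.induction_on (p := fun u => inner ℂ u (v - w) = 0) u (isClosed_eq (by fun_prop) continuous_const) fun a => ?_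
      rw [inner_sub_right, h, sub_self]
    exact inner_self_eq_zero.1 (hc _)
  have Sre : ∀ n a, S (a * e n) = S a := by
    intro n a
    apply sd
    intro b
    rw [hSi', hSi', ← mul_assoc, Ler]
  have See : ∀ n, S (e n) = S (e 0) := by
    intro n
    apply sd
    intro b
    rw [hSi', hSi', Ler, Ler]
  set ξ : K := S (e 0) with hξ
  have σξ : ∀ a, σ a ξ = S a := by
    intro a
    rw [hσ, Sre]
  have ξS : ∀ a, inner ℂ ξ (S a) = φ a := by
    intro a
    rw [hξ, hSi', (E.esa 0).star_eq, Lel]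
  have Snorm : ∀ a, ‖S a‖ ≤ ‖ρ a‖ := by
    intro a
    have h1 : ‖S a‖ ^ 2 ≤ ‖ρ a‖ ^ 2 := by
      refine le_trans (le_of_eq ?_) (Lle a)
      rw [← hSi', inner_self_eq_norm_sq_to_K, norm_pow]
      simp
    exact (sq_le_sq₀ (norm_nonneg _) (norm_nonneg _)).1 h1
  have hσ0 : ∀ a, ρ a = 0 → σ a = 0 := by
    intro a ha
    ext v
    refine hS.induction_on (p := fun v => σ a v = (0 : K →L[ℂ] K) v) v (isClosed_eq (by fun_prop) (by fun_prop)) fun b => ?_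
    rw [hσ]
    have h1 : ‖S (a * b)‖ ≤ 0 := (Snorm _).trans (by rw [map_mul, ha, zero_mul, norm_zero])
    simpa using h1
  have hσ1 : ∀ x, IsSelfAdjoint x → σ x = 0 → ρ x = 0 := by
    intro x hx h0
    by_contra hne
    have hn : ‖ρ x‖ ≠ 0 := by simpa using hne
    set r : ℝ := ‖ρ x‖⁻¹ with hr
    have hs : IsSelfAdjoint ((r : ℂ) • x) := by
      rw [IsSelfAdjoint, star_smul, hx.star_eq]; simp
    have hs1 : ‖ρ ((r : ℂ) • x)‖ = 1 := by
      rw [map_smul, norm_smul, Complex.norm_real, hr, norm_inv, norm_norm]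
      exact inv_mul_cancel₀ hn
    obtain ⟨x', hx', hd, y, hy⟩ := E.faith _ hs hs1
    apply hy
    have hσx : ‖σ x'‖ ≤ 1/2 := by
      have h2 : σ x' = σ (x' - (r : ℂ) • x) := by rw [map_sub, map_smul, h0]; simp
      rw [h2]
      refine (pi_le σ _).trans ?_
      linarith
    have hσs : IsSelfAdjoint (σ x') := hx'.map σ
    have h3 : σ (cfcₙ f2 x') = 0 := by
      rw [NonUnitalStarAlgHomClass.map_cfcₙ (R := ℝ) (S := ℂ) σ f2 x' (hf := f2_cont.continuousOn) (hf₀ := f2_zero) (hφ := pi_cont σ) (ha := hx') (hφa := hσs)]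
      exact f2_eq_zero hσs hσx
    rw [← hSi', ← hσ, h3]
    simp
  have hker : ∀ a, σ a = 0 ↔ ρ a = 0 := by
    intro a
    refine ⟨fun h => ?_, hσ0 a⟩
    have h1 := hσ1 (star a * a) (IsSelfAdjoint.star_mul_self a) (by rw [map_mul, h, mul_zero])
    rw [map_mul, map_star] at h1
    exact CStarRing.star_mul_self_eq_zero_iff _ |>.1 h1
  refine ⟨K, i1, i2, i3, σ, ξ, ⟨?_, ?_⟩, hker, ?_, ?_⟩
  · exact ⟨g 0, fun h => E.ne 0 ((hker _).1 h)⟩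
  · intro M hM hinv
    haveI : CompleteSpace M := hM.completeSpace_coe
    set P := M.starProjection with hP
    have hcomm := proj_comm (fun a => σ a) (fun a => map_star σ a) M hinv
    have hcomm' : ∀ a v, P (σ a v) = σ a (P v) := fun a v => congrArg (fun T : K →L[ℂ] K => T v) (hcomm a)
    have hen : ∀ n, σ (e n) (P ξ) = P ξ := by
      intro n
      rw [← hcomm', σξ, See]
    have key : ∀ a, inner ℂ (P ξ) (S a) = φ a * inner ℂ (P ξ) ξ := by
      intro a
      have small : ∀ ε > 0, ‖inner ℂ (P ξ) (S a) - φ a * inner ℂ (P ξ) ξ‖ ≤ ‖P ξ‖ * (4 * ε) := by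
        intro ε hε
        obtain ⟨N, hN⟩ := E.polar a hε
        set x : A := e N * a * e N - φ a • (e N * e N) with hx
        have hxn : ‖ρ x‖ ≤ 4 * ε := by
          have hb : ∀ v w : H, ‖v‖ ≤ 1 → ‖w‖ ≤ 1 → ‖inner ℂ v (ρ x w)‖ ≤ 4 * ε := by
            intro v w hv hw
            obtain ⟨v', hv'⟩ := E.esub N v
            obtain ⟨w', hw'⟩ := E.esub N w
            have h1 := hN N le_rfl v' w'
            rw [← hv', ← hw'] at h1
            have h2 : inner ℂ v (ρ x w) = inner ℂ (ρ (e N) v) (ρ a (ρ (e N) w)) - φ a * inner ℂ (ρ (e N) v) (ρ (e N) w) := by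
              rw [← sinner', ← sinner', (E.esa N).star_eq, hx, map_sub, map_smul, ContinuousLinearMap.sub_apply, ContinuousLinearMap.smul_apply,
                inner_sub_right, inner_smul_right, mul_assoc, map_mul_apply, map_mul_apply, map_mul_apply]
            rw [h2]
            refine h1.trans ?_
            have h3 : ∀ u : H, ‖u‖ ≤ 1 → ‖ρ (e N) u‖ ≤ 1 := by
              intro u hu
              refine ((ρ (e N)).le_opNorm u).trans ?_
              exact mul_le_one₀ ((pi_le ρ _).trans (E.enorm N)) (norm_nonneg _) hu
            have h4 := h3 v hv
            have h5 := h3 w hw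
            have h6 : (‖ρ (e N) v‖ + ‖ρ (e N) w‖) ^ 2 ≤ 4 := by nlinarith [norm_nonneg (ρ (e N) v), norm_nonneg (ρ (e N) w)]
            nlinarith
          refine ContinuousLinearMap.opNorm_le_of_unit_norm (𝕜 := ℂ) (by positivity) fun w hw => ?_
          by_cases h0 : ρ x w = 0
          · rw [h0, norm_zero]; positivity
          have hne : ‖ρ x w‖ ≠ 0 := by simpa using h0
          have h1 := hb (((‖ρ x w‖⁻¹ : ℝ) : ℂ) • ρ x w) w (by
            rw [norm_smul, Complex.norm_real, norm_inv, norm_norm, inv_mul_cancel₀ hne]) hw.le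
          rw [inner_smul_left, inner_self_eq_norm_sq_to_K, norm_mul, RCLike.norm_conj, Complex.norm_real, norm_inv, norm_norm, norm_pow] at h1
          simp only [Complex.coe_algebraMap, Complex.norm_real, norm_norm] at h1
          rwa [sq, ← mul_assoc, inv_mul_cancel₀ hne, one_mul] at h1
        have h1 : inner ℂ (P ξ) (S x) = inner ℂ (P ξ) (S a) - φ a * inner ℂ (P ξ) ξ := by
          rw [hx, map_sub, map_smul, inner_sub_right, inner_smul_right, Sre, Sre, See, ← hσ]
          congr 1
          conv_lhs => rw [← (E.esa N).star_eq, sinner', hen]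
        rw [← h1]
        exact (norm_inner_le_norm _ _).trans (by gcongr; exact (Snorm x).trans hxn)
      have h0 : ‖inner ℂ (P ξ) (S a) - φ a * inner ℂ (P ξ) ξ‖ ≤ 0 := by
        refine le_of_forall_pos_le_add fun ε hε => ?_
        have h1 := small (ε / (4 * (‖P ξ‖ + 1))) (by positivity)
        refine h1.trans ?_
        have h2 : 0 < ‖P ξ‖ + 1 := by positivity
        rw [show ‖P ξ‖ * (4 * (ε / (4 * (‖P ξ‖ + 1)))) = (‖P ξ‖ / (‖P ξ‖ + 1)) * ε by field_simp]
        have h3 : ‖P ξ‖ / (‖P ξ‖ + 1) ≤ 1 := by rw [div_le_one h2]; linarith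
        nlinarith
      rw [← sub_eq_zero]
      simpa using h0
    have hPξ : P ξ = (starRingEnd ℂ (inner ℂ (P ξ) ξ)) • ξ := by
      apply sd
      intro a
      rw [inner_smul_right, ← inner_conj_symm (S a) (P ξ), key, map_mul, ← ξS, inner_conj_symm (S a) ξ, mul_comm]
    refine scalar_proj M (starRingEnd ℂ (inner ℂ (P ξ) ξ)) fun v => ?_
    refine hS.induction_on (p := fun v => M.starProjection v = (starRingEnd ℂ (inner ℂ (P ξ) ξ)) • v) v (isClosed_eq (by fun_prop) (by fun_prop)) fun a => ?_
    rw [← σξ, ← hP, hcomm', hPξ]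
    rw [map_smul, ← hPξ]
  · have : (fun a => σ a ξ) = S := funext σξ
    rw [this]; exact hS
  · intro a
    rw [σξ, ξS]

end gnssec
end TP

namespace TP
open Filter Topology Matrix

section comb
variable {A B X : Type u} [NonUnitalCStarAlgebra A] [NonUnitalCStarAlgebra B] [NonUnitalNormedRing X] [StarRing X] [NormedSpace ℂ X] [CompleteSpace X] [IsScalarTower ℂ X X] [SMulCommClass ℂ X X]
  {NA : ∀ p : ℕ, Matrix (Fin p) (Fin p) A → ℝ} {NB : ∀ p : ℕ, Matrix (Fin p) (Fin p) B → ℝ} {ι : (A ⊗[ℂ] B) →ₗ[ℂ] X}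
variable {H : Type u} [NormedAddCommGroup H] [InnerProductSpace ℂ H] [CompleteSpace H]

theorem mixed_lim {ρ1 : A →⋆ₙₐ[ℂ] (H →L[ℂ] H)} {ρ2 : B →⋆ₙₐ[ℂ] (H →L[ℂ] H)} (hcomm : ∀ a b, ρ1 a * ρ2 b = ρ2 b * ρ1 a)
    {g e : ℕ → A} {φ : A → ℂ} {f k : ℕ → B} {ψ : B → ℂ} (E1 : Exc ρ1 g e φ) (E2 : Exc ρ2 f k ψ) (η : ℕ → H)
    (hη : ∀ n, ‖ρ1 (g n) (ρ2 (f n) (η n))‖ = 1) (a : A) (b : B) :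
    Tendsto (fun n => inner ℂ (ρ1 (g n) (ρ2 (f n) (η n))) (ρ1 a (ρ2 b (ρ1 (g n) (ρ2 (f n) (η n)))))) atTop (𝓝 (φ a * ψ b)) := by
  have hc : ∀ a b v, ρ1 a (ρ2 b v) = ρ2 b (ρ1 a v) := fun a b v => congrArg (fun T : H →L[ℂ] H => T v) (hcomm a b)
  have t2 : Tendsto (fun n => φ a * inner ℂ (ρ1 (g n) (ρ2 (f n) (η n))) (ρ2 b (ρ1 (g n) (ρ2 (f n) (η n))))) atTop (𝓝 (φ a * ψ b)) := by
    have := (E2.lim (fun n => ρ1 (g n) (η n)) (fun n => by rw [← hc]; exact hη n) b).const_mul (φ a)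
    refine this.congr fun n => ?_
    simp only [hc]
  have t1 : Tendsto (fun n => inner ℂ (ρ1 (g n) (ρ2 (f n) (η n))) (ρ1 a (ρ2 b (ρ1 (g n) (ρ2 (f n) (η n))))) -
      φ a * inner ℂ (ρ1 (g n) (ρ2 (f n) (η n))) (ρ2 b (ρ1 (g n) (ρ2 (f n) (η n))))) atTop (𝓝 0) := by
    rw [Metric.tendsto_atTop]
    intro ε hε
    obtain ⟨N, hN⟩ := E1.polar a (ε := ε / (2 * (1 + ‖b‖) ^ 2)) (by positivity)
    refine ⟨N, fun n hn => ?_⟩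
    have h1 := hN n hn (ρ2 (f n) (η n)) (ρ2 b (ρ2 (f n) (η n)))
    rw [hc (g n) b, hη] at h1
    rw [dist_zero_right]
    refine h1.trans_lt ?_
    have h2 : ‖ρ2 b (ρ1 (g n) (ρ2 (f n) (η n)))‖ ≤ ‖b‖ := by
      refine ((ρ2 b).le_opNorm _).trans ?_
      rw [hη, mul_one]
      exact pi_le ρ2 b
    calc ε / (2 * (1 + ‖b‖) ^ 2) * (1 + ‖ρ2 b (ρ1 (g n) (ρ2 (f n) (η n)))‖) ^ 2 ≤ ε / (2 * (1 + ‖b‖) ^ 2) * (1 + ‖b‖) ^ 2 := by gcongr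
      _ = ε / 2 := by
        have : (1 + ‖b‖) ≠ 0 := by positivity
        field_simp
      _ < ε := by linarith
  have := t1.add t2
  rw [zero_add] at this
  refine this.congr fun n => ?_
  ring

/-- matrix coefficient functional. -/
def mcoef {K : Type*} [NormedAddCommGroup K] [InnerProductSpace ℂ K] [CompleteSpace K] (P : X →L[ℂ] (K →L[ℂ] K)) (v w : K) : X →L[ℂ] ℂ :=
  (innerSL ℂ v) ∘L (ContinuousLinearMap.apply ℂ K w) ∘L P

theorem mcoef_apply {K : Type*} [NormedAddCommGroup K] [InnerProductSpace ℂ K] [CompleteSpace K] (P : X →L[ℂ] (K →L[ℂ] K)) (v w : K) (x : X) :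
    mcoef P v w x = inner ℂ v (P x w) := rfl

theorem prim_forw (hNA : ∀ p, IsCStarNorm (NA p)) (hNB : ∀ p, IsCStarNorm (NB p)) (hX : IsTensorCompletion (osProjNorm NA NB) X ι)
    [TopologicalSpace.SeparableSpace A] [TopologicalSpace.SeparableSpace B] (K : TwoSidedIdeal X) (hK : IsClosed (K : Set X)) (hp : IsPrimitiveIdeal K) :
    ∃ (E : TwoSidedIdeal A) (F : TwoSidedIdeal B), IsPrimitiveIdeal E ∧ IsPrimitiveIdeal F ∧
      (K : Set X) = tensorIdeal ι Set.univ (F : Set B) + tensorIdeal ι (E : Set A) Set.univ := by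
  obtain ⟨H, _, _, _, π, hc, hi, hKπ⟩ := prim_irr hp
  obtain ⟨ρ1, ρ2, hπ, hcomm, p1, p2, hne⟩ := split_rep hNA hNB hX π hc hi
  have hcm : ∀ a b v, ρ1 a (ρ2 b v) = ρ2 b (ρ1 a v) := fun a b v => congrArg (fun T : H →L[ℂ] H => T v) (hcomm a b)
  obtain ⟨g, e, φ, E1⟩ := exc_exists ρ1 p1
  obtain ⟨f, k, ψ, E2⟩ := exc_exists ρ2 p2
  obtain ⟨H1, _, _, _, σ1, ξ1, i1, k1, d1, v1⟩ := exc_gns E1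
  obtain ⟨H2, _, _, _, σ2, ξ2, i2, k2, d2, v2⟩ := exc_gns E2
  obtain ⟨E, hE⟩ := ker_ideal σ1
  obtain ⟨F, hF⟩ := ker_ideal σ2
  refine ⟨E, F, irr_prim σ1 (pi_cont σ1) i1 E hE, irr_prim σ2 (pi_cont σ2) i2 F hF, ?_⟩
  have hEs : (E : Set A) = {a | σ1 a = 0} := Set.ext hE
  have hFs : (F : Set B) = {b | σ2 b = 0} := Set.ext hF
  let πc : X →L[ℂ] (H →L[ℂ] H) := ⟨{ toFun := π, map_add' := map_add π, map_smul' := map_smul π }, hc⟩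
  have hπc : ∀ x, πc x = π x := fun x => rfl
  apply Set.Subset.antisymm
  · intro z hz
    have hz0 : π z = 0 := (hKπ z).1 hz
    rw [hEs, hFs, ← kil_iff hNA hNB hX σ1 σ2]
    obtain ⟨τ1, τ2, P, ht1, ht2, hP, hPk⟩ := tens_clm hNA hNB hX σ1 σ2
    rw [← hPk]
    have hu : ∀ n, ∃ η, ‖ρ1 (g n) (ρ2 (f n) η)‖ = 1 := by
      intro n
      have : ρ1 (g n) * ρ2 (f n) ≠ 0 := by
        intro h
        rcases hne _ _ h with h | h
        · exact E1.ne n h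
        · exact E2.ne n h
      exact unit_ran this
    choose η hη using hu
    let ζ : ℕ → H := fun n => ρ1 (g n) (ρ2 (f n) (η n))
    have hζ : ∀ n, ‖ζ n‖ = 1 := hη
    have core : ∀ s s' t t', inner ℂ (tt (σ1 s ξ1) (σ2 s' ξ2)) (P z (tt (σ1 t ξ1) (σ2 t' ξ2))) = 0 := by
      intro s s' t t'
      have hb : ∀ (a : A) (b : B) n, ‖ρ1 a (ρ2 b (ζ n))‖ ≤ ‖a‖ * ‖b‖ := by
        intro a b n
        have h1 := (ρ1 a).le_opNorm (ρ2 b (ζ n))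
        have h2 := (ρ2 b).le_opNorm (ζ n)
        rw [hζ, mul_one] at h2
        refine h1.trans ?_
        have h3 := pi_le ρ1 a
        have h4 := h2.trans (pi_le ρ2 b)
        gcongr
      refine X_lim hX (l := atTop) (fun n => mcoef πc (ρ1 s (ρ2 s' (ζ n))) (ρ1 t (ρ2 t' (ζ n)))) (mcoef P (tt (σ1 s ξ1) (σ2 s' ξ2)) (tt (σ1 t ξ1) (σ2 t' ξ2)))
        (C := ‖s‖ * ‖s'‖ * (‖πc‖ * (‖t‖ * ‖t'‖))) ?_ ?_ z ?_
      · intro n x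
        rw [mcoef_apply]
        refine (norm_inner_le_norm _ _).trans ?_
        have h1 := (πc x).le_opNorm (ρ1 t (ρ2 t' (ζ n)))
        have h2 := πc.le_opNorm x
        have h3 := hb s s' n
        have h4 := hb t t' n
        calc _ ≤ (‖s‖ * ‖s'‖) * ((‖πc‖ * ‖x‖) * (‖t‖ * ‖t'‖)) := by
              refine mul_le_mul h3 (h1.trans ?_) (norm_nonneg _) (by positivity)
              gcongr
          _ = _ := by ring
      · intro a b
        have h1 := mixed_lim hcomm E1 E2 η hη (star s * (a * t)) (star s' * (b * t'))
        have h2 : mcoef P (tt (σ1 s ξ1) (σ2 s' ξ2)) (tt (σ1 t ξ1) (σ2 t' ξ2)) (ι (a ⊗ₜ b)) = φ (star s * (a * t)) * ψ (star s' * (b * t')) := by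
          rw [mcoef_apply, hP, ContinuousLinearMap.mul_apply, ht2, ht1, tt_inner, ← v1, ← v2]
          simp only [map_mul_apply, sinner']
        rw [h2]
        refine h1.congr fun n => ?_
        rw [mcoef_apply, hπc, hπ, ContinuousLinearMap.mul_apply]
        simp only [map_mul_apply, ζ]
        rw [hcm s s', ← sinner' ρ2 s', ← sinner' ρ1 s]
        simp only [hcm]
      · intro n
        rw [mcoef_apply, hπc, hz0]
        simp
    refine ht_opext fun u u' w w' => ?_
    rw [ContinuousLinearMap.zero_apply, inner_zero_right]
    have c1 : ∀ s s' t w', inner ℂ (tt (σ1 s ξ1) (σ2 s' ξ2)) (P z (tt (σ1 t ξ1) w')) = 0 := by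
      intro s s' t w'
      refine d2.induction_on (p := fun w' => inner ℂ (tt (σ1 s ξ1) (σ2 s' ξ2)) (P z (tt (σ1 t ξ1) w')) = 0) w' (isClosed_eq ?_ continuous_const) (core s s' t)
      simp only [← ttL_apply]; fun_prop
    have c2 : ∀ s s' w w', inner ℂ (tt (σ1 s ξ1) (σ2 s' ξ2)) (P z (tt w w')) = 0 := by
      intro s s' w w'
      refine d1.induction_on (p := fun w => inner ℂ (tt (σ1 s ξ1) (σ2 s' ξ2)) (P z (tt w w')) = 0) w (isClosed_eq ?_ continuous_const) (fun t => c1 s s' t w')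
      simp only [← ttL_apply]; fun_prop
    have c3 : ∀ s u' w w', inner ℂ (tt (σ1 s ξ1) u') (P z (tt w w')) = 0 := by
      intro s u' w w'
      refine d2.induction_on (p := fun u' => inner ℂ (tt (σ1 s ξ1) u') (P z (tt w w')) = 0) u' (isClosed_eq ?_ continuous_const) (fun s' => c2 s s' w w')
      simp only [← ttL_apply]; fun_prop
    refine d1.induction_on (p := fun u => inner ℂ (tt u u') (P z (tt w w')) = 0) u (isClosed_eq ?_ continuous_const) (fun s => c3 s u' w w')
    simp only [← ttL_apply]; fun_prop
  · rintro _ ⟨y, hy, y', hy', rfl⟩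
    let Kπ : Submodule ℂ X := LinearMap.ker πc.toLinearMap
    have hcl : IsClosed (Kπ : Set X) := πc.isClosed_ker
    rw [← tI_coe] at hy hy'
    have m1 : y ∈ Kπ := by
      refine tI_ind Kπ hcl (fun a _ b hb => ?_) hy
      show π (ι (a ⊗ₜ b)) = 0
      have : ρ2 b = 0 := (k2 b).1 ((hF b).1 hb)
      rw [hπ, this, mul_zero]
    have m2 : y' ∈ Kπ := by
      refine tI_ind Kπ hcl (fun a ha b _ => ?_) hy'
      show π (ι (a ⊗ₜ b)) = 0
      have : ρ1 a = 0 := (k1 a).1 ((hE a).1 ha)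
      rw [hπ, this, zero_mul]
    exact (hKπ _).2 (Kπ.add_mem m1 m2)

end comb
end TP

/-- For separable C⋆-algebras `A` and `B`, a closed two-sided ideal `K` of
`A ⊗̂ B` is primitive if and only if `K = A ⊗̂ F + E ⊗̂ B` for some primitive ideals `E` of
`A` and `F` of `B`. -/
theorem primitive_iff_of_separable {A B X : Type u} [NonUnitalCStarAlgebra A] [NonUnitalCStarAlgebra B]
    [NonUnitalNormedRing X] [StarRing X] [NormedSpace ℂ X] [CompleteSpace X]
    [IsScalarTower ℂ X X] [SMulCommClass ℂ X X]
    (NA : ∀ p : ℕ, Matrix (Fin p) (Fin p) A → ℝ)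
    (NB : ∀ q : ℕ, Matrix (Fin q) (Fin q) B → ℝ)
    (hNA : ∀ p, IsCStarNorm (NA p)) (hNB : ∀ q, IsCStarNorm (NB q))
    (ι : A ⊗[ℂ] B →ₗ[ℂ] X) (hX : IsTensorCompletion (osProjNorm NA NB) X ι)
    [TopologicalSpace.SeparableSpace A] [TopologicalSpace.SeparableSpace B]
    (K : TwoSidedIdeal X) (hK : IsClosed (K : Set X)) :
    IsPrimitiveIdeal K ↔
      ∃ (E : TwoSidedIdeal A) (F : TwoSidedIdeal B),
        IsPrimitiveIdeal E ∧ IsPrimitiveIdeal F ∧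
        (K : Set X) =
          tensorIdeal ι (Set.univ : Set A) (F : Set B) +
            tensorIdeal ι (E : Set A) (Set.univ : Set B) := by
  constructor
  · exact TP.prim_forw hNA hNB hX K hK
  · rintro ⟨E, F, hE, hF, h⟩
    exact TP.prim_back hNA hNB hX K E F hE hF h

end
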